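/- Let f be a self-homeomorphism of S² of finite order (f^n = id for some n ≥ 1) which, as a continuous map, is homotopic to the identity map of S². Then f is conjugate in the group of self-homeomorphisms of S² to the restriction to S² of a rotation of ℝ³; that is, there exist a self-homeomorphism g of S² and an element A of the special orthogonal group SO(3) (a linear isometry of EuclideanSpace ℝ (Fin 3) with determinant 1) such that f = g⁻¹ ∘ (A restricted to S²) ∘ g. -/

import Mathlib

noncomputable section

/-- The group of self-homeomorphisms of a topological space, with `(f * g) x = f (g x)`. -/
instance homeoGroup (X : Type*) [TopologicalSpace X] : Group (X ≃ₜ X) where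
  mul f g := g.trans f
  one := Homeomorph.refl X
  inv := Homeomorph.symm
  mul_assoc a b c := Homeomorph.ext fun _ => rfl
  one_mul a := Homeomorph.ext fun _ => rfl
  mul_one a := Homeomorph.ext fun _ => rfl
  inv_mul_cancel a := Homeomorph.ext fun x => a.symm_apply_apply x

/-- The unit sphere `S²` in `ℝ³`. -/
abbrev S2 : Set (EuclideanSpace ℝ (Fin 3)) := Metric.sphere (0 : EuclideanSpace ℝ (Fin 3)) 1

set_option linter.all false

namespace BKE
open Set Filter Topology Metric
open scoped unitInterval

/-- `g` has a continuous logarithm on `S`. -/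
def HasLog {X : Type*} [TopologicalSpace X] (g : X → ℂ) (S : Set X) : Prop :=
  ∃ u : X → ℂ, ContinuousOn u S ∧ ∀ z ∈ S, g z = Complex.exp (u z)

theorem homotopy_log {A : Type*} [TopologicalSpace A] (K : I × A → ℂ) (hK : Continuous K)
    (h0 : ∀ x, K x ≠ 0) (u0 : A → ℂ) (hu0 : Continuous u0)
    (he : ∀ a, K (0, a) = Complex.exp (u0 a)) :
    ∃ v : I × A → ℂ, Continuous v ∧ (∀ x, K x = Complex.exp (v x)) ∧ ∀ a, v (0, a) = u0 a := by
  have cov := Complex.isCoveringMap_exp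
  let H : C(I × A, {z : ℂ // z ≠ 0}) := ⟨fun x => ⟨K x, h0 x⟩, by fun_prop⟩
  let f : C(A, ℂ) := ⟨u0, hu0⟩
  have H0 : ∀ a, H (0, a) = (⟨_, (f a).exp_ne_zero⟩ : {z : ℂ // z ≠ 0}) := by
    intro a; apply Subtype.ext; exact he a
  refine ⟨cov.liftHomotopy H f H0, by fun_prop, fun x => ?_, fun a => ?_⟩
  · have := congrFun (cov.liftHomotopy_lifts H f H0) x
    have := congrArg Subtype.val this
    exact this.symm
  · exact cov.liftHomotopy_zero H f H0 a

theorem hasLog_iff_subtype {X : Type*} [TopologicalSpace X] {g : X → ℂ} {S : Set X} :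
    HasLog g S ↔ ∃ u : S → ℂ, Continuous u ∧ ∀ z : S, g z = Complex.exp (u z) := by
  classical
  constructor
  · rintro ⟨u, hu, h⟩
    exact ⟨fun z => u z, continuousOn_iff_continuous_restrict.1 hu, fun z => h z z.2⟩
  · rintro ⟨u, hu, h⟩
    refine ⟨fun z => if hz : z ∈ S then u ⟨z, hz⟩ else 0, ?_, ?_⟩
    · rw [continuousOn_iff_continuous_restrict]
      convert hu using 1
      ext z; simp [Set.restrict]
    · intro z hz; simp [hz, h ⟨z, hz⟩]

/-- Homotopy invariance of having a logarithm. -/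
theorem hasLog_of_homotopy {X : Type*} [TopologicalSpace X] {S : Set X} (K : ℝ → X → ℂ)
    (hK : ContinuousOn (fun p : ℝ × X => K p.1 p.2) (Icc 0 1 ×ˢ S))
    (h0 : ∀ t ∈ Icc (0:ℝ) 1, ∀ x ∈ S, K t x ≠ 0) (hl : HasLog (K 0) S) : HasLog (K 1) S := by
  rw [hasLog_iff_subtype] at hl ⊢
  obtain ⟨u, hu, h⟩ := hl
  obtain ⟨v, hv, hv1, hv2⟩ := homotopy_log (A := S) (fun p => K p.1 p.2) (by
    have : Continuous (fun p : I × S => ((p.1 : ℝ), (p.2 : X))) := by fun_prop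
    exact hK.comp_continuous this (fun p => ⟨p.1.2, p.2.2⟩))
    (fun p => h0 _ p.1.2 _ p.2.2) u hu (fun a => h a)
  exact ⟨fun a => v (1, a), by fun_prop, fun a => hv1 (1, a)⟩

theorem HasLog.mono {X : Type*} [TopologicalSpace X] {g : X → ℂ} {S T : Set X}
    (h : HasLog g T) (hST : S ⊆ T) : HasLog g S :=
  let ⟨u, hu, e⟩ := h; ⟨u, hu.mono hST, fun z hz => e z (hST hz)⟩

theorem HasLog.congr {X : Type*} [TopologicalSpace X] {g g' : X → ℂ} {S : Set X}
    (h : HasLog g S) (hg : ∀ z ∈ S, g' z = g z) : HasLog g' S :=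
  let ⟨u, hu, e⟩ := h; ⟨u, hu, fun z hz => (hg z hz).trans (e z hz)⟩

theorem HasLog.mul {X : Type*} [TopologicalSpace X] {g g' : X → ℂ} {S : Set X}
    (h : HasLog g S) (h' : HasLog g' S) : HasLog (fun z => g z * g' z) S := by
  obtain ⟨u, hu, e⟩ := h; obtain ⟨v, hv, e'⟩ := h'
  exact ⟨fun z => u z + v z, hu.add hv, fun z hz => by dsimp only; rw [Complex.exp_add, e z hz, e' z hz]⟩

theorem HasLog.inv {X : Type*} [TopologicalSpace X] {g : X → ℂ} {S : Set X}
    (h : HasLog g S) : HasLog (fun z => (g z)⁻¹) S := by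
  obtain ⟨u, hu, e⟩ := h
  exact ⟨fun z => - u z, hu.neg, fun z hz => by dsimp only; rw [Complex.exp_neg, e z hz]⟩

theorem HasLog.div {X : Type*} [TopologicalSpace X] {g g' : X → ℂ} {S : Set X}
    (h : HasLog g S) (h' : HasLog g' S) : HasLog (fun z => g z / g' z) S := by
  simpa [div_eq_mul_inv] using h.mul h'.inv

theorem HasLog.zpow {X : Type*} [TopologicalSpace X] {g : X → ℂ} {S : Set X}
    (h : HasLog g S) (m : ℤ) : HasLog (fun z => (g z) ^ m) S := by
  obtain ⟨u, hu, e⟩ := h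
  exact ⟨fun z => m * u z, continuousOn_const.mul hu, fun z hz => by
    dsimp only; rw [Complex.exp_int_mul, e z hz]⟩

theorem HasLog.comp {X Y : Type*} [TopologicalSpace X] [TopologicalSpace Y] {g : X → ℂ} {S : Set X}
    {T : Set Y} {f : Y → X}
    (h : HasLog g S) (hf : ContinuousOn f T) (hm : MapsTo f T S) : HasLog (fun y => g (f y)) T := by
  obtain ⟨u, hu, e⟩ := h
  exact ⟨fun z => u (f z), hu.comp hf hm, fun z hz => e _ (hm hz)⟩

theorem HasLog.ne_zero {X : Type*} [TopologicalSpace X] {g : X → ℂ} {S : Set X}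
    (h : HasLog g S) : ∀ z ∈ S, g z ≠ 0 := by
  obtain ⟨u, hu, e⟩ := h
  intro z hz; rw [e z hz]; exact Complex.exp_ne_zero _

theorem HasLog.continuousOn {X : Type*} [TopologicalSpace X] {g : X → ℂ} {S : Set X}
    (h : HasLog g S) : ContinuousOn g S := by
  obtain ⟨u, hu, e⟩ := h
  exact (Complex.continuous_exp.comp_continuousOn hu).congr e

theorem hasLog_const {X : Type*} [TopologicalSpace X] {c : ℂ} (hc : c ≠ 0) (S : Set X) :
    HasLog (fun _ => c) S :=
  ⟨fun _ => Complex.log c, continuousOn_const, fun _ _ => (Complex.exp_log hc).symm⟩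

theorem hasLog_exp {X : Type*} [TopologicalSpace X] {u : X → ℂ} {S : Set X}
    (hu : ContinuousOn u S) : HasLog (fun z => Complex.exp (u z)) S := ⟨u, hu, fun _ _ => rfl⟩

theorem hasLog_slit {X : Type*} [TopologicalSpace X] {g : X → ℂ} {S : Set X}
    (hg : ContinuousOn g S) (h : ∀ z ∈ S, g z ∈ Complex.slitPlane) : HasLog g S :=
  ⟨fun z => Complex.log (g z), hg.clog h,
    fun z hz => (Complex.exp_log (Complex.slitPlane_ne_zero (h z hz))).symm⟩

/-- Close functions differ by a function with a logarithm. -/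
theorem hasLog_div_of_close {X : Type*} [TopologicalSpace X] {g g' : X → ℂ} {S : Set X}
    (hg : ContinuousOn g S) (hg' : ContinuousOn g' S) (h : ∀ z ∈ S, ‖g z - g' z‖ < ‖g' z‖) :
    HasLog (fun z => g z / g' z) S := by
  have hne : ∀ z ∈ S, g' z ≠ 0 := fun z hz h0 => by
    have := h z hz; rw [h0, norm_zero] at this; exact absurd this (not_lt.2 (norm_nonneg _))
  refine hasLog_slit (hg.div hg' hne) fun z hz => ?_
  left
  have h1 : ‖g z / g' z - 1‖ < 1 := by
    rw [div_sub_one (hne z hz), norm_div, div_lt_one (norm_pos_iff.2 (hne z hz))]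
    exact h z hz
  have h2 := Complex.abs_re_le_norm (g z / g' z - 1)
  simp only [Complex.sub_re, Complex.one_re] at h2
  have := (abs_lt.1 (lt_of_le_of_lt h2 h1)).1
  linarith

/-- A nonvanishing function on a star-shaped set has a logarithm. -/
theorem hasLog_star {E : Type*} [AddCommGroup E] [Module ℝ E] [TopologicalSpace E]
    [ContinuousAdd E] [ContinuousSMul ℝ E] {S : Set E} {x₀ : E} (hS : StarConvex ℝ x₀ S)
    (hx : x₀ ∈ S) {g : E → ℂ} (hg : ContinuousOn g S) (h0 : ∀ z ∈ S, g z ≠ 0) : HasLog g S := by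
  have hm : ∀ t ∈ Icc (0:ℝ) 1, ∀ x ∈ S, (1 - t) • x₀ + t • x ∈ S := fun t ht x hxS =>
    hS hxS (by linarith [ht.2]) ht.1 (by ring)
  have := hasLog_of_homotopy (S := S) (fun t x => g ((1 - t) • x₀ + t • x)) ?_ ?_ ?_
  · simpa using this
  · refine hg.comp (by fun_prop) ?_
    rintro ⟨t, x⟩ ⟨ht, hx⟩
    exact hm t ht x hx
  · intro t ht x hx; exact h0 _ (hm t ht x hx)
  · simpa using hasLog_const (h0 _ hx) S

theorem hasLog_convex {E : Type*} [AddCommGroup E] [Module ℝ E] [TopologicalSpace E]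
    [ContinuousAdd E] [ContinuousSMul ℝ E] {S : Set E} (hS : Convex ℝ S)
    {g : E → ℂ} (hg : ContinuousOn g S) (h0 : ∀ z ∈ S, g z ≠ 0) : HasLog g S := by
  rcases S.eq_empty_or_nonempty with rfl | ⟨x, hx⟩
  · exact ⟨0, continuousOn_empty _, by simp⟩
  · exact hasLog_star (hS.starConvex hx) hx hg h0

/-- Two logarithms on a preconnected set differ by a constant. -/
theorem log_diff_const {X : Type*} [TopologicalSpace X] {S : Set X} (hS : IsPreconnected S)
    {u v : X → ℂ} (hu : ContinuousOn u S) (hv : ContinuousOn v S)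
    (h : ∀ z ∈ S, Complex.exp (u z) = Complex.exp (v z)) :
    ∃ m : ℤ, ∀ z ∈ S, u z = v z + m * (2 * Real.pi * Complex.I) := by
  rcases S.eq_empty_or_nonempty with rfl | ⟨x, hx⟩
  · exact ⟨0, by simp⟩
  have h' : ∀ z ∈ S, ∃ n : ℤ, u z = v z + n * (2 * Real.pi * Complex.I) := fun z hz =>
    Complex.exp_eq_exp_iff_exists_int.1 (h z hz)
  choose! n hn using h'
  have hpi : (2 * Real.pi * Complex.I : ℂ) ≠ 0 := by simp [Real.pi_ne_zero]
  have hcont : ContinuousOn (fun z => ((u z - v z) / (2 * Real.pi * Complex.I)).re) S :=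
    Complex.continuous_re.comp_continuousOn ((hu.sub hv).div_const _)
  have heq : ∀ z ∈ S, ((u z - v z) / (2 * Real.pi * Complex.I)).re = (n z : ℝ) := by
    intro z hz
    have : (u z - v z) / (2 * Real.pi * Complex.I) = (n z : ℂ) := by
      rw [hn z hz]; field_simp; ring
    rw [this]; simp
  have hnc : ContinuousOn n S := by
    have h1 : ContinuousOn (fun z => (n z : ℝ)) S := hcont.congr (fun z hz => (heq z hz).symm)
    exact (Int.isClosedEmbedding_coe_real.isInducing.continuousOn_iff).2 h1
  refine ⟨n x, fun z hz => ?_⟩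
  rw [hn z hz, hS.constant hnc hz hx]

end BKE

namespace BKE
open Set Filter Topology Metric
open scoped unitInterval

/-- a 1-periodic nonvanishing function with winding number `m` -/
def Wind (g : ℝ → ℂ) (m : ℤ) : Prop :=
  ∃ L : ℝ → ℂ, Continuous L ∧ (∀ t, g t = Complex.exp (L t)) ∧
    ∀ t, L (t + 1) = L t + m * (2 * Real.pi * Complex.I)

theorem two_pi_I_ne : (2 * Real.pi * Complex.I : ℂ) ≠ 0 := by simp [Real.pi_ne_zero]

theorem exp_int_two_pi (m : ℤ) : Complex.exp (m * (2 * Real.pi * Complex.I)) = 1 :=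
  Complex.exp_eq_one_iff.2 ⟨m, rfl⟩

/-- a continuous log of a function on a preconnected space differs from another by const -/
theorem log_diff_const' {X : Type*} [TopologicalSpace X] [PreconnectedSpace X]
    {u v : X → ℂ} (hu : Continuous u) (hv : Continuous v)
    (h : ∀ z, Complex.exp (u z) = Complex.exp (v z)) :
    ∃ m : ℤ, ∀ z, u z = v z + m * (2 * Real.pi * Complex.I) := by
  obtain ⟨m, hm⟩ := log_diff_const (S := univ) isPreconnected_univ hu.continuousOn
    hv.continuousOn (fun z _ => h z)
  exact ⟨m, fun z => hm z (mem_univ z)⟩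

theorem exists_log_of_convex_univ {g : ℝ → ℂ} (hg : Continuous g) (h0 : ∀ t, g t ≠ 0) :
    ∃ L : ℝ → ℂ, Continuous L ∧ ∀ t, g t = Complex.exp (L t) := by
  obtain ⟨L, hL, h⟩ := hasLog_convex (S := univ) (convex_univ) hg.continuousOn (fun z _ => h0 z)
  exact ⟨L, continuousOn_univ.1 hL, fun t => h t (mem_univ t)⟩

theorem wind_of_log {g L : ℝ → ℂ} (hp : ∀ t, g (t + 1) = g t) (hL : Continuous L)
    (h : ∀ t, g t = Complex.exp (L t)) :
    ∃ m : ℤ, ∀ t, L (t + 1) = L t + m * (2 * Real.pi * Complex.I) :=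
  log_diff_const' (by fun_prop) hL (fun t => by rw [← h, ← h, hp])

theorem exists_wind {g : ℝ → ℂ} (hg : Continuous g) (h0 : ∀ t, g t ≠ 0)
    (hp : ∀ t, g (t + 1) = g t) : ∃ m, Wind g m := by
  obtain ⟨L, hL, h⟩ := exists_log_of_convex_univ hg h0
  obtain ⟨m, hm⟩ := wind_of_log hp hL h
  exact ⟨m, L, hL, h, hm⟩

theorem Wind.unique {g : ℝ → ℂ} {m n : ℤ} (h : Wind g m) (h' : Wind g n) : m = n := by
  obtain ⟨L, hL, e, p⟩ := h
  obtain ⟨L', hL', e', p'⟩ := h'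
  obtain ⟨k, hk⟩ := log_diff_const' hL hL' (fun t => by rw [← e, ← e'])
  have h1 := p 0
  rw [hk, hk, p'] at h1
  have h2 : ((n : ℂ) - m) * (2 * Real.pi * Complex.I) = 0 := by linear_combination h1
  rcases mul_eq_zero.1 h2 with h | h
  · exact_mod_cast (sub_eq_zero.1 h).symm
  · exact absurd h two_pi_I_ne

theorem Wind.mul {g g' : ℝ → ℂ} {m n : ℤ} (h : Wind g m) (h' : Wind g' n) :
    Wind (fun t => g t * g' t) (m + n) := by
  obtain ⟨L, hL, e, p⟩ := h
  obtain ⟨L', hL', e', p'⟩ := h'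
  refine ⟨fun t => L t + L' t, by fun_prop, fun t => by dsimp only; rw [Complex.exp_add, e, e'],
    fun t => ?_⟩
  dsimp only; rw [p, p']; push_cast; ring

theorem Wind.zpow {g : ℝ → ℂ} {m : ℤ} (h : Wind g m) (k : ℤ) :
    Wind (fun t => g t ^ k) (k * m) := by
  obtain ⟨L, hL, e, p⟩ := h
  refine ⟨fun t => k * L t, by fun_prop, fun t => by dsimp only; rw [Complex.exp_int_mul, e],
    fun t => ?_⟩
  dsimp only; rw [p]; push_cast; ring

theorem Wind.inv {g : ℝ → ℂ} {m : ℤ} (h : Wind g m) : Wind (fun t => (g t)⁻¹) (-m) := by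
  simpa using h.zpow (-1)

theorem Wind.div {g g' : ℝ → ℂ} {m n : ℤ} (h : Wind g m) (h' : Wind g' n) :
    Wind (fun t => g t / g' t) (m - n) := by
  simpa [div_eq_mul_inv, sub_eq_add_neg] using h.mul h'.inv

theorem Wind.congr {g g' : ℝ → ℂ} {m : ℤ} (h : Wind g m) (e : ∀ t, g' t = g t) : Wind g' m := by
  have : g' = g := funext e
  rw [this]; exact h

theorem Wind.shift {g : ℝ → ℂ} {m : ℤ} (h : Wind g m) (a : ℝ) : Wind (fun t => g (t + a)) m := by
  obtain ⟨L, hL, e, p⟩ := h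
  refine ⟨fun t => L (t + a), by fun_prop, fun t => e _, fun t => ?_⟩
  dsimp only; rw [← p]; ring_nf

theorem Wind.ne_zero {g : ℝ → ℂ} {m : ℤ} (h : Wind g m) (t : ℝ) : g t ≠ 0 := by
  obtain ⟨L, hL, e, p⟩ := h
  rw [e]; exact Complex.exp_ne_zero _

theorem Wind.continuous {g : ℝ → ℂ} {m : ℤ} (h : Wind g m) : Continuous g := by
  obtain ⟨L, hL, e, p⟩ := h
  rw [funext e]; fun_prop

theorem Wind.periodic {g : ℝ → ℂ} {m : ℤ} (h : Wind g m) (t : ℝ) : g (t + 1) = g t := by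
  obtain ⟨L, hL, e, p⟩ := h
  rw [e, e, p, Complex.exp_add, exp_int_two_pi, mul_one]

theorem wind_of_hasLog {X : Type*} [TopologicalSpace X] {G : X → ℂ} {S : Set X} (h : HasLog G S)
    {c : ℝ → X} (hc : Continuous c) (hp : ∀ t, c (t + 1) = c t) (hS : ∀ t, c t ∈ S) :
    Wind (fun t => G (c t)) 0 := by
  obtain ⟨u, hu, e⟩ := h
  exact ⟨fun t => u (c t), hu.comp_continuous hc hS, fun t => e _ (hS t), fun t => by simp [hp]⟩

theorem wind_const {a : ℂ} (ha : a ≠ 0) : Wind (fun _ => a) 0 :=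
  ⟨fun _ => Complex.log a, by fun_prop, fun t => (Complex.exp_log ha).symm, by simp⟩

/-- Winding numbers are homotopy invariant. -/
theorem Wind.homotopy {K : ℝ → ℝ → ℂ} (hK : ContinuousOn (fun p : ℝ × ℝ => K p.1 p.2) (Icc 0 1 ×ˢ univ))
    (h0 : ∀ s ∈ Icc (0:ℝ) 1, ∀ t, K s t ≠ 0) (hp : ∀ s ∈ Icc (0:ℝ) 1, ∀ t, K s (t + 1) = K s t)
    {m : ℤ} (h : Wind (K 0) m) : Wind (K 1) m := by
  obtain ⟨L, hL, e, p⟩ := h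
  have h01 : (0:ℝ) ∈ Icc (0:ℝ) 1 := by simp
  obtain ⟨v, hv, ev⟩ := hasLog_convex (S := Icc (0:ℝ) 1 ×ˢ (univ : Set ℝ))
    ((convex_Icc _ _).prod convex_univ) hK (fun z hz => h0 _ hz.1 _)
  obtain ⟨k, hk⟩ := log_diff_const (S := Icc (0:ℝ) 1 ×ˢ (univ : Set ℝ))
    ((convex_Icc _ _).prod convex_univ).isPreconnected (u := fun q : ℝ × ℝ => v (q.1, q.2 + 1)) (v := v)
    (hv.comp (by fun_prop) (fun q hq => ⟨hq.1, mem_univ _⟩)) hv (fun z hz => by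
      rw [← ev z hz, ← ev (z.1, z.2 + 1) ⟨hz.1, mem_univ _⟩]; exact hp _ hz.1 _)
  have hcv : ∀ s ∈ Icc (0:ℝ) 1, Continuous (fun t => v (s, t)) := fun s hs =>
    hv.comp_continuous (by fun_prop) (fun t => ⟨hs, mem_univ _⟩)
  have w0 : Wind (K 0) k := ⟨fun t => v (0, t), hcv 0 h01, fun t => ev (0, t) ⟨h01, mem_univ _⟩,
    fun t => hk (0, t) ⟨h01, mem_univ _⟩⟩
  have : m = k := Wind.unique ⟨L, hL, e, p⟩ w0
  subst this
  exact ⟨fun t => v (1, t), hcv 1 (by simp), fun t => ev (1, t) ⟨by simp, mem_univ _⟩,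
    fun t => hk (1, t) ⟨by simp, mem_univ _⟩⟩

theorem Wind.of_close {g g' : ℝ → ℂ} {m : ℤ} (h : Wind g m) (hg' : Continuous g')
    (hp : ∀ t, g' (t + 1) = g' t) (hcl : ∀ t, ‖g' t - g t‖ < ‖g t‖) : Wind g' m := by
  have hd : HasLog (fun t => g' t / g t) univ :=
    hasLog_div_of_close hg'.continuousOn h.continuous.continuousOn (fun t _ => hcl t)
  have hslit : Wind (fun t => g' t / g t) 0 := by
    have hne : ∀ t, g' t / g t ∈ Complex.slitPlane := by
      intro t
      left
      have h1 : ‖g' t / g t - 1‖ < 1 := by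
        rw [div_sub_one (h.ne_zero t), norm_div, div_lt_one (norm_pos_iff.2 (h.ne_zero t))]
        exact hcl t
      have h2 := Complex.abs_re_le_norm (g' t / g t - 1)
      simp only [Complex.sub_re, Complex.one_re] at h2
      have := (abs_lt.1 (lt_of_le_of_lt h2 h1)).1
      linarith
    refine ⟨fun t => Complex.log (g' t / g t), ?_, fun t =>
      (Complex.exp_log (Complex.slitPlane_ne_zero (hne t))).symm, fun t => ?_⟩
    · exact (hg'.div h.continuous h.ne_zero).clog hne
    · simp [hp, h.periodic]
  have := h.mul hslit
  simp only [add_zero] at this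
  exact this.congr (fun t => by rw [mul_div_cancel₀ _ (h.ne_zero t)])

/-- parametrized Jordan curve -/
structure IsJordan {X : Type*} [TopologicalSpace X] (c : ℝ → X) : Prop where
  cont : Continuous c
  per : ∀ t, c (t + 1) = c t
  inj : ∀ s t, c s = c t → ∃ k : ℤ, s = t + k

theorem per_int {X : Type*} {c : ℝ → X} (hp : ∀ t, c (t + 1) = c t) (k : ℤ) (t : ℝ) :
    c (t + k) = c t := by
  have : Function.Periodic c 1 := hp
  simpa using this.int_mul k t

theorem IsJordan.descend {X Y : Type*} [TopologicalSpace X] [T2Space X] [TopologicalSpace Y]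
    {c : ℝ → X} (hc : IsJordan c) {L : ℝ → Y} (hL : Continuous L) (hp : ∀ t, L (t + 1) = L t) :
    ∃ u : X → Y, ContinuousOn u (range c) ∧ ∀ t, u (c t) = L t := by
  classical
  haveI : Fact ((0:ℝ) < 1) := ⟨one_pos⟩
  have pc : Function.Periodic c 1 := hc.per
  have pL : Function.Periodic L 1 := hp
  have cc : Continuous (pc.lift : AddCircle (1:ℝ) → X) := by
    refine continuous_quot_lift _ hc.cont
  have cL : Continuous (pL.lift : AddCircle (1:ℝ) → Y) := continuous_quot_lift _ hL
  have ic : Function.Injective (pc.lift : AddCircle (1:ℝ) → X) := by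
    intro x y
    induction x using QuotientAddGroup.induction_on with | H a => ?_
    induction y using QuotientAddGroup.induction_on with | H b => ?_
    intro h
    rw [Function.Periodic.lift_coe, Function.Periodic.lift_coe] at h
    obtain ⟨k, hk⟩ := hc.inj _ _ h
    rw [hk]
    simp
  have emb : IsClosedEmbedding (pc.lift : AddCircle (1:ℝ) → X) := cc.isClosedEmbedding ic
  haveI : Nonempty (AddCircle (1:ℝ)) := ⟨0⟩
  refine ⟨fun x => pL.lift (Function.invFun pc.lift x), ?_, fun t => ?_⟩
  · have hr : range c = range (pc.lift : AddCircle (1:ℝ) → X) := by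
      ext x; constructor
      · rintro ⟨t, rfl⟩; exact ⟨(t : AddCircle (1:ℝ)), Function.Periodic.lift_coe _ _⟩
      · rintro ⟨y, rfl⟩
        induction y using QuotientAddGroup.induction_on with | H a => ?_
        exact ⟨a, (Function.Periodic.lift_coe _ _).symm⟩
    rw [hr]
    refine cL.comp_continuousOn ?_
    rw [continuousOn_iff_continuous_restrict]
    have h2 : (range (pc.lift : AddCircle (1:ℝ) → X)).restrict (Function.invFun pc.lift) =
        emb.toIsEmbedding.toHomeomorph.symm := by
      ext x
      obtain ⟨y, rfl⟩ := emb.toIsEmbedding.toHomeomorph.surjective x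
      simp only [Homeomorph.symm_apply_apply, restrict_apply]
      exact Function.leftInverse_invFun ic y
    have h3 := emb.toIsEmbedding.toHomeomorph.symm.continuous
    rw [← h2] at h3; exact h3
  · have : Function.invFun pc.lift (c t) = (t : AddCircle (1:ℝ)) := by
      rw [← Function.Periodic.lift_coe pc t]; exact Function.leftInverse_invFun ic _
    dsimp only; rw [this, Function.Periodic.lift_coe]

theorem IsJordan.hasLog {X : Type*} [TopologicalSpace X] [T2Space X] {c : ℝ → X} (hc : IsJordan c)
    {G : X → ℂ} (h : Wind (fun t => G (c t)) 0) : HasLog G (range c) := by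
  obtain ⟨L, hL, e, p⟩ := h
  obtain ⟨u, hu, hu'⟩ := hc.descend hL (fun t => by simp [p])
  refine ⟨u, hu, ?_⟩
  rintro _ ⟨t, rfl⟩
  rw [hu', ← e]

theorem IsJordan.isCompact {X : Type*} [TopologicalSpace X] {c : ℝ → X} (hc : IsJordan c) :
    IsCompact (range c) := by
  have : range c = c '' Icc 0 1 := by
    ext x; constructor
    · rintro ⟨t, rfl⟩
      refine ⟨Int.fract t, ⟨Int.fract_nonneg t, (Int.fract_lt_one t).le⟩, ?_⟩
      have := per_int hc.per ⌊t⌋ (Int.fract t)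
      rw [Int.fract_add_floor] at this; exact this.symm
    · rintro ⟨t, -, rfl⟩; exact ⟨t, rfl⟩
  rw [this]; exact isCompact_Icc.image hc.cont

/-- The standard circle -/
def circ (a : ℂ) (R : ℝ) (t : ℝ) : ℂ := a + R * Complex.exp (t * (2 * Real.pi * Complex.I))

theorem circ_continuous (a : ℂ) (R : ℝ) : Continuous (circ a R) := by unfold circ; fun_prop

theorem circ_per (a : ℂ) (R : ℝ) (t : ℝ) : circ a R (t + 1) = circ a R t := by
  have h := exp_int_two_pi 1
  simp only [Int.cast_one, one_mul] at h
  unfold circ; push_cast; rw [add_mul, Complex.exp_add, one_mul, h, mul_one]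

theorem norm_exp_real (t : ℝ) : ‖Complex.exp (t * (2 * Real.pi * Complex.I))‖ = 1 := by
  have : (t * (2 * Real.pi * Complex.I) : ℂ) = ((t * (2 * Real.pi) : ℝ) : ℂ) * Complex.I := by
    push_cast; ring
  rw [this, Complex.norm_exp_ofReal_mul_I]

theorem norm_circ_sub (a : ℂ) {R : ℝ} (hR : 0 ≤ R) (t : ℝ) : ‖circ a R t - a‖ = R := by
  simp [circ, norm_exp_real, abs_of_nonneg hR]

theorem isJordan_circ (a : ℂ) {R : ℝ} (hR : 0 < R) : IsJordan (circ a R) := by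
  refine ⟨circ_continuous a R, circ_per a R, fun s t h => ?_⟩
  unfold circ at h
  have hR' : (R : ℂ) ≠ 0 := by exact_mod_cast hR.ne'
  have h1 := mul_left_cancel₀ hR' (add_left_cancel h)
  obtain ⟨n, hn⟩ := Complex.exp_eq_exp_iff_exists_int.1 h1
  refine ⟨n, ?_⟩
  rw [← add_mul] at hn
  have := mul_right_cancel₀ two_pi_I_ne hn
  exact_mod_cast this

theorem mem_range_circ {a : ℂ} {R : ℝ} (hR : 0 ≤ R) {z : ℂ} : z ∈ range (circ a R) ↔ ‖z - a‖ = R := by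
  constructor
  · rintro ⟨t, rfl⟩; exact norm_circ_sub a hR t
  · intro h
    refine ⟨(z - a).arg / (2 * Real.pi), ?_⟩
    unfold circ
    have h1 : (((z - a).arg / (2 * Real.pi) : ℝ) * (2 * Real.pi * Complex.I) : ℂ)
        = (z - a).arg * Complex.I := by
      have : (Real.pi : ℂ) ≠ 0 := by simp [Real.pi_ne_zero]
      push_cast; field_simp
    rw [h1, ← h, Complex.norm_mul_exp_arg_mul_I]; ring

theorem wind_circ (a : ℂ) {R : ℝ} (hR : 0 < R) : Wind (fun t => circ a R t - a) 1 := by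
  refine ⟨fun t => Real.log R + t * (2 * Real.pi * Complex.I), by fun_prop, fun t => ?_, fun t => ?_⟩
  · simp only [circ, Complex.exp_add, add_sub_cancel_left]
    rw [← Complex.ofReal_exp, Real.exp_log hR]
  · push_cast; ring

/-- a function on an annulus with winding 0 on one circle has a log -/
theorem annulus_log {a : ℂ} {T : Set ℝ} (hT : T.OrdConnected) (hpos : ∀ r ∈ T, 0 < r) {R : ℝ}
    (hR : R ∈ T) {g : ℂ → ℂ} (hg : ContinuousOn g {z | ‖z - a‖ ∈ T}) (h0 : ∀ z, ‖z - a‖ ∈ T → g z ≠ 0)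
    (hw : Wind (fun t => g (circ a R t)) 0) : HasLog g {z | ‖z - a‖ ∈ T} := by
  have hl := (isJordan_circ a (hpos R hR)).hasLog hw
  set S : Set ℂ := {z | ‖z - a‖ ∈ T}
  have hz : ∀ z ∈ S, 0 < ‖z - a‖ := fun z hz => hpos _ hz
  -- radius function
  let ρ : ℝ → ℂ → ℝ := fun t z => (1 - t) * R + t * ‖z - a‖
  have hρ : ∀ t ∈ Icc (0:ℝ) 1, ∀ z ∈ S, ρ t z ∈ T := fun t ht z hzS =>
    hT.convex hR hzS (by linarith [ht.2]) ht.1 (by ring)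
  let P : ℝ → ℂ → ℂ := fun t z => a + (ρ t z / ‖z - a‖ : ℝ) * (z - a)
  have hPn : ∀ t ∈ Icc (0:ℝ) 1, ∀ z ∈ S, ‖P t z - a‖ = ρ t z := by
    intro t ht z hzS
    have h1 := hz z hzS
    simp only [P, add_sub_cancel_left, norm_mul, Complex.norm_real, norm_div, norm_norm]
    rw [Real.norm_of_nonneg (hpos _ (hρ t ht z hzS)).le]
    field_simp
  have hPc : ContinuousOn (fun p : ℝ × ℂ => P p.1 p.2) (Icc 0 1 ×ˢ S) := by
    simp only [P, ρ]
    refine continuousOn_const.add (ContinuousOn.mul ?_ (by fun_prop))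
    refine Complex.continuous_ofReal.comp_continuousOn (ContinuousOn.div (by fun_prop) (by fun_prop) ?_)
    rintro ⟨t, z⟩ ⟨ht, h⟩; exact (hz z h).ne'
  have := hasLog_of_homotopy (S := S) (fun t z => g (P t z)) ?_ ?_ ?_
  · refine this.congr fun z hzS => ?_
    have : ((‖z - a‖ : ℝ) : ℂ) ≠ 0 := by exact_mod_cast (hz z hzS).ne'
    simp [P, ρ, div_self this]
  · refine hg.comp hPc ?_
    rintro ⟨t, z⟩ ⟨ht, h⟩
    show ‖P t z - a‖ ∈ T
    rw [hPn t ht z h]; exact hρ t ht z h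
  · intro t ht z h
    apply h0
    rw [hPn t ht z h]; exact hρ t ht z h
  · refine hl.comp (f := P 0) ?_ ?_
    · exact hPc.comp (f := fun z => ((0:ℝ), z)) (by fun_prop) (fun z h => ⟨by simp, h⟩)
    · intro z h
      rw [mem_range_circ (hpos R hR).le, hPn 0 (by simp) z h]; simp [ρ]

theorem annulus_classify {a : ℂ} {T : Set ℝ} (hT : T.OrdConnected) (hpos : ∀ r ∈ T, 0 < r)
    (hne : T.Nonempty)
    {g : ℂ → ℂ} (hg : ContinuousOn g {z | ‖z - a‖ ∈ T}) (h0 : ∀ z, ‖z - a‖ ∈ T → g z ≠ 0) :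
    ∃ m : ℤ, HasLog (fun z => g z / (z - a) ^ m) {z | ‖z - a‖ ∈ T} ∧
      ∀ R ∈ T, Wind (fun t => g (circ a R t)) m := by
  obtain ⟨R, hR⟩ := hne
  have hmem : ∀ R ∈ T, ∀ t, circ a R t ∈ {z | ‖z - a‖ ∈ T} := fun R hR t => by
    simp only [mem_setOf_eq]; rw [norm_circ_sub a (hpos R hR).le]; exact hR
  obtain ⟨m, hm⟩ := exists_wind (g := fun t => g (circ a R t))
    (hg.comp_continuous (circ_continuous a R) (hmem R hR))
    (fun t => h0 _ (hmem R hR t)) (fun t => by rw [circ_per])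
  have hne : ∀ z ∈ {z | ‖z - a‖ ∈ T}, z - a ≠ 0 := fun z hz h => by
    have := hpos _ hz; rw [h] at this; simp at this
  have hl : HasLog (fun z => g z / (z - a) ^ m) {z | ‖z - a‖ ∈ T} := by
    refine annulus_log hT hpos hR ?_ ?_ ?_
    · refine hg.div (ContinuousOn.zpow₀ (by fun_prop) _ fun z hz => Or.inl (hne z hz)) ?_
      intro z hz; exact zpow_ne_zero _ (hne z hz)
    · intro z hz; exact div_ne_zero (h0 z hz) (zpow_ne_zero _ (hne z hz))
    · have := hm.div ((wind_circ a (hpos R hR)).zpow m)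
      simpa using this
  refine ⟨m, hl, fun R' hR' => ?_⟩
  have h1 := wind_of_hasLog hl (circ_continuous a R') (circ_per a R') (hmem R' hR')
  have h2 := h1.mul ((wind_circ a (hpos R' hR')).zpow m)
  simp only [zero_add, mul_one] at h2
  refine h2.congr fun t => ?_
  rw [div_mul_cancel₀]
  exact zpow_ne_zero _ (hne _ (hmem R' hR' t))

end BKE

namespace BKE
open Set Filter Topology Metric
open scoped unitInterval

theorem tietze {X : Type*} [TopologicalSpace X] [NormalSpace X] {S : Set X} (hS : IsClosed S)
    {u : X → ℂ} (hu : ContinuousOn u S) : ∃ v : X → ℂ, Continuous v ∧ ∀ z ∈ S, v z = u z := by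
  obtain ⟨v, hv⟩ := ContinuousMap.exists_restrict_eq hS
    (⟨fun z : S => u z, continuousOn_iff_continuous_restrict.1 hu⟩ : C(S, ℂ))
  refine ⟨v, v.continuous, fun z hz => ?_⟩
  exact congrArg (fun f : C(S, ℂ) => f ⟨z, hz⟩) hv

theorem glue_cont {X Y : Type*} [TopologicalSpace X] [TopologicalSpace Y] {A B : Set X}
    [DecidablePred (· ∈ A)]
    (hA : IsClosed A) (hB : IsClosed B) {u v : X → Y} (hu : ContinuousOn u A)
    (hv : ContinuousOn v B) (h : ∀ z ∈ A ∩ B, u z = v z) :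
    ContinuousOn (fun z => if z ∈ A then u z else v z) (A ∪ B) := by
  refine ContinuousOn.union_of_isClosed ?_ ?_ hA hB
  · exact hu.congr fun z hz => by simp [hz]
  · refine hv.congr fun z hz => ?_
    by_cases hzA : z ∈ A
    · simp [hzA, h z ⟨hzA, hz⟩]
    · simp [hzA]

theorem HasLog.glue {X : Type*} [TopologicalSpace X] {A B : Set X} (hA : IsClosed A)
    (hB : IsClosed B) (hc : IsPreconnected (A ∩ B)) {g : X → ℂ} (h1 : HasLog g A)
    (h2 : HasLog g B) : HasLog g (A ∪ B) := by
  classical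
  obtain ⟨u, hu, eu⟩ := h1
  obtain ⟨v, hv, ev⟩ := h2
  obtain ⟨m, hm⟩ := log_diff_const hc (hu.mono inter_subset_left) (hv.mono inter_subset_right)
    (fun z hz => by rw [← eu z hz.1, ← ev z hz.2])
  refine ⟨fun z => if z ∈ A then u z else v z + m * (2 * Real.pi * Complex.I),
    glue_cont hA hB hu (hv.add continuousOn_const) hm, ?_⟩
  intro z hz
  by_cases hzA : z ∈ A
  · simp [hzA, eu z hzA]
  · have hzB : z ∈ B := hz.resolve_left hzA
    simp only [hzA, if_false]
    rw [Complex.exp_add, exp_int_two_pi, mul_one, ev z hzB]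

theorem eilenberg_aux {W C : Set ℂ} (hWo : IsOpen W) (hW : Convex ℝ W) (hC : IsClosed C)
    (hCW : C ⊆ W) (F : Finset ℂ) (hF : ∀ a ∈ F, a ∉ C) :
    ∀ g : ℂ → ℂ, ContinuousOn g W → (∀ z ∈ W, z ∉ F → g z ≠ 0) →
    ∃ m : ℂ → ℤ, HasLog (fun z => g z / ∏ a ∈ F, (z - a) ^ m a) C := by
  classical
  induction F using Finset.induction_on with
  | empty =>
    intro g hg h0
    exact ⟨0, by simpa using (hasLog_convex hW hg (by simpa using h0)).mono hCW⟩
  | insert a F ha ih =>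
    intro g hg h0
    have haC : a ∉ C := hF a (by simp)
    have hF' : ∀ b ∈ F, b ∉ C := fun b hb => hF b (by simp [hb])
    by_cases haW : a ∈ W
    swap
    · obtain ⟨m, hm⟩ := ih hF' g hg (fun z hz hzF => h0 z hz (by
        simp only [Finset.mem_insert, not_or]; exact ⟨fun h => haW (h ▸ hz), hzF⟩))
      refine ⟨fun b => if b = a then 0 else m b, hm.congr fun z hz => ?_⟩
      rw [Finset.prod_insert ha]
      simp only [if_true, zpow_zero, one_mul]
      congr 1
      refine Finset.prod_congr rfl fun b hb => ?_
      rw [if_neg]; rintro rfl; exact ha hb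
    -- small disc
    have hopen : IsOpen (W ∩ Cᶜ ∩ (↑F : Set ℂ)ᶜ) :=
      (hWo.inter hC.isOpen_compl).inter (F.finite_toSet.isClosed.isOpen_compl)
    obtain ⟨r, hr, hrb⟩ := nhds_basis_closedBall.mem_iff.1
      (hopen.mem_nhds (x := a) ⟨⟨haW, haC⟩, by simpa using ha⟩)
    have hann : {z : ℂ | ‖z - a‖ ∈ Ioc 0 r} ⊆ closedBall a r := fun z hz => by
      rw [mem_closedBall, dist_eq_norm]; exact hz.2
    obtain ⟨m, ⟨u, hu, eu⟩, -⟩ := annulus_classify (a := a) (T := Ioc 0 r) ordConnected_Ioc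
      (fun x hx => hx.1) ⟨r, hr, le_rfl⟩ (g := g)
      (hg.mono fun z hz => (hrb (hann hz)).1.1)
      (fun z hz => h0 z (hrb (hann hz)).1.1 (by
        simp only [Finset.mem_insert, not_or]
        refine ⟨?_, by simpa using (hrb (hann hz)).2⟩
        rintro rfl; simp at hz))
    obtain ⟨v, hv, ev⟩ := tietze (S := sphere a r) isClosed_sphere (u := u)
      (hu.mono fun z hz => by
        rw [mem_sphere, dist_eq_norm] at hz
        show ‖z - a‖ ∈ Ioc 0 r
        rw [hz]; exact ⟨hr, le_rfl⟩)
    have hne : ∀ z, z ∉ ball a r → z - a ≠ 0 := fun z hz h => hz (by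
      rw [sub_eq_zero.1 h]; exact mem_ball_self hr)
    let g' : ℂ → ℂ := fun z => if z ∈ closedBall a r then Complex.exp (v z) else g z / (z - a) ^ m
    have hg'1 : ∀ z ∈ closedBall a r, g' z = Complex.exp (v z) := fun z hz => by simp only [g', if_pos hz]
    have hg'2 : ∀ z, z ∉ ball a r → g' z = g z / (z - a) ^ m := fun z hz => by
      by_cases h : z ∈ closedBall a r
      · have hs : z ∈ sphere a r := by
          rw [mem_sphere]; rw [mem_closedBall] at h; rw [mem_ball, not_lt] at hz; exact le_antisymm h hz
        rw [hg'1 z h, ev z hs]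
        rw [mem_sphere, dist_eq_norm] at hs
        exact (eu z (by show ‖z - a‖ ∈ Ioc 0 r; rw [hs]; exact ⟨hr, le_rfl⟩)).symm
      · simp only [g', if_neg h]
    have hcont : ContinuousOn g' W := by
      have : W = (closedBall a r) ∪ (W ∩ (ball a r)ᶜ) := by
        ext z; constructor
        · intro hz; by_cases h : z ∈ ball a r
          · exact Or.inl (ball_subset_closedBall h)
          · exact Or.inr ⟨hz, h⟩
        · rintro (h | h)
          · exact (hrb h).1.1
          · exact h.1
      have c1 : ContinuousOn g' (closedBall a r) :=
        (Complex.continuous_exp.comp hv).continuousOn.congr hg'1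
      have c2 : ContinuousOn g' (W ∩ (ball a r)ᶜ) := by
        refine ContinuousOn.congr (f := fun z => g z / (z - a) ^ m) ?_ (fun z hz => hg'2 z hz.2)
        refine (hg.mono inter_subset_left).div (ContinuousOn.zpow₀ (by fun_prop) _ fun z hz =>
          Or.inl (hne z hz.2)) fun z hz => zpow_ne_zero _ (hne z hz.2)
      rw [this]
      intro z hz
      refine ContinuousWithinAt.union ?_ ?_
      · by_cases h : z ∈ closedBall a r
        · exact c1 z h
        · exact continuousWithinAt_of_notMem_closure (by rwa [isClosed_closedBall.closure_eq])
      · by_cases h : z ∈ ball a r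
        · refine continuousWithinAt_of_notMem_closure fun hcl => ?_
          have := closure_mono (inter_subset_right : W ∩ (ball a r)ᶜ ⊆ _) hcl
          rw [isOpen_ball.isClosed_compl.closure_eq] at this
          exact this h
        · exact c2 z ⟨this ▸ hz, h⟩
    obtain ⟨m', hm'⟩ := ih hF' g' hcont (fun z hz hzF => by
      by_cases h : z ∈ ball a r
      · rw [hg'1 z (ball_subset_closedBall h)]; exact Complex.exp_ne_zero _
      · rw [hg'2 z h]
        refine div_ne_zero (h0 z hz ?_) (zpow_ne_zero _ (hne z h))
        simp only [Finset.mem_insert, not_or]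
        exact ⟨fun e => hne z h (sub_eq_zero.2 e), hzF⟩)
    refine ⟨fun b => if b = a then m else m' b, hm'.congr fun z hz => ?_⟩
    have hzb : z ∉ ball a r := fun h => (hrb (ball_subset_closedBall h)).1.2 hz
    rw [hg'2 z hzb, Finset.prod_insert ha, div_div]
    simp only [if_true]
    congr 2
    refine Finset.prod_congr rfl fun b hb => ?_
    rw [if_neg]; rintro rfl; exact ha hb

/-- Eilenberg's theorem -/
theorem eilenberg {C : Set ℂ} (hC : IsCompact C) {g : ℂ → ℂ} (hg : ContinuousOn g C)
    (h0 : ∀ z ∈ C, g z ≠ 0) :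
    ∃ (F : Finset ℂ) (m : ℂ → ℤ), (∀ a ∈ F, a ∉ C) ∧
      HasLog (fun z => g z / ∏ a ∈ F, (z - a) ^ m a) C := by
  classical
  rcases C.eq_empty_or_nonempty with rfl | hne
  · exact ⟨∅, 0, by simp, 0, continuousOn_empty _, by simp⟩
  obtain ⟨δ, hδ, hδ'⟩ : ∃ δ > 0, ∀ z ∈ C, δ ≤ ‖g z‖ := by
    obtain ⟨z, hz, hmin⟩ := hC.exists_isMinOn hne hg.norm
    exact ⟨‖g z‖, norm_pos_iff.2 (h0 z hz), fun w hw => hmin hw⟩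
  obtain ⟨g1, hg1, eg1⟩ := tietze hC.isClosed hg
  obtain ⟨G, hG, hGa, -⟩ := hg1.exists_contDiff_approx 1 (ε := fun _ => δ / 2) continuous_const
    (fun _ => half_pos hδ)
  have hd : ∀ x, HasFDerivAt G (fderiv ℝ G x) x := fun x =>
    (hG.differentiable (by norm_num) x).hasFDerivAt
  have sard := MeasureTheory.addHaar_image_eq_zero_of_det_fderivWithin_eq_zero
    (MeasureTheory.volume : MeasureTheory.Measure ℂ) (s := {x | (fderiv ℝ G x).det = 0})
    (f := G) (f' := fun x => fderiv ℝ G x) (fun x hx => (hd x).hasFDerivWithinAt) (fun x hx => hx)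
  obtain ⟨c, hcb, hc⟩ : ∃ c ∈ ball (0:ℂ) (δ / 2), c ∉ G '' {x | (fderiv ℝ G x).det = 0} := by
    by_contra hcon
    push Not at hcon
    have h1 : MeasureTheory.volume (ball (0:ℂ) (δ / 2)) ≤ 0 := by
      rw [← sard]; exact MeasureTheory.measure_mono hcon
    have h2 := Metric.measure_ball_pos MeasureTheory.volume (0:ℂ) (half_pos hδ)
    exact absurd h1 (not_le.2 h2)
  obtain ⟨R, hR⟩ := hC.isBounded.subset_ball 0
  have hfin : (closedBall (0:ℂ) R ∩ {z | G z = c}).Finite := by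
    by_contra hinf
    have hcl : IsClosed {z | G z = c} := isClosed_eq hG.continuous continuous_const
    obtain ⟨x, hx, hacc⟩ := Set.Infinite.exists_accPt_of_subset_isCompact hinf
      ((isCompact_closedBall (0:ℂ) R).inter_right hcl) subset_rfl
    have hdet : (fderiv ℝ G x).det ≠ 0 := fun h => hc ⟨x, h, hx.2⟩
    have := (hd x).eventually_ne (c := c) ⟨_, ((fderiv ℝ G x).toContinuousLinearEquivOfDetNeZero
      hdet).antilipschitz⟩
    rw [accPt_iff_frequently_nhdsNE] at hacc
    obtain ⟨y, hy1, hy2⟩ := (hacc.and_eventually this).exists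
    exact hy2 hy1.2
  have hclose : ∀ z ∈ C, ‖(G z - c) - g z‖ < ‖g z‖ := by
    intro z hz
    have h1 := hGa z
    rw [dist_eq_norm, eg1 z hz] at h1
    have h2 : ‖c‖ < δ / 2 := by simpa using hcb
    calc ‖(G z - c) - g z‖ = ‖(G z - g z) - c‖ := by ring_nf
      _ ≤ ‖G z - g z‖ + ‖c‖ := norm_sub_le _ _
      _ < δ := by linarith
      _ ≤ _ := hδ' z hz
  have hFC : ∀ a ∈ hfin.toFinset, a ∉ C := by
    intro a ha haC
    have := hclose a haC
    simp only [Finite.mem_toFinset, mem_inter_iff, mem_setOf_eq] at ha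
    rw [ha.2] at this; simp at this
  obtain ⟨m, hm⟩ := eilenberg_aux isOpen_ball (convex_ball (0:ℂ) R) hC.isClosed hR hfin.toFinset hFC
    (fun z => G z - c) (by have := hG.continuous; fun_prop) (fun z hz hzF => by
      simp only [Finite.mem_toFinset, mem_inter_iff, mem_setOf_eq] at hzF
      intro h; exact hzF ⟨ball_subset_closedBall hz, sub_eq_zero.1 h⟩)
  refine ⟨hfin.toFinset, m, hFC, ?_⟩
  have h3 := hm.div (hasLog_div_of_close (g := fun z => G z - c) (g' := g) (by have := hG.continuous; fun_prop) hg hclose)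
  refine h3.congr fun z hz => ?_
  have : G z - c ≠ 0 := by
    intro h; have := hclose z hz; rw [h] at this; simp at this
  have := h0 z hz
  field_simp

theorem compl_ball_preconnected (a : ℂ) (R : ℝ) (hR : 0 < R) : IsPathConnected {z : ℂ | R < ‖z - a‖} := by
  have : {z : ℂ | R < ‖z - a‖} = (fun s => a + Complex.exp s) '' {s : ℂ | Real.log R < s.re} := by
    ext z; constructor
    · intro hz
      have hz' : R < ‖z - a‖ := hz
      have h0 : z - a ≠ 0 := by rw [← norm_pos_iff]; linarith
      refine ⟨Complex.log (z - a), ?_, by simp [Complex.exp_log h0]⟩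
      show Real.log R < _
      rw [Complex.log_re]; exact Real.log_lt_log hR hz'
    · rintro ⟨s, hs, rfl⟩
      have hs' : Real.log R < s.re := hs
      show R < ‖a + Complex.exp s - a‖
      rw [add_sub_cancel_left, Complex.norm_exp]
      rwa [← Real.log_lt_iff_lt_exp hR]
  rw [this]
  refine IsPathConnected.image ?_ (by fun_prop)
  refine Convex.isPathConnected (convex_halfSpace_re_gt _) ⟨((Real.log R + 1 : ℝ) : ℂ), ?_⟩
  simp

theorem hasLog_of_joined {C : Set ℂ} {p q : ℂ} (h : JoinedIn Cᶜ p q) :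
    HasLog (fun z => (z - p) / (z - q)) C := by
  obtain ⟨γ, hγ⟩ := h.symm
  have hq : q ∉ C := by simpa using hγ 0
  have := hasLog_of_homotopy (S := C) (fun t z => (z - γ.extend t) / (z - q)) ?_ ?_ ?_
  · simpa using this
  · refine ContinuousOn.div ?_ (by fun_prop) ?_
    · have := γ.continuous_extend
      fun_prop
    · rintro ⟨t, z⟩ ⟨ht, hz⟩ h
      exact hq (by rw [← sub_eq_zero.1 h]; exact hz)
  · intro t ht z hz
    refine div_ne_zero ?_ ?_
    · intro h
      rw [Path.extend_apply γ ht] at h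
      exact hγ ⟨t, ht⟩ (by rw [← sub_eq_zero.1 h]; exact hz)
    · intro h; exact hq (by rw [← sub_eq_zero.1 h]; exact hz)
  · refine (hasLog_const one_ne_zero C).congr fun z hz => ?_
    have : z - q ≠ 0 := fun h => hq (by rw [← sub_eq_zero.1 h]; exact hz)
    simp [div_self this]

theorem hasLog_far {C : Set ℂ} {R : ℝ} (hC : C ⊆ ball 0 R) {a : ℂ} (ha : R ≤ ‖a‖) :
    HasLog (fun z => z - a) C := by
  refine (hasLog_convex (convex_ball (0:ℂ) R) (by fun_prop) ?_).mono hC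
  intro z hz h
  rw [sub_eq_zero.1 h] at hz; simp at hz; linarith

theorem hasLog_sub_of_unbounded {C : Set ℂ} {R : ℝ} (hC : C ⊆ ball 0 R) {a b : ℂ} (hb : R ≤ ‖b‖)
    (hj : JoinedIn Cᶜ a b) : HasLog (fun z => z - a) C := by
  refine ((hasLog_of_joined hj).mul (hasLog_far hC hb)).congr fun z hz => ?_
  have : z - b ≠ 0 := (hasLog_far hC hb).ne_zero z hz
  rw [div_mul_cancel₀ _ this]

theorem HasLog.prod {X : Type*} [TopologicalSpace X] {S : Set X} {ι : Type*} (F : Finset ι)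
    (g : ι → X → ℂ) (h : ∀ i ∈ F, HasLog (g i) S) : HasLog (fun z => ∏ i ∈ F, g i z) S := by
  classical
  induction F using Finset.induction_on with
  | empty => simpa using hasLog_const one_ne_zero S
  | insert a F ha ih =>
    simp only [Finset.prod_insert ha]
    exact (h a (by simp)).mul (ih fun i hi => h i (by simp [hi]))

/-- log criterion -/
theorem hasLog_of_connected_compl {C : Set ℂ} (hC : IsCompact C)
    (hcc : ∀ p ∉ C, ∀ q ∉ C, JoinedIn Cᶜ p q) {g : ℂ → ℂ} (hg : ContinuousOn g C)
    (h0 : ∀ z ∈ C, g z ≠ 0) : HasLog g C := by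
  obtain ⟨F, m, hF, hl⟩ := eilenberg hC hg h0
  obtain ⟨R, hR⟩ := hC.isBounded.subset_ball 0
  have hb : R ≤ ‖((|R| : ℝ) : ℂ)‖ := by simp [le_abs_self]
  have hbC : ((|R| : ℝ) : ℂ) ∉ C := fun h => by
    have := hR h; rw [mem_ball_zero_iff] at this; linarith
  have h1 : HasLog (fun z => ∏ a ∈ F, (z - a) ^ m a) C := HasLog.prod F (fun a z => (z - a) ^ m a)
    fun a ha => (hasLog_sub_of_unbounded hR hb (hcc a (hF a ha) _ hbC)).zpow (m a)
  refine (hl.mul h1).congr fun z hz => ?_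
  rw [div_mul_cancel₀ _ (h1.ne_zero z hz)]

theorem joinedIn_of_mem_component {C : Set ℂ} (hC : IsClosed C) {p q : ℂ} (hp : p ∉ C)
    (hq : q ∈ connectedComponentIn Cᶜ p) : JoinedIn Cᶜ p q := by
  have ho : IsOpen (connectedComponentIn Cᶜ p) := hC.isOpen_compl.connectedComponentIn
  have hc : IsConnected (connectedComponentIn Cᶜ p) := isConnected_connectedComponentIn_iff.2 hp
  exact ((ho.isConnected_iff_isPathConnected.1 hc).joinedIn p (mem_connectedComponentIn hp) q hq).mono
    (connectedComponentIn_subset _ _)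

theorem mem_component_of_joinedIn {C : Set ℂ} {p q : ℂ} (h : JoinedIn Cᶜ p q) :
    q ∈ connectedComponentIn Cᶜ p := by
  obtain ⟨γ, hγ⟩ := h
  have hr : range γ ⊆ connectedComponentIn Cᶜ p := by
    refine IsPreconnected.subset_connectedComponentIn (isPreconnected_range γ.continuous)
      ⟨0, γ.source⟩ ?_
    rintro _ ⟨t, rfl⟩; exact hγ t
  exact hr ⟨1, γ.target⟩

theorem joinedIn_iff_component {C : Set ℂ} (hC : IsClosed C) {p q : ℂ} (hp : p ∉ C) :
    JoinedIn Cᶜ p q ↔ q ∈ connectedComponentIn Cᶜ p :=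
  ⟨mem_component_of_joinedIn, joinedIn_of_mem_component hC hp⟩

/-- frontier of a component of an open set lies in the complement -/
theorem closure_component_subset {X : Type*} [TopologicalSpace X] [LocallyConnectedSpace X]
    {C : Set X} (hC : IsClosed C) {p : X} :
    closure (connectedComponentIn Cᶜ p) ⊆ connectedComponentIn Cᶜ p ∪ C := by
  intro z hz
  by_contra hcon
  rw [mem_union, not_or] at hcon
  have hz' : z ∈ Cᶜ := hcon.2
  have ho : IsOpen (connectedComponentIn Cᶜ z) := hC.isOpen_compl.connectedComponentIn
  obtain ⟨w, hw1, hw2⟩ := mem_closure_iff.1 hz _ ho (mem_connectedComponentIn hz')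
  have e1 := connectedComponentIn_eq hw1
  have e2 := connectedComponentIn_eq hw2
  exact hcon.1 (by rw [e2, ← e1]; exact mem_connectedComponentIn hz')

/-- independence of the functions z - p, z - q -/
theorem indep {C : Set ℂ} (hC : IsClosed C) {p q : ℂ} (hp : p ∉ C) (hq : q ∉ C)
    (hb : Bornology.IsBounded (connectedComponentIn Cᶜ p)) (hqD : q ∉ connectedComponentIn Cᶜ p)
    {k l : ℤ} (h : HasLog (fun z => (z - p) ^ k * (z - q) ^ l) C) : k = 0 := by
  classical
  set D := connectedComponentIn Cᶜ p with hD
  have hDo : IsOpen D := hC.isOpen_compl.connectedComponentIn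
  have hpD : p ∈ D := mem_connectedComponentIn hp
  have hDC : ∀ z ∈ D, z ∉ C := fun z hz => connectedComponentIn_subset _ _ hz
  have hcl : closure D ⊆ D ∪ C := closure_component_subset hC
  obtain ⟨u, hu, eu⟩ := h
  obtain ⟨v, hv, ev⟩ := tietze hC hu
  let Φ : ℂ → ℂ := fun z => if z ∈ closure D then Complex.exp (v z) else (z - p) ^ k * (z - q) ^ l
  have h1 : ∀ z ∈ closure D, Φ z = Complex.exp (v z) := fun z hz => by simp only [Φ, if_pos hz]
  have h2 : ∀ z, z ∉ D → Φ z = (z - p) ^ k * (z - q) ^ l := fun z hz => by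
    by_cases h : z ∈ closure D
    · have hzC : z ∈ C := (hcl h).resolve_left hz
      rw [h1 z h, ev z hzC]; exact (eu z hzC).symm
    · simp only [Φ, if_neg h]
  have hpq : p ≠ q := fun h => hqD (h ▸ hpD)
  have hΦ0 : ∀ z, z ≠ q → Φ z ≠ 0 := by
    intro z hz
    by_cases h : z ∈ D
    · rw [h1 z (subset_closure h)]; exact Complex.exp_ne_zero _
    · rw [h2 z h]
      refine mul_ne_zero (zpow_ne_zero _ ?_) (zpow_ne_zero _ (sub_ne_zero.2 hz))
      rw [sub_ne_zero]; rintro rfl; exact h hpD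
  have hΦc : ContinuousOn Φ {q}ᶜ := by
    have e : ({q}ᶜ : Set ℂ) = ({q}ᶜ ∩ closure D) ∪ ({q}ᶜ ∩ Dᶜ) := by
      rw [← inter_union_distrib_left]
      ext z; simp only [mem_compl_iff, mem_singleton_iff, mem_inter_iff, mem_union]
      constructor
      · intro hz; refine ⟨hz, ?_⟩
        by_cases h : z ∈ D
        · exact Or.inl (subset_closure h)
        · exact Or.inr h
      · exact fun h => h.1
    have c1 : ContinuousOn Φ (closure D) := (Complex.continuous_exp.comp hv).continuousOn.congr h1
    have c2 : ContinuousOn Φ ({q}ᶜ ∩ Dᶜ) := by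
      refine ContinuousOn.congr (f := fun z => (z - p) ^ k * (z - q) ^ l) ?_ (fun z hz => h2 z hz.2)
      refine ContinuousOn.mul (ContinuousOn.zpow₀ (by fun_prop) _ fun z hz => Or.inl ?_)
        (ContinuousOn.zpow₀ (by fun_prop) _ fun z hz => Or.inl ?_)
      · rw [sub_ne_zero]; rintro rfl; exact hz.2 hpD
      · rw [sub_ne_zero]; exact hz.1
    rw [e]
    intro z hz
    have hzq : z ∈ ({q}ᶜ : Set ℂ) := e ▸ hz
    refine ContinuousWithinAt.union ?_ ?_
    · by_cases h : z ∈ closure D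
      · exact (c1 z h).mono inter_subset_right
      · refine continuousWithinAt_of_notMem_closure fun hcl => h ?_
        simpa using closure_mono (inter_subset_right : ({q}ᶜ ∩ closure D : Set ℂ) ⊆ _) hcl
    · by_cases h : z ∈ D
      · refine continuousWithinAt_of_notMem_closure fun hcl => ?_
        have := closure_mono (inter_subset_right : ({q}ᶜ ∩ Dᶜ : Set ℂ) ⊆ _) hcl
        rw [hDo.isClosed_compl.closure_eq] at this
        exact this h
      · exact c2 z ⟨hzq, h⟩
  have hset : {z : ℂ | ‖z - q‖ ∈ Ioi (0:ℝ)} = {q}ᶜ := by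
    ext z; simp [sub_eq_zero]
  obtain ⟨m, -, hm⟩ := annulus_classify (a := q) (T := Ioi 0) ordConnected_Ioi (fun x hx => hx)
    ⟨1, mem_Ioi.2 one_pos⟩ (g := Φ) (by rw [hset]; exact hΦc) (fun z hz => hΦ0 z (by
      rintro rfl; simp at hz))
  have hpq' : 0 < ‖p - q‖ := norm_pos_iff.2 (sub_ne_zero.2 hpq)
  -- small circle
  have hqcl : q ∉ closure D := fun h => (hcl h).elim hqD hq
  obtain ⟨r, hr, hrb⟩ := Metric.isOpen_iff.1 (isClosed_closure (s := D)).isOpen_compl q hqcl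
  set r' := min (r / 2) (‖p - q‖ / 2) with hr'
  have hr'0 : 0 < r' := lt_min (half_pos hr) (half_pos hpq')
  have w1 : Wind (fun t => Φ (circ q r' t)) l := by
    have ha : Wind (fun t => circ q r' t - p) 0 := by
      refine (wind_const (sub_ne_zero.2 hpq.symm)).of_close ?_ ?_ ?_
      · have := circ_continuous q r'; fun_prop
      · intro t; rw [circ_per]
      · intro t
        have : circ q r' t - p - (q - p) = circ q r' t - q := by ring
        rw [this, norm_circ_sub q hr'0.le, norm_sub_rev]
        exact lt_of_le_of_lt (min_le_right _ _) (half_lt_self hpq')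
    have := (ha.zpow k).mul ((wind_circ q hr'0).zpow l)
    simp only [mul_zero, mul_one, zero_add] at this
    refine this.congr fun t => h2 _ fun h => hrb ?_ (subset_closure h)
    rw [mem_ball, dist_eq_norm, norm_circ_sub q hr'0.le]
    exact lt_of_le_of_lt (min_le_left _ _) (half_lt_self hr)
  -- big circle
  obtain ⟨R, hR⟩ := hb.subset_ball q
  set R' := max R (‖p - q‖ + 1) with hR'
  have hR'0 : 0 < R' := lt_of_lt_of_le (by linarith) (le_max_right _ _)
  have w2 : Wind (fun t => Φ (circ q R' t)) (k + l) := by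
    have ha : Wind (fun t => circ q R' t - p) 1 := by
      refine (wind_circ q hR'0).of_close ?_ ?_ ?_
      · have := circ_continuous q R'; fun_prop
      · intro t; rw [circ_per]
      · intro t
        have : circ q R' t - p - (circ q R' t - q) = q - p := by ring
        rw [this, norm_circ_sub q hR'0.le, norm_sub_rev]
        exact lt_of_lt_of_le (by linarith) (le_max_right _ _)
    have := (ha.zpow k).mul ((wind_circ q hR'0).zpow l)
    simp only [mul_one] at this
    refine this.congr fun t => h2 _ fun h => ?_
    have := hR h
    rw [mem_ball, dist_eq_norm, norm_circ_sub q hR'0.le] at this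
    exact absurd this (not_lt.2 (le_max_left _ _))
  have e1 := (hm r' hr'0).unique w1
  have e2 := (hm R' hR'0).unique w2
  omega

theorem joined_far {C : Set ℂ} {R : ℝ} (hR : 0 < R) (hC : C ⊆ ball 0 R) {a b : ℂ} (ha : R < ‖a‖)
    (hb : R < ‖b‖) : JoinedIn Cᶜ a b := by
  refine ((compl_ball_preconnected 0 R hR).joinedIn a (by simpa using ha) b (by simpa using hb)).mono ?_
  intro z hz hzC
  have := hC hzC
  simp at hz this; linarith

theorem joined_of_unbounded {C : Set ℂ} (hC : IsCompact C) {p q : ℂ} (hp : p ∉ C) (hq : q ∉ C)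
    (h1 : ¬ Bornology.IsBounded (connectedComponentIn Cᶜ p))
    (h2 : ¬ Bornology.IsBounded (connectedComponentIn Cᶜ q)) : JoinedIn Cᶜ p q := by
  obtain ⟨R, hR⟩ := hC.isBounded.subset_ball 0
  have hR' : C ⊆ ball 0 (max R 1) := hR.trans (ball_subset_ball (le_max_left _ _))
  have key : ∀ p, p ∉ C → ¬ Bornology.IsBounded (connectedComponentIn Cᶜ p) →
      ∃ a, max R 1 < ‖a‖ ∧ JoinedIn Cᶜ p a := by
    intro p hp h
    by_contra hcon
    push Not at hcon
    refine h ((isBounded_closedBall (x := (0:ℂ)) (r := max R 1)).subset fun z hz => ?_)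
    by_contra hz'
    rw [mem_closedBall_zero_iff, not_le] at hz'
    exact hcon z hz' (joinedIn_of_mem_component hC.isClosed hp hz)
  obtain ⟨a, ha, hpa⟩ := key p hp h1
  obtain ⟨b, hb, hqb⟩ := key q hq h2
  exact (hpa.trans (joined_far (by positivity) hR' ha hb)).trans hqb.symm

theorem joined_of_hasLog {C : Set ℂ} (hC : IsCompact C) {p q : ℂ} (hp : p ∉ C) (hq : q ∉ C)
    (h : HasLog (fun z => (z - p) / (z - q)) C) : JoinedIn Cᶜ p q := by
  by_contra hcon
  have hpq : q ∉ connectedComponentIn Cᶜ p := fun h => hcon (joinedIn_of_mem_component hC.isClosed hp h)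
  have hqp : p ∉ connectedComponentIn Cᶜ q := fun h => hcon (joinedIn_of_mem_component hC.isClosed hq h).symm
  by_cases hb1 : Bornology.IsBounded (connectedComponentIn Cᶜ p)
  · have := indep hC.isClosed hp hq hb1 hpq (k := 1) (l := -1) (h.congr fun z hz => by
      simp [div_eq_mul_inv])
    omega
  by_cases hb2 : Bornology.IsBounded (connectedComponentIn Cᶜ q)
  · have := indep hC.isClosed hq hp hb2 hqp (k := -1) (l := 1) (h.congr fun z hz => by
      simp [div_eq_mul_inv, mul_comm])
    omega
  exact hcon (joined_of_unbounded hC hp hq hb1 hb2)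

theorem janiszewski {A B : Set ℂ} (hA : IsCompact A) (hB : IsCompact B) (hc : IsPreconnected (A ∩ B))
    {p q : ℂ} (h1 : JoinedIn Aᶜ p q) (h2 : JoinedIn Bᶜ p q) : JoinedIn (A ∪ B)ᶜ p q := by
  refine joined_of_hasLog (hA.union hB) ?_ ?_ ?_
  · exact fun h => h.elim h1.source_mem h2.source_mem
  · exact fun h => h.elim h1.target_mem h2.target_mem
  · exact HasLog.glue hA.isClosed hB.isClosed hc (hasLog_of_joined h1) (hasLog_of_joined h2)

end BKE

namespace BKE
open Set Filter Topology Metric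
open scoped unitInterval

theorem descend_compact {X Y Z : Type*} [TopologicalSpace X] [TopologicalSpace Y] [T2Space Y]
    [TopologicalSpace Z] [hZ : Nonempty Z] {K : Set X} (hK : IsCompact K) {φ : X → Y} (hφ : ContinuousOn φ K)
    (hi : InjOn φ K) {L : X → Z} (hL : ContinuousOn L K) :
    ∃ u : Y → Z, ContinuousOn u (φ '' K) ∧ ∀ x ∈ K, u (φ x) = L x := by
  classical
  obtain ⟨z0⟩ := hZ
  rcases K.eq_empty_or_nonempty with rfl | ⟨x0, hx0⟩
  · exact ⟨fun _ => z0, by simp, by simp⟩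
  haveI : CompactSpace K := isCompact_iff_compactSpace.1 hK
  haveI : Nonempty X := ⟨x0⟩
  have hinv : ∀ x ∈ K, Function.invFunOn φ K (φ x) = x := fun x hx => hi.leftInvOn_invFunOn hx
  refine ⟨fun y => L (Function.invFunOn φ K y), ?_, fun x hx => by dsimp only; rw [hinv x hx]⟩
  have hc : Continuous (fun x : K => φ x) := continuousOn_iff_continuous_restrict.1 hφ
  have emb : IsClosedEmbedding (fun x : K => φ x) := hc.isClosedEmbedding (fun x y h =>
    Subtype.ext (hi x.2 y.2 h))
  have hr : range (fun x : K => φ x) = φ '' K := by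
    ext y; simp
  have hLc : Continuous (fun x : K => L x) := continuousOn_iff_continuous_restrict.1 hL
  rw [← hr, continuousOn_iff_continuous_restrict]
  have h3 := hLc.comp emb.toIsEmbedding.toHomeomorph.symm.continuous
  convert h3 using 1
  ext y
  obtain ⟨x, rfl⟩ := emb.toIsEmbedding.toHomeomorph.surjective y
  simp only [Function.comp, Homeomorph.symm_apply_apply]
  show L (Function.invFunOn φ K (φ x)) = L x
  rw [hinv x x.2]

theorem hasLog_arc {φ : ℝ → ℂ} {a b : ℝ} (hφ : ContinuousOn φ (Icc a b)) (hi : InjOn φ (Icc a b))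
    {g : ℂ → ℂ} (hg : ContinuousOn g (φ '' Icc a b)) (h0 : ∀ z ∈ φ '' Icc a b, g z ≠ 0) :
    HasLog g (φ '' Icc a b) := by
  obtain ⟨L, hL, e⟩ := hasLog_convex (convex_Icc a b) (g := fun t => g (φ t))
    (hg.comp hφ (mapsTo_image _ _)) (fun t ht => h0 _ ⟨t, ht, rfl⟩)
  obtain ⟨u, hu, e'⟩ := descend_compact isCompact_Icc hφ hi hL
  refine ⟨u, hu, ?_⟩
  rintro _ ⟨t, ht, rfl⟩
  rw [e' t ht]; exact e t ht

theorem arc_joined {φ : ℝ → ℂ} {a b : ℝ} (hφ : ContinuousOn φ (Icc a b)) (hi : InjOn φ (Icc a b))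
    {p q : ℂ} (hp : p ∉ φ '' Icc a b) (hq : q ∉ φ '' Icc a b) : JoinedIn (φ '' Icc a b)ᶜ p q := by
  refine joined_of_hasLog (isCompact_Icc.image_of_continuousOn hφ) hp hq (hasLog_arc hφ hi ?_ ?_)
  · refine ContinuousOn.div (by fun_prop) (by fun_prop) fun z hz h => hq ?_
    rw [← sub_eq_zero.1 h]; exact hz
  · intro z hz
    refine div_ne_zero (fun h => hp ?_) (fun h => hq ?_) <;>
    · rw [← sub_eq_zero.1 h]; exact hz

section Jordan
variable {c : ℝ → ℂ}

/-- inside of a Jordan curve -/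
def inside (c : ℝ → ℂ) : Set ℂ := {p | p ∉ range c ∧ ¬ Wind (fun t => c t - p) 0}
/-- outside of a Jordan curve -/
def outside (c : ℝ → ℂ) : Set ℂ := {p | p ∉ range c ∧ Wind (fun t => c t - p) 0}

theorem IsJordan.exists_wind (hc : IsJordan c) {p : ℂ} (hp : p ∉ range c) :
    ∃ m, Wind (fun t => c t - p) m := by
  refine BKE.exists_wind ?_ ?_ ?_
  · have := hc.cont; fun_prop
  · intro t h; exact hp ⟨t, sub_eq_zero.1 h⟩
  · intro t; rw [hc.per]

theorem IsJordan.joined_of_wind (hc : IsJordan c) {p q : ℂ} (hp : p ∉ range c) (hq : q ∉ range c)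
    {m : ℤ} (h1 : Wind (fun t => c t - p) m) (h2 : Wind (fun t => c t - q) m) :
    JoinedIn (range c)ᶜ p q := by
  refine joined_of_hasLog hc.isCompact hp hq (hc.hasLog ?_)
  simpa using h1.div h2

theorem IsJordan.wind_of_joined (hc : IsJordan c) {p q : ℂ} (h : JoinedIn (range c)ᶜ p q)
    {m : ℤ} (h2 : Wind (fun t => c t - q) m) : Wind (fun t => c t - p) m := by
  have := (wind_of_hasLog (hasLog_of_joined h) hc.cont hc.per (fun t => ⟨t, rfl⟩)).mul h2
  simp only [zero_add] at this
  refine this.congr fun t => ?_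
  rw [div_mul_cancel₀]; exact h2.ne_zero t

theorem IsJordan.bounded_of_inside (hc : IsJordan c) {p : ℂ} (hp : p ∈ inside c) :
    Bornology.IsBounded (connectedComponentIn (range c)ᶜ p) := by
  by_contra hcon
  obtain ⟨R, hR⟩ := hc.isCompact.isBounded.subset_ball 0
  have : ∃ b ∈ connectedComponentIn (range c)ᶜ p, R ≤ ‖b‖ := by
    by_contra h
    push Not at h
    exact hcon ((isBounded_ball (x := (0:ℂ)) (r := R)).subset fun z hz => by simpa using h z hz)
  obtain ⟨b, hb, hbR⟩ := this
  have := wind_of_hasLog (hasLog_sub_of_unbounded hR hbR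
    (joinedIn_of_mem_component hc.isCompact.isClosed hp.1 hb)) hc.cont hc.per (fun t => ⟨t, rfl⟩)
  exact hp.2 this

theorem IsJordan.inside_joined (hc : IsJordan c) {p q : ℂ} (hp : p ∈ inside c) (hq : q ∈ inside c) :
    JoinedIn (range c)ᶜ p q := by
  by_contra hcon
  obtain ⟨m, hm⟩ := hc.exists_wind hp.1
  obtain ⟨n, hn⟩ := hc.exists_wind hq.1
  have hw := (hm.zpow n).mul (hn.zpow (-m))
  have e : n * m + -m * n = 0 := by ring
  rw [e] at hw
  have := indep hc.isCompact.isClosed hp.1 hq.1 (hc.bounded_of_inside hp)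
    (fun h => hcon (joinedIn_of_mem_component hc.isCompact.isClosed hp.1 h))
    (hc.hasLog (G := fun z => (z - p) ^ n * (z - q) ^ (-m)) hw)
  subst this
  exact hq.2 hn

theorem Wind.prod {ι : Type*} (F : Finset ι) (g : ι → ℝ → ℂ) (w : ι → ℤ) 
    (h : ∀ i ∈ F, Wind (g i) (w i)) : Wind (fun t => ∏ i ∈ F, g i t) (∑ i ∈ F, w i) := by
  classical
  induction F using Finset.induction_on with
  | empty => simpa using wind_const one_ne_zero
  | insert a F ha ih =>
    simp only [Finset.prod_insert ha, Finset.sum_insert ha]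
    exact (h a (by simp)).mul (ih fun i hi => h i (by simp [hi]))

theorem IsJordan.wind_inside (hc : IsJordan c) :
    (inside c).Nonempty ∧ ∃ w : ℤ, (w = 1 ∨ w = -1) ∧ ∀ p ∈ inside c, Wind (fun t => c t - p) w := by
  classical
  obtain ⟨g, hg, eg⟩ := hc.descend (circ_continuous 0 1) (circ_per 0 1)
  have hw1 : Wind (fun t => g (c t)) 1 := (wind_circ 0 one_pos).congr fun t => by rw [eg]; simp
  obtain ⟨F, m, hF, hl⟩ := eilenberg hc.isCompact hg (by
    rintro _ ⟨t, rfl⟩; exact hw1.ne_zero t)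
  choose! w hw using fun a (ha : a ∈ F) => hc.exists_wind (hF a ha)
  have h1 := wind_of_hasLog hl hc.cont hc.per (fun t => ⟨t, rfl⟩)
  have h2 := Wind.prod F (fun a t => (c t - a) ^ m a) (fun a => m a * w a)
    (fun a ha => (hw a ha).zpow (m a))
  have h3 := h1.mul h2
  have h4 : (1 : ℤ) = 0 + ∑ a ∈ F, m a * w a := by
    refine hw1.unique (h3.congr fun t => ?_)
    rw [div_mul_cancel₀]; exact h2.ne_zero t
  rw [zero_add] at h4
  have hne : ∃ a ∈ F, w a ≠ 0 := by
    by_contra hcon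
    push Not at hcon
    rw [Finset.sum_eq_zero (fun a ha => by rw [hcon a ha, mul_zero])] at h4
    omega
  obtain ⟨a, ha, hwa⟩ := hne
  have hain : a ∈ inside c := ⟨hF a ha, fun h => hwa ((hw a ha).unique h)⟩
  refine ⟨⟨a, hain⟩, w a, ?_, fun p hp => hc.wind_of_joined (hc.inside_joined hp hain) (hw a ha)⟩
  have hdvd : w a ∣ 1 := by
    rw [h4]
    refine Finset.dvd_sum fun b hb => Dvd.dvd.mul_left ?_ _
    by_cases hb0 : w b = 0
    · rw [hb0]; exact dvd_zero _
    · have hbin : b ∈ inside c := ⟨hF b hb, fun h => hb0 ((hw b hb).unique h)⟩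
      have := (hc.wind_of_joined (hc.inside_joined hbin hain) (hw a ha)).unique (hw b hb)
      rw [this]
  exact Int.isUnit_iff.1 (isUnit_of_dvd_one hdvd)

theorem IsJordan.inside_eq (hc : IsJordan c) {p : ℂ} (hp : p ∈ inside c) :
    inside c = connectedComponentIn (range c)ᶜ p := by
  ext q; constructor
  · intro hq; exact mem_component_of_joinedIn (hc.inside_joined hp hq)
  · intro hq
    have hj := joinedIn_of_mem_component hc.isCompact.isClosed hp.1 hq
    exact ⟨hj.target_mem, fun h => hp.2 (hc.wind_of_joined hj h)⟩

theorem IsJordan.outside_eq (hc : IsJordan c) {p : ℂ} (hp : p ∈ outside c) :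
    outside c = connectedComponentIn (range c)ᶜ p := by
  ext q; constructor
  · intro hq; exact mem_component_of_joinedIn (hc.joined_of_wind hp.1 hq.1 hp.2 hq.2)
  · intro hq
    have hj := joinedIn_of_mem_component hc.isCompact.isClosed hp.1 hq
    exact ⟨hj.target_mem, hc.wind_of_joined hj.symm hp.2⟩

theorem IsJordan.outside_far (hc : IsJordan c) {R : ℝ} (hR : range c ⊆ ball 0 R) {b : ℂ}
    (hb : R ≤ ‖b‖) : b ∈ outside c := by
  refine ⟨fun h => ?_, wind_of_hasLog (hasLog_far hR hb) hc.cont hc.per (fun t => ⟨t, rfl⟩)⟩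
  have := hR h; rw [mem_ball_zero_iff] at this; linarith

theorem IsJordan.outside_nonempty (hc : IsJordan c) : (outside c).Nonempty := by
  obtain ⟨R, hR⟩ := hc.isCompact.isBounded.subset_ball 0
  exact ⟨_, hc.outside_far hR (b := ((|R| : ℝ) : ℂ)) (by simp [le_abs_self])⟩

theorem IsJordan.inside_bounded (hc : IsJordan c) : Bornology.IsBounded (inside c) := by
  obtain ⟨p, hp⟩ := hc.wind_inside.1
  rw [hc.inside_eq hp]; exact hc.bounded_of_inside hp

theorem IsJordan.inside_open (hc : IsJordan c) : IsOpen (inside c) := by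
  obtain ⟨p, hp⟩ := hc.wind_inside.1
  rw [hc.inside_eq hp]; exact hc.isCompact.isClosed.isOpen_compl.connectedComponentIn

theorem IsJordan.outside_open (hc : IsJordan c) : IsOpen (outside c) := by
  obtain ⟨p, hp⟩ := hc.outside_nonempty
  rw [hc.outside_eq hp]; exact hc.isCompact.isClosed.isOpen_compl.connectedComponentIn

theorem IsJordan.inside_connected (hc : IsJordan c) : IsConnected (inside c) := by
  obtain ⟨p, hp⟩ := hc.wind_inside.1
  rw [hc.inside_eq hp]; exact isConnected_connectedComponentIn_iff.2 hp.1

theorem IsJordan.outside_connected (hc : IsJordan c) : IsConnected (outside c) := by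
  obtain ⟨p, hp⟩ := hc.outside_nonempty
  rw [hc.outside_eq hp]; exact isConnected_connectedComponentIn_iff.2 hp.1

theorem IsJordan.compl_eq (hc : IsJordan c) : (range c)ᶜ = inside c ∪ outside c := by
  ext z; constructor
  · intro hz
    by_cases h : Wind (fun t => c t - z) 0
    · exact Or.inr ⟨hz, h⟩
    · exact Or.inl ⟨hz, h⟩
  · rintro (h | h) <;> exact h.1

theorem inside_disjoint_outside : Disjoint (inside c) (outside c) :=
  Set.disjoint_left.2 fun _ h h' => h.2 h'.2

theorem IsJordan.closure_inside_subset (hc : IsJordan c) : closure (inside c) ⊆ inside c ∪ range c := by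
  obtain ⟨p, hp⟩ := hc.wind_inside.1
  rw [hc.inside_eq hp]; exact closure_component_subset hc.isCompact.isClosed

theorem IsJordan.closure_outside_subset (hc : IsJordan c) : closure (outside c) ⊆ outside c ∪ range c := by
  obtain ⟨p, hp⟩ := hc.outside_nonempty
  rw [hc.outside_eq hp]; exact closure_component_subset hc.isCompact.isClosed

theorem IsJordan.shift {X : Type*} [TopologicalSpace X] {c : ℝ → X} (hc : IsJordan c) (a : ℝ) : IsJordan (fun t => c (t + a)) :=
  ⟨by have := hc.cont; fun_prop, fun t => by
      have := hc.per (t + a); rw [← this]; congr 1; ring,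
    fun s t h => by obtain ⟨k, hk⟩ := hc.inj _ _ h; exact ⟨k, by linarith⟩⟩

theorem IsJordan.injOn {X : Type*} [TopologicalSpace X] {c : ℝ → X} (hc : IsJordan c) {a b : ℝ}
    (h : b - a < 1) : InjOn c (Icc a b) := by
  intro s hs t ht e
  obtain ⟨k, hk⟩ := hc.inj _ _ e
  have h1 : (k : ℝ) < 1 := by linarith [hs.2, ht.1]
  have h2 : (-1 : ℝ) < k := by linarith [hs.1, ht.2]
  have h3 : k < 1 := by exact_mod_cast h1
  have h4 : -1 < k := by exact_mod_cast h2
  have : k = 0 := by omega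
  rw [hk, this]; simp

theorem exists_rep {X : Type*} {c : ℝ → X} (hp : ∀ t, c (t + 1) = c t) (a t : ℝ) :
    ∃ s ∈ Ico a (a + 1), c s = c t := by
  refine ⟨a + Int.fract (t - a), ⟨by linarith [Int.fract_nonneg (t - a)],
    by linarith [Int.fract_lt_one (t - a)]⟩, ?_⟩
  have := per_int hp ⌊t - a⌋ (a + Int.fract (t - a))
  rw [← this]; congr 1; rw [add_assoc, Int.fract_add_floor]; ring

theorem IsJordan.dense_aux (hc : IsJordan c) {V : Set ℂ} (hVo : IsOpen V)
    (hcl : closure V ⊆ V ∪ range c) (hVJ : Disjoint V (range c)) (hne : V.Nonempty)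
    (hq : ∃ q, q ∉ V ∧ q ∉ range c) : range c ⊆ closure V := by
  rintro _ ⟨t0, rfl⟩
  rw [Metric.mem_closure_iff]
  intro ε hε
  by_contra hcon
  push Not at hcon
  obtain ⟨δ, hδ, hδc⟩ := Metric.continuousAt_iff.1 (hc.cont.continuousAt (x := t0)) ε hε
  set d := min (δ / 2) (1 / 4) with hd
  have hd0 : 0 < d := lt_min (half_pos hδ) (by norm_num)
  have hd1 : d ≤ 1 / 4 := min_le_right _ _
  have hd2 : d < δ := lt_of_le_of_lt (min_le_left _ _) (half_lt_self hδ)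
  set A := c '' Icc (t0 + d) (t0 + 1 - d) with hA
  have hAJ : A ⊆ range c := image_subset_range _ _
  have hJA : ∀ x ∈ range c, x ∉ A → dist x (c t0) < ε := by
    rintro _ ⟨t, rfl⟩ hx
    obtain ⟨s, hs, e⟩ := exists_rep hc.per (t0 - d) t
    rw [← e] at hx ⊢
    apply hδc
    by_contra h
    rw [not_lt, Real.dist_eq] at h
    refine hx ⟨s, ⟨?_, by linarith [hs.2]⟩, rfl⟩
    by_contra h2
    rw [not_le] at h2
    have : |s - t0| ≤ d := abs_le.2 ⟨by linarith [hs.1], by linarith⟩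
    linarith
  obtain ⟨p, hp⟩ := hne
  obtain ⟨q, hqV, hqJ⟩ := hq
  have hpA : p ∉ A := fun h => hVJ.le_bot ⟨hp, hAJ h⟩
  have hqA : q ∉ A := fun h => hqJ (hAJ h)
  have hj := arc_joined (φ := c) hc.cont.continuousOn (hc.injOn (a := t0 + d) (b := t0 + 1 - d)
    (by linarith)) hpA hqA
  have hq' := mem_component_of_joinedIn hj
  have hsub : connectedComponentIn Aᶜ p ⊆ V := by
    refine IsPreconnected.subset_of_closure_inter_subset isPreconnected_connectedComponentIn hVo
      ⟨p, mem_connectedComponentIn hpA, hp⟩ ?_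
    rintro z ⟨hz1, hz2⟩
    rcases hcl hz1 with h | h
    · exact h
    · exfalso
      have hzA : z ∉ A := connectedComponentIn_subset _ _ hz2
      have h3 := hJA z h hzA
      obtain ⟨y, hy, hyd⟩ := Metric.mem_closure_iff.1 hz1 (ε - dist z (c t0)) (by linarith)
      have h4 := hcon y hy
      have h5 := dist_triangle (c t0) z y
      rw [dist_comm (c t0) z] at h5
      linarith
  exact hqV (hsub hq')

theorem IsJordan.subset_closure_inside (hc : IsJordan c) : range c ⊆ closure (inside c) := by
  obtain ⟨q, hq⟩ := hc.outside_nonempty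
  refine hc.dense_aux hc.inside_open hc.closure_inside_subset ?_ hc.wind_inside.1
    ⟨q, fun h => h.2 hq.2, hq.1⟩
  exact Set.disjoint_left.2 fun z h h' => h.1 h'

theorem IsJordan.subset_closure_outside (hc : IsJordan c) : range c ⊆ closure (outside c) := by
  obtain ⟨q, hq⟩ := hc.wind_inside.1
  refine hc.dense_aux hc.outside_open hc.closure_outside_subset ?_ hc.outside_nonempty
    ⟨q, fun h => hq.2 h.2, hq.1⟩
  exact Set.disjoint_left.2 fun z h h' => h.1 h'

theorem IsJordan.closure_inside (hc : IsJordan c) : closure (inside c) = inside c ∪ range c :=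
  Subset.antisymm hc.closure_inside_subset (union_subset subset_closure hc.subset_closure_inside)

theorem IsJordan.closure_outside (hc : IsJordan c) : closure (outside c) = outside c ∪ range c :=
  Subset.antisymm hc.closure_outside_subset (union_subset subset_closure hc.subset_closure_outside)

theorem IsJordan.isCompact_closure (hc : IsJordan c) : IsCompact (closure (inside c)) :=
  hc.inside_bounded.isCompact_closure

theorem IsJordan.compl_closure_inside (hc : IsJordan c) : (closure (inside c))ᶜ = outside c := by
  rw [hc.closure_inside]
  ext z
  constructor
  · intro h
    rw [mem_compl_iff, mem_union, not_or] at h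
    have : z ∈ inside c ∪ outside c := by rw [← hc.compl_eq]; exact h.2
    exact this.resolve_left h.1
  · intro h h'
    rcases h' with h' | h'
    · exact h'.2 h.2
    · exact h.1 h'

theorem IsJordan.hasLog_closure (hc : IsJordan c) {g : ℂ → ℂ}
    (hg : ContinuousOn g (closure (inside c))) (h0 : ∀ z ∈ closure (inside c), g z ≠ 0) :
    HasLog g (closure (inside c)) := by
  refine hasLog_of_connected_compl hc.isCompact_closure ?_ hg h0
  intro p hp q hq
  have hp' : p ∈ (closure (inside c))ᶜ := hp
  have hq' : q ∈ (closure (inside c))ᶜ := hq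
  rw [hc.compl_closure_inside] at hp' hq' ⊢
  exact (hc.outside_open.isConnected_iff_isPathConnected.1 hc.outside_connected).joinedIn p hp' q hq'

end Jordan
end BKE

namespace BKE
open Set Filter Topology Metric
open scoped unitInterval

/-! ### log domains -/

structure LogDomain (D : Set ℂ) : Prop where
  isOpen : IsOpen D
  conn : IsConnected D
  bdd : Bornology.IsBounded D
  log : ∀ g : ℂ → ℂ, ContinuousOn g D → (∀ z ∈ D, g z ≠ 0) → HasLog g D

theorem hasLog_of_exhaust {g : ℂ → ℂ} {D : Set ℂ} (hD : IsConnected D) (hDo : IsOpen D)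
    (U : ℕ → Set ℂ) (hU : ∀ n, IsOpen (U n)) (hmono : Monotone U) (hUD : ⋃ n, U n = D)
    (hl : ∀ n, HasLog g (U n)) : HasLog g D := by
  obtain ⟨z0, hz0⟩ := hD.nonempty
  obtain ⟨N0, hN0⟩ := mem_iUnion.1 (hUD ▸ hz0)
  have hN : ∀ n, z0 ∈ U (N0 + n) := fun n => hmono (Nat.le_add_right _ _) hN0
  choose u hu hgu using fun n => hl (N0 + n)
  -- components
  set C : ℕ → Set ℂ := fun n => connectedComponentIn (U (N0 + n)) z0 with hC
  have hCo : ∀ n, IsOpen (C n) := fun n => (hU _).connectedComponentIn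
  have hCs : ∀ n, C n ⊆ U (N0 + n) := fun n => connectedComponentIn_subset _ _
  have hCm : Monotone C := fun m n h => connectedComponentIn_mono _ (hmono (by omega))
  have hz : ∀ n, z0 ∈ C n := fun n => mem_connectedComponentIn (hN n)
  have hCD : ∀ z ∈ D, ∃ n, z ∈ C n := by
    intro z hz
    have hj := ((hDo.isConnected_iff_isPathConnected).1 hD).joinedIn z0 hz0 z hz
    obtain ⟨γ, hγ⟩ := hj
    have hK : IsCompact (range γ) := isCompact_range γ.continuous
    obtain ⟨n, hn⟩ := hK.elim_directed_cover U hU (by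
      rw [hUD]; rintro _ ⟨t, rfl⟩; exact hγ t) (hmono.directed_le)
    refine ⟨n, ?_⟩
    have hpc : IsPreconnected (range γ) := isPreconnected_range γ.continuous
    refine hpc.subset_connectedComponentIn ⟨0, γ.source⟩ (hn.trans (hmono (by omega))) ⟨1, γ.target⟩
  -- normalized logs
  set v : ℕ → ℂ → ℂ := fun n z => u n z - u n z0 with hv
  have hvc : ∀ n, ContinuousOn (v n) (C n) := fun n =>
    ((hu n).mono (hCs n)).sub continuousOn_const
  have hge : ∀ n, ∀ z ∈ C n, g z = g z0 * Complex.exp (v n z) := by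
    intro n z hzC
    rw [hgu n z (hCs n hzC), hgu n z0 (hN n), ← Complex.exp_add]; congr 1; simp [hv]
  have hg0 : g z0 ≠ 0 := by rw [hgu 0 z0 (hN 0)]; exact Complex.exp_ne_zero _
  have hcomp : ∀ m n, m ≤ n → EqOn (v n) (v m) (C m) := by
    intro m n hmn z hz'
    obtain ⟨k, hk⟩ := log_diff_const (S := C m) (isPreconnected_connectedComponentIn) ((hvc n).mono (hCm hmn)) (hvc m)
      (fun w hw => by
        have h1 := hge n w (hCm hmn hw); have h2 := hge m w hw
        exact mul_left_cancel₀ hg0 (h1 ▸ h2))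
    have h1 := hk z0 (hz m)
    have h2 := hk z hz'
    simp only [hv, sub_self, zero_add] at h1
    rw [h2, ← h1, add_zero]
  choose! N hNz using hCD
  obtain ⟨l, hl0⟩ : ∃ l, Complex.exp l = g z0 := ⟨Complex.log (g z0), Complex.exp_log hg0⟩
  refine ⟨fun z => l + v (N z) z, ?_, ?_⟩
  · intro z hz
    have hzn := hNz z hz
    have h1 : ContinuousAt (v (N z)) z := (hvc (N z)).continuousAt ((hCo _).mem_nhds hzn)
    have h2 : ContinuousAt (fun w => l + v (N z) w) z := continuousAt_const.add h1
    refine ContinuousAt.continuousWithinAt (h2.congr ?_)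
    filter_upwards [(hCo _).mem_nhds hzn, hDo.mem_nhds hz] with w hw hwD
    rcases le_total (N z) (N w) with h | h
    · rw [hcomp _ _ h hw]
    · rw [hcomp _ _ h (hNz w hwD)]
  · intro z hz
    dsimp only
    rw [Complex.exp_add, hl0, hge _ _ (hNz z hz)]

theorem IsJordan.logDomain {c : ℝ → ℂ} (hc : IsJordan c) : LogDomain (inside c) := by
  refine ⟨hc.inside_open, hc.inside_connected, hc.inside_bounded, fun g hg h0 => ?_⟩
  set W := outside c with hW
  have hWne : W.Nonempty := hc.outside_nonempty
  have hin : ∀ z, z ∈ inside c ↔ 0 < infDist z W := by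
    intro z
    have h0 := (isClosed_closure (s := W)).notMem_iff_infDist_pos (x := z) hWne.closure
    rw [infDist_closure, hc.closure_outside] at h0
    rw [← h0]
    have h1 := hc.compl_eq
    have h2 := inside_disjoint_outside (c := c)
    constructor
    · intro h h'
      rcases h' with h' | h'
      · exact Set.disjoint_left.1 h2 h h'
      · exact h.1 h'
    · intro h
      have : z ∈ (range c)ᶜ := fun h' => h (Or.inr h')
      rw [h1] at this
      rcases this with h' | h'
      · exact h'
      · exact absurd (Or.inl h') h
  refine hasLog_of_exhaust hc.inside_connected hc.inside_open (fun n => {z | (1 : ℝ) / (n + 1) < infDist z W})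
    (fun n => isOpen_lt continuous_const (continuous_infDist_pt W)) ?_ ?_ ?_
  · intro m n h z hz
    have hz' : (1 : ℝ) / (m + 1) < infDist z W := hz
    exact lt_of_le_of_lt (Nat.one_div_le_one_div h) hz'
  · ext z
    simp only [mem_iUnion, mem_setOf_eq, hin]
    exact ⟨fun ⟨n, hn⟩ => lt_trans (by positivity) hn, fun h => exists_nat_one_div_lt h⟩
  · intro n
    set K : Set ℂ := {z | (1 : ℝ) / (n + 1) ≤ infDist z W} with hK
    have hKD : K ⊆ inside c := fun z hz => (hin z).2 (lt_of_lt_of_le (by positivity) hz)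
    have hKc : IsCompact K := Metric.isCompact_of_isClosed_isBounded
      (isClosed_le continuous_const (continuous_infDist_pt W)) (hc.inside_bounded.subset hKD)
    have hWK : W ⊆ Kᶜ := fun z hz h => Set.disjoint_left.1 (inside_disjoint_outside (c := c)) (hKD h) hz
    have hj : ∀ p ∉ K, ∃ w ∈ W, JoinedIn Kᶜ p w := by
      intro p hp
      have : infDist p W < 1 / (n + 1) := not_le.1 hp
      obtain ⟨w, hw, hpw⟩ := (infDist_lt_iff hWne).1 this
      refine ⟨w, hw, JoinedIn.of_segment_subset fun z hz h => ?_⟩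
      have h1 : dist z w ≤ dist p w := by
        have := (convex_closedBall w (dist p w)).segment_subset (x := p) (y := w) (by simp) (by simp) hz
        simpa using this
      have : infDist z W ≤ dist z w := infDist_le_dist_of_mem hw
      have h3 : (1 : ℝ) / (n + 1) ≤ infDist z W := h
      linarith
    refine HasLog.mono (T := K) (hasLog_of_connected_compl hKc ?_ (hg.mono hKD) (fun z hz => h0 z (hKD hz))) ?_
    · intro p hp q hq
      obtain ⟨a, ha, h1⟩ := hj p hp
      obtain ⟨b, hb, h2⟩ := hj q hq
      have h3 := ((hc.outside_open.isConnected_iff_isPathConnected).1 hc.outside_connected).joinedIn a ha b hb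
      exact (h1.trans (h3.mono hWK)).trans h2.symm
    · intro z hz
      have hz' : (1 : ℝ) / (n + 1) < infDist z W := hz
      exact le_of_lt hz'


theorem differentiableOn_of_exp {u g : ℂ → ℂ} {D : Set ℂ} (hD : IsOpen D) (hu : ContinuousOn u D)
    (hg : DifferentiableOn ℂ g D) (h : ∀ z ∈ D, g z = Complex.exp (u z)) : DifferentiableOn ℂ u D := by
  intro z hz
  have hn := hD.mem_nhds hz
  have h1 : HasDerivAt g (deriv g z) z := (hg.differentiableAt hn).hasDerivAt
  have huc := hu.continuousAt hn
  -- near z, u w = u z + log (g w / g z)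
  have hgz : g z ≠ 0 := by rw [h z hz]; exact Complex.exp_ne_zero _
  have h2 : DifferentiableAt ℂ (fun w => u z + Complex.log (g w / g z)) z := by
    refine DifferentiableAt.const_add _ (DifferentiableAt.clog ?_ ?_)
    · exact (hg.differentiableAt hn).div_const _
    · rw [div_self hgz]; exact Complex.one_mem_slitPlane
  refine DifferentiableAt.differentiableWithinAt (h2.congr_of_eventuallyEq ?_)
  have h3 : ∀ᶠ w in 𝓝 z, ‖u w - u z‖ < 1 := by
    have : Tendsto (fun w => ‖u w - u z‖) (𝓝 z) (𝓝 0) := by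
      have := (huc.sub_const (u z)).norm
      simpa [ContinuousAt] using this
    exact this.eventually (gt_mem_nhds one_pos)
  filter_upwards [h3, hn] with w hw hwD
  rw [h w hwD, h z hz, ← Complex.exp_sub, Complex.log_exp]
  · ring
  · have := (Complex.abs_im_le_norm (u w - u z)); have := Real.pi_gt_three
    have := neg_abs_le (u w - u z).im; linarith
  · have := (Complex.abs_im_le_norm (u w - u z)); have := Real.pi_gt_three
    have := le_abs_self (u w - u z).im; linarith

/-- ultrafilter Montel -/
theorem montel {D : Set ℂ} (hD : IsOpen D) (F : ℕ → ℂ → ℂ) (hF : ∀ n, DifferentiableOn ℂ (F n) D)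
    (hm : ∀ n, MapsTo (F n) D (ball 0 1)) (𝒰 : Ultrafilter ℕ) :
    ∃ f : ℂ → ℂ, TendstoLocallyUniformlyOn F f 𝒰 D ∧ ∀ z ∈ D, f z ∈ closedBall (0 : ℂ) 1 := by
  have hlim : ∀ z, ∃ w : ℂ, z ∈ D → w ∈ closedBall (0 : ℂ) 1 ∧ Tendsto (fun n => F n z) 𝒰 (𝓝 w) := by
    intro z
    by_cases hz : z ∈ D
    · obtain ⟨w, hw, h⟩ := (isCompact_closedBall (0 : ℂ) 1).ultrafilter_le_nhds (𝒰.map fun n => F n z) (by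
        rw [le_principal_iff]
        exact Filter.mem_map.2 (Filter.univ_mem' fun n => ball_subset_closedBall (hm n hz)))
      exact ⟨w, fun _ => ⟨hw, h⟩⟩
    · exact ⟨0, fun h => absurd h hz⟩
  choose f hf using hlim
  refine ⟨f, ?_, fun z hz => (hf z hz).1⟩
  rw [Metric.tendstoLocallyUniformlyOn_iff]
  intro ε hε x hx
  obtain ⟨r, hr, hrD⟩ := Metric.isOpen_iff.1 hD x hx
  have hlip : ∀ n, ∀ y ∈ ball x r, dist (F n y) (F n x) ≤ 2 / r * dist y x := by
    intro n y hy
    refine Complex.dist_le_div_mul_dist_of_mapsTo_ball ((hF n).mono hrD) ?_ hy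
    intro z hz
    have h1 := hm n (hrD hz); have h2 := hm n hx
    rw [mem_ball_zero_iff] at h1 h2
    refine mem_closedBall.2 ?_
    rw [dist_eq_norm]
    exact (norm_sub_le _ _).trans (by linarith)
  set δ := min r (ε * r / 8) with hδ
  have hδ0 : 0 < δ := lt_min hr (by positivity)
  refine ⟨ball x δ, mem_nhdsWithin_of_mem_nhds (ball_mem_nhds x hδ0), ?_⟩
  have hx' := (hf x hx).2
  filter_upwards [Metric.tendsto_nhds.1 hx' (ε / 4) (by positivity)] with n hn y hy
  have hyr : y ∈ ball x r := ball_subset_ball (min_le_left _ _) hy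
  have hb : 2 / r * dist y x ≤ ε / 4 := by
    have : dist y x ≤ ε * r / 8 := (le_of_lt hy).trans (min_le_right _ _)
    calc 2 / r * dist y x ≤ 2 / r * (ε * r / 8) := by gcongr
      _ = ε / 4 := by field_simp; norm_num
  have h1 : ∀ n, dist (F n y) (F n x) ≤ ε / 4 := fun n => (hlip n y hyr).trans hb
  have h2 : dist (f y) (f x) ≤ ε / 4 :=
    le_of_tendsto ((hf y (hrD hyr)).2.dist hx') (Eventually.of_forall h1)
  have h3 := h1 n
  calc dist (f y) (F n y) ≤ dist (f y) (f x) + dist (f x) (F n x) + dist (F n x) (F n y) :=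
        dist_triangle4 _ _ _ _
    _ < ε := by rw [dist_comm (f x), dist_comm (F n x) (F n y)]; linarith

/-- Hurwitz for injectivity -/
theorem hurwitz_inj {D : Set ℂ} (hD : IsOpen D) (hc : IsPreconnected D) {F : ℕ → ℂ → ℂ} {f : ℂ → ℂ}
    {l : Filter ℕ} [l.NeBot] (hF : ∀ n, DifferentiableOn ℂ (F n) D) (hi : ∀ n, InjOn (F n) D)
    (hl : TendstoLocallyUniformlyOn F f l D) {z0 : ℂ} (hz0 : z0 ∈ D) (hd : deriv f z0 ≠ 0) :
    InjOn f D := by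
  have hfd : DifferentiableOn ℂ f D := hl.differentiableOn (Eventually.of_forall hF) hD
  have hfa : AnalyticOnNhd ℂ f D := hfd.analyticOnNhd hD
  have hpt : ∀ z ∈ D, Tendsto (fun n => F n z) l (𝓝 (f z)) := fun z hz => hl.tendsto_at hz
  intro a ha b hb hab
  by_contra hne
  -- f not eventually constant near a
  have hiso : ∀ᶠ z in 𝓝[≠] a, f z ≠ f b := by
    rcases (hfa a ha).eventually_eq_or_eventually_ne (analyticAt_const (v := f b)) with h | h
    · exfalso
      have := hfa.eqOn_of_preconnected_of_eventuallyEq (analyticOnNhd_const (v := f b)) hc ha h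
      apply hd
      have h2 : f =ᶠ[𝓝 z0] fun _ => f b := by
        filter_upwards [hD.mem_nhds hz0] with z hz using this hz
      rw [h2.deriv_eq]; simp
    · exact h
  rw [eventually_nhdsWithin_iff] at hiso
  obtain ⟨r1, hr1, h1⟩ := Metric.eventually_nhds_iff_ball.1 hiso
  obtain ⟨r2, hr2, h2⟩ := Metric.isOpen_iff.1 hD a ha
  have hab' : 0 < dist b a := dist_pos.2 (Ne.symm hne)
  set r := min (min r1 r2) (dist b a) / 2 with hr
  have hm0 : 0 < min (min r1 r2) (dist b a) := lt_min (lt_min hr1 hr2) hab'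
  have hr0 : 0 < r := by positivity
  have hlt : r < min (min r1 r2) (dist b a) := half_lt_self hm0
  have hrr1 : r < r1 := hlt.trans_le ((min_le_left _ _).trans (min_le_left _ _))
  have hrr2 : r < r2 := hlt.trans_le ((min_le_left _ _).trans (min_le_right _ _))
  have hrb : r < dist b a := hlt.trans_le (min_le_right _ _)
  have hcb : closedBall a r ⊆ D := (closedBall_subset_ball hrr2).trans h2
  have hsc : IsCompact (sphere a r) := isCompact_sphere a r
  have hsn : (sphere a r).Nonempty := NormedSpace.sphere_nonempty.2 hr0.le
  obtain ⟨w, hw, hmin⟩ := hsc.exists_isMinOn hsn (f := fun z => ‖f z - f b‖)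
    (((hfd.continuousOn.mono (sphere_subset_closedBall.trans hcb)).sub continuousOn_const).norm)
  set δ := ‖f w - f b‖ with hδ
  have hδ0 : 0 < δ := by
    rw [hδ, norm_pos_iff, sub_ne_zero]
    refine h1 w ?_ ?_
    · rw [mem_ball]; rw [mem_sphere] at hw; linarith
    · rintro rfl; simp at hw; linarith
  have hu := (tendstoLocallyUniformlyOn_iff_forall_isCompact hD).1 hl (sphere a r)
    (sphere_subset_closedBall.trans hcb) hsc
  have e1 := Metric.tendstoUniformlyOn_iff.1 hu (δ / 4) (by positivity)
  have e2 := Metric.tendsto_nhds.1 (hpt b hb) (δ / 8) (by positivity)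
  have e3 := Metric.tendsto_nhds.1 (hpt a ha) (δ / 8) (by positivity)
  obtain ⟨n, hn1, hn2, hn3⟩ := (e1.and (e2.and e3)).exists
  -- contradiction
  have hnz : ∀ z ∈ closedBall a r, F n z - F n b ≠ 0 := by
    intro z hz h
    have := hi n (hcb hz) hb (sub_eq_zero.1 h)
    rw [this, mem_closedBall] at hz; linarith
  have hdc : DiffContOnCl ℂ (fun z => (F n z - F n b)⁻¹) (ball a r) := by
    have : DifferentiableOn ℂ (fun z => (F n z - F n b)⁻¹) (closedBall a r) :=
      (((hF n).mono hcb).sub_const _).inv hnz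
    exact DifferentiableOn.diffContOnCl (by rw [closure_ball a hr0.ne']; exact this)
  have hbd := Complex.norm_le_of_forall_mem_frontier_norm_le (C := 2 / δ) isBounded_ball hdc (by
    intro z hz
    rw [frontier_ball a hr0.ne'] at hz
    have h3 : δ ≤ ‖f z - f b‖ := hmin hz
    have h4 := hn1 z hz
    rw [dist_eq_norm] at h4
    rw [dist_eq_norm] at hn2
    have h5 : δ / 2 ≤ ‖F n z - F n b‖ := by
      have : f z - f b = (F n z - F n b) + (f z - F n z) + (F n b - f b) := by ring
      rw [this] at h3
      have := norm_add₃_le (a := F n z - F n b) (b := f z - F n z) (c := F n b - f b)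
      linarith
    rw [norm_inv]
    rw [inv_le_comm₀ (by linarith) (by positivity)]
    rw [inv_div]; exact h5) (subset_closure (mem_ball_self hr0))
  rw [norm_inv] at hbd
  have hp : 0 < ‖F n a - F n b‖ := norm_pos_iff.2 (hnz a (mem_closedBall_self hr0.le))
  rw [inv_le_comm₀ hp (by positivity), inv_div] at hbd
  rw [dist_eq_norm] at hn2 hn3
  have : F n a - F n b = (F n a - f a) - (F n b - f b) := by rw [hab]; ring
  rw [this] at hbd
  have := norm_sub_le (F n a - f a) (F n b - f b)
  linarith

end BKE

namespace BKE
open Set Filter Topology Metric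
open scoped unitInterval ComplexConjugate

def mob (a z : ℂ) : ℂ := (z - a) / (1 - conj a * z)

theorem mob_den {a z : ℂ} (ha : ‖a‖ < 1) (hz : ‖z‖ ≤ 1) : 1 - conj a * z ≠ 0 := by
  intro h
  have h1 : conj a * z = 1 := (sub_eq_zero.1 h).symm
  have h2 : ‖a‖ * ‖z‖ = 1 := by rw [← Complex.norm_conj a, ← norm_mul, h1, norm_one]
  nlinarith [norm_nonneg a, norm_nonneg z]

theorem mob_id (a z : ℂ) : ‖1 - conj a * z‖ ^ 2 - ‖z - a‖ ^ 2 = (1 - ‖a‖ ^ 2) * (1 - ‖z‖ ^ 2) := by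
  simp only [← Complex.normSq_eq_norm_sq, Complex.normSq_apply]
  simp
  ring

theorem mob_norm {a z : ℂ} (ha : ‖a‖ < 1) (hz : ‖z‖ < 1) : ‖mob a z‖ < 1 := by
  have h := mob_den ha hz.le
  rw [mob, norm_div, div_lt_one (norm_pos_iff.2 h)]
  have h1 := mob_id a z
  have h2 : 0 < (1 - ‖a‖ ^ 2) * (1 - ‖z‖ ^ 2) :=
    mul_pos (by nlinarith [norm_nonneg a]) (by nlinarith [norm_nonneg z])
  exact lt_of_pow_lt_pow_left₀ 2 (norm_nonneg _) (by linarith)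

theorem mob_inv {a z : ℂ} (ha : ‖a‖ < 1) (hz : ‖z‖ < 1) : mob (-a) (mob a z) = z := by
  have h := mob_den ha hz.le
  have h2 := mob_den (a := -a) (z := mob a z) (by simpa using ha) (mob_norm ha hz).le
  rw [mob, div_eq_iff h2]
  rw [mob]
  have h3 : 1 - conj (-a) * ((z - a) / (1 - conj a * z)) = (1 - conj a * a) / (1 - conj a * z) := by
    rw [map_neg]; field_simp; ring
  rw [h3, sub_neg_eq_add, ← mul_div_assoc, div_add' _ _ _ h]
  congr 1
  ring

theorem mob_injOn {a : ℂ} (ha : ‖a‖ < 1) : InjOn (mob a) (ball 0 1) := by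
  intro z hz w hw h
  rw [mem_ball_zero_iff] at hz hw
  rw [← mob_inv ha hz, h, mob_inv ha hw]

theorem mob_hasDerivAt {a z : ℂ} (ha : ‖a‖ < 1) (hz : ‖z‖ < 1) :
    HasDerivAt (mob a) ((1 - conj a * a) / (1 - conj a * z) ^ 2) z := by
  have h := mob_den ha hz.le
  have h1 : HasDerivAt (fun z : ℂ => z - a) 1 z := (hasDerivAt_id z).sub_const a
  have h2 : HasDerivAt (fun z : ℂ => 1 - conj a * z) (-(conj a * 1)) z :=
    ((hasDerivAt_id z).const_mul (conj a)).const_sub 1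
  refine (h1.div h2 h).congr_deriv ?_
  congr 1
  ring

def Fam (D : Set ℂ) (z0 : ℂ) : Set (ℂ → ℂ) :=
  {g | DifferentiableOn ℂ g D ∧ InjOn g D ∧ MapsTo g D (ball 0 1) ∧ g z0 = 0}

theorem fam_extremal {D : Set ℂ} (hD : LogDomain D) {z0 : ℂ} (hz0 : z0 ∈ D) :
    ∃ g ∈ Fam D z0, deriv g z0 ≠ 0 ∧ ∀ k ∈ Fam D z0, ‖deriv k z0‖ ≤ ‖deriv g z0‖ := by
  obtain ⟨r, hr, hrD⟩ := Metric.isOpen_iff.1 hD.isOpen z0 hz0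
  set S : Set ℝ := (fun g => ‖deriv g z0‖) '' Fam D z0 with hS
  have hbdd : BddAbove S := by
    refine ⟨1 / r, ?_⟩
    rintro _ ⟨g, ⟨h1, h2, h3, h4⟩, rfl⟩
    refine Complex.norm_deriv_le_div_of_mapsTo_ball (h1.mono hrD) ?_ hr
    rw [h4]; exact fun z hz => ball_subset_closedBall (h3 (hrD hz))
  obtain ⟨R, hR⟩ := hD.bdd.subset_ball z0
  have hR0 : 0 < R := by have := hR hz0; rw [mem_ball, dist_self] at this; exact this
  have hRc : (R : ℂ) ≠ 0 := by exact_mod_cast hR0.ne'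
  have hg0 : (fun z => (z - z0) / R) ∈ Fam D z0 := by
    refine ⟨by fun_prop, ?_, ?_, by simp⟩
    · intro z _ w _ h
      have h' : (z - z0) / R = (w - z0) / R := h
      field_simp at h'; simpa using h'
    · intro z hz
      have := hR hz
      rw [mem_ball, dist_eq_norm] at this
      rw [mem_ball_zero_iff, norm_div, Complex.norm_real, Real.norm_of_nonneg hR0.le, div_lt_one hR0]
      exact this
  have hd0 : deriv (fun z : ℂ => (z - z0) / R) z0 = 1 / R := by
    have : HasDerivAt (fun z : ℂ => (z - z0) / R) (1 / R) z0 := ((hasDerivAt_id z0).sub_const z0).div_const _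
    exact this.deriv
  have hSne : S.Nonempty := ⟨_, _, hg0, rfl⟩
  have hSpos : 0 < sSup S := by
    have : ‖deriv (fun z : ℂ => (z - z0) / R) z0‖ ≤ sSup S := le_csSup hbdd ⟨_, hg0, rfl⟩
    rw [hd0] at this
    exact lt_of_lt_of_le (norm_pos_iff.2 (by simp [hR0.ne'])) this
  obtain ⟨s, hsmono, hslim, hs⟩ := exists_seq_tendsto_sSup hSne hbdd
  choose F hF hFs using hs
  set 𝒰 : Ultrafilter ℕ := hyperfilter ℕ with h𝒰
  have hle : (𝒰 : Filter ℕ) ≤ atTop := Nat.hyperfilter_le_atTop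
  obtain ⟨f, hf, hfb⟩ := montel hD.isOpen F (fun n => (hF n).1) (fun n => (hF n).2.2.1) 𝒰
  have hdl := (hf.deriv (Eventually.of_forall fun n => (hF n).1) hD.isOpen).tendsto_at hz0
  have hdn : ‖deriv f z0‖ = sSup S := by
    refine tendsto_nhds_unique (hdl.norm) ?_
    have : (fun n => ‖(deriv ∘ F) n z0‖) = s := funext fun n => hFs n
    rw [this]; exact hslim.mono_left hle
  have hd : deriv f z0 ≠ 0 := norm_pos_iff.1 (hdn ▸ hSpos)
  have hfd : DifferentiableOn ℂ f D := hf.differentiableOn (Eventually.of_forall fun n => (hF n).1) hD.isOpen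
  have hfi := hurwitz_inj hD.isOpen hD.conn.isPreconnected (fun n => (hF n).1) (fun n => (hF n).2.1) hf hz0 hd
  refine ⟨f, ⟨hfd, hfi, ?_, ?_⟩, hd, ?_⟩
  · intro z hz
    have h1 := hfb z hz
    rw [mem_closedBall_zero_iff] at h1
    rw [mem_ball_zero_iff]
    refine lt_of_le_of_ne h1 fun h => hd ?_
    have := Complex.eqOn_of_isPreconnected_of_isMaxOn_norm hD.conn.isPreconnected hD.isOpen hfd hz
      (fun w hw => by
        have h2 := hfb w hw
        rw [mem_closedBall_zero_iff] at h2
        show ‖f w‖ ≤ ‖f z‖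
        rw [h]; exact h2)
    have h2 : f =ᶠ[𝓝 z0] fun _ => f z := by
      filter_upwards [hD.isOpen.mem_nhds hz0] with w hw using this hw
    rw [h2.deriv_eq]; simp
  · have := hf.tendsto_at hz0
    refine tendsto_nhds_unique this ?_
    simp only [fun n => (hF n).2.2.2]
    exact tendsto_const_nhds
  · intro k hk
    rw [hdn]; exact le_csSup hbdd ⟨k, hk, rfl⟩

theorem koebe {D : Set ℂ} (hD : LogDomain D) {z0 : ℂ} (hz0 : z0 ∈ D) {g : ℂ → ℂ} (hg : g ∈ Fam D z0)
    (hd : deriv g z0 ≠ 0) {ω : ℂ} (hω : ‖ω‖ < 1) (hmiss : ∀ z ∈ D, g z ≠ ω) :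
    ∃ k ∈ Fam D z0, ‖deriv g z0‖ < ‖deriv k z0‖ := by
  obtain ⟨h1, h2, h3, h4⟩ := hg
  have hn : ∀ z ∈ D, ‖g z‖ < 1 := fun z hz => mem_ball_zero_iff.1 (h3 hz)
  set G : ℂ → ℂ := fun z => mob ω (g z) with hG
  have hGd' : ∀ z ∈ D, HasDerivAt G ((1 - conj ω * ω) / (1 - conj ω * g z) ^ 2 * deriv g z) z := by
    intro z hz
    exact (mob_hasDerivAt hω (hn z hz)).comp z (h1.differentiableAt (hD.isOpen.mem_nhds hz)).hasDerivAt
  have hGd : DifferentiableOn ℂ G D := fun z hz => (hGd' z hz).differentiableAt.differentiableWithinAt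
  have hG0 : ∀ z ∈ D, G z ≠ 0 := fun z hz =>
    div_ne_zero (sub_ne_zero.2 (hmiss z hz)) (mob_den hω (hn z hz).le)
  obtain ⟨u, hu, hGu⟩ := hD.log G hGd.continuousOn hG0
  have hud := differentiableOn_of_exp hD.isOpen hu hGd hGu
  set s : ℂ → ℂ := fun z => Complex.exp (u z / 2) with hs
  have hss : ∀ z ∈ D, s z * s z = G z := by
    intro z hz; rw [hGu z hz, hs]; dsimp only; rw [← Complex.exp_add]; congr 1; ring
  have hsn : ∀ z ∈ D, ‖s z‖ < 1 := by
    intro z hz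
    have h5 : ‖s z‖ * ‖s z‖ < 1 := by
      rw [← norm_mul, hss z hz]; exact mob_norm hω (hn z hz)
    nlinarith [norm_nonneg (s z)]
  have hsd : DifferentiableOn ℂ s D := (hud.div_const 2).cexp
  set b := s z0 with hb
  have hb1 : ‖b‖ < 1 := hsn z0 hz0
  have hb0 : b ≠ 0 := Complex.exp_ne_zero _
  have hbb : b * b = -ω := by rw [hb, hss z0 hz0, hG]; simp [mob, h4]
  have hkd' : ∀ z ∈ D, HasDerivAt (fun z => mob b (s z)) ((1 - conj b * b) / (1 - conj b * s z) ^ 2 * deriv s z) z := by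
    intro z hz
    exact (mob_hasDerivAt hb1 (hsn z hz)).comp z (hsd.differentiableAt (hD.isOpen.mem_nhds hz)).hasDerivAt
  refine ⟨fun z => mob b (s z), ⟨fun z hz => (hkd' z hz).differentiableAt.differentiableWithinAt, ?_, ?_, ?_⟩, ?_⟩
  · intro z hz w hw h
    have e1 := mob_injOn hb1 (mem_ball_zero_iff.2 (hsn z hz)) (mem_ball_zero_iff.2 (hsn w hw)) h
    have e2 : G z = G w := by rw [← hss z hz, ← hss w hw, e1]
    exact h2 hz hw (mob_injOn hω (h3 hz) (h3 hw) e2)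
  · intro z hz; exact mem_ball_zero_iff.2 (mob_norm hb1 (hsn z hz))
  · simp [mob, hb]
  · rw [(hkd' z0 hz0).deriv]
    have hds : deriv G z0 = 2 * b * deriv s z0 := by
      have e1 : HasDerivAt s (deriv s z0) z0 := (hsd.differentiableAt (hD.isOpen.mem_nhds hz0)).hasDerivAt
      have e2 := e1.mul e1
      have e3 : G =ᶠ[𝓝 z0] s * s := by
        filter_upwards [hD.isOpen.mem_nhds hz0] with z hz using (hss z hz).symm
      rw [e3.deriv_eq, e2.deriv]; ring
    rw [(hGd' z0 hz0).deriv, h4] at hds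
    simp only [mul_zero, sub_zero, one_pow, div_one] at hds
    -- norms
    have n1 : ‖(1 - conj ω * ω : ℂ)‖ = 1 - ‖ω‖ ^ 2 := by
      rw [mul_comm, Complex.mul_conj, Complex.normSq_eq_norm_sq]
      rw [← Complex.ofReal_one, ← Complex.ofReal_sub, Complex.norm_real, Real.norm_of_nonneg]
      nlinarith [norm_nonneg ω]
    have n2 : conj b * b = ((‖b‖ ^ 2 : ℝ) : ℂ) := by
      rw [mul_comm, Complex.mul_conj, Complex.normSq_eq_norm_sq]
    have hωb : ‖ω‖ = ‖b‖ ^ 2 := by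
      have := congrArg norm hbb
      rw [norm_mul, norm_neg] at this; rw [← this]; ring
    have hB : 0 < ‖b‖ := norm_pos_iff.2 hb0
    have n3 := congrArg norm hds
    rw [norm_mul, n1, norm_mul, norm_mul, hωb] at n3
    simp only [Complex.norm_ofNat] at n3
    have hB2 : 0 < 1 - ‖b‖ ^ 2 := by nlinarith
    rw [norm_mul, ← hb, n2, norm_div, norm_pow]
    have n4 : ‖(1 - ((‖b‖ ^ 2 : ℝ) : ℂ))‖ = 1 - ‖b‖ ^ 2 := by
      rw [← Complex.ofReal_one, ← Complex.ofReal_sub, Complex.norm_real, Real.norm_of_nonneg hB2.le]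
    rw [n4]
    have hg' : 0 < ‖deriv g z0‖ := norm_pos_iff.2 hd
    set β := ‖b‖
    set x := ‖deriv g z0‖
    set y := ‖deriv s z0‖
    have hy : y = (1 - β ^ 4) * x / (2 * β) := by field_simp; nlinarith
    rw [hy]
    have : (1 - β ^ 2) / (1 - β ^ 2) ^ 2 * ((1 - β ^ 4) * x / (2 * β)) = (1 + β ^ 2) / (2 * β) * x := by
      field_simp; ring
    rw [this]
    have : 1 < (1 + β ^ 2) / (2 * β) := by rw [lt_div_iff₀ (by positivity)]; nlinarith
    nlinarith

/-- inverse of an injective holomorphic function -/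
theorem inv_holo {D : Set ℂ} (hD : IsOpen D) (hc : IsPreconnected D) {g : ℂ → ℂ} (hg : DifferentiableOn ℂ g D)
    (hi : InjOn g D) {z0 : ℂ} (hz0 : z0 ∈ D) (hd : deriv g z0 ≠ 0) :
    IsOpen (g '' D) ∧ DifferentiableOn ℂ (Function.invFunOn g D) (g '' D) := by
  have hga := hg.analyticOnNhd hD
  have hop : ∀ s ⊆ D, IsOpen s → IsOpen (g '' s) := by
    rcases hga.is_constant_or_isOpen hc with ⟨w, hw⟩ | h
    · exfalso
      have h2 : g =ᶠ[𝓝 z0] fun _ => w := by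
        filter_upwards [hD.mem_nhds hz0] with z hz using hw z hz
      exact hd (by rw [h2.deriv_eq]; simp)
    · exact h
  set ψ := Function.invFunOn g D with hψ
  have hleft : ∀ z ∈ D, ψ (g z) = z := fun z hz => hi.leftInvOn_invFunOn hz
  have hgo := hop D subset_rfl hD
  have hψc : ContinuousOn ψ (g '' D) := by
    rw [_root_.continuousOn_iff']
    intro t ht
    refine ⟨g '' (t ∩ D), hop _ inter_subset_right (ht.inter hD), ?_⟩
    ext w
    constructor
    · rintro ⟨h1, z, hz, rfl⟩
      refine ⟨⟨z, ⟨?_, hz⟩, rfl⟩, z, hz, rfl⟩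
      have : ψ (g z) ∈ t := h1
      rwa [hleft z hz] at this
    · rintro ⟨⟨z, ⟨hzt, hz⟩, rfl⟩, _⟩
      refine ⟨?_, z, hz, rfl⟩
      show ψ (g z) ∈ t
      rwa [hleft z hz]
  refine ⟨hgo, ?_⟩
  -- differentiable where deriv ≠ 0
  have h1 : ∀ z ∈ D, deriv g z ≠ 0 → DifferentiableAt ℂ ψ (g z) := by
    intro z hz hdz
    have e1 : HasDerivAt g (deriv g z) (ψ (g z)) := by
      rw [hleft z hz]; exact (hg.differentiableAt (hD.mem_nhds hz)).hasDerivAt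
    refine (HasDerivAt.of_local_left_inverse (hψc.continuousAt (hgo.mem_nhds ⟨z, hz, rfl⟩)) e1 hdz ?_).differentiableAt
    filter_upwards [hgo.mem_nhds ⟨z, hz, rfl⟩] with w hw
    obtain ⟨y, hy, rfl⟩ := hw
    rw [hleft y hy]
  rintro _ ⟨z, hz, rfl⟩
  have hda : AnalyticOnNhd ℂ (deriv g) D := hga.deriv
  have hiso : ∀ᶠ y in 𝓝[≠] z, deriv g y ≠ 0 := by
    rcases (hda z hz).eventually_eq_zero_or_eventually_ne_zero with h | h
    · exact absurd (hda.eqOn_zero_of_preconnected_of_eventuallyEq_zero hc hz h hz0) hd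
    · exact h
  rw [eventually_nhdsWithin_iff] at hiso
  obtain ⟨t, ht, hto, hzt⟩ := _root_.eventually_nhds_iff.1 hiso
  have hV : IsOpen (g '' (t ∩ D)) := hop _ inter_subset_right (hto.inter hD)
  have hmem : g z ∈ g '' (t ∩ D) := ⟨z, ⟨hzt, hz⟩, rfl⟩
  have := (Complex.differentiableOn_compl_singleton_and_continuousAt_iff (f := ψ) (hV.mem_nhds hmem)).1 ⟨by
    rintro _ ⟨⟨y, ⟨hyt, hyD⟩, rfl⟩, hne⟩
    refine (h1 y hyD (ht y hyt ?_)).differentiableWithinAt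
    rintro rfl; exact hne rfl, hψc.continuousAt (hgo.mem_nhds ⟨z, hz, rfl⟩)⟩
  exact (this.differentiableAt (hV.mem_nhds hmem)).differentiableWithinAt

/-- Riemann mapping theorem -/
theorem riemann_map {D : Set ℂ} (hD : LogDomain D) : ∃ φ ψ : ℂ → ℂ,
    DifferentiableOn ℂ φ (ball 0 1) ∧ DifferentiableOn ℂ ψ D ∧ MapsTo φ (ball 0 1) D ∧ MapsTo ψ D (ball 0 1) ∧
    (∀ z ∈ ball (0 : ℂ) 1, ψ (φ z) = z) ∧ ∀ w ∈ D, φ (ψ w) = w := by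
  obtain ⟨z0, hz0⟩ := hD.conn.nonempty
  obtain ⟨g, hg, hd, hmax⟩ := fam_extremal hD hz0
  have hsurj : g '' D = ball 0 1 := by
    refine Subset.antisymm (image_subset_iff.2 hg.2.2.1) fun ω hω => ?_
    by_contra hne
    obtain ⟨k, hk, hlt⟩ := koebe hD hz0 hg hd (mem_ball_zero_iff.1 hω) (fun z hz h => hne ⟨z, hz, h⟩)
    exact absurd (hmax k hk) (not_le.2 hlt)
  have h := inv_holo hD.isOpen hD.conn.isPreconnected hg.1 hg.2.1 hz0 hd
  rw [hsurj] at h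
  have hex : ∀ z ∈ ball (0 : ℂ) 1, ∃ w ∈ D, g w = z := fun z hz => by rw [← hsurj] at hz; exact hz
  refine ⟨Function.invFunOn g D, g, h.2, hg.1, ?_, hg.2.2.1, ?_, ?_⟩
  · intro z hz; exact Function.invFunOn_mem (hex z hz)
  · intro z hz; exact Function.invFunOn_eq (hex z hz)
  · intro w hw; exact hg.2.1.leftInvOn_invFunOn hw

end BKE

namespace BKE
open Set Filter Topology Metric MeasureTheory
open scoped unitInterval ComplexConjugate

/-! ### length-area -/

def dens (φ : ℂ → ℂ) (z : ℂ) : ENNReal :=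
  (ball (0 : ℂ) 1).indicator (fun w => ENNReal.ofReal (‖deriv φ w‖ ^ 2)) (z - 1)

theorem dens_measurable (φ : ℂ → ℂ) : Measurable (dens φ) := by
  unfold dens
  refine Measurable.comp (g := (ball (0 : ℂ) 1).indicator (fun w => ENNReal.ofReal (‖deriv φ w‖ ^ 2))) ?_ (by fun_prop)
  refine Measurable.indicator ?_ measurableSet_ball
  have := measurable_deriv φ
  fun_prop

theorem det_smul_one (a : ℂ) : (a • (1 : ℂ →L[ℝ] ℂ)).det = ‖a‖ ^ 2 := by
  have h1 : ((a • (1 : ℂ →L[ℝ] ℂ) : ℂ →L[ℝ] ℂ) : ℂ →ₗ[ℝ] ℂ) = Algebra.lmul ℝ ℂ a := by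
    ext <;> simp
  rw [ContinuousLinearMap.det, h1, ← Algebra.norm_apply, Algebra.norm_complex_apply, Complex.normSq_eq_norm_sq]

theorem dens_finite {φ : ℂ → ℂ} (hφ : DifferentiableOn ℂ φ (ball 0 1)) (hi : InjOn φ (ball 0 1))
    (hb : Bornology.IsBounded (φ '' ball 0 1)) : ∫⁻ z, dens φ z < ⊤ := by
  unfold dens
  rw [lintegral_sub_right_eq_self (fun z => (ball (0 : ℂ) 1).indicator (fun w => ENNReal.ofReal (‖deriv φ w‖ ^ 2)) z) 1]
  rw [lintegral_indicator measurableSet_ball]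
  have h1 := lintegral_image_eq_lintegral_abs_det_fderiv_mul (volume : Measure ℂ) (s := ball (0 : ℂ) 1)
    (f := φ) (f' := fun z => deriv φ z • (1 : ℂ →L[ℝ] ℂ)) measurableSet_ball
    (fun z hz => ((hφ.differentiableAt (isOpen_ball.mem_nhds hz)).hasDerivAt.complexToReal_fderiv).hasFDerivWithinAt)
    hi (fun _ => 1)
  simp only [det_smul_one, mul_one, lintegral_const, one_mul, Measure.restrict_apply MeasurableSet.univ,
    univ_inter, abs_pow, abs_norm] at h1
  rw [← h1]
  exact hb.measure_lt_top

def Lam (φ : ℂ → ℂ) (r : ℝ) : ENNReal :=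
  ∫⁻ θ in Ioo (-Real.pi) Real.pi, dens φ (r * Complex.exp (θ * Complex.I))

theorem lam_finite {φ : ℂ → ℂ} (hφ : DifferentiableOn ℂ φ (ball 0 1)) (hi : InjOn φ (ball 0 1))
    (hb : Bornology.IsBounded (φ '' ball 0 1)) : ∫⁻ r in Ioi (0 : ℝ), ENNReal.ofReal r * Lam φ r < ⊤ := by
  have h1 := dens_finite hφ hi hb
  rw [← Complex.lintegral_comp_polarCoord_symm, polarCoord_target, Measure.volume_eq_prod,
    ← Measure.prod_restrict, lintegral_prod] at h1
  · refine lt_of_le_of_lt (le_of_eq ?_) h1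
    refine lintegral_congr fun r => ?_
    unfold Lam
    rw [← lintegral_const_mul]
    · refine lintegral_congr fun θ => ?_
      rw [Complex.polarCoord_symm_apply, Complex.exp_mul_I, smul_eq_mul]
      simp
    · exact (dens_measurable φ).comp (by fun_prop)
  · refine Measurable.aemeasurable ?_
    simp only [smul_eq_mul, Complex.polarCoord_symm_apply]
    refine Measurable.mul (by fun_prop) ((dens_measurable φ).comp ?_)
    fun_prop

theorem lam_small {φ : ℂ → ℂ} (hφ : DifferentiableOn ℂ φ (ball 0 1)) (hi : InjOn φ (ball 0 1))
    (hb : Bornology.IsBounded (φ '' ball 0 1)) {δ s : ℝ} (hδ : 0 < δ) (hs : 0 < s) :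
    ∃ r, 0 < r ∧ r < δ ∧ ENNReal.ofReal (r ^ 2) * Lam φ r ≤ ENNReal.ofReal s := by
  by_contra hcon
  push Not at hcon
  have h1 := lam_finite hφ hi hb
  have h2 : ∫⁻ r in Ioo 0 δ, ENNReal.ofReal (s * r⁻¹) < ⊤ := by
    refine lt_of_le_of_lt ?_ h1
    refine (setLIntegral_mono' measurableSet_Ioo ?_).trans (lintegral_mono_set Ioo_subset_Ioi_self)
    intro r hr
    have h3 := (hcon r hr.1 hr.2).le
    have hr0 := hr.1
    calc ENNReal.ofReal (s * r⁻¹) = ENNReal.ofReal r⁻¹ * ENNReal.ofReal s := by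
          rw [mul_comm, ENNReal.ofReal_mul (by positivity)]
      _ ≤ ENNReal.ofReal r⁻¹ * (ENNReal.ofReal (r ^ 2) * Lam φ r) := by gcongr
      _ = ENNReal.ofReal r * Lam φ r := by
          rw [← mul_assoc, ← ENNReal.ofReal_mul (by positivity)]
          congr 2; field_simp
  have h3 : IntegrableOn (fun r : ℝ => s * r⁻¹) (Ioo 0 δ) := by
    refine ⟨by fun_prop, ?_⟩
    rw [hasFiniteIntegral_iff_norm]
    refine lt_of_le_of_lt (le_of_eq ?_) h2
    refine setLIntegral_congr_fun measurableSet_Ioo fun r hr => ?_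
    have hr0 := hr.1
    rw [Real.norm_of_nonneg (by positivity)]
  have h4 : IntegrableOn (fun r : ℝ => r⁻¹) (Ioo 0 δ) := by
    have := h3.const_mul s⁻¹
    refine IntegrableOn.congr_fun (f := fun r : ℝ => s⁻¹ * (s * r⁻¹)) this (fun r _ => ?_) measurableSet_Ioo
    dsimp only; rw [← mul_assoc, inv_mul_cancel₀ hs.ne', one_mul]
  have h5 : IntervalIntegrable (fun r : ℝ => r⁻¹) volume 0 δ := by
    rw [intervalIntegrable_iff_integrableOn_Ioo_of_le hδ.le]; exact h4
  rw [intervalIntegrable_inv_iff] at h5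
  rcases h5 with h5 | h5
  · exact hδ.ne h5
  · exact h5 left_mem_uIcc

theorem arc_small_aux {φ : ℂ → ℂ} (hφ : DifferentiableOn ℂ φ (ball 0 1)) {r s : ℝ} (hr : 0 < r) (hs : 0 < s)
    (hl : ENNReal.ofReal (r ^ 2) * Lam φ r ≤ ENNReal.ofReal (s ^ 2)) {a b : ℝ} (hab : a ≤ b) (ha : -Real.pi < a)
    (hb : b < Real.pi) (hin : ∀ θ ∈ Icc a b, r * Complex.exp (θ * Complex.I) - 1 ∈ ball (0 : ℂ) 1) :
    dist (φ (r * Complex.exp (a * Complex.I) - 1)) (φ (r * Complex.exp (b * Complex.I) - 1)) ≤ 4 * s := by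
  set E : ℝ → ℂ := fun θ => r * Complex.exp (θ * Complex.I) - 1 with hE
  have hEd : ∀ θ : ℝ, HasDerivAt E (r * (Complex.exp (θ * Complex.I) * Complex.I)) θ := by
    intro θ
    have h1 : HasDerivAt (fun t : ℝ => (t : ℂ) * Complex.I) (1 * Complex.I) θ :=
      (Complex.ofRealCLM.hasDerivAt).mul_const _
    have h2 := ((h1.cexp).const_mul (r : ℂ)).sub_const 1
    rw [one_mul] at h2
    exact h2
  have hEc : Continuous E := by rw [hE]; fun_prop
  have hdφ : ContinuousOn (deriv φ) (ball 0 1) := (hφ.deriv isOpen_ball).continuousOn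
  set F' : ℝ → ℂ := fun θ => (r * (Complex.exp (θ * Complex.I) * Complex.I)) * deriv φ (E θ) with hF'
  have hder : ∀ θ ∈ uIcc a b, HasDerivAt (fun t => φ (E t)) (F' θ) θ := by
    intro θ hθ
    rw [uIcc_of_le hab] at hθ
    have := (hφ.differentiableAt (isOpen_ball.mem_nhds (hin θ hθ))).hasDerivAt
    exact this.scomp θ (hEd θ)
  have hF'c : ContinuousOn F' (uIcc a b) := by
    rw [uIcc_of_le hab]
    refine ContinuousOn.mul (by fun_prop) (hdφ.comp hEc.continuousOn fun θ hθ => hin θ hθ)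
  have hIntg := intervalIntegral.integral_eq_sub_of_hasDerivAt hder hF'c.intervalIntegrable
  have hnorm : ∀ θ, ‖F' θ‖ = r * ‖deriv φ (E θ)‖ := by
    intro θ
    rw [hF']; dsimp only
    rw [norm_mul, norm_mul, norm_mul, Complex.norm_exp_ofReal_mul_I]; simp [abs_of_pos hr]
  rw [dist_comm, dist_eq_norm]
  change ‖φ (E b) - φ (E a)‖ ≤ _
  rw [← hIntg, intervalIntegral.integral_of_le hab]
  rw [← ENNReal.ofReal_le_ofReal_iff (by positivity), ofReal_norm]
  refine (enorm_integral_le_lintegral_enorm _).trans ?_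
  have hbound : ∀ θ ∈ Ioc a b, ‖F' θ‖ₑ ≤ ENNReal.ofReal (s / 2) +
      ENNReal.ofReal (r ^ 2 / (2 * s)) * dens φ (r * Complex.exp (θ * Complex.I)) := by
    intro θ hθ
    have h1 : dens φ (r * Complex.exp (θ * Complex.I)) = ENNReal.ofReal (‖deriv φ (E θ)‖ ^ 2) := by
      unfold dens; rw [indicator_of_mem (hin θ ⟨hθ.1.le, hθ.2⟩)]
    rw [h1, ← ofReal_norm, hnorm, ← ENNReal.ofReal_mul (by positivity), ← ENNReal.ofReal_add (by positivity) (by positivity)]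
    refine ENNReal.ofReal_le_ofReal ?_
    set x := ‖deriv φ (E θ)‖
    have : s / 2 + r ^ 2 / (2 * s) * x ^ 2 - r * x = (s - r * x) ^ 2 / (2 * s) := by field_simp; ring
    have : 0 ≤ (s - r * x) ^ 2 / (2 * s) := by positivity
    linarith
  refine (setLIntegral_mono' measurableSet_Ioc hbound).trans ?_
  have hsub : Ioc a b ⊆ Ioo (-Real.pi) Real.pi := fun θ hθ => ⟨ha.trans hθ.1, hθ.2.trans_lt hb⟩
  refine (lintegral_mono_set hsub).trans ?_
  rw [lintegral_add_left measurable_const, lintegral_const_mul _ (show Measurable (fun θ : ℝ => dens φ (r * Complex.exp (θ * Complex.I))) from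
      (dens_measurable φ).comp (by fun_prop))]
  change _ + _ * Lam φ r ≤ _
  have h2 : ENNReal.ofReal (r ^ 2 / (2 * s)) * Lam φ r ≤ ENNReal.ofReal (s / 2) := by
    calc ENNReal.ofReal (r ^ 2 / (2 * s)) * Lam φ r
        = ENNReal.ofReal (1 / (2 * s)) * (ENNReal.ofReal (r ^ 2) * Lam φ r) := by
          rw [← mul_assoc, ← ENNReal.ofReal_mul (by positivity)]; congr 2; field_simp
      _ ≤ ENNReal.ofReal (1 / (2 * s)) * ENNReal.ofReal (s ^ 2) := by gcongr
      _ = ENNReal.ofReal (s / 2) := by rw [← ENNReal.ofReal_mul (by positivity)]; congr 1; field_simp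
  refine (add_le_add_right h2 _).trans ?_
  rw [lintegral_const, Measure.restrict_apply MeasurableSet.univ, univ_inter, Real.volume_Ioo,
    ← ENNReal.ofReal_mul (by positivity), ← ENNReal.ofReal_add (mul_nonneg (by positivity) (by linarith [Real.pi_pos])) (by positivity)]
  refine ENNReal.ofReal_le_ofReal ?_
  have := Real.pi_lt_d2
  nlinarith

theorem arc_small {φ : ℂ → ℂ} (hφ : DifferentiableOn ℂ φ (ball 0 1)) (hi : InjOn φ (ball 0 1))
    (hb : Bornology.IsBounded (φ '' ball 0 1)) {ε δ : ℝ} (hε : 0 < ε) (hδ : 0 < δ) :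
    ∃ r, 0 < r ∧ r < δ ∧ ∀ z ∈ ball (0 : ℂ) 1, ∀ w ∈ ball (0 : ℂ) 1, ‖z + 1‖ = r → ‖w + 1‖ = r →
      dist (φ z) (φ w) ≤ ε := by
  obtain ⟨r, hr, hrδ, hl⟩ := lam_small hφ hi hb hδ (s := (ε / 4) ^ 2) (by positivity)
  refine ⟨r, hr, hrδ, ?_⟩
  have hnorm : ∀ θ : ℝ, r * Complex.exp (θ * Complex.I) - 1 ∈ ball (0 : ℂ) 1 ↔ r < 2 * Real.cos θ := by
    intro θ
    rw [mem_ball_zero_iff, ← sq_lt_one_iff₀ (norm_nonneg _), ← Complex.normSq_eq_norm_sq, Complex.normSq_apply]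
    have h1 : (r * Complex.exp (θ * Complex.I) - 1).re = r * Real.cos θ - 1 := by
      simp [Complex.exp_ofReal_mul_I_re]
    have h2 : (r * Complex.exp (θ * Complex.I) - 1).im = r * Real.sin θ := by
      simp [Complex.exp_ofReal_mul_I_im]
    rw [h1, h2]
    have h3 := Real.sin_sq_add_cos_sq θ
    have h4 : (r * Real.cos θ - 1) * (r * Real.cos θ - 1) + r * Real.sin θ * (r * Real.sin θ)
      = r * (r - 2 * Real.cos θ) + 1 := by linear_combination r ^ 2 * h3
    rw [h4]
    constructor
    · intro h; by_contra h5; push Not at h5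
      have := mul_nonneg hr.le (sub_nonneg.2 h5); linarith
    · intro h; have := mul_neg_of_pos_of_neg hr (sub_neg.2 h); linarith
  have hrep : ∀ z ∈ ball (0 : ℂ) 1, ‖z + 1‖ = r → ∃ θ : ℝ, |θ| < Real.pi ∧ z = r * Complex.exp (θ * Complex.I) - 1 ∧
      r < 2 * Real.cos θ := by
    intro z hz h
    have h0 : z = r * Complex.exp ((z + 1).arg * Complex.I) - 1 := by
      rw [← h, Complex.norm_mul_exp_arg_mul_I]; ring
    have h1 : r < 2 * Real.cos (z + 1).arg := (hnorm _).1 (h0 ▸ hz)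
    refine ⟨(z + 1).arg, lt_of_le_of_ne (Complex.abs_arg_le_pi _) fun h2 => ?_, h0, h1⟩
    rw [← Real.cos_abs, h2, Real.cos_pi] at h1; linarith
  have key : ∀ a b : ℝ, a ≤ b → |a| < Real.pi → |b| < Real.pi → r < 2 * Real.cos a → r < 2 * Real.cos b →
      dist (φ (r * Complex.exp (a * Complex.I) - 1)) (φ (r * Complex.exp (b * Complex.I) - 1)) ≤ ε := by
    intro a b hab ha hb' hca hcb
    have := arc_small_aux hφ hr (s := ε / 4) (by positivity) hl hab (abs_lt.1 ha).1 (abs_lt.1 hb').2 ?_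
    · linarith
    · intro θ hθ
      rw [hnorm]
      -- cos θ ≥ min
      have hm : |θ| ≤ max |a| |b| := abs_le_max_abs_abs hθ.1 hθ.2
      have hmc : r < 2 * Real.cos (max |a| |b|) := by
        rcases max_choice |a| |b| with h | h <;> rw [h, Real.cos_abs] <;> assumption
      have : Real.cos (max |a| |b|) ≤ Real.cos |θ| :=
        Real.cos_le_cos_of_nonneg_of_le_pi (abs_nonneg _) (max_lt ha hb').le hm
      rw [Real.cos_abs] at this; linarith
  intro z hz w hw hzr hwr
  obtain ⟨a, ha, rfl, hca⟩ := hrep z hz hzr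
  obtain ⟨b, hb', rfl, hcb⟩ := hrep w hw hwr
  rcases le_total a b with h | h
  · exact key a b h ha hb' hca hcb
  · rw [dist_comm]; exact key b a h hb' ha hcb hca

/-- rotated version, around an arbitrary boundary point -/
theorem arc_small' {φ : ℂ → ℂ} (hφ : DifferentiableOn ℂ φ (ball 0 1)) (hi : InjOn φ (ball 0 1))
    (hb : Bornology.IsBounded (φ '' ball 0 1)) {ζ : ℂ} (hζ : ‖ζ‖ = 1) {ε δ : ℝ} (hε : 0 < ε) (hδ : 0 < δ) :
    ∃ r, 0 < r ∧ r < δ ∧ ∀ z ∈ ball (0 : ℂ) 1, ∀ w ∈ ball (0 : ℂ) 1, ‖z - ζ‖ = r → ‖w - ζ‖ = r →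
      dist (φ z) (φ w) ≤ ε := by
  have hζ0 : ζ ≠ 0 := by rintro rfl; simp at hζ
  have hm : MapsTo (fun z => -ζ * z) (ball (0 : ℂ) 1) (ball 0 1) := by
    intro z hz; rw [mem_ball_zero_iff] at hz ⊢; simpa [hζ] using hz
  obtain ⟨r, hr, hrδ, h⟩ := arc_small (φ := fun z => φ (-ζ * z))
    (hφ.comp (by fun_prop) hm) (fun z hz w hw h => by
      have := hi (hm hz) (hm hw) h
      exact mul_left_cancel₀ (neg_ne_zero.2 hζ0) this)
    (hb.subset (by rintro _ ⟨z, hz, rfl⟩; exact ⟨_, hm hz, rfl⟩)) hε hδ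
  refine ⟨r, hr, hrδ, fun z hz w hw hzr hwr => ?_⟩
  have hn : ∀ z : ℂ, ‖-ζ⁻¹ * z‖ = ‖z‖ := fun z => by rw [norm_mul, norm_neg, norm_inv, hζ]; simp
  have hn' : ∀ z : ℂ, ‖-ζ⁻¹ * z + 1‖ = ‖z - ζ‖ := fun z => by
    rw [← hn (z - ζ)]; congr 1; field_simp; ring
  have hc : ∀ z : ℂ, -ζ * (-ζ⁻¹ * z) = z := fun z => by field_simp
  have := h (-ζ⁻¹ * z) (by rw [mem_ball_zero_iff, hn]; simpa using hz) (-ζ⁻¹ * w)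
    (by rw [mem_ball_zero_iff, hn]; simpa using hw) (by rw [hn', hzr]) (by rw [hn', hwr])
  simpa only [hc] using this

end BKE

namespace BKE
open Set Filter Topology Metric
open scoped unitInterval ComplexConjugate

/-! ### Loops and Caratheodory -/

theorem isJordan_of_loop {X : Type*} [TopologicalSpace X] {f : ℝ → X} (hf : ContinuousOn f (Icc 0 1))
    (h01 : f 0 = f 1) (hi : InjOn f (Ico 0 1)) : IsJordan (fun t => f (Int.fract t)) where
  cont := hf.comp_fract'' h01
  per := fun t => by simp [Int.fract_add_one]
  inj := fun s t h => by
    have := hi ⟨Int.fract_nonneg s, Int.fract_lt_one s⟩ ⟨Int.fract_nonneg t, Int.fract_lt_one t⟩ h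
    refine ⟨⌊s⌋ - ⌊t⌋, ?_⟩
    have h1 := Int.fract_add_floor s
    have h2 := Int.fract_add_floor t
    push_cast; linarith

theorem range_loop {X : Type*} {f : ℝ → X} (h01 : f 0 = f 1) :
    range (fun t => f (Int.fract t)) = f '' Icc 0 1 := by
  ext x; constructor
  · rintro ⟨t, rfl⟩; exact ⟨Int.fract t, ⟨Int.fract_nonneg t, (Int.fract_lt_one t).le⟩, rfl⟩
  · rintro ⟨t, ht, rfl⟩
    rcases ht.2.lt_or_eq with h | h
    · exact ⟨t, by simp only; rw [Int.fract_eq_self.2 ⟨ht.1, h⟩]⟩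
    · exact ⟨0, by simp only [Int.fract_zero]; rw [h, h01]⟩

theorem two_arcs {X : Type*} [TopologicalSpace X] {a b : ℝ → X} (ha : ContinuousOn a (Icc 0 1))
    (hb : ContinuousOn b (Icc 0 1)) (hai : InjOn a (Icc 0 1)) (hbi : InjOn b (Icc 0 1))
    (h0 : a 0 = b 0) (h1 : a 1 = b 1)
    (hd : ∀ s ∈ Icc (0:ℝ) 1, ∀ t ∈ Icc (0:ℝ) 1, a s = b t → (s = 0 ∧ t = 0) ∨ (s = 1 ∧ t = 1)) :
    ∃ c : ℝ → X, IsJordan c ∧ range c = a '' Icc 0 1 ∪ b '' Icc 0 1 ∧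
      (∀ t ∈ Icc (0:ℝ) (1/2), c t = a (2 * t)) ∧ (∀ t ∈ Icc (1/2:ℝ) 1, c t = b (2 - 2 * t)) := by
  set f : ℝ → X := fun t => if t ≤ 1 / 2 then a (2 * t) else b (2 - 2 * t) with hfdef
  have f1 : ∀ t, t ≤ 1 / 2 → f t = a (2 * t) := fun t ht => by simp only [hfdef, if_pos ht]
  have f2 : ∀ t, 1 / 2 ≤ t → f t = b (2 - 2 * t) := fun t ht => by
    rcases ht.lt_or_eq with h | h
    · simp only [hfdef, if_neg (not_le.2 h)]
    · rw [f1 _ h.symm.le, ← h]; norm_num [h1]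
  have h01 : f 0 = f 1 := by rw [f1 0 (by norm_num), f2 1 (by norm_num)]; norm_num [h0]
  have hf : ContinuousOn f (Icc 0 1) := by
    have e : Icc (0:ℝ) 1 = Icc 0 (1/2) ∪ Icc (1/2) 1 := by
      rw [Icc_union_Icc_eq_Icc] <;> norm_num
    rw [e]
    refine ContinuousOn.union_of_isClosed ?_ ?_ isClosed_Icc isClosed_Icc
    · refine ContinuousOn.congr (f := fun t => a (2 * t)) ?_ fun t ht => f1 t ht.2
      exact ha.comp (by fun_prop) fun t ht => ⟨by linarith [ht.1], by linarith [ht.2]⟩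
    · refine ContinuousOn.congr (f := fun t => b (2 - 2 * t)) ?_ fun t ht => f2 t ht.1
      exact hb.comp (by fun_prop) fun t ht => ⟨by linarith [ht.2], by linarith [ht.1]⟩
  have hi : InjOn f (Ico 0 1) := by
    intro s hs t ht e
    rcases le_total s (1/2) with hs2 | hs2 <;> rcases le_total t (1/2) with ht2 | ht2
    · rw [f1 s hs2, f1 t ht2] at e
      have := hai ⟨by linarith [hs.1], by linarith⟩ ⟨by linarith [ht.1], by linarith⟩ e
      linarith
    · rw [f1 s hs2, f2 t ht2] at e
      rcases hd _ ⟨by linarith [hs.1], by linarith⟩ _ ⟨by linarith [ht.2], by linarith⟩ e with h | h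
      · linarith [ht.2, h.2]
      · linarith [h.1, h.2]
    · rw [f2 s hs2, f1 t ht2] at e
      rcases hd _ ⟨by linarith [ht.1], by linarith⟩ _ ⟨by linarith [hs.2], by linarith⟩ e.symm with h | h
      · linarith [hs.2, h.2]
      · linarith [h.1, h.2]
    · rw [f2 s hs2, f2 t ht2] at e
      have := hbi ⟨by linarith [hs.2], by linarith⟩ ⟨by linarith [ht.2], by linarith⟩ e
      linarith
  have hval : ∀ t ∈ Icc (0:ℝ) 1, f (Int.fract t) = f t := by
    intro t ht
    rcases ht.2.lt_or_eq with h | h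
    · rw [Int.fract_eq_self.2 ⟨ht.1, h⟩]
    · rw [h, Int.fract_one, h01]
  refine ⟨fun t => f (Int.fract t), isJordan_of_loop hf h01 hi, ?_, ?_, ?_⟩
  · rw [range_loop h01]
    apply Subset.antisymm
    · rintro _ ⟨t, ht, rfl⟩
      rcases le_total t (1/2) with h | h
      · rw [f1 t h]; exact Or.inl ⟨_, ⟨by linarith [ht.1], by linarith⟩, rfl⟩
      · rw [f2 t h]; exact Or.inr ⟨_, ⟨by linarith [ht.2], by linarith⟩, rfl⟩
    · rintro _ (⟨t, ht, rfl⟩ | ⟨t, ht, rfl⟩)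
      · refine ⟨t / 2, ⟨by linarith [ht.1], by linarith [ht.2]⟩, ?_⟩
        rw [f1 _ (by linarith [ht.2])]; congr 1; ring
      · refine ⟨1 - t / 2, ⟨by linarith [ht.2], by linarith [ht.1]⟩, ?_⟩
        rw [f2 _ (by linarith [ht.2])]; congr 1; ring
  · intro t ht; dsimp only
    rw [hval t ⟨ht.1, by linarith [ht.2]⟩, f1 t ht.2]
  · intro t ht; dsimp only
    rw [hval t ⟨by linarith [ht.1], ht.2⟩, f2 t ht.1]

theorem small_arc {c : ℝ → ℂ} (hc : IsJordan c) {η : ℝ} (hη : 0 < η) :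
    ∃ ε > 0, ∀ x ∈ range c, ∃ a b : ℝ, a ≤ b ∧ c '' Icc a b ⊆ ball x η ∧
      ∀ y ∈ range c, dist y x < ε → y ∈ c '' Icc a b := by
  have huc := isCompact_Icc.uniformContinuousOn_of_continuous (s := Icc (-1:ℝ) 2) hc.cont.continuousOn
  rw [Metric.uniformContinuousOn_iff] at huc
  obtain ⟨δ0, hδ0, hδ⟩ := huc η hη
  set δ := min (δ0 / 2) (1/4) with hδd
  have d0 : 0 < δ := by positivity
  have d1 : δ < δ0 := by have := min_le_left (δ0/2) (1/4); linarith
  have d2 : δ ≤ 1/4 := min_le_right _ _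
  have hK : IsCompact {p : ℝ × ℝ | (0 ≤ p.1 ∧ p.1 ≤ 1) ∧ p.1 + δ ≤ p.2 ∧ p.2 ≤ p.1 + 1 - δ} := by
    refine IsCompact.of_isClosed_subset (isCompact_Icc (a := ((0:ℝ), (0:ℝ))) (b := (1, 2))) ?_ ?_
    · exact IsClosed.inter (IsClosed.inter (isClosed_le continuous_const continuous_fst)
        (isClosed_le continuous_fst continuous_const))
        (IsClosed.inter (isClosed_le (continuous_fst.add continuous_const) continuous_snd)
        (isClosed_le continuous_snd ((continuous_fst.add continuous_const).sub continuous_const)))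
    · rintro ⟨s, t⟩ ⟨⟨h1, h2⟩, h3, h4⟩
      dsimp only at h1 h2 h3 h4
      exact ⟨⟨h1, by dsimp only; linarith⟩, ⟨h2, by dsimp only; linarith⟩⟩
  have hcc := hc.cont
  obtain ⟨ε, hε, hmin⟩ := hK.exists_forall_le' (f := fun p => dist (c p.1) (c p.2)) (a := 0)
    (by fun_prop) (by
      rintro ⟨s, t⟩ ⟨⟨h1, h2⟩, h3, h4⟩
      dsimp only at h1 h2 h3 h4 ⊢
      rw [dist_pos]
      intro e
      obtain ⟨k, hk⟩ := hc.inj _ _ e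
      have k1 : (k:ℝ) < 0 := by linarith
      have k2 : (-1:ℝ) < k := by linarith
      have k1' : k < 0 := by exact_mod_cast k1
      have k2' : -1 < k := by exact_mod_cast k2
      omega)
  refine ⟨ε, hε, ?_⟩
  rintro _ ⟨s0, rfl⟩
  obtain ⟨s, hs, e⟩ := exists_rep hc.per 0 s0
  rw [← e]
  have hs1 := hs.1
  have hs2 := hs.2
  refine ⟨s - δ, s + δ, by linarith, ?_, ?_⟩
  · rintro _ ⟨t, ht, rfl⟩
    refine hδ t ⟨by linarith [ht.1], by linarith [ht.2]⟩ s ⟨by linarith, by linarith⟩ ?_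
    rw [Real.dist_eq, abs_lt]; exact ⟨by linarith [ht.1], by linarith [ht.2]⟩
  · rintro _ ⟨t0, rfl⟩ hd
    obtain ⟨t, ht, e'⟩ := exists_rep hc.per (s - δ) t0
    rw [← e'] at hd ⊢
    by_cases hts : t ≤ s + δ
    · exact ⟨t, ⟨ht.1, hts⟩, rfl⟩
    · exfalso
      have := hmin (s, t) ⟨⟨hs1, by dsimp only; linarith⟩, by dsimp only; linarith, by dsimp only; linarith [ht.2]⟩
      dsimp only at this
      rw [dist_comm] at this; linarith

theorem circ_pt {ζ : ℂ} (hζ : ‖ζ‖ = 1) (r θ : ℝ) :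
    ‖ζ * (1 - r * Complex.exp (θ * Complex.I))‖ ^ 2 = 1 + r ^ 2 - 2 * r * Real.cos θ := by
  rw [norm_mul, hζ, one_mul, Complex.sq_norm, Complex.exp_mul_I, ← Complex.ofReal_cos, ← Complex.ofReal_sin,
    Complex.normSq_apply]
  simp only [Complex.sub_re, Complex.one_re, Complex.mul_re, Complex.ofReal_re, Complex.add_re, Complex.I_re,
    Complex.ofReal_im, Complex.I_im, Complex.sub_im, Complex.one_im, Complex.mul_im, Complex.add_im]
  linear_combination r ^ 2 * Real.sin_sq_add_cos_sq θ

theorem osc {c : ℝ → ℂ} (hc : IsJordan c) {φ ψ : ℂ → ℂ} (hφ : DifferentiableOn ℂ φ (ball 0 1))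
    (hψ : ContinuousOn ψ (inside c)) (m1 : MapsTo φ (ball 0 1) (inside c))
    (m2 : MapsTo ψ (inside c) (ball 0 1)) (l : ∀ z ∈ ball (0:ℂ) 1, ψ (φ z) = z)
    (l' : ∀ w ∈ inside c, φ (ψ w) = w) {ζ : ℂ} (hζ : ‖ζ‖ = 1) {ρ : ℝ} (hρ : 0 < ρ) :
    ∃ r > 0, ∃ e, φ '' (ball 0 1 ∩ ball ζ r) ⊆ closedBall e ρ := by
  have h0 : (0:ℂ) ∈ ball (0:ℂ) 1 := by simp
  have hJc := hc.isCompact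
  have hJne : (range c).Nonempty := range_nonempty c
  have hd0 : 0 < infDist (φ 0) (range c) :=
    (hJc.isClosed.notMem_iff_infDist_pos hJne).1 (m1 h0).1
  set d0 := infDist (φ 0) (range c)
  set ρ' := min ρ (d0 / 2) with hρd
  have r0 : 0 < ρ' := by positivity
  have r1 : ρ' ≤ ρ := min_le_left _ _
  have r2 : ρ' < d0 := by have := min_le_right ρ (d0/2); linarith
  obtain ⟨ε0, hε0, hsm⟩ := small_arc hc r0
  have hinj : InjOn φ (ball 0 1) := fun z hz w hw e => by rw [← l z hz, ← l w hw, e]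
  have hbd : Bornology.IsBounded (φ '' ball 0 1) := hc.inside_bounded.subset m1.image_subset
  obtain ⟨r, hr0, hr1, har⟩ := arc_small' hφ hinj hbd hζ (ε := min (ε0 / 2) (ρ' / 2)) (δ := 1)
    (by positivity) one_pos
  have har1 : ∀ z ∈ ball (0 : ℂ) 1, ∀ w ∈ ball (0 : ℂ) 1, ‖z - ζ‖ = r → ‖w - ζ‖ = r →
      dist (φ z) (φ w) ≤ min (ε0 / 2) (ρ' / 2) := har
  set κ := φ '' {z | z ∈ ball (0:ℂ) 1 ∧ ‖z - ζ‖ = r} with hκ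
  have hκD : κ ⊆ inside c := by rintro _ ⟨z, hz, rfl⟩; exact m1 hz.1
  have hκc : IsCompact (closure κ) := (hc.inside_bounded.subset hκD).isCompact_closure
  have hκsub : closure κ ⊆ inside c ∪ range c := (closure_mono hκD).trans hc.closure_inside_subset
  have hdiam : ∀ x ∈ closure κ, ∀ y ∈ closure κ, dist x y ≤ min (ε0 / 2) (ρ' / 2) := by
    intro x hx y hy
    have hcl : IsClosed {p : ℂ × ℂ | dist p.1 p.2 ≤ min (ε0 / 2) (ρ' / 2)} :=
      isClosed_le (by fun_prop) continuous_const
    have : closure (κ ×ˢ κ) ⊆ {p : ℂ × ℂ | dist p.1 p.2 ≤ min (ε0 / 2) (ρ' / 2)} := by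
      refine closure_minimal ?_ hcl
      rintro ⟨_, _⟩ ⟨⟨z, hz, rfl⟩, ⟨w, hw, rfl⟩⟩
      exact har1 z hz.1 w hw.1 hz.2 hw.2
    rw [closure_prod_eq] at this
    exact this (a := (x, y)) ⟨hx, hy⟩
  obtain ⟨e, heκ, heJ⟩ : (closure κ ∩ range c).Nonempty := by
    by_contra hemp
    rw [not_nonempty_iff_eq_empty] at hemp
    have hsub : closure κ ⊆ inside c := by
      intro x hx
      rcases hκsub hx with h | h
      · exact h
      · exact absurd (show x ∈ closure κ ∩ range c from ⟨hx, h⟩) (by rw [hemp]; simp)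
    have hcomp : IsCompact (ψ '' closure κ) := hκc.image_of_continuousOn (hψ.mono hsub)
    set E : ℝ → ℂ := fun θ => ζ * (1 - r * Complex.exp (θ * Complex.I)) with hE
    set α := Real.arccos (r / 2) with hα
    have hcos : Real.cos α = r / 2 := Real.cos_arccos (by linarith) (by linarith)
    have hα0 : 0 < α := Real.arccos_pos.2 (by linarith)
    have hαπ : α ≤ Real.pi := Real.arccos_le_pi _
    have hmem : ∀ θ ∈ Ico 0 α, E θ ∈ ψ '' closure κ := by
      intro θ hθ
      have hcosθ : r / 2 < Real.cos θ := by
        rw [← hcos]; exact Real.cos_lt_cos_of_nonneg_of_le_pi hθ.1 hαπ hθ.2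
      have hn : E θ ∈ ball (0:ℂ) 1 := by
        rw [mem_ball_zero_iff]
        have := circ_pt hζ r θ
        have h2 : ‖E θ‖ ^ 2 < 1 := by rw [hE]; dsimp only; rw [this]; nlinarith
        nlinarith [norm_nonneg (E θ)]
      refine ⟨φ (E θ), subset_closure ⟨E θ, ⟨hn, ?_⟩, rfl⟩, l _ hn⟩
      have : E θ - ζ = - (ζ * r * Complex.exp (θ * Complex.I)) := by rw [hE]; ring
      rw [this, norm_neg, norm_mul, norm_mul, hζ, Complex.norm_exp_ofReal_mul_I]
      simp [abs_of_pos hr0]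
    have hEc : Continuous E := by rw [hE]; fun_prop
    have hm : E α ∈ ψ '' closure κ := by
      have h1 : α ∈ closure (Ico 0 α) := by rw [closure_Ico hα0.ne]; exact ⟨hα0.le, le_rfl⟩
      have := map_mem_closure hEc h1 hmem
      rwa [hcomp.isClosed.closure_eq] at this
    obtain ⟨w, hw, hwe⟩ := hm
    have h1 := m2 (hsub hw)
    rw [hwe, mem_ball_zero_iff] at h1
    have h2 := circ_pt hζ r α
    rw [hcos] at h2
    have h3 : ‖E α‖ ^ 2 = 1 := by rw [hE]; dsimp only; rw [h2]; ring
    nlinarith [norm_nonneg (E α)]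
  obtain ⟨a, b, hab, hJ1, hJ2⟩ := hsm e heJ
  have hκb : closure κ ⊆ ball e ρ' := by
    intro x hx
    have := hdiam x hx e heκ
    have h2 := min_le_right (ε0 / 2) (ρ' / 2)
    rw [mem_ball]; linarith
  have hAB : (closure κ ∪ c '' Icc a b) ∩ range c = c '' Icc a b := by
    apply Subset.antisymm
    · rintro x ⟨h | h, hx⟩
      · apply hJ2 x hx
        have := hdiam x h e heκ
        have h2 := min_le_left (ε0 / 2) (ρ' / 2)
        linarith
      · exact h
    · intro x hx; exact ⟨Or.inr hx, image_subset_range _ _ hx⟩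
  have hAb : closure κ ∪ c '' Icc a b ⊆ ball e ρ' := union_subset hκb hJ1
  have hp : ρ' < ‖φ 0 - e‖ := by
    have := infDist_le_dist_of_mem (x := φ 0) heJ
    rw [dist_eq_norm] at this; linarith
  refine ⟨r, hr0, e, ?_⟩
  rintro _ ⟨z, ⟨hz, hzr⟩, rfl⟩
  refine closedBall_subset_closedBall r1 ?_
  by_contra hcon
  have hq : ρ' < ‖φ z - e‖ := by rwa [mem_closedBall, not_le, dist_eq_norm] at hcon
  have j1 : JoinedIn (closure κ ∪ c '' Icc a b)ᶜ (φ 0) (φ z) := by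
    refine ((compl_ball_preconnected e ρ' r0).joinedIn _ hp _ hq).mono ?_
    intro y hy hy2
    have hy' : ρ' < ‖y - e‖ := hy
    have := hAb hy2
    rw [mem_ball, dist_eq_norm] at this; linarith
  have j2 : JoinedIn (range c)ᶜ (φ 0) (φ z) := hc.inside_joined (m1 h0) (m1 hz)
  have hAc : IsCompact (closure κ ∪ c '' Icc a b) := hκc.union (isCompact_Icc.image hc.cont)
  have j3 := janiszewski hAc hJc (by rw [hAB]; exact isPreconnected_Icc.image _ hc.cont.continuousOn) j1 j2
  obtain ⟨γ, hγ⟩ := j3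
  have hγD : ∀ t, γ t ∈ inside c := by
    intro t
    rw [hc.inside_eq (m1 h0)]
    have hsub : range γ ⊆ (range c)ᶜ := by
      rintro _ ⟨t, rfl⟩ h; exact hγ t (Or.inr h)
    exact (isPreconnected_range γ.continuous).subset_connectedComponentIn ⟨0, γ.source⟩ hsub ⟨t, rfl⟩
  have hcont : Continuous (fun t => ‖ψ (γ t) - ζ‖) := by
    have : Continuous (fun t => ψ (γ t)) := hψ.comp_continuous γ.continuous hγD
    exact (this.sub continuous_const).norm
  have hv0 : ‖ψ (γ 0) - ζ‖ = 1 := by rw [γ.source, l 0 h0]; simp [hζ]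
  have hv1 : ‖ψ (γ 1) - ζ‖ < r := by
    rw [γ.target, l z hz, ← dist_eq_norm]; exact hzr
  obtain ⟨t, ht⟩ := mem_range_of_exists_le_of_exists_ge hcont (c := r) ⟨1, hv1.le⟩ ⟨0, by rw [hv0]; linarith⟩
  refine hγ t (Or.inl (Or.inl (subset_closure ⟨ψ (γ t), ⟨m2 (hγD t), ht⟩, l' _ (hγD t)⟩)))


theorem exists_circle {u : ℂ} (h : ‖u‖ = 1) : ∃ q : Circle, (q : ℂ) = u :=
  ⟨⟨u, mem_sphere_zero_iff_norm.2 h⟩, rfl⟩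

theorem caratheodory_inj {c : ℝ → ℂ} (hc : IsJordan c) {Φ : ℂ → ℂ} (hd : DifferentiableOn ℂ Φ (ball 0 1))
    (hΦ : ContinuousOn Φ (closedBall 0 1)) (hi : InjOn Φ (ball 0 1)) (h1 : Φ '' ball 0 1 = inside c)
    (h2 : MapsTo Φ (sphere 0 1) (range c)) {ζ₁ ζ₂ : ℂ} (z1 : ζ₁ ∈ sphere (0:ℂ) 1) (z2 : ζ₂ ∈ sphere (0:ℂ) 1)
    (he : Φ ζ₁ = Φ ζ₂) : ζ₁ = ζ₂ := by
  by_contra hne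
  have n1 : ‖ζ₁‖ = 1 := by simpa using z1
  have n2 : ‖ζ₂‖ = 1 := by simpa using z2
  have hin : ∀ z ∈ ball (0:ℂ) 1, Φ z ∈ inside c := fun z hz => by rw [← h1]; exact ⟨z, hz, rfl⟩
  have hmix : ∀ z ∈ ball (0:ℂ) 1, ∀ ζ ∈ sphere (0:ℂ) 1, Φ z ≠ Φ ζ := fun z hz ζ hζ e =>
    (hin z hz).1 (e ▸ h2 hζ)
  have hnorm : ∀ ζ : ℂ, ‖ζ‖ = 1 → ∀ t ∈ Icc (0:ℝ) 1, ‖(t:ℂ) * ζ‖ = t := by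
    intro ζ hζ t ht; rw [norm_mul, hζ, Complex.norm_real, Real.norm_eq_abs, abs_of_nonneg ht.1, mul_one]
  have hcl : ∀ ζ : ℂ, ‖ζ‖ = 1 → ∀ t ∈ Icc (0:ℝ) 1, (t:ℂ) * ζ ∈ closedBall (0:ℂ) 1 := by
    intro ζ hζ t ht; rw [mem_closedBall_zero_iff, hnorm ζ hζ t ht]; exact ht.2
  have hop : ∀ ζ : ℂ, ‖ζ‖ = 1 → ∀ t ∈ Icc (0:ℝ) 1, t ≠ 1 → (t:ℂ) * ζ ∈ ball (0:ℂ) 1 := by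
    intro ζ hζ t ht h; rw [mem_ball_zero_iff, hnorm ζ hζ t ht]; exact lt_of_le_of_ne ht.2 h
  have key : ∀ ζ ζ' : ℂ, ‖ζ‖ = 1 → ‖ζ'‖ = 1 → ∀ s ∈ Icc (0:ℝ) 1, ∀ t ∈ Icc (0:ℝ) 1,
      Φ (s * ζ) = Φ (t * ζ') → (s = 1 ∧ t = 1) ∨ (s = t ∧ (s:ℂ) * ζ = t * ζ') := by
    intro ζ ζ' hζ hζ' s hs t ht e
    by_cases hs1 : s = 1
    · by_cases ht1 : t = 1
      · exact Or.inl ⟨hs1, ht1⟩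
      · exact absurd e.symm (hmix _ (hop ζ' hζ' t ht ht1) _ (by rw [hs1]; simpa using hζ))
    · by_cases ht1 : t = 1
      · exact absurd e (hmix _ (hop ζ hζ s hs hs1) _ (by rw [ht1]; simpa using hζ'))
      · right
        have h := hi (hop ζ hζ s hs hs1) (hop ζ' hζ' t ht ht1) e
        refine ⟨?_, h⟩
        rw [← hnorm ζ hζ s hs, ← hnorm ζ' hζ' t ht, h]
  have hray : ∀ ζ : ℂ, ‖ζ‖ = 1 → ContinuousOn (fun t : ℝ => Φ (t * ζ)) (Icc 0 1) := fun ζ hζ =>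
    hΦ.comp (by fun_prop) (hcl ζ hζ)
  have hrinj : ∀ ζ : ℂ, ‖ζ‖ = 1 → InjOn (fun t : ℝ => Φ (t * ζ)) (Icc 0 1) := by
    intro ζ hζ s hs t ht e
    rcases key ζ ζ hζ hζ s hs t ht e with h | h
    · rw [h.1, h.2]
    · exact h.1
  obtain ⟨C, hC, hCr, -, -⟩ := two_arcs (hray ζ₁ n1) (hray ζ₂ n2) (hrinj ζ₁ n1) (hrinj ζ₂ n2)
    (by simp) (by simpa using he) (by
      intro s hs t ht e
      rcases key ζ₁ ζ₂ n1 n2 s hs t ht e with h | ⟨h, h'⟩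
      · exact Or.inr h
      · left
        subst h
        have : s = 0 := by
          by_contra h0
          exact hne (mul_left_cancel₀ (Complex.ofReal_ne_zero.2 h0) h')
        exact ⟨this, this⟩)
  have hCsub : range C ⊆ inside c ∪ {Φ ζ₁} := by
    rw [hCr]
    rintro _ (⟨t, ht, rfl⟩ | ⟨t, ht, rfl⟩)
    · by_cases h : t = 1
      · right; simp [h]
      · left; exact hin _ (hop _ n1 t ht h)
    · by_cases h : t = 1
      · right; simp [h, he]
      · left; exact hin _ (hop _ n2 t ht h)
  have hxJ : Φ ζ₁ ∈ range c := h2 z1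
  have hout : outside c ⊆ (range C)ᶜ := by
    intro y hy hyC
    rcases hCsub hyC with h | h
    · exact disjoint_left.1 inside_disjoint_outside h hy
    · rw [mem_singleton_iff] at h; rw [h] at hy; exact hy.1 hxJ
  have hout2 : outside c ⊆ outside C := by
    obtain ⟨R1, hR1⟩ := hc.isCompact.isBounded.subset_ball 0
    obtain ⟨R2, hR2⟩ := hC.isCompact.isBounded.subset_ball 0
    set R := max (max R1 R2) 1
    have hRn : ‖(R:ℂ)‖ = R := by
      rw [Complex.norm_real, Real.norm_eq_abs, abs_of_nonneg (le_trans zero_le_one (le_max_right _ _))]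
    have b1 : (R:ℂ) ∈ outside c := hc.outside_far hR1 (by rw [hRn]; exact le_trans (le_max_left _ _) (le_max_left _ _))
    have b2 : (R:ℂ) ∈ outside C := hC.outside_far hR2 (by rw [hRn]; exact le_trans (le_max_right _ _) (le_max_left _ _))
    rw [hC.outside_eq b2]
    exact hc.outside_connected.isPreconnected.subset_connectedComponentIn b1 hout
  have hCin : inside C ⊆ inside c := by
    intro y hy
    have hno : y ∉ range c := by
      intro hyJ
      obtain ⟨w, hw1, hw2⟩ := mem_closure_iff.1 (hc.subset_closure_outside hyJ) _ hC.inside_open hy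
      exact disjoint_left.1 inside_disjoint_outside hw1 (hout2 hw2)
    have : y ∈ inside c ∪ outside c := by rw [← hc.compl_eq]; exact hno
    rcases this with h | h
    · exact h
    · exact absurd (hout2 h) (disjoint_left.1 inside_disjoint_outside hy)
  obtain ⟨w, hw⟩ := hC.wind_inside.1
  obtain ⟨z, hz, hzw⟩ : w ∈ Φ '' ball 0 1 := by rw [h1]; exact hCin hw
  have hwC : Φ z ∉ range C := by rw [hzw]; exact hw.1
  have hoff : ∀ t ∈ Icc (0:ℝ) 1, z ≠ t * ζ₁ ∧ z ≠ t * ζ₂ := by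
    intro t ht
    constructor
    · intro e; apply hwC; rw [hCr, e]; exact Or.inl ⟨t, ht, rfl⟩
    · intro e; apply hwC; rw [hCr, e]; exact Or.inr ⟨t, ht, rfl⟩
  have hz0 : z ≠ 0 := by have := (hoff 0 ⟨le_rfl, zero_le_one⟩).1; simpa using this
  have hzn : 0 < ‖z‖ := norm_pos_iff.2 hz0
  have hz1 : ‖z‖ < 1 := by simpa using hz
  set u : ℂ := z / ‖z‖ with hu
  have hun : ‖u‖ = 1 := by rw [hu, norm_div]; simp [hzn.ne']
  have huz : z = ‖z‖ * u := by
    rw [hu, mul_div_cancel₀]; exact Complex.ofReal_ne_zero.2 hzn.ne'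
  have u1 : u ≠ ζ₁ := fun e => (hoff ‖z‖ ⟨hzn.le, hz1.le⟩).1 (e ▸ huz)
  have u2 : u ≠ ζ₂ := fun e => (hoff ‖z‖ ⟨hzn.le, hz1.le⟩).2 (e ▸ huz)
  have hec : Continuous (fun t : ℝ => u * Complex.exp (t * Complex.I)) := by fun_prop
  have hnear : ∀ᶠ t : ℝ in 𝓝 0, u * Complex.exp (t * Complex.I) ≠ ζ₁ ∧ u * Complex.exp (t * Complex.I) ≠ ζ₂ := by
    apply Filter.Eventually.and
    · exact hec.continuousAt.eventually_ne (by simpa using u1)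
    · exact hec.continuousAt.eventually_ne (by simpa using u2)
  obtain ⟨δ, hδ, hball⟩ := Metric.eventually_nhds_iff_ball.1 hnear
  have hen : ∀ t : ℝ, ‖u * Complex.exp (t * Complex.I)‖ = 1 := fun t => by
    rw [norm_mul, hun, Complex.norm_exp_ofReal_mul_I, one_mul]
  have hsec : ∀ r ∈ Ioo (0:ℝ) 1, ∀ t ∈ ball (0:ℝ) δ, Φ (r * (u * Complex.exp (t * Complex.I))) ∈ inside C := by
    set P : ℝ × ℝ → ℂ := fun p => Φ (p.1 * (u * Complex.exp (p.2 * Complex.I))) with hP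
    have hpc : IsPreconnected (Ioo (0:ℝ) 1 ×ˢ ball (0:ℝ) δ) :=
      isPreconnected_Ioo.prod (convex_ball _ _).isPreconnected
    have hPc : ContinuousOn P (Ioo (0:ℝ) 1 ×ˢ ball (0:ℝ) δ) := by
      refine hΦ.comp (by fun_prop) ?_
      rintro ⟨r, t⟩ ⟨hr, ht⟩
      exact hcl _ (hen t) r ⟨hr.1.le, hr.2.le⟩
    have hPi := hpc.image P hPc
    have hsub : P '' (Ioo (0:ℝ) 1 ×ˢ ball (0:ℝ) δ) ⊆ (range C)ᶜ := by
      rintro _ ⟨⟨r, t⟩, ⟨hr, ht⟩, rfl⟩ hmem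
      rw [hCr] at hmem
      have hrI : r ∈ Icc (0:ℝ) 1 := ⟨hr.1.le, hr.2.le⟩
      have aux : ∀ ζ : ℂ, ‖ζ‖ = 1 → u * Complex.exp (t * Complex.I) ≠ ζ → ∀ s ∈ Icc (0:ℝ) 1,
          Φ (s * ζ) ≠ Φ (r * (u * Complex.exp (t * Complex.I))) := by
        intro ζ hζ hneq s hs e
        rcases key _ _ (hen t) hζ r hrI s hs e.symm with h | h
        · exact hr.2.ne h.1
        · obtain ⟨h, h'⟩ := h
          rw [← h] at h'
          exact hneq (mul_left_cancel₀ (Complex.ofReal_ne_zero.2 hr.1.ne') h')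
      rcases hmem with ⟨s, hs, e⟩ | ⟨s, hs, e⟩
      · exact aux ζ₁ n1 (hball t ht).1 s hs e
      · exact aux ζ₂ n2 (hball t ht).2 s hs e
    have hwm : w ∈ P '' (Ioo (0:ℝ) 1 ×ˢ ball (0:ℝ) δ) := by
      refine ⟨(‖z‖, 0), ⟨⟨hzn, hz1⟩, mem_ball_self hδ⟩, ?_⟩
      rw [hP]; dsimp only
      rw [← hzw]; congr 1
      simp [← huz]
    intro r hr t ht
    rw [hC.inside_eq hw]
    exact hPi.subset_connectedComponentIn hwm hsub ⟨(r, t), ⟨hr, ht⟩, rfl⟩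
  have harc : ∀ t ∈ ball (0:ℝ) δ, Φ (u * Complex.exp (t * Complex.I)) = Φ ζ₁ := by
    intro t ht
    set v := u * Complex.exp (t * Complex.I)
    have hv : ‖v‖ = 1 := hen t
    have hvs : v ∈ sphere (0:ℂ) 1 := by simpa using hv
    have hcl1 : Φ v ∈ closure (inside C) := by
      have h := hray v hv
      have h1m : (1:ℝ) ∈ closure (Ioo (0:ℝ) 1) := by
        rw [closure_Ioo zero_ne_one]; exact ⟨zero_le_one, le_rfl⟩
      have := (h 1 ⟨zero_le_one, le_rfl⟩).mono (Ioo_subset_Icc_self)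
      have := this.mem_closure h1m (t := inside C) (fun r hr => hsec r hr t ht)
      simpa using this
    rcases hC.closure_inside_subset hcl1 with h | h
    · exact absurd (h2 hvs) (hCin h).1
    · rcases hCsub h with h | h
      · exact absurd (h2 hvs) h.1
      · exact h
  set V : Set Circle := {q | Φ q = Φ ζ₁} with hV
  have hVn : (interior V).Nonempty := by
    obtain ⟨U, hU⟩ := exists_circle hun
    refine ⟨U, ?_⟩
    rw [mem_interior_iff_mem_nhds]
    have hu0 : u ≠ 0 := by rintro h; simp [h] at hun
    have hcA : ContinuousAt (fun q : Circle => Complex.arg ((q:ℂ) / u)) U := by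
      refine ContinuousAt.comp (g := Complex.arg) ?_ ?_
      · rw [hU, div_self hu0]; exact Complex.continuousAt_arg (by simp)
      · exact (Continuous.div_const (by fun_prop) u).continuousAt
    have hev := hcA.eventually (Metric.ball_mem_nhds _ hδ)
    filter_upwards [hev] with q hq
    have hq' : Complex.arg ((q:ℂ) / u) ∈ ball (0:ℝ) δ := by
      have e0 : Complex.arg (u / u) = 0 := by rw [div_self hu0]; simp
      have hq2 : Complex.arg ((q:ℂ) / u) ∈ ball (Complex.arg ((U:ℂ) / u)) δ := hq
      rwa [hU, e0] at hq2
    have := harc _ hq'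
    have hqe : (q:ℂ) = u * Complex.exp (Complex.arg ((q:ℂ) / u) * Complex.I) := by
      have h := Complex.norm_mul_exp_arg_mul_I ((q:ℂ) / u)
      rw [norm_div, hun, Circle.norm_coe, div_one, Complex.ofReal_one, one_mul] at h
      rw [h]; field_simp
    rw [hV]; show Φ q = Φ ζ₁
    rw [hqe]; exact this
  obtain ⟨T, hT⟩ := compact_covered_by_mul_left_translates (isCompact_univ (X := Circle)) hVn
  have hrot : ∀ g : Circle, ∀ z ∈ closedBall (0:ℂ) 1, (g:ℂ) * z ∈ closedBall (0:ℂ) 1 := by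
    intro g z hz; rw [mem_closedBall_zero_iff] at hz ⊢; rw [norm_mul, Circle.norm_coe, one_mul]; exact hz
  have hrot' : ∀ g : Circle, ∀ z ∈ ball (0:ℂ) 1, (g:ℂ) * z ∈ ball (0:ℂ) 1 := by
    intro g z hz; rw [mem_ball_zero_iff] at hz ⊢; rw [norm_mul, Circle.norm_coe, one_mul]; exact hz
  have hdc : DiffContOnCl ℂ (fun z => ∏ g ∈ T, (Φ (g * z) - Φ ζ₁)) (ball 0 1) := by
    constructor
    · refine DifferentiableOn.fun_finsetProd fun g _ => ?_
      refine DifferentiableOn.sub_const ?_ _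
      exact hd.comp (by fun_prop) (hrot' g)
    · rw [closure_ball _ one_ne_zero]
      refine continuousOn_finsetProd _ fun g _ => ?_
      refine ContinuousOn.sub ?_ continuousOn_const
      exact hΦ.comp (by fun_prop) (hrot g)
  have hfin := Complex.norm_le_of_forall_mem_frontier_norm_le (C := 0) isBounded_ball hdc (by
    intro y hy
    rw [frontier_ball _ one_ne_zero] at hy
    have hyn : ‖y‖ = 1 := by simpa using hy
    obtain ⟨Y, hY⟩ := exists_circle hyn
    have hq := hT (mem_univ Y)
    simp only [mem_iUnion] at hq
    obtain ⟨g, hg, hgV⟩ := hq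
    have hgV' : Φ (g * y) = Φ ζ₁ := by
      have h5 : Φ ((g * Y : Circle) : ℂ) = Φ ζ₁ := hgV
      rwa [Circle.coe_mul, hY] at h5
    rw [Finset.prod_eq_zero hg (by rw [hgV', sub_self])]; simp) (z := 0) (subset_closure (by simp))
  simp only [mul_zero, norm_le_zero_iff, Finset.prod_const] at hfin
  have h3 := eq_zero_of_pow_eq_zero hfin
  exact hmix 0 (by simp) ζ₁ z1 (sub_eq_zero.1 h3)

theorem caratheodory {c : ℝ → ℂ} (hc : IsJordan c) : ∃ Φ : ℂ → ℂ, ContinuousOn Φ (closedBall 0 1) ∧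
    InjOn Φ (closedBall 0 1) ∧ Φ '' closedBall 0 1 = closure (inside c) ∧ Φ '' sphere 0 1 = range c ∧
    Φ '' ball 0 1 = inside c := by
  obtain ⟨φ, ψ, hφ, hψ, m1, m2, l, l'⟩ := riemann_map hc.logDomain
  have hψc := hψ.continuousOn
  have hcb : closure (ball (0:ℂ) 1) = closedBall 0 1 := closure_ball _ one_ne_zero
  have hext : ContinuousOn (extendFrom (ball 0 1) φ) (closedBall 0 1) := by
    refine continuousOn_extendFrom (by rw [hcb]) ?_
    intro x hx
    have hNB : (𝓝[ball (0:ℂ) 1] x).NeBot := mem_closure_iff_nhdsWithin_neBot.1 (by rw [hcb]; exact hx)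
    by_cases hxb : x ∈ ball (0:ℂ) 1
    · exact ⟨φ x, hφ.continuousOn x hxb⟩
    · have hxn : ‖x‖ = 1 := by
        rw [mem_ball_zero_iff, not_lt] at hxb
        exact le_antisymm (by simpa using hx) hxb
      refine cauchy_map_iff_exists_tendsto.1 (Metric.cauchy_iff.2 ⟨hNB.map φ, ?_⟩)
      intro ε hε
      obtain ⟨r, hr, e, he⟩ := osc hc hφ hψc m1 m2 l l' hxn (ρ := ε / 3) (by positivity)
      refine ⟨φ '' (ball 0 1 ∩ ball x r), image_mem_map (inter_mem self_mem_nhdsWithin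
        (mem_nhdsWithin_of_mem_nhds (ball_mem_nhds _ hr))), ?_⟩
      intro a ha b hb
      have h1 := he ha
      have h2 := he hb
      rw [mem_closedBall] at h1 h2
      have := dist_triangle_right a b e
      linarith
  set Φ := extendFrom (ball (0:ℂ) 1) φ with hΦ
  have hΦφ : ∀ z ∈ ball (0:ℂ) 1, Φ z = φ z := fun z hz =>
    extendFrom_eq (subset_closure hz) (hφ.continuousOn z hz)
  have him : Φ '' ball 0 1 = inside c := by
    apply Subset.antisymm
    · rintro _ ⟨z, hz, rfl⟩; rw [hΦφ z hz]; exact m1 hz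
    · intro w hw; exact ⟨ψ w, m2 hw, by rw [hΦφ _ (m2 hw), l' w hw]⟩
  have hsub : ∀ z ∈ closedBall (0:ℂ) 1, Φ z ∈ closure (inside c) := by
    intro z hz
    have := (hext z hz).mono ball_subset_closedBall
    exact this.mem_closure (by rw [hcb]; exact hz) (fun y hy => by rw [← him]; exact ⟨y, hy, rfl⟩)
  have hsph : MapsTo Φ (sphere 0 1) (range c) := by
    intro ζ hζ
    have hζc := sphere_subset_closedBall hζ
    rcases hc.closure_inside_subset (hsub ζ hζc) with h | h
    · exfalso
      have hNB : (𝓝[ball (0:ℂ) 1] ζ).NeBot := mem_closure_iff_nhdsWithin_neBot.1 (by rw [hcb]; exact hζc)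
      have t1 : Tendsto Φ (𝓝[ball 0 1] ζ) (𝓝 (Φ ζ)) := (hext ζ hζc).mono ball_subset_closedBall
      have t2 : Tendsto ψ (𝓝 (Φ ζ)) (𝓝 (ψ (Φ ζ))) := (hψc.continuousAt (hc.inside_open.mem_nhds h))
      have t3 := t2.comp t1
      have t4 : Tendsto (fun z : ℂ => z) (𝓝[ball 0 1] ζ) (𝓝 ζ) := tendsto_id.mono_left nhdsWithin_le_nhds
      have t5 : Tendsto (fun z : ℂ => z) (𝓝[ball 0 1] ζ) (𝓝 (ψ (Φ ζ))) := by
        refine t3.congr' ?_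
        filter_upwards [self_mem_nhdsWithin] with z hz
        simp only [Function.comp]; rw [hΦφ z hz, l z hz]
      have e := tendsto_nhds_unique t4 t5
      have h2 := m2 h
      rw [← e, mem_ball_zero_iff] at h2
      have h3 : ‖ζ‖ = 1 := by simpa using hζ
      linarith
    · exact h
  have himc : Φ '' closedBall 0 1 = closure (inside c) := by
    apply Subset.antisymm
    · rintro _ ⟨z, hz, rfl⟩; exact hsub z hz
    · refine closure_minimal ?_ ((isCompact_closedBall _ _).image_of_continuousOn hext).isClosed
      rw [← him]; exact image_mono ball_subset_closedBall
  have hinj : InjOn Φ (ball 0 1) := fun z hz w hw e => by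
    rw [hΦφ z hz, hΦφ w hw] at e; rw [← l z hz, ← l w hw, e]
  have hd : DifferentiableOn ℂ Φ (ball 0 1) := hφ.congr hΦφ
  have hin : ∀ z ∈ ball (0:ℂ) 1, Φ z ∈ inside c := fun z hz => by rw [← him]; exact ⟨z, hz, rfl⟩
  refine ⟨Φ, hext, ?_, himc, ?_, him⟩
  · intro z hz w hw e
    rw [← ball_union_sphere] at hz hw
    rcases hz with hz | hz <;> rcases hw with hw | hw
    · exact hinj hz hw e
    · exact absurd (hsph hw) (by rw [← e]; exact (hin z hz).1)
    · exact absurd (hsph hz) (by rw [e]; exact (hin w hw).1)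
    · exact caratheodory_inj hc hd hext hinj him hsph hz hw e
  · apply Subset.antisymm hsph.image_subset
    intro x hx
    obtain ⟨z, hz, rfl⟩ : x ∈ Φ '' closedBall 0 1 := by rw [himc]; exact hc.subset_closure_inside hx
    rw [← ball_union_sphere] at hz
    rcases hz with hz | hz
    · exact absurd hx (hin z hz).1
    · exact ⟨z, hz, rfl⟩

end BKE

namespace BKE
open Set Filter Topology Metric
open scoped unitInterval ComplexConjugate

/-! ### Schoenflies -/

theorem range_circ_unit : range (circ 0 1) = sphere (0:ℂ) 1 := by
  ext z; rw [mem_range_circ zero_le_one]; simp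

/-- coning a parametrization of the circle -/
theorem cone_homeo {k : ℝ → ℂ} (hk : IsJordan k) (hkr : range k = sphere (0:ℂ) 1) :
    ∃ X : ℂ → ℂ, Continuous X ∧ Function.Injective X ∧ (∀ z, ‖X z‖ = ‖z‖) ∧ Function.Surjective X ∧
      ∀ t, X (circ 0 1 t) = k t := by
  obtain ⟨η, hη, hηk⟩ := (isJordan_circ 0 one_pos).descend hk.cont hk.per
  rw [range_circ_unit] at hη
  have hηn : ∀ z ∈ sphere (0:ℂ) 1, ‖η z‖ = 1 := by
    intro z hz
    rw [← range_circ_unit] at hz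
    obtain ⟨t, rfl⟩ := hz
    have : k t ∈ sphere (0:ℂ) 1 := by rw [← hkr]; exact ⟨t, rfl⟩
    rw [hηk]; simpa using this
  have hηi : InjOn η (sphere 0 1) := by
    intro z hz w hw e
    rw [← range_circ_unit] at hz hw
    obtain ⟨s, rfl⟩ := hz
    obtain ⟨t, rfl⟩ := hw
    rw [hηk, hηk] at e
    obtain ⟨m, rfl⟩ := hk.inj _ _ e
    exact per_int (circ_per 0 1) m t
  have hηs : ∀ w ∈ sphere (0:ℂ) 1, ∃ z ∈ sphere (0:ℂ) 1, η z = w := by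
    intro w hw
    rw [← hkr] at hw
    obtain ⟨t, rfl⟩ := hw
    exact ⟨circ 0 1 t, by rw [← range_circ_unit]; exact ⟨t, rfl⟩, hηk t⟩
  have hu : ∀ z : ℂ, z ≠ 0 → z / ‖z‖ ∈ sphere (0:ℂ) 1 := by
    intro z hz
    rw [mem_sphere_zero_iff_norm, norm_div]; simp [norm_ne_zero_iff.2 hz]
  set X : ℂ → ℂ := fun z => ‖z‖ * η (z / ‖z‖) with hX
  have hXn : ∀ z, ‖X z‖ = ‖z‖ := by
    intro z
    by_cases hz : z = 0
    · simp [hX, hz]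
    · simp only [hX, norm_mul, hηn _ (hu z hz)]; simp
  have hX0 : ∀ z, X z = 0 ↔ z = 0 := fun z => by rw [← norm_eq_zero, hXn, norm_eq_zero]
  refine ⟨X, ?_, ?_, hXn, ?_, ?_⟩
  · rw [continuous_iff_continuousAt]
    intro z
    by_cases hz : z = 0
    · subst hz
      have h0 : X 0 = 0 := (hX0 0).2 rfl
      rw [ContinuousAt, h0, tendsto_zero_iff_norm_tendsto_zero]
      simp only [hXn]
      simpa using (continuous_norm (E := ℂ)).tendsto 0
    · have ho : IsOpen {z : ℂ | z ≠ 0} := isOpen_ne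
      have : ContinuousOn X {z : ℂ | z ≠ 0} := by
        refine ContinuousOn.mul (by fun_prop) ?_
        refine hη.comp ?_ (fun z hz => hu z hz)
        exact continuousOn_id.div (by fun_prop) (fun z hz => by
          have hz' : z ≠ 0 := hz
          simpa using hz')
      exact this.continuousAt (ho.mem_nhds hz)
  · intro z w e
    have hn : ‖z‖ = ‖w‖ := by rw [← hXn z, ← hXn w, e]
    by_cases hz : z = 0
    · subst hz
      rw [eq_comm, ← norm_eq_zero, ← hn, norm_zero]
    · have hw : w ≠ 0 := by rw [← norm_ne_zero_iff, ← hn]; exact norm_ne_zero_iff.2 hz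
      have e' : (‖z‖ : ℂ) * η (z / ‖z‖) = ‖w‖ * η (w / ‖w‖) := e
      have hzc : (‖w‖ : ℂ) ≠ 0 := Complex.ofReal_ne_zero.2 (norm_ne_zero_iff.2 hw)
      rw [hn] at e'
      have h := hηi (by have := hu z hz; rwa [hn] at this) (hu w hw) (mul_left_cancel₀ hzc e')
      exact (div_left_inj' hzc).1 h
  · intro w
    by_cases hw : w = 0
    · exact ⟨0, by rw [hw, hX0]⟩
    · obtain ⟨z, hz, hzw⟩ := hηs _ (hu w hw)
      have hwc : (‖w‖ : ℂ) ≠ 0 := Complex.ofReal_ne_zero.2 (norm_ne_zero_iff.2 hw)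
      have hz1 : ‖z‖ = 1 := by simpa using hz
      refine ⟨‖w‖ * z, ?_⟩
      have hn : ‖(‖w‖ : ℂ) * z‖ = ‖w‖ := by rw [norm_mul, hz1]; simp
      show ((‖(‖w‖ : ℂ) * z‖ : ℝ) : ℂ) * η (‖w‖ * z / (‖(‖w‖ : ℂ) * z‖ : ℝ)) = w
      rw [hn, mul_div_cancel_left₀ _ hwc, hzw, mul_div_cancel₀ _ hwc]
  · intro t
    have hn : ‖circ 0 1 t‖ = 1 := by simpa using norm_circ_sub 0 zero_le_one t
    show ((‖circ 0 1 t‖ : ℝ) : ℂ) * η (circ 0 1 t / (‖circ 0 1 t‖ : ℝ)) = k t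
    rw [hn]; simp [hηk]

theorem schoenflies {c : ℝ → ℂ} (hc : IsJordan c) : ∃ Ψ : ℂ → ℂ, ContinuousOn Ψ (closedBall 0 1) ∧
    InjOn Ψ (closedBall 0 1) ∧ Ψ '' closedBall 0 1 = closure (inside c) ∧ Ψ '' ball 0 1 = inside c ∧
    ∀ t, Ψ (circ 0 1 t) = c t := by
  obtain ⟨Φ, hΦ, hi, h1, h2, h3⟩ := caratheodory hc
  obtain ⟨Ξ, hΞ, hΞΦ⟩ := descend_compact (isCompact_closedBall (0:ℂ) 1) hΦ hi continuousOn_id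
  simp only [id] at hΞΦ
  rw [h1] at hΞ
  have hk : ∀ t, Ξ (c t) ∈ sphere (0:ℂ) 1 ∧ Φ (Ξ (c t)) = c t := by
    intro t
    have : c t ∈ Φ '' sphere 0 1 := by rw [h2]; exact ⟨t, rfl⟩
    obtain ⟨z, hz, hzc⟩ := this
    rw [← hzc, hΞΦ z (sphere_subset_closedBall hz)]
    exact ⟨hz, rfl⟩
  have hkJ : IsJordan (fun t => Ξ (c t)) := by
    refine ⟨?_, fun t => by simp only [hc.per], fun s t e => ?_⟩
    · exact hΞ.comp_continuous hc.cont fun t => hc.subset_closure_inside ⟨t, rfl⟩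
    · apply hc.inj; rw [← (hk s).2, ← (hk t).2]; rw [show Ξ (c s) = Ξ (c t) from e]
  have hkr : range (fun t => Ξ (c t)) = sphere (0:ℂ) 1 := by
    apply Subset.antisymm
    · rintro _ ⟨t, rfl⟩; exact (hk t).1
    · intro z hz
      have : Φ z ∈ range c := by rw [← h2]; exact ⟨z, hz, rfl⟩
      obtain ⟨t, ht⟩ := this
      exact ⟨t, by simp only; rw [ht, hΞΦ z (sphere_subset_closedBall hz)]⟩
  obtain ⟨X, Xc, Xi, Xn, Xs, Xk⟩ := cone_homeo hkJ hkr
  have i1 : X '' closedBall 0 1 = closedBall 0 1 := by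
    apply Subset.antisymm
    · rintro _ ⟨z, hz, rfl⟩; simpa [Xn] using hz
    · intro w hw; obtain ⟨z, rfl⟩ := Xs w; exact ⟨z, by simpa [Xn] using hw, rfl⟩
  have i2 : X '' ball 0 1 = ball 0 1 := by
    apply Subset.antisymm
    · rintro _ ⟨z, hz, rfl⟩; simpa [Xn] using hz
    · intro w hw; obtain ⟨z, rfl⟩ := Xs w; exact ⟨z, by simpa [Xn] using hw, rfl⟩
  have m1 : MapsTo X (closedBall 0 1) (closedBall 0 1) := by
    intro z hz; rw [← i1]; exact ⟨z, hz, rfl⟩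
  refine ⟨Φ ∘ X, hΦ.comp Xc.continuousOn m1, hi.comp Xi.injOn m1, ?_, ?_, ?_⟩
  · rw [image_comp, i1, h1]
  · rw [image_comp, i2, h3]
  · intro t; simp only [Function.comp]; rw [Xk]; exact (hk t).2

end BKE

namespace BKE
open Set Filter Topology Metric
open scoped unitInterval ComplexConjugate

/-! ### Arc lemma -/

theorem descend_quot {X Y Z : Type*} [TopologicalSpace X] [TopologicalSpace Y] [T2Space Y]
    [TopologicalSpace Z] [hZ : Nonempty Z] {K : Set X} (hK : IsCompact K) {h : X → Y} (hh : ContinuousOn h K)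
    {L : X → Z} (hL : ContinuousOn L K) (hf : ∀ s ∈ K, ∀ t ∈ K, h s = h t → L s = L t) :
    ∃ u : Y → Z, ContinuousOn u (h '' K) ∧ ∀ x ∈ K, u (h x) = L x := by
  classical
  obtain ⟨z0⟩ := hZ
  set u : Y → Z := fun y => if hy : ∃ x ∈ K, h x = y then L hy.choose else z0 with hu
  have hval : ∀ x ∈ K, u (h x) = L x := by
    intro x hx
    have hy : ∃ x' ∈ K, h x' = h x := ⟨x, hx, rfl⟩
    simp only [hu, dif_pos hy]
    exact hf _ hy.choose_spec.1 _ hx hy.choose_spec.2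
  refine ⟨u, ?_, hval⟩
  rw [continuousOn_iff_isClosed]
  intro F hF
  obtain ⟨F', hF', e⟩ := continuousOn_iff_isClosed.1 hL F hF
  refine ⟨h '' (K ∩ F'), ((hK.inter_right hF').image_of_continuousOn (hh.mono inter_subset_left)).isClosed, ?_⟩
  ext y; constructor
  · rintro ⟨hy, x, hx, rfl⟩
    refine ⟨⟨x, ⟨hx, ?_⟩, rfl⟩, x, hx, rfl⟩
    have : x ∈ L ⁻¹' F ∩ K := ⟨by rw [mem_preimage, ← hval x hx]; exact hy, hx⟩
    rw [e] at this; exact this.1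
  · rintro ⟨⟨x, ⟨hx, hxF⟩, rfl⟩, -⟩
    refine ⟨?_, x, hx, rfl⟩
    rw [mem_preimage, hval x hx]
    have : x ∈ F' ∩ K := ⟨hxF, hx⟩
    rw [← e] at this; exact this.1

/-- running maximum -/
def rmax (K : Set ℝ) (g : ℝ → ℝ) (t : ℝ) : ℝ := sSup (g '' (K ∩ Iic t))

section
variable {K : Set ℝ} (hK : IsCompact K) (g : ℝ → ℝ) (hg : Continuous g)

theorem rmax_bdd {K : Set ℝ} (hK : IsCompact K) {g : ℝ → ℝ} (hg : Continuous g) (t : ℝ) :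
    BddAbove (g '' (K ∩ Iic t)) :=
  (hK.image hg).bddAbove.mono (image_mono inter_subset_left)

theorem le_rmax {K : Set ℝ} (hK : IsCompact K) {g : ℝ → ℝ} (hg : Continuous g) {s t : ℝ} (hs : s ∈ K)
    (hst : s ≤ t) : g s ≤ rmax K g t :=
  le_csSup (rmax_bdd hK hg t) ⟨s, ⟨hs, hst⟩, rfl⟩

theorem rmax_le {K : Set ℝ} {g : ℝ → ℝ} {t M : ℝ} (ht : t ∈ K)
    (h : ∀ r ∈ K, r ≤ t → g r ≤ M) : rmax K g t ≤ M := by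
  refine csSup_le ⟨g t, t, ⟨ht, le_refl t⟩, rfl⟩ ?_
  rintro _ ⟨r, ⟨hr, hrt⟩, rfl⟩; exact h r hr hrt

theorem rmax_mono {K : Set ℝ} (hK : IsCompact K) {g : ℝ → ℝ} (hg : Continuous g) {s t : ℝ} (hs : s ∈ K)
    (hst : s ≤ t) : rmax K g s ≤ rmax K g t :=
  rmax_le hs fun r hr hrs => le_rmax hK hg hr (hrs.trans hst)

theorem rmax_cont {K : Set ℝ} (hK : IsCompact K) {g : ℝ → ℝ} (hg : Continuous g) :
    ContinuousOn (rmax K g) K := by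
  have hu : UniformContinuousOn (rmax K g) K := by
    obtain ⟨R, hR⟩ := hK.isBounded.subset_closedBall 0
    have huc := (isCompact_closedBall (0:ℝ) R).uniformContinuousOn_of_continuous hg.continuousOn
    rw [Metric.uniformContinuousOn_iff] at huc ⊢
    intro ε hε
    obtain ⟨δ, hδ, h⟩ := huc (ε / 2) (by positivity)
    refine ⟨δ, hδ, ?_⟩
    have key : ∀ s ∈ K, ∀ t ∈ K, s ≤ t → dist s t < δ → dist (rmax K g s) (rmax K g t) < ε := by
      intro s hs t ht hst hd
      have h1 := rmax_mono hK hg hs hst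
      have h2 : rmax K g t ≤ rmax K g s + ε / 2 := by
        refine rmax_le ht fun r hr hrt => ?_
        rcases le_total r s with h3 | h3
        · have := le_rmax hK hg hr h3; linarith
        · have hrs : dist r s < δ := by
            rw [Real.dist_eq, abs_of_nonneg (by linarith)]
            rw [Real.dist_eq, abs_of_nonpos (by linarith)] at hd; linarith
          have h4 := h r (hR hr) s (hR hs) hrs
          rw [Real.dist_eq, abs_lt] at h4
          have := le_rmax hK hg hs le_rfl
          linarith [h4.2]
      rw [Real.dist_eq, abs_of_nonpos (by linarith)]; linarith
    intro s hs t ht hd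
    rcases le_total s t with h3 | h3
    · exact key s hs t ht h3 hd
    · rw [dist_comm]; exact key t ht s hs h3 (by rwa [dist_comm])
  exact hu.continuousOn
end

theorem arc_lemma {Z : Type*} [MetricSpace Z] {p : ℝ → Z} (hp : Continuous p) (hne : p 0 ≠ p 1) :
    ∃ c : ℝ → Z, ContinuousOn c (Icc 0 1) ∧ InjOn c (Icc 0 1) ∧ c 0 = p 0 ∧ c 1 = p 1 ∧
      c '' Icc 0 1 ⊆ p '' Icc 0 1 := by
  set S : Set (Set ℝ) := {K | IsClosed K ∧ K ⊆ Icc 0 1 ∧ 0 ∈ K ∧ 1 ∈ K ∧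
    ∀ a ∈ K, ∀ b ∈ K, a < b → Disjoint (Ioo a b) K → p a = p b} with hS
  obtain ⟨K, hKmin⟩ : ∃ K, Minimal (· ∈ S) K := by
    refine zorn_superset S ?_
    intro C hC hchain
    rcases C.eq_empty_or_nonempty with rfl | hCne
    · refine ⟨Icc 0 1, ⟨isClosed_Icc, Subset.rfl, by simp, by simp, ?_⟩, by simp⟩
      intro a ha b hb hab hd
      exact absurd (show (a + b) / 2 ∈ Icc (0:ℝ) 1 from ⟨by linarith [ha.1, hb.1], by linarith [ha.2, hb.2]⟩)
        (disjoint_left.1 hd ⟨by linarith, by linarith⟩)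
    · obtain ⟨K0, hK0⟩ := hCne
      refine ⟨⋂₀ C, ⟨isClosed_sInter fun K hK => (hC hK).1, (sInter_subset_of_mem hK0).trans (hC hK0).2.1,
        fun K hK => (hC hK).2.2.1, fun K hK => (hC hK).2.2.2.1, ?_⟩, fun K hK => sInter_subset_of_mem hK⟩
      intro a ha b hb hab hd
      by_contra hpab
      have hdp : 0 < dist (p a) (p b) := dist_pos.2 hpab
      set d := dist (p a) (p b)
      obtain ⟨δ1, hδ1, h1⟩ := Metric.continuous_iff.1 hp a (d / 2) (by positivity)
      obtain ⟨δ2, hδ2, h2⟩ := Metric.continuous_iff.1 hp b (d / 2) (by positivity)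
      set δ := min (min δ1 δ2) (b - a) / 3 with hδ
      have m0 : 0 < min (min δ1 δ2) (b - a) := lt_min (lt_min hδ1 hδ2) (by linarith)
      have m1 : min (min δ1 δ2) (b - a) ≤ δ1 := (min_le_left _ _).trans (min_le_left _ _)
      have m2 : min (min δ1 δ2) (b - a) ≤ δ2 := (min_le_left _ _).trans (min_le_right _ _)
      have m3 : min (min δ1 δ2) (b - a) ≤ b - a := min_le_right _ _
      have e0 : 0 < δ := by positivity
      -- some member of the chain misses the middle
      obtain ⟨K, hKC, hKd⟩ : ∃ K ∈ C, Disjoint (Icc (a + δ) (b - δ)) K := by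
        by_contra hcon
        push Not at hcon
        have hne2 : (⋂ K : C, Icc (a + δ) (b - δ) ∩ (K : Set ℝ)).Nonempty := by
          haveI : Nonempty C := ⟨⟨K0, hK0⟩⟩
          refine IsCompact.nonempty_iInter_of_directed_nonempty_isCompact_isClosed _ ?_ ?_ ?_ ?_
          · intro K1 K2
            rcases hchain.total K1.2 K2.2 with h | h
            · exact ⟨K1, Subset.rfl, inter_subset_inter_right _ h⟩
            · exact ⟨K2, inter_subset_inter_right _ h, Subset.rfl⟩
          · intro K; exact not_disjoint_iff_nonempty_inter.1 (hcon K K.2)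
          · intro K; exact isCompact_Icc.inter_right (hC K.2).1
          · intro K; exact isClosed_Icc.inter (hC K.2).1
        obtain ⟨x, hx⟩ := hne2
        rw [mem_iInter] at hx
        have hx1 := (hx ⟨K0, hK0⟩).1
        have hxI : x ∈ Ioo a b := ⟨by linarith [hx1.1], by linarith [hx1.2]⟩
        exact disjoint_left.1 hd hxI (fun K hK => (hx ⟨K, hK⟩).2)
      have hKS := hC hKC
      have haK : a ∈ K := ha K hKC
      have hbK : b ∈ K := hb K hKC
      obtain ⟨a', ⟨ha'K, ha'⟩, hamax⟩ := (isCompact_Icc.inter_left hKS.1 : IsCompact (K ∩ Icc a (a + δ))).exists_isGreatest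
        ⟨a, haK, le_rfl, by linarith⟩
      obtain ⟨b', ⟨hb'K, hb'⟩, hbmin⟩ := (isCompact_Icc.inter_left hKS.1 : IsCompact (K ∩ Icc (b - δ) b)).exists_isLeast
        ⟨b, hbK, by linarith, le_rfl⟩
      have hab' : p a' = p b' := by
        refine hKS.2.2.2.2 a' ha'K b' hb'K (by linarith [ha'.2, hb'.1]) ?_
        rw [disjoint_left]
        intro x hx hxK
        rcases le_total x (a + δ) with h | h
        · have := hamax ⟨hxK, by linarith [hx.1, ha'.1], h⟩; linarith [hx.1]
        · rcases le_total x (b - δ) with h' | h'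
          · exact disjoint_left.1 hKd ⟨h, h'⟩ hxK
          · have := hbmin ⟨hxK, h', by linarith [hx.2, hb'.2]⟩; linarith [hx.2]
      have d1 := h1 a' (by rw [Real.dist_eq, abs_of_nonneg (by linarith [ha'.1])]; linarith [ha'.2])
      have d2 := h2 b' (by rw [Real.dist_eq, abs_of_nonpos (by linarith [hb'.2])]; linarith [hb'.1])
      rw [hab', dist_comm] at d1
      have := dist_triangle (p a) (p b') (p b)
      linarith
  obtain ⟨hKcl, hKI, h0K, h1K, hgap⟩ := hKmin.prop
  have hKc : IsCompact K := isCompact_Icc.of_isClosed_subset hKcl hKI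
  have hsep : ∀ s ∈ K, ∀ t ∈ K, s < t → p s = p t → Disjoint (Ioo s t) K := by
    intro s hs t ht hst hpst
    have hK' : K \ Ioo s t ∈ S := by
      refine ⟨hKcl.sdiff isOpen_Ioo, diff_subset.trans hKI, ⟨h0K, fun h => ?_⟩, ⟨h1K, fun h => ?_⟩, ?_⟩
      · linarith [h.1, (hKI hs).1]
      · linarith [h.2, (hKI ht).2]
      · rintro a ⟨ha, ha'⟩ b ⟨hb, hb'⟩ hab hd
        by_cases hdK : Disjoint (Ioo a b) K
        · exact hgap a ha b hb hab hdK
        · rw [not_disjoint_iff] at hdK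
          obtain ⟨r, hr, hrK⟩ := hdK
          have hrs : r ∈ Ioo s t := by
            by_contra h; exact disjoint_left.1 hd hr ⟨hrK, h⟩
          have has : a ≤ s := by
            by_contra h; exact ha' ⟨by linarith, by linarith [hr.1, hrs.2]⟩
          have hbt : t ≤ b := by
            by_contra h; exact hb' ⟨by linarith [hr.2, hrs.1], by linarith⟩
          have has' : a = s := by
            by_contra h
            exact disjoint_left.1 hd (show s ∈ Ioo a b from ⟨lt_of_le_of_ne has h, by linarith⟩) ⟨hs, fun h => lt_irrefl _ h.1⟩
          have hbt' : b = t := by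
            by_contra h
            exact disjoint_left.1 hd (show t ∈ Ioo a b from ⟨by linarith, lt_of_le_of_ne hbt (Ne.symm h)⟩) ⟨ht, fun h => lt_irrefl _ h.2⟩
          rw [has', hbt', hpst]
    have := hKmin.le_of_le hK' diff_subset
    rw [disjoint_left]; intro x hx hxK; exact (this hxK).2 hx
  set g : ℕ → ℝ → ℝ := fun j r => max 0 (1 - dist (p r) (p (TopologicalSpace.denseSeq ℝ j))) with hg
  have hgc : ∀ j, Continuous (g j) := fun j => by simp only [hg]; fun_prop
  have hg0 : ∀ j r, 0 ≤ g j r := fun j r => le_max_left _ _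
  have hg1 : ∀ j r, g j r ≤ 1 := fun j r => max_le zero_le_one (by linarith [dist_nonneg (x := p r) (y := p (TopologicalSpace.denseSeq ℝ j))])
  set h : ℝ → ℝ := fun t => ∑' j, (1/2:ℝ) ^ j * rmax K (g j) t with hh
  have hr0 : ∀ j, ∀ t ∈ K, 0 ≤ rmax K (g j) t := fun j t ht => (hg0 j t).trans (le_rmax hKc (hgc j) ht le_rfl)
  have hr1 : ∀ j, ∀ t ∈ K, rmax K (g j) t ≤ 1 := fun j t ht => rmax_le ht fun r _ _ => hg1 j r
  have hsumm : Summable (fun j : ℕ => (1/2:ℝ) ^ j) := summable_geometric_of_lt_one (by norm_num) (by norm_num)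
  have hsum : ∀ t ∈ K, Summable (fun j => (1/2:ℝ) ^ j * rmax K (g j) t) := by
    intro t ht
    refine Summable.of_nonneg_of_le (fun j => mul_nonneg (by positivity) (hr0 j t ht)) (fun j => ?_) hsumm
    exact mul_le_of_le_one_right (by positivity) (hr1 j t ht)
  have hhc : ContinuousOn h K := by
    refine continuousOn_tsum (u := fun j => (1/2:ℝ) ^ j) (fun j => continuousOn_const.mul (rmax_cont hKc (hgc j))) hsumm ?_
    intro j t ht
    rw [Real.norm_eq_abs, abs_of_nonneg (mul_nonneg (by positivity) (hr0 j t ht))]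
    exact mul_le_of_le_one_right (by positivity) (hr1 j t ht)
  have heq : ∀ s ∈ K, ∀ t ∈ K, s < t → p s = p t → h s = h t := by
    intro s hs t ht hst e
    have hd := hsep s hs t ht hst e
    simp only [hh]
    congr 1; ext j; congr 1
    refine le_antisymm (rmax_mono hKc (hgc j) hs hst.le) (rmax_le ht fun r hr hrt => ?_)
    rcases le_or_gt r s with h1 | h1
    · exact le_rmax hKc (hgc j) hr h1
    · rcases hrt.lt_or_eq with h2 | h2
      · exact absurd hr (disjoint_left.1 hd ⟨h1, h2⟩)
      · have : g j r = g j s := by simp only [hg]; rw [h2, e]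
        rw [this]; exact le_rmax hKc (hgc j) hs le_rfl
  have hlt : ∀ s ∈ K, ∀ t ∈ K, s < t → p s ≠ p t → h s < h t := by
    intro s hs t ht hst e
    have hnot : p t ∉ p '' (K ∩ Iic s) := by
      rintro ⟨r, ⟨hr, hrs⟩, hrt⟩
      have hrs' : r ≤ s := hrs
      have hd := hsep r hr t ht (by linarith) hrt
      rcases hrs'.lt_or_eq with h1 | h1
      · exact disjoint_left.1 hd ⟨h1, hst⟩ hs
      · exact e (h1 ▸ hrt)
    have hcc : IsCompact (p '' (K ∩ Iic s)) := (hKc.inter_right isClosed_Iic).image hp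
    have hpos : 0 < infDist (p t) (p '' (K ∩ Iic s)) :=
      (hcc.isClosed.notMem_iff_infDist_pos ⟨p s, s, ⟨hs, le_refl s⟩, rfl⟩).1 hnot
    set d := infDist (p t) (p '' (K ∩ Iic s))
    obtain ⟨δ, hδ, hδ'⟩ := Metric.continuous_iff.1 hp t (min 1 (d / 2)) (by positivity)
    obtain ⟨j, hj⟩ := (TopologicalSpace.denseRange_denseSeq ℝ).exists_mem_open isOpen_ball ⟨t, mem_ball_self hδ⟩
    have hjd := hδ' _ hj
    have hj1 := hjd.trans_le (min_le_left _ _)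
    have hj2 := hjd.trans_le (min_le_right _ _)
    rw [dist_comm] at hj1 hj2
    simp only [hh]
    refine Summable.tsum_lt_tsum (i := j) (fun i => ?_) ?_ (hsum s hs) (hsum t ht)
    · exact mul_le_mul_of_nonneg_left (rmax_mono hKc (hgc i) hs hst.le) (by positivity)
    · refine mul_lt_mul_of_pos_left ?_ (by positivity)
      have h1 : g j t ≤ rmax K (g j) t := le_rmax hKc (hgc j) ht le_rfl
      have h2 : rmax K (g j) s ≤ max 0 (1 - d / 2) := by
        refine rmax_le hs fun r hr hrs => ?_
        refine max_le_max le_rfl ?_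
        have h3 : d ≤ dist (p t) (p r) := infDist_le_dist_of_mem ⟨r, ⟨hr, hrs⟩, rfl⟩
        have h4 := dist_triangle_right (p t) (p r) (p (TopologicalSpace.denseSeq ℝ j))
        linarith
      have h3 : max 0 (1 - d / 2) < g j t := by
        refine lt_of_lt_of_le ?_ (le_max_right _ _)
        exact max_lt (by linarith) (by linarith)
      linarith
  have hle : ∀ s ∈ K, ∀ t ∈ K, s ≤ t → h s ≤ h t := by
    intro s hs t ht hst
    rcases hst.lt_or_eq with h1 | h1
    · by_cases e : p s = p t
      · exact (heq s hs t ht h1 e).le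
      · exact (hlt s hs t ht h1 e).le
    · rw [h1]
  have hiff : ∀ s ∈ K, ∀ t ∈ K, (h s = h t ↔ p s = p t) := by
    have aux : ∀ s ∈ K, ∀ t ∈ K, s ≤ t → (h s = h t ↔ p s = p t) := by
      intro s hs t ht hst
      rcases hst.lt_or_eq with h1 | h1
      · exact ⟨fun e => by by_contra hc; exact (hlt s hs t ht h1 hc).ne e, heq s hs t ht h1⟩
      · rw [h1]; simp
    intro s hs t ht
    rcases le_total s t with h1 | h1
    · exact aux s hs t ht h1
    · rw [eq_comm, aux t ht s hs h1, eq_comm]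
  have h01 : h 0 < h 1 := hlt 0 h0K 1 h1K zero_lt_one hne
  have himg : h '' K = Icc (h 0) (h 1) := by
    apply Subset.antisymm
    · rintro _ ⟨t, ht, rfl⟩
      exact ⟨hle 0 h0K t ht (hKI ht).1, hle t ht 1 h1K (hKI ht).2⟩
    · intro y hy
      have hc1 : IsCompact (K ∩ h ⁻¹' Iic y) := by
        obtain ⟨u, hu, e⟩ := continuousOn_iff_isClosed.1 hhc (Iic y) isClosed_Iic
        rw [inter_comm, e]; exact hKc.inter_left hu
      have hc2 : IsCompact (K ∩ h ⁻¹' Ici y) := by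
        obtain ⟨u, hu, e⟩ := continuousOn_iff_isClosed.1 hhc (Ici y) isClosed_Ici
        rw [inter_comm, e]; exact hKc.inter_left hu
      obtain ⟨a, ⟨haK, hay⟩, hamax⟩ := hc1.exists_isGreatest ⟨0, h0K, hy.1⟩
      have hay' : h a ≤ y := hay
      rcases hay'.lt_or_eq with hlt' | heq'
      · have hc3 : IsCompact ((K ∩ h ⁻¹' Ici y) ∩ Ici a) := hc2.inter_right isClosed_Ici
        obtain ⟨b, ⟨⟨hbK, hby⟩, hab⟩, hbmin⟩ := hc3.exists_isLeast ⟨1, ⟨h1K, hy.2⟩, (hKI haK).2⟩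
        have hby' : y ≤ h b := hby
        have hab' : a ≤ b := hab
        have hab2 : a < b := lt_of_le_of_ne hab' (fun e => by rw [← e] at hby'; linarith)
        have hd : Disjoint (Ioo a b) K := by
          rw [disjoint_left]; intro r hr hrK
          rcases le_total (h r) y with h1 | h1
          · have := hamax ⟨hrK, h1⟩; linarith [hr.1]
          · have := hbmin ⟨⟨hrK, h1⟩, hr.1.le⟩; linarith [hr.2]
        have := heq a haK b hbK hab2 (hgap a haK b hbK hab2 hd)
        linarith
      · exact ⟨a, haK, heq'⟩
  haveI : Nonempty Z := ⟨p 0⟩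
  obtain ⟨u, hu, huv⟩ := descend_quot hKc hhc hp.continuousOn (fun s hs t ht e => (hiff s hs t ht).1 e)
  rw [himg] at hu
  have hui : InjOn u (Icc (h 0) (h 1)) := by
    rw [← himg]
    rintro _ ⟨s, hs, rfl⟩ _ ⟨t, ht, rfl⟩ e
    rw [huv s hs, huv t ht] at e
    exact (hiff s hs t ht).2 e
  set A : ℝ → ℝ := fun t => h 0 + t * (h 1 - h 0) with hA
  have hAm : MapsTo A (Icc 0 1) (Icc (h 0) (h 1)) := by
    intro t ht
    simp only [hA]
    exact ⟨by nlinarith [ht.1], by nlinarith [ht.2]⟩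
  refine ⟨u ∘ A, hu.comp (by simp only [hA]; fun_prop) hAm, hui.comp ?_ hAm, ?_, ?_, ?_⟩
  · intro s _ t _ e
    simp only [hA] at e
    have : s * (h 1 - h 0) = t * (h 1 - h 0) := by linarith
    exact mul_right_cancel₀ (by linarith) this
  · simp [hA, huv 0 h0K]
  · simp [hA, huv 1 h1K]
  · rintro _ ⟨t, ht, rfl⟩
    have := hAm ht
    rw [← himg] at this
    obtain ⟨s, hs, e⟩ := this
    exact ⟨s, hKI hs, by simp only [Function.comp]; rw [← e, huv s hs]⟩

end BKE

namespace BKE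
open Set Filter Topology Metric
open scoped unitInterval ComplexConjugate

/-! ### Periodic maps of the plane have a unique fixed point -/

/-- Orientation-preserving, expressed by logarithms of difference quotients. -/
def Ori (H : ℂ → ℂ) : Prop := ∀ b, HasLog (fun z => (H z - H b) / (z - b)) {b}ᶜ

theorem ori_id : Ori id := fun b =>
  (hasLog_const one_ne_zero _).congr fun z hz => div_self (sub_ne_zero.2 hz)

theorem Ori.comp {H G : ℂ → ℂ} (hH : Ori H) (hG : Ori G) (hc : Continuous G)
    (hi : Function.Injective G) : Ori (H ∘ G) := fun b => by
  have h1 := (hH (G b)).comp (f := G) (T := {b}ᶜ) hc.continuousOn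
    (fun z hz h => hz (hi h))
  refine (h1.mul (hG b)).congr fun z hz => ?_
  have h2 : G z - G b ≠ 0 := sub_ne_zero.2 fun h => hz (hi h)
  have h3 : z - b ≠ 0 := sub_ne_zero.2 hz
  simp only [Function.comp]
  field_simp

theorem Ori.iterate {H : ℂ → ℂ} (hH : Ori H) (hc : Continuous H)
    (hi : Function.Injective H) (n : ℕ) : Ori (H^[n]) := by
  induction n with
  | zero => exact ori_id
  | succ k ih => rw [Function.iterate_succ]; exact ih.comp hH hc hi

theorem inj_of_period {X : Type*} {T : X → X} {p : ℕ} (hp : 1 ≤ p) (h : T^[p] = id) :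
    Function.Injective T := by
  intro x y e
  have h1 : ∀ z, T^[p-1] (T z) = z := fun z => by
    rw [← Function.iterate_succ_apply, Nat.succ_eq_add_one, Nat.sub_add_cancel hp, h]; rfl
  rw [← h1 x, ← h1 y, e]

theorem equiv_curve {X : Type*} [TopologicalSpace X] {T : X → X} (hT : Continuous T) {p : ℕ}
    (hp : 1 ≤ p) (hTp : T^[p] = id) {α : ℝ → X} (hα : ContinuousOn α (Icc 0 1))
    (h1 : α 1 = T (α 0))
    (hinj : ∀ u ∈ Ico (0:ℝ) 1, ∀ v ∈ Ico (0:ℝ) 1, ∀ k < p, α u = T^[k] (α v) → u = v ∧ k = 0) :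
    ∃ c : ℝ → X, IsJordan c ∧ (∀ t, T (c t) = c (t + 1 / p)) := by
  have hr : ∀ z, T^[p-1] (T z) = z := fun z => by
    rw [← Function.iterate_succ_apply, Nat.succ_eq_add_one, Nat.sub_add_cancel hp, hTp]; rfl
  have hl : ∀ z, T (T^[p-1] z) = z := fun z => by
    rw [← Function.iterate_succ_apply' T, Nat.succ_eq_add_one, Nat.sub_add_cancel hp, hTp]; rfl
  let e : Equiv.Perm X := ⟨T, T^[p-1], hr, hl⟩
  have hek : ∀ (k : ℕ) x, (e ^ k) x = T^[k] x := fun k x => by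
    rw [← Equiv.Perm.iterate_eq_pow]; rfl
  have hep : e ^ p = 1 := by
    ext x; rw [hek, hTp]; rfl
  have hp0 : (0:ℤ) < p := by exact_mod_cast hp
  have hez : ∀ n : ℤ, ∃ k : ℕ, k < p ∧ (∃ j : ℤ, n = k + p * j) ∧ ∀ x, (e ^ n) x = T^[k] x := by
    intro n
    have hk0 := Int.emod_nonneg n hp0.ne'
    have hk1 := Int.emod_lt_of_pos n hp0
    obtain ⟨k, hk⟩ := Int.eq_ofNat_of_zero_le hk0
    have hn : n = k + p * (n / p) := by rw [← hk]; exact (Int.emod_add_mul_ediv n p).symm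
    refine ⟨k, by omega, ⟨_, hn⟩, fun x => ?_⟩
    rw [hn, zpow_add, zpow_mul, zpow_natCast, zpow_natCast, hep, one_zpow, mul_one, hek]
  have hec : ∀ n : ℤ, Continuous (e ^ n : Equiv.Perm X) := by
    intro n
    obtain ⟨k, -, -, h⟩ := hez n
    have : ((e ^ n : Equiv.Perm X) : X → X) = T^[k] := funext h
    rw [this]; exact hT.iterate k
  let β : ℝ → X := fun τ => (e ^ ⌊τ⌋) (α (Int.fract τ))
  have hβn : ∀ (n : ℤ) (τ : ℝ), τ ∈ Icc (n:ℝ) (n+1) → β τ = (e ^ n) (α (τ - n)) := by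
    intro n τ hτ
    rcases hτ.2.lt_or_eq with h | h
    · have : ⌊τ⌋ = n := Int.floor_eq_iff.2 ⟨hτ.1, h⟩
      simp only [β, Int.fract, this]
    · have h2 : τ = ((n + 1 : ℤ) : ℝ) := by rw [h]; push_cast; rfl
      simp only [β]
      rw [h2, Int.floor_intCast, Int.fract_intCast, zpow_add, zpow_one, Equiv.Perm.mul_apply]
      push_cast
      rw [add_sub_cancel_left, h1]; rfl
  have hβc0 : ∀ n : ℤ, ContinuousOn β (Icc (n:ℝ) (n+1)) := by
    intro n
    refine ContinuousOn.congr (f := fun τ => (e ^ n) (α (τ - n))) ?_ (hβn n)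
    refine (hec n).comp_continuousOn (hα.comp (by fun_prop) ?_)
    intro τ hτ
    exact ⟨by linarith [hτ.1], by linarith [hτ.2]⟩
  have hβc : Continuous β := by
    rw [continuous_iff_continuousAt]
    intro τ
    have h2 := (hβc0 (⌊τ⌋ - 1)).union_of_isClosed (hβc0 ⌊τ⌋) isClosed_Icc isClosed_Icc
    have h3 := Int.floor_le τ
    have h4 := Int.lt_floor_add_one τ
    refine h2.continuousAt ?_
    refine mem_of_superset (Ioo_mem_nhds (a := (⌊τ⌋:ℝ) - 1) (b := ⌊τ⌋ + 1) (by linarith) h4) ?_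
    intro x hx
    rcases le_total x ⌊τ⌋ with h | h
    · left; push_cast; exact ⟨hx.1.le, by linarith⟩
    · right; exact ⟨h, hx.2.le⟩
  have hβadd : ∀ (n : ℤ) τ, β (τ + n) = (e ^ n) (β τ) := by
    intro n τ
    simp only [β]
    rw [Int.floor_add_intCast, Int.fract_add_intCast, add_comm, zpow_add, Equiv.Perm.mul_apply]
  have hpr : (p:ℝ) ≠ 0 := by positivity
  refine ⟨fun t => β (p * t), ⟨by fun_prop, fun t => ?_, fun s t hst => ?_⟩, fun t => ?_⟩
  · try dsimp only
    have := hβadd p (p * t)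
    rw [zpow_natCast, hep] at this
    rw [mul_add, mul_one]
    simpa using this
  · have hst' : (e ^ ⌊(p:ℝ) * s⌋) (α (Int.fract ((p:ℝ) * s)))
      = (e ^ ⌊(p:ℝ) * t⌋) (α (Int.fract ((p:ℝ) * t))) := hst
    obtain ⟨k, hk, ⟨j, hj⟩, hk2⟩ := hez (⌊(p:ℝ) * t⌋ - ⌊(p:ℝ) * s⌋)
    have h2 : α (Int.fract ((p:ℝ) * s)) = T^[k] (α (Int.fract ((p:ℝ) * t))) := by
      rw [← hk2, sub_eq_neg_add, zpow_add, Equiv.Perm.mul_apply, ← hst', ← Equiv.Perm.mul_apply,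
        ← zpow_add]
      simp
    obtain ⟨h3, h4⟩ := hinj _ ⟨Int.fract_nonneg _, Int.fract_lt_one _⟩ _
      ⟨Int.fract_nonneg _, Int.fract_lt_one _⟩ k hk h2
    refine ⟨-j, ?_⟩
    have h5 : ((⌊(p:ℝ) * t⌋ : ℝ) - ⌊(p:ℝ) * s⌋) = p * j := by
      rw [h4] at hj; push_cast at hj; rw [zero_add] at hj; exact_mod_cast hj
    have h6 := Int.floor_add_fract ((p:ℝ) * s)
    have h7 := Int.floor_add_fract ((p:ℝ) * t)
    push_cast
    apply mul_left_cancel₀ hpr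
    linarith
  · dsimp only
    have := hβadd 1 (p * t)
    rw [zpow_one] at this
    rw [mul_add, mul_one_div_cancel hpr]
    push_cast at this
    exact this.symm

theorem wind_chord {c : ℝ → ℂ} (hc : IsJordan c) {δ : ℝ} (h0 : 0 < δ) (h1 : δ < 1) :
    ∃ k : ℤ, Wind (fun t => c (t + δ) - c t) (2 * k + 1) := by
  let S : Set (ℝ × ℝ) := {q | q.1 < q.2 ∧ q.2 < q.1 + 1}
  have hS : Convex ℝ S := by
    rintro ⟨a, b⟩ ⟨hx1, hx2⟩ ⟨a', b'⟩ ⟨hy1, hy2⟩ r s hr hs hrs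
    simp only at hx1 hx2 hy1 hy2
    simp only [S, mem_setOf_eq, Prod.fst_add, Prod.snd_add, Prod.smul_fst, Prod.smul_snd, smul_eq_mul]
    have hs' : s = 1 - r := by linarith
    subst hs'
    rcases hr.eq_or_lt with h | h
    · subst h; constructor <;> linarith
    · constructor <;> nlinarith
  have hcc := hc.cont
  obtain ⟨L, hL, eL⟩ := hasLog_convex (g := fun q : ℝ × ℝ => c q.2 - c q.1) hS
    (by fun_prop) (by
      rintro ⟨a, b⟩ ⟨hx1, hx2⟩ h
      simp only at hx1 hx2
      obtain ⟨k, hk⟩ := hc.inj _ _ (sub_eq_zero.1 h)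
      simp only at hk
      have h2 : (0:ℝ) < k := by linarith
      have h3 : (k:ℝ) < 1 := by linarith
      have h2' : 0 < k := by exact_mod_cast h2
      have h3' : k < 1 := by exact_mod_cast h3
      omega)
  have hmap : ∀ q ∈ S, ((q.2, q.1 + 1) : ℝ × ℝ) ∈ S := by
    rintro ⟨a, b⟩ ⟨hx1, hx2⟩
    exact ⟨hx2, by simpa using hx1⟩
  obtain ⟨m, hm⟩ := log_diff_const (S := S) hS.isPreconnected
    (u := fun q => L (q.2, q.1 + 1)) (v := fun q => L q + Real.pi * Complex.I)
    (hL.comp (by fun_prop) hmap) (hL.add continuousOn_const) (by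
      intro q hq
      try dsimp only
      rw [Complex.exp_add, ← eL _ hq, ← eL _ (hmap q hq), Complex.exp_pi_mul_I]
      simp only [hc.per]; ring)
  refine ⟨m, fun t => L (t, t + δ), ?_, fun t => ?_, fun t => ?_⟩
  · exact hL.comp_continuous (by fun_prop) fun t => ⟨by simpa using h0, by simpa using h1⟩
  · exact eL (t, t + δ) ⟨by simpa using h0, by simpa using h1⟩
  · have hq : ((t, t + δ) : ℝ × ℝ) ∈ S := ⟨by simpa using h0, by simpa using h1⟩
    have e1 := hm _ hq
    have e2 := hm _ (hmap _ hq)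
    dsimp only at e1 e2 ⊢
    rw [show t + 1 + δ = t + δ + 1 by ring, e2, e1]
    push_cast; ring

/-- iterated multiplicative cocycle -/
theorem iter_cocycle {T : ℂ → ℂ} {b : ℂ} (hb : T b = b) (hi : Function.Injective T) {u : ℂ → ℂ}
    (hu : ∀ z ∈ ({b}ᶜ : Set ℂ), (T z - T b) / (z - b) = Complex.exp (u z)) (k : ℕ) {z : ℂ}
    (hz : z ≠ b) : T^[k] z ≠ b ∧
      T^[k] z - b = (z - b) * Complex.exp (∑ i ∈ Finset.range k, u (T^[i] z)) := by
  induction k with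
  | zero => simp [hz]
  | succ k ih =>
    rw [Function.iterate_succ_apply']
    refine ⟨fun h => ih.1 (hi (h.trans hb.symm)), ?_⟩
    have h1 := hu _ ih.1
    rw [hb, div_eq_iff (sub_ne_zero.2 ih.1)] at h1
    rw [h1, ih.2, Finset.sum_range_succ, Complex.exp_add]; ring

theorem exists_cocycle {T : ℂ → ℂ} (hT : Continuous T) {p : ℕ} (hp : 1 ≤ p) (hTp : T^[p] = id)
    (hori : Ori T) {b c0 : ℂ} (hb : T b = b) (hc0 : T c0 = c0) (hne : c0 ≠ b) :
    ∃ u : ℂ → ℂ, ContinuousOn u {b}ᶜ ∧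
      (∀ z ∈ ({b}ᶜ : Set ℂ), (T z - T b) / (z - b) = Complex.exp (u z)) ∧
      ∀ z ∈ ({b}ᶜ : Set ℂ), ∑ i ∈ Finset.range p, u (T^[i] z) = 0 := by
  have hi := inj_of_period hp hTp
  obtain ⟨u0, hu0, e0⟩ := hori b
  have h1 : Complex.exp (u0 c0) = 1 := by
    rw [← e0 c0 hne]; dsimp only; rw [hc0, hb, div_self (sub_ne_zero.2 hne)]
  have e : ∀ z ∈ ({b}ᶜ : Set ℂ), (T z - T b) / (z - b) = Complex.exp (u0 z - u0 c0) := by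
    intro z hz
    rw [Complex.exp_sub, h1, div_one]; exact e0 z hz
  refine ⟨fun z => u0 z - u0 c0, hu0.sub continuousOn_const, e, ?_⟩
  have hcont : ContinuousOn (fun z => ∑ i ∈ Finset.range p, (u0 (T^[i] z) - u0 c0)) {b}ᶜ := by
    refine continuousOn_finsetSum _ fun i _ => ?_
    refine (hu0.comp (hT.iterate i).continuousOn ?_).sub continuousOn_const
    intro z hz
    exact (iter_cocycle hb hi e i hz).1
  have hpre : IsPreconnected ({b}ᶜ : Set ℂ) :=
    (isConnected_compl_singleton_of_one_lt_rank (by simp) _).isPreconnected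
  obtain ⟨m, hm⟩ := log_diff_const hpre hcont (continuousOn_const (c := (0:ℂ))) (by
    intro z hz
    have h2 := (iter_cocycle hb hi e p hz).2
    rw [hTp, id] at h2
    have h3 : z - b ≠ 0 := sub_ne_zero.2 hz
    rw [Complex.exp_zero]
    exact (mul_left_cancel₀ h3 (by rw [mul_one]; exact h2)).symm)
  have h4 := hm c0 hne
  have hfix : ∀ i, T^[i] c0 = c0 := fun i => Function.iterate_fixed hc0 i
  simp only [hfix, sub_self, Finset.sum_const_zero] at h4
  intro z hz
  rw [hm z hz, ← h4]

theorem curve_exists_fixed {T : ℂ → ℂ} (hT : Continuous T) {p : ℕ} (hp : 2 ≤ p)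
    {c : ℝ → ℂ} (hc : IsJordan c) (hTc : ∀ t, T (c t) = c (t + 1 / p)) :
    ∃ b ∈ inside c, T b = b := by
  have hp' : (2:ℝ) ≤ p := by exact_mod_cast hp
  have hd0 : (0:ℝ) < 1 / p := by positivity
  have hd1 : (1:ℝ) / p < 1 := by rw [div_lt_one (by linarith)]; linarith
  obtain ⟨k, hk⟩ := wind_chord hc hd0 hd1
  have hfix : ∃ b ∈ closure (inside c), T b = b := by
    by_contra hcon
    push Not at hcon
    have h1 := hc.hasLog_closure (g := fun z => T z - z) (by fun_prop)
      (fun z hz => sub_ne_zero.2 (hcon z hz))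
    have h2 := wind_of_hasLog h1 hc.cont hc.per
      (fun t => hc.subset_closure_inside (mem_range_self t))
    have h3 := h2.unique (hk.congr fun t => by rw [hTc])
    omega
  obtain ⟨b, hb, hTb⟩ := hfix
  refine ⟨b, ?_, hTb⟩
  rcases hc.closure_inside_subset hb with h | ⟨t, rfl⟩
  · exact h
  · exact absurd (by rw [← hTc, hTb, sub_self]) (hk.ne_zero t)

theorem curve_fixed {T : ℂ → ℂ} (hT : Continuous T) {p : ℕ} (hp : 2 ≤ p) (hTp : T^[p] = id)
    (hori : Ori T) {c : ℝ → ℂ} (hc : IsJordan c) (hTc : ∀ t, T (c t) = c (t + 1 / p)) :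
    ∃ b, T b = b ∧ ∀ z, T z = z → z = b := by
  have hp' : (2:ℝ) ≤ p := by exact_mod_cast hp
  have hi := inj_of_period (by omega) hTp
  obtain ⟨b, hbi, hTb⟩ := curve_exists_fixed hT hp hc hTc
  refine ⟨b, hTb, fun c0 hc0 => ?_⟩
  by_contra hne
  obtain ⟨u, hu, eu, hsum⟩ := exists_cocycle hT (by omega) hTp hori hTb hc0 hne
  obtain ⟨-, w, hw, hww⟩ := hc.wind_inside
  obtain ⟨l, hl, el, pl⟩ := hww b hbi
  have hcb : ∀ t, c t ≠ b := fun t h => hbi.1 ⟨t, h⟩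
  have hcc := hc.cont
  obtain ⟨m, hm⟩ := log_diff_const' (u := fun t => l (t + 1 / p)) (v := fun t => l t + u (c t))
    (by fun_prop) (hl.add (hu.comp_continuous hcc hcb)) (by
      intro t
      try dsimp only
      have h1 := eu _ (hcb t)
      rw [hTb, div_eq_iff (sub_ne_zero.2 (hcb t))] at h1
      rw [Complex.exp_add, ← el, ← el]; dsimp only; rw [← hTc, h1, mul_comm])
  have hit : ∀ (k : ℕ) t, c (t + k / p) = T^[k] (c t) := by
    intro k
    induction k with
    | zero => intro t; simp
    | succ k ih => intro t; rw [Function.iterate_succ_apply', ← ih, hTc]; congr 1; push_cast; ring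
  have hitl : ∀ (k : ℕ) t, l (t + k / p) = l t + ∑ i ∈ Finset.range k, u (T^[i] (c t))
      + k * (m * (2 * Real.pi * Complex.I)) := by
    intro k
    induction k with
    | zero => intro t; simp
    | succ k ih =>
      intro t
      have := hm (t + k / p)
      try dsimp only at this
      rw [show t + (k:ℝ) / p + 1 / p = t + ((k + 1 : ℕ) : ℝ) / p by push_cast; ring] at this
      rw [this, ih, Finset.sum_range_succ, hit]; push_cast; ring
  have h1 := hitl p 0
  rw [div_self (by linarith), pl, hsum _ (hcb 0)] at h1
  have h2 : ((w:ℂ) - p * m) * (2 * Real.pi * Complex.I) = 0 := by linear_combination h1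
  rcases mul_eq_zero.1 h2 with h | h
  · have h3 : w = p * m := by exact_mod_cast sub_eq_zero.1 h
    have h4 : (p:ℤ) ∣ 1 := by
      rcases hw with hw | hw
      · exact ⟨m, by rw [← h3, hw]⟩
      · exact ⟨-m, by rw [mul_neg, ← h3, hw]; rfl⟩
    have h5 := Int.le_of_dvd one_pos h4
    omega
  · exact two_pi_I_ne h

theorem fix_iterate {X : Type*} {H : X → X} {p : ℕ} (hp : p.Prime) (hHp : H^[p] = id) {i : ℕ}
    (hi : ¬ p ∣ i) {x : X} (hx : H^[i] x = x) : H x = x := by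
  have h1 : Function.IsPeriodicPt H i x := hx
  have h2 : Function.IsPeriodicPt H p x := by
    show H^[p] x = x
    rw [hHp]; rfl
  have h3 := h1.gcd h2
  have h4 : i.gcd p = 1 := Nat.Coprime.symm ((Nat.Prime.coprime_iff_not_dvd hp).2 hi)
  rw [h4] at h3
  exact h3

theorem joined_curve {H : ℂ → ℂ} (hH : Continuous H) {p : ℕ} (hp : p.Prime) (hHp : H^[p] = id)
    {x : ℂ} (hx : H x ≠ x) (hj : JoinedIn {z | H z = z}ᶜ x (H x)) :
    ∃ i, ¬ p ∣ i ∧ (H^[i])^[p] = id ∧ ∃ c : ℝ → ℂ, IsJordan c ∧ ∀ t, H^[i] (c t) = c (t + 1 / p) := by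
  have hinj := inj_of_period hp.one_le hHp
  obtain ⟨γ, hγ⟩ := hj
  obtain ⟨a0, ha0, ha0i, ha00, ha01, ha0s⟩ := arc_lemma (p := γ.extend) γ.continuous_extend
    (by simpa using hx.symm)
  rw [Path.extend_zero] at ha00
  rw [Path.extend_one] at ha01
  have hfree0 : ∀ t ∈ Icc (0:ℝ) 1, H (a0 t) ≠ a0 t := by
    intro t ht
    obtain ⟨s, hs, e⟩ := ha0s ⟨t, ht, rfl⟩
    rw [← e, Path.extend_apply γ hs]
    exact hγ _
  let a : ℝ → ℂ := fun t => a0 (max 0 (min 1 t))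
  have hclamp : ∀ t : ℝ, max 0 (min 1 t) ∈ Icc (0:ℝ) 1 := fun t =>
    ⟨le_max_left _ _, max_le zero_le_one (min_le_left _ _)⟩
  have hac : Continuous a := ha0.comp_continuous (by fun_prop) hclamp
  have haa : ∀ t ∈ Icc (0:ℝ) 1, a t = a0 t := fun t ht => by
    simp only [a]; rw [min_eq_right ht.2, max_eq_right ht.1]
  have hai : InjOn a (Icc 0 1) := fun s hs t ht e => by
    rw [haa s hs, haa t ht] at e; exact ha0i hs ht e
  have hfree : ∀ t, H (a t) ≠ a t := fun t => hfree0 _ (hclamp t)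
  have ha0' : a 0 = x := by rw [haa 0 (by simp), ha00]
  have ha1' : a 1 = H x := by rw [haa 1 (by simp), ha01]
  let K : Set (ℝ × ℝ) := (Icc 0 1 ×ˢ Icc 0 1) ∩
    ⋃ i ∈ Finset.Ioo 0 p, {q | a q.2 = H^[i] (a q.1)}
  have hK : IsCompact K := by
    refine (isCompact_Icc.prod isCompact_Icc).inter_right ?_
    refine Set.Finite.isClosed_biUnion (Finset.finite_toSet _) fun i _ => ?_
    have := hH.iterate i
    exact isClosed_eq (by fun_prop) (by fun_prop)
  have hKm : ∀ s t, (s, t) ∈ K ↔ (s ∈ Icc (0:ℝ) 1 ∧ t ∈ Icc (0:ℝ) 1) ∧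
      ∃ i, (0 < i ∧ i < p) ∧ a t = H^[i] (a s) := by
    intro s t
    simp only [K, mem_inter_iff, mem_prod, mem_iUnion, Finset.mem_Ioo, mem_setOf_eq, exists_prop]
  have hKne : K.Nonempty := ⟨(0, 1), (hKm 0 1).2 ⟨by simp, 1, ⟨one_pos, hp.one_lt⟩, by
    rw [ha0', ha1']; rfl⟩⟩
  obtain ⟨⟨s0, t0⟩, hst0, hmin0⟩ := hK.exists_isMinOn hKne
    (f := fun q : ℝ × ℝ => |q.2 - q.1|) (by fun_prop)
  have hmin1 : ∀ s t, (s, t) ∈ K → |t0 - s0| ≤ |t - s| := fun s t h => hmin0 h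
  have hsym : ∀ s t, (s, t) ∈ K → (t, s) ∈ K := by
    intro s t h
    rw [hKm] at h ⊢
    obtain ⟨⟨h1, h2⟩, i, ⟨h3, h4⟩, h5⟩ := h
    refine ⟨⟨h2, h1⟩, p - i, ⟨by omega, by omega⟩, ?_⟩
    rw [h5, ← Function.iterate_add_apply, Nat.sub_add_cancel h4.le, hHp]; rfl
  have hnd : ∀ i, 0 < i → i < p → ¬ p ∣ i := fun i h1 h2 h3 => by
    have := Nat.le_of_dvd h1 h3; omega
  obtain ⟨s, t, hst, hlt, hmin⟩ : ∃ s t, (s, t) ∈ K ∧ s < t ∧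
      ∀ s' t', (s', t') ∈ K → t - s ≤ |t' - s'| := by
    rcases lt_trichotomy s0 t0 with h | h | h
    · exact ⟨s0, t0, hst0, h, fun s' t' h' => by
        have := hmin1 s' t' h'; rwa [abs_of_pos (by linarith)] at this⟩
    · exfalso
      obtain ⟨-, i, ⟨h3, h4⟩, h5⟩ := (hKm _ _).1 hst0
      rw [h] at h5
      exact hfree t0 (fix_iterate hp hHp (hnd i h3 h4) h5.symm)
    · exact ⟨t0, s0, hsym _ _ hst0, h, fun s' t' h' => by
        have := hmin1 s' t' h'; rw [abs_of_neg (by linarith)] at this; linarith⟩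
  obtain ⟨⟨hs, ht⟩, i, ⟨hi0, hip⟩, hai2⟩ := (hKm _ _).1 hst
  have hTp : (H^[i])^[p] = id := by
    rw [← Function.iterate_mul, mul_comm, Function.iterate_mul, hHp, Function.iterate_id]
  have hmem : ∀ u ∈ Icc (0:ℝ) 1, s + (t - s) * u ∈ Icc (0:ℝ) 1 := by
    intro u hu
    constructor
    · nlinarith [hs.1, hu.1]
    · nlinarith [ht.2, hu.2]
  obtain ⟨c, hc, hTc⟩ := equiv_curve (hH.iterate i) hp.one_le hTp
    (α := fun τ => a (s + (t - s) * τ)) (by fun_prop) (by simpa using hai2) (by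
      intro u hu v hv k hk e
      try dsimp only at e
      have hu' := hmem u ⟨hu.1, hu.2.le⟩
      have hv' := hmem v ⟨hv.1, hv.2.le⟩
      rcases Nat.eq_zero_or_pos k with hk0 | hk0
      · refine ⟨?_, hk0⟩
        rw [hk0] at e
        have := hai hu' hv' e
        have h2 : (t - s) * (u - v) = 0 := by linarith
        rcases mul_eq_zero.1 h2 with h | h <;> linarith
      · exfalso
        rw [← Function.iterate_mul] at e
        have hik : ¬ p ∣ i * k := fun h => by
          rcases (Nat.Prime.dvd_mul hp).1 h with h | h
          · exact hnd i hi0 hip h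
          · exact hnd k hk0 hk h
        have h3 : H^[i * k] = H^[i * k % p] := by
          conv_lhs => rw [← Nat.mod_add_div (i * k) p]
          rw [Function.iterate_add, Function.iterate_mul, hHp, Function.iterate_id]; rfl
        rw [h3] at e
        have h4 : (s + (t - s) * v, s + (t - s) * u) ∈ K := (hKm _ _).2 ⟨⟨hv', hu'⟩, _,
          ⟨Nat.pos_of_ne_zero fun h => hik (Nat.dvd_of_mod_eq_zero h), Nat.mod_lt _ hp.pos⟩, e⟩
        have h5 := hmin _ _ h4
        rw [show s + (t - s) * u - (s + (t - s) * v) = (t - s) * (u - v) by ring, abs_mul,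
          abs_of_pos (by linarith)] at h5
        have h6 : |u - v| < 1 := by
          rw [abs_lt]; constructor <;> linarith [hu.1, hu.2, hv.1, hv.2]
        nlinarith)
  exact ⟨i, hnd i hi0 hip, hTp, c, hc, hTc⟩

theorem claim_joined {H : ℂ → ℂ} (hH : Continuous H) {p : ℕ} (hp : p.Prime) (hHp : H^[p] = id)
    (hori : Ori H) {x : ℂ} (hx : H x ≠ x) (hj : JoinedIn {z | H z = z}ᶜ x (H x)) :
    ∃ b, H b = b ∧ ∀ z, H z = z → z = b := by
  have hinj := inj_of_period hp.one_le hHp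
  obtain ⟨i, hi, hTp, c, hc, hTc⟩ := joined_curve hH hp hHp hx hj
  obtain ⟨b, hb, hbu⟩ := curve_fixed (hH.iterate i) hp.two_le hTp (hori.iterate hH hinj i) hc hTc
  exact ⟨b, fix_iterate hp hHp hi hb, fun z hz => hbu z (Function.iterate_fixed hz i)⟩

theorem prime_fixed {H : ℂ → ℂ} (hH : Continuous H) {p : ℕ} (hp : p.Prime) (hHp : H^[p] = id) :
    ∃ b, H b = b := by
  by_contra hcon
  push Not at hcon
  have hu : ({z | H z = z} : Set ℂ)ᶜ = univ := by
    ext z; simp [hcon z]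
  have hj : JoinedIn ({z | H z = z} : Set ℂ)ᶜ 0 (H 0) := by
    rw [hu, joinedIn_univ]
    exact PathConnectedSpace.joined _ _
  obtain ⟨i, hi, hTp, c, hc, hTc⟩ := joined_curve hH hp hHp (hcon 0) hj
  obtain ⟨b, -, hb⟩ := curve_exists_fixed (hH.iterate i) hp.two_le hc hTc
  exact hcon b (fix_iterate hp hHp hi hb)

theorem claim_not_joined {H : ℂ → ℂ} (hH : Continuous H) {p : ℕ} (hp : p.Prime) (hHp : H^[p] = id)
    (hori : Ori H) {x : ℂ} (hx : H x ≠ x) {b c0 : ℂ} (hb : H b = b) (hc0 : H c0 = c0)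
    (hne : c0 ≠ b) : JoinedIn {z | H z = z}ᶜ x (H x) := by
  classical
  by_contra hj
  have hinj := inj_of_period hp.one_le hHp
  obtain ⟨u, hu, eu, hsum⟩ := exists_cocycle hH hp.one_le hHp hori hb hc0 hne
  have hu0 : ∀ z, H z = z → z ≠ b → u z = 0 := by
    intro z hz hzb
    have := hsum z hzb
    have hfix : ∀ i, H^[i] z = z := fun i => Function.iterate_fixed hz i
    simp only [hfix, Finset.sum_const, Finset.card_range, nsmul_eq_mul] at this
    rcases mul_eq_zero.1 this with h | h
    · exact absurd (by exact_mod_cast h) hp.ne_zero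
    · exact h
  have hFc : IsClosed {z | H z = z} := isClosed_eq hH continuous_id
  set U := connectedComponentIn {z | H z = z}ᶜ x with hU
  have hUo : IsOpen U := hFc.isOpen_compl.connectedComponentIn
  have hxU : x ∈ U := mem_connectedComponentIn hx
  have hfr : ∀ z ∈ frontier U, H z = z := by
    intro z hz
    rw [hUo.frontier_eq] at hz
    rcases closure_component_subset hFc hz.1 with h | h
    · exact absurd h hz.2
    · exact h
  let Ψ : ℂ → ℂ := U.piecewise H id
  let v : ℂ → ℂ := U.piecewise u 0
  have hΨ : Continuous Ψ := by
    rw [← continuousOn_univ]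
    exact ContinuousOn.piecewise (fun z hz => hfr z hz.2) hH.continuousOn continuousOn_id
  have hbU : b ∉ U := fun h => connectedComponentIn_subset _ _ h hb
  have hv : ContinuousOn v {b}ᶜ :=
    ContinuousOn.piecewise (fun z hz => hu0 z (hfr z hz.2) hz.1) (hu.mono inter_subset_left)
      continuousOn_const
  have hΨv : ∀ z ∈ ({b}ᶜ : Set ℂ), Ψ z - b = (z - b) * Complex.exp (v z) := by
    intro z hz
    by_cases h : z ∈ U
    · simp only [Ψ, v, piecewise_eq_of_mem _ _ _ h]
      have := eu z hz
      rw [hb, div_eq_iff (sub_ne_zero.2 hz)] at this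
      rw [this, mul_comm]
    · simp only [Ψ, v, piecewise_eq_of_notMem _ _ _ h]
      simp
  have hmiss : ∀ z, Ψ z ≠ x := by
    intro z h
    by_cases hz : z ∈ U
    · simp only [Ψ, piecewise_eq_of_mem _ _ _ hz] at h
      have h1 := (joinedIn_of_mem_component hFc hx hz).symm.map hH
      rw [h] at h1
      refine hj (h1.mono ?_)
      rintro _ ⟨y, hy, rfl⟩ h2
      exact hy (hinj h2)
    · simp only [Ψ, piecewise_eq_of_notMem _ _ _ hz, id] at h
      rw [h] at hz; exact hz hxU
  obtain ⟨R, hR0, hR⟩ : ∃ R > 0, ∀ z, ‖z - b‖ = R → ‖x - b‖ < ‖Ψ z - b‖ := by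
    have hB : IsCompact (closedBall b ‖x - b‖ ∪ H^[p-1] '' closedBall b ‖x - b‖) :=
      (isCompact_closedBall _ _).union ((isCompact_closedBall _ _).image (hH.iterate _))
    obtain ⟨r, hr⟩ := hB.isBounded.subset_closedBall b
    refine ⟨max r 0 + 1, by positivity, fun z hz => ?_⟩
    by_contra hcon
    push Not at hcon
    have hnz : z ∉ closedBall b r := by
      rw [mem_closedBall, dist_eq_norm, hz]
      have := le_max_left r 0
      linarith
    apply hnz
    apply hr
    by_cases h : z ∈ U
    · right
      simp only [Ψ, piecewise_eq_of_mem _ _ _ h] at hcon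
      refine ⟨H z, by rwa [mem_closedBall, dist_eq_norm], ?_⟩
      rw [← Function.iterate_succ_apply, Nat.succ_eq_add_one, Nat.sub_add_cancel hp.one_le, hHp]
      rfl
    · left
      simp only [Ψ, piecewise_eq_of_notMem _ _ _ h, id] at hcon
      rwa [mem_closedBall, dist_eq_norm]
  have hcn : ∀ t, ‖circ b R t - b‖ = R := fun t => norm_circ_sub b hR0.le t
  have hcb : ∀ t, circ b R t ∈ ({b}ᶜ : Set ℂ) := fun t h => by
    have h1 := hcn t
    rw [mem_singleton_iff.1 h, sub_self, norm_zero] at h1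
    linarith
  have w1 : Wind (fun t => Ψ (circ b R t) - b) 1 := by
    have := (wind_circ b hR0).mul
      (wind_of_hasLog (hasLog_exp hv) (circ_continuous b R) (circ_per b R) hcb)
    rw [add_zero] at this
    exact this.congr fun t => hΨv _ (hcb t)
  have hcc := circ_continuous b R
  have w2 : Wind (fun t => Ψ (circ b R t) - x) 1 := by
    refine w1.of_close (by fun_prop) (fun t => by rw [circ_per]) fun t => ?_
    rw [sub_sub_sub_cancel_left, norm_sub_rev]
    exact hR _ (hcn t)
  have w3 := wind_of_hasLog (hasLog_convex (g := fun z => Ψ z - x) convex_univ (by fun_prop)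
    (fun z _ => sub_ne_zero.2 (hmiss z))) hcc (circ_per b R) (fun t => mem_univ _)
  exact absurd (w2.unique w3) one_ne_zero

theorem theorem_AB {H : ℂ → ℂ} (hH : Continuous H) {p : ℕ} (hp : p.Prime) (hHp : H^[p] = id)
    (hori : Ori H) (hne : H ≠ id) : ∃ b, H b = b ∧ ∀ z, H z = z → z = b := by
  obtain ⟨x, hx⟩ : ∃ x, H x ≠ x := by
    by_contra h
    push Not at h
    exact hne (funext h)
  by_cases hj : JoinedIn {z | H z = z}ᶜ x (H x)
  · exact claim_joined hH hp hHp hori hx hj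
  · have hF : ∃ b, H b = b := by
      by_contra h
      push Not at h
      apply hj
      have : {z | H z = z}ᶜ = univ := by ext z; simp [h z]
      rw [this, joinedIn_univ]
      exact PathConnectedSpace.joined _ _
    obtain ⟨b, hb⟩ := hF
    refine ⟨b, hb, fun c0 hc0 => ?_⟩
    by_contra h
    exact hj (claim_not_joined hH hp hHp hori hx hb hc0 h)

end BKE

namespace BKE
open Set Filter Topology Metric
open scoped unitInterval ComplexConjugate

/-! ### Degree of self-maps of the sphere through clutching -/

def zc (x : S2) : ℂ := ⟨x.1 0, x.1 1⟩
def hc (x : S2) : ℝ := x.1 2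

theorem zc_cont : Continuous zc := by
  have h : Continuous fun x : S2 => Complex.equivRealProdCLM.symm (x.1 0, x.1 1) := by fun_prop
  exact h

theorem hc_cont : Continuous hc := by unfold hc; fun_prop

theorem mem_S2_iff (v : EuclideanSpace ℝ (Fin 3)) : v ∈ S2 ↔ v 0 ^ 2 + v 1 ^ 2 + v 2 ^ 2 = 1 := by
  unfold S2
  rw [EuclideanSpace.sphere_zero_eq 1 zero_le_one]
  simp [Fin.sum_univ_three]

theorem S2_eq (x : S2) : Complex.normSq (zc x) + hc x ^ 2 = 1 := by
  have := (mem_S2_iff x.1).1 x.2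
  simp only [Complex.normSq_apply, zc, hc]
  linarith

theorem S2_ext {x y : S2} (h1 : zc x = zc y) (h2 : hc x = hc y) : x = y := by
  apply Subtype.ext
  ext i
  fin_cases i
  · exact congrArg Complex.re h1
  · exact congrArg Complex.im h1
  · exact h2

def mkS (z : ℂ) (h : ℝ) (e : Complex.normSq z + h ^ 2 = 1) : S2 :=
  ⟨!₂[z.re, z.im, h], (mem_S2_iff _).2 (by rw [Complex.normSq_apply] at e; simp; linarith)⟩

@[simp] theorem zc_mkS (z h e) : zc (mkS z h e) = z := by simp [zc, mkS]
@[simp] theorem hc_mkS (z h e) : hc (mkS z h e) = h := by simp [hc, mkS]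

def nS : S2 := mkS 0 1 (by simp)

theorem eta_aux {a b : ℂ} (h : a ≠ 0 ∨ b ≠ 0) : 0 < Complex.normSq a + Complex.normSq b := by
  rcases h with h | h
  · have := Complex.normSq_pos.2 h; have := Complex.normSq_nonneg b; linarith
  · have := Complex.normSq_pos.2 h; have := Complex.normSq_nonneg a; linarith

theorem eta_aux2 {a b : ℂ} (h : a ≠ 0 ∨ b ≠ 0) :
    Complex.normSq (2 * a * conj b / ((Complex.normSq a + Complex.normSq b : ℝ) : ℂ)) +
    ((Complex.normSq a - Complex.normSq b) / (Complex.normSq a + Complex.normSq b)) ^ 2 = 1 := by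
  have h1 := eta_aux h
  simp only [map_div₀, map_mul, Complex.normSq_ofReal, Complex.normSq_conj]
  have : Complex.normSq 2 = 4 := by rw [Complex.normSq_apply]; norm_num
  rw [this]
  field_simp
  ring

open Classical in
/-- The Hopf map. -/
def eta (a b : ℂ) : S2 := if h : a ≠ 0 ∨ b ≠ 0 then mkS _ _ (eta_aux2 h) else nS

theorem zc_eta {a b : ℂ} (h : a ≠ 0 ∨ b ≠ 0) :
    zc (eta a b) = 2 * a * conj b / ((Complex.normSq a + Complex.normSq b : ℝ) : ℂ) := by
  rw [eta, dif_pos h, zc_mkS]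

theorem hc_eta {a b : ℂ} (h : a ≠ 0 ∨ b ≠ 0) :
    hc (eta a b) = (Complex.normSq a - Complex.normSq b) / (Complex.normSq a + Complex.normSq b) := by
  rw [eta, dif_pos h, hc_mkS]

theorem cont_vec3 {X : Type*} [TopologicalSpace X] {p q r : X → ℝ} (hp : Continuous p)
    (hq : Continuous q) (hr : Continuous r) :
    Continuous fun x => (!₂[p x, q x, r x] : EuclideanSpace ℝ (Fin 3)) := by
  fun_prop

theorem S2_vec (x : S2) : (x : EuclideanSpace ℝ (Fin 3)) = !₂[(zc x).re, (zc x).im, hc x] := by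
  ext i
  fin_cases i <;> rfl

theorem continuous_to_S2 {X : Type*} [TopologicalSpace X] {k : X → S2}
    (h1 : Continuous fun x => zc (k x)) (h2 : Continuous fun x => hc (k x)) : Continuous k := by
  have h3 := cont_vec3 (Complex.continuous_re.comp h1) (Complex.continuous_im.comp h1) h2
  rw [continuous_induced_rng]
  exact h3.congr fun x => (S2_vec (k x)).symm

theorem eta_cont {X : Type*} [TopologicalSpace X] {a b : X → ℂ} (ha : Continuous a) (hb : Continuous b)
    (h : ∀ x, a x ≠ 0 ∨ b x ≠ 0) : Continuous fun x => eta (a x) (b x) := by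
  have hn : ∀ x, Complex.normSq (a x) + Complex.normSq (b x) ≠ 0 := fun x => (eta_aux (h x)).ne'
  have h1 : Continuous fun x => Complex.normSq (a x) := Complex.continuous_normSq.comp ha
  have h2 : Continuous fun x => Complex.normSq (b x) := Complex.continuous_normSq.comp hb
  apply continuous_to_S2
  · simp only [fun x => zc_eta (h x)]
    refine Continuous.div ?_ ?_ (fun x => by exact_mod_cast hn x)
    · have := Complex.continuous_conj.comp hb
      simp only [Function.comp_def] at this
      fun_prop
    · exact Complex.continuous_ofReal.comp (h1.add h2)
  · simp only [fun x => hc_eta (h x)]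
    exact (h1.sub h2).div (h1.add h2) hn

theorem lin_eta {a b : ℂ} (h : a ≠ 0 ∨ b ≠ 0) :
    a * (1 - hc (eta a b)) = b * zc (eta a b) ∧ a * conj (zc (eta a b)) = b * (1 + hc (eta a b)) := by
  have hn : ((Complex.normSq a + Complex.normSq b : ℝ) : ℂ) ≠ 0 := by
    exact_mod_cast (eta_aux h).ne'
  rw [zc_eta h, hc_eta h]
  push_cast at hn ⊢
  rw [map_div₀]
  simp only [map_mul, map_add, Complex.conj_conj, Complex.conj_ofReal, Complex.normSq_eq_conj_mul_self] at hn ⊢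
  have h2 : (starRingEnd ℂ) 2 = 2 := Complex.conj_ofNat 2
  rw [h2]
  have hn' : conj a * a + conj b * b ≠ 0 := hn
  have hn'' : a * conj a + b * conj b ≠ 0 := by rwa [mul_comm a, mul_comm b]
  generalize conj a = A at *
  generalize conj b = B at *
  constructor
  · rw [show (1:ℂ) - (A * a - B * b) / (A * a + B * b) = 2 * (B * b) / (A * a + B * b) by
      rw [eq_div_iff hn', sub_mul, div_mul_cancel₀ _ hn']; ring]
    ring
  · field_simp
    ring

theorem eta_of_lin {a b : ℂ} {k : S2} (h : a ≠ 0 ∨ b ≠ 0) (h1 : a * (1 - hc k) = b * zc k)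
    (h2 : a * conj (zc k) = b * (1 + hc k)) : eta a b = k := by
  have hn : ((Complex.normSq a + Complex.normSq b : ℝ) : ℂ) ≠ 0 := by
    exact_mod_cast (eta_aux h).ne'
  have h3 : conj a * zc k = conj b * (1 + hc k) := by
    have := congrArg conj h2
    simpa using this
  apply S2_ext
  · rw [zc_eta h, div_eq_iff hn]
    push_cast
    rw [Complex.normSq_eq_conj_mul_self, Complex.normSq_eq_conj_mul_self]
    linear_combination (-a) * h3 + conj b * h1
  · rw [hc_eta h, div_eq_iff (eta_aux h).ne']
    have : ((Complex.normSq a - Complex.normSq b : ℝ) : ℂ)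
        = ((hc k * (Complex.normSq a + Complex.normSq b) : ℝ) : ℂ) := by
      push_cast
      rw [Complex.normSq_eq_conj_mul_self, Complex.normSq_eq_conj_mul_self]
      linear_combination conj a * h1 + b * h3
    exact_mod_cast this

theorem eta_prop {a b a' b' : ℂ} (h : a ≠ 0 ∨ b ≠ 0) (h' : a' ≠ 0 ∨ b' ≠ 0)
    (e : eta a b = eta a' b') : a * b' = b * a' := by
  obtain ⟨h1, h2⟩ := lin_eta h
  obtain ⟨h3, h4⟩ := lin_eta h'
  rw [← e] at h3 h4
  linear_combination (1/2) * (b' * h1 - b * h3) + (1/2) * (a' * h2 - a * h4)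

theorem eta_smul {a b : ℂ} (h : a ≠ 0 ∨ b ≠ 0) {c : ℂ} (hc0 : c ≠ 0) : eta (c * a) (c * b) = eta a b := by
  obtain ⟨h1, h2⟩ := lin_eta h
  refine eta_of_lin ?_ (by linear_combination c * h1) (by linear_combination c * h2)
  rcases h with h | h
  · exact Or.inl (mul_ne_zero hc0 h)
  · exact Or.inr (mul_ne_zero hc0 h)

theorem S2_eqC (k : S2) : zc k * conj (zc k) = 1 - (hc k : ℂ) ^ 2 := by
  rw [Complex.mul_conj]
  have := S2_eq k
  have : Complex.normSq (zc k) = 1 - hc k ^ 2 := by linarith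
  rw [this]; push_cast; ring

theorem eta_tr {a b : ℂ} {k : S2}
    (h : (1 + hc k) * a + zc k * b ≠ 0 ∨ conj (zc k) * a + (1 - hc k) * b ≠ 0) :
    eta ((1 + hc k) * a + zc k * b) (conj (zc k) * a + (1 - hc k) * b) = k := by
  have := S2_eqC k
  exact eta_of_lin h (by linear_combination (-a) * this) (by linear_combination b * this)

theorem zc_neg (k : S2) : zc (-k) = - zc k := by
  simp only [zc]; apply Complex.ext <;> simp

theorem hc_neg (k : S2) : hc (-k) = - hc k := by simp [hc]

theorem tr_ne {a b : ℂ} {k : S2} (h : a ≠ 0 ∨ b ≠ 0) (hk : eta a b ≠ -k) :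
    (1 + hc k) * a + zc k * b ≠ 0 ∨ conj (zc k) * a + (1 - hc k) * b ≠ 0 := by
  by_contra hcon
  push Not at hcon
  apply hk
  apply eta_of_lin h
  · rw [zc_neg, hc_neg]; push_cast; linear_combination hcon.1
  · rw [zc_neg, hc_neg]; push_cast; rw [map_neg]; linear_combination -hcon.2

theorem eta_surj (k : S2) : ∃ a b : ℂ, (a ≠ 0 ∨ b ≠ 0) ∧ eta a b = k := by
  by_cases h : eta 1 0 = -k
  · have h2 : eta 0 1 ≠ -k := by
      intro h3
      have := eta_prop (by simp) (by simp) (h.trans h3.symm)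
      simp at this
    exact ⟨_, _, tr_ne (by simp) h2, eta_tr (tr_ne (by simp) h2)⟩
  · exact ⟨_, _, tr_ne (by simp) h, eta_tr (tr_ne (by simp) h)⟩

theorem neg_eta {a b : ℂ} (h : a ≠ 0 ∨ b ≠ 0) : -eta a b = eta (-conj b) (conj a) := by
  obtain ⟨h1, h2⟩ := lin_eta h
  symm
  have e1 := congrArg conj h1
  have e2 := congrArg conj h2
  simp only [map_mul, map_sub, map_add, map_one, Complex.conj_ofReal, Complex.conj_conj] at e1 e2
  apply eta_of_lin
  · rcases h with h | h
    · right; simpa using h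
    · left; simpa using h
  · rw [zc_neg, hc_neg]; push_cast; linear_combination e2
  · rw [zc_neg, hc_neg]; push_cast; rw [map_neg]; linear_combination -e1

theorem dist_neg_S2 (k : S2) : dist k (-k) = 2 := by
  rw [Subtype.dist_eq, dist_eq_norm]
  have : (k : EuclideanSpace ℝ (Fin 3)) - ((-k : S2) : EuclideanSpace ℝ (Fin 3)) = (2:ℝ) • k.1 := by
    rw [two_smul]; simp
  rw [this, norm_smul, mem_sphere_zero_iff_norm.1 k.2]; norm_num

theorem lift_homotopy {X : Type*} [MetricSpace X] [CompactSpace X] {K : I × X → S2}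
    (hK : Continuous K) {k0 : S2} (h0 : ∀ x, K (0, x) = k0) :
    ∃ a b : X → ℂ, Continuous a ∧ Continuous b ∧ (∀ x, a x ≠ 0 ∨ b x ≠ 0) ∧
      ∀ x, eta (a x) (b x) = K (1, x) := by
  have huc := CompactSpace.uniformContinuous_of_continuous hK
  obtain ⟨δ, hδ, hd⟩ := Metric.uniformContinuous_iff.1 huc 1 one_pos
  obtain ⟨N, hN⟩ := exists_nat_gt (1 / δ)
  have hN0 : (0:ℝ) < N := lt_trans (by positivity) hN
  have hN1 : 1 / (N:ℝ) < δ := by rw [div_lt_iff₀ hN0]; rw [div_lt_iff₀ hδ] at hN; linarith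
  let τ : ℕ → I := fun j => projIcc 0 1 zero_le_one ((j:ℝ) / N)
  have hτ : ∀ j, dist (τ (j+1)) (τ j) < δ := by
    intro j
    have h1 : dist (τ (j+1)) (τ j) ≤ dist (((j+1:ℕ):ℝ) / N) ((j:ℝ) / N) := by
      have := (LipschitzWith.projIcc (zero_le_one (α := ℝ))).dist_le_mul (((j+1:ℕ):ℝ) / N) ((j:ℝ) / N)
      rw [NNReal.coe_one, one_mul] at this
      exact this
    refine h1.trans_lt ?_
    rw [Real.dist_eq, ← sub_div]
    push_cast
    rw [add_sub_cancel_left, abs_of_pos (by positivity)]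
    exact hN1
  have key : ∀ j : ℕ, ∃ a b : X → ℂ, Continuous a ∧ Continuous b ∧ (∀ x, a x ≠ 0 ∨ b x ≠ 0) ∧
      ∀ x, eta (a x) (b x) = K (τ j, x) := by
    intro j
    induction j with
    | zero =>
      obtain ⟨a, b, h1, h2⟩ := eta_surj k0
      refine ⟨fun _ => a, fun _ => b, continuous_const, continuous_const, fun _ => h1, fun x => ?_⟩
      have : τ 0 = 0 := by simp [τ]
      rw [this, h0, h2]
    | succ j ih =>
      obtain ⟨a, b, ha, hb, hn, he⟩ := ih
      have hz : Continuous fun x => zc (K (τ (j+1), x)) := zc_cont.comp (by fun_prop)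
      have hh : Continuous fun x => ((hc (K (τ (j+1), x)) : ℝ) : ℂ) :=
        Complex.continuous_ofReal.comp (hc_cont.comp (by fun_prop))
      have hcz : Continuous fun x => conj (zc (K (τ (j+1), x))) := Complex.continuous_conj.comp hz
      have hne : ∀ x, eta (a x) (b x) ≠ - K (τ (j+1), x) := by
        intro x h
        rw [he] at h
        have h1 : dist (K (τ (j+1), x)) (K (τ j, x)) < 1 := by
          apply hd
          rw [Prod.dist_eq]
          simpa using hτ j
        rw [h, dist_neg_S2] at h1
        norm_num at h1
      exact ⟨_, _, ((continuous_const.add hh).mul ha).add (hz.mul hb),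
        (hcz.mul ha).add ((continuous_const.sub hh).mul hb), fun x => tr_ne (hn x) (hne x),
        fun x => eta_tr (tr_ne (hn x) (hne x))⟩
  have hτN : τ N = 1 := by
    simp only [τ]
    rw [div_self hN0.ne']
    simp
  have := key N
  rw [hτN] at this
  exact this

/-- ratio of two proportional vectors -/
def rat (a1 a2 b1 b2 : ℂ) : ℂ := (b1 * conj a1 + b2 * conj a2) / (a1 * conj a1 + a2 * conj a2)

theorem rat_den {a1 a2 : ℂ} (h : a1 ≠ 0 ∨ a2 ≠ 0) : a1 * conj a1 + a2 * conj a2 ≠ 0 := by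
  rw [Complex.mul_conj, Complex.mul_conj]
  exact_mod_cast (eta_aux h).ne'

theorem rat_spec {a1 a2 b1 b2 : ℂ} (h : a1 ≠ 0 ∨ a2 ≠ 0) (h' : b1 ≠ 0 ∨ b2 ≠ 0)
    (e : eta a1 a2 = eta b1 b2) :
    b1 = rat a1 a2 b1 b2 * a1 ∧ b2 = rat a1 a2 b1 b2 * a2 ∧ rat a1 a2 b1 b2 ≠ 0 := by
  have hp := eta_prop h h' e
  have hd := rat_den h
  have e1 : b1 = rat a1 a2 b1 b2 * a1 := by
    unfold rat; rw [div_mul_eq_mul_div, eq_div_iff hd]; linear_combination (-conj a2) * hp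
  have e2 : b2 = rat a1 a2 b1 b2 * a2 := by
    unfold rat; rw [div_mul_eq_mul_div, eq_div_iff hd]; linear_combination (conj a1) * hp
  refine ⟨e1, e2, fun h0 => ?_⟩
  rw [h0, zero_mul] at e1 e2
  rcases h' with h | h <;> exact h ‹_›

theorem rat_cont {X : Type*} [TopologicalSpace X] {S : Set X} {a1 a2 b1 b2 : X → ℂ}
    (h1 : ContinuousOn a1 S) (h2 : ContinuousOn a2 S) (h3 : ContinuousOn b1 S)
    (h4 : ContinuousOn b2 S) (h : ∀ x ∈ S, a1 x ≠ 0 ∨ a2 x ≠ 0) :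
    ContinuousOn (fun x => rat (a1 x) (a2 x) (b1 x) (b2 x)) S := by
  have h5 : ContinuousOn (fun x => conj (a1 x)) S := Complex.continuous_conj.comp_continuousOn h1
  have h6 : ContinuousOn (fun x => conj (a2 x)) S := Complex.continuous_conj.comp_continuousOn h2
  exact ((h3.mul h5).add (h4.mul h6)).div ((h1.mul h5).add (h2.mul h6)) fun x hx => rat_den (h x hx)

def em (b : ℂ) (R : ℝ) (w : ℂ) : S2 := eta (b + R * w) 1
def ep (b : ℂ) (R : ℝ) (w : ℂ) : S2 := eta (R + b * conj w) (conj w)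

theorem ep_ne (b : ℂ) {R : ℝ} (hR : 0 < R) (w : ℂ) : (R + b * conj w : ℂ) ≠ 0 ∨ conj w ≠ 0 := by
  by_cases h : conj w = 0
  · left; rw [h]; simpa using hR.ne'
  · right; exact h

theorem em_cont (b : ℂ) (R : ℝ) : Continuous (em b R) :=
  eta_cont (by fun_prop) continuous_const fun _ => Or.inr one_ne_zero

theorem ep_cont (b : ℂ) {R : ℝ} (hR : 0 < R) : Continuous (ep b R) := by
  have := Complex.continuous_conj
  exact eta_cont (by fun_prop) (by fun_prop) (ep_ne b hR)

theorem conj_unit {w : ℂ} (hw : ‖w‖ = 1) : conj w * w = 1 := by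
  rw [← Complex.normSq_eq_conj_mul_self, Complex.normSq_eq_norm_sq, hw]; simp

theorem em_eq_ep (b : ℂ) (R : ℝ) {w : ℂ} (hw : ‖w‖ = 1) : em b R w = ep b R w := by
  have h1 := conj_unit hw
  have h2 : conj w ≠ 0 := fun h => by rw [h, zero_mul] at h1; exact zero_ne_one h1
  unfold em ep
  rw [← eta_smul (a := b + R * w) (b := 1) (Or.inr one_ne_zero) h2, mul_one,
    show conj w * (b + R * w) = R + b * conj w by linear_combination (R:ℂ) * h1]

def Clutch (b : ℂ) (R : ℝ) (k : S2 → S2) (m : ℤ) : Prop := ∃ a1 a2 b1 b2 : ℂ → ℂ,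
  ContinuousOn a1 (closedBall 0 1) ∧ ContinuousOn a2 (closedBall 0 1) ∧
  ContinuousOn b1 (closedBall 0 1) ∧ ContinuousOn b2 (closedBall 0 1) ∧
  (∀ w ∈ closedBall (0:ℂ) 1, (a1 w ≠ 0 ∨ a2 w ≠ 0) ∧ (b1 w ≠ 0 ∨ b2 w ≠ 0) ∧
    eta (a1 w) (a2 w) = k (em b R w) ∧ eta (b1 w) (b2 w) = k (ep b R w)) ∧
  ∃ l : ℝ → ℂ, Wind l m ∧ ∀ t, b1 (circ 0 1 t) = l t * a1 (circ 0 1 t) ∧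
    b2 (circ 0 1 t) = l t * a2 (circ 0 1 t)

theorem circ01_norm (t : ℝ) : ‖circ 0 1 t‖ = 1 := by
  have := norm_circ_sub 0 zero_le_one t; simpa using this

theorem circ01_mem (t : ℝ) : circ 0 1 t ∈ closedBall (0:ℂ) 1 := by
  simp [circ01_norm]

theorem Clutch.unique {b : ℂ} {R : ℝ} {k : S2 → S2} {m m' : ℤ} (h : Clutch b R k m)
    (h' : Clutch b R k m') : m = m' := by
  obtain ⟨a1, a2, b1, b2, ca1, ca2, cb1, cb2, hs, l, hl, hb⟩ := h
  obtain ⟨a1', a2', b1', b2', ca1', ca2', cb1', cb2', hs', l', hl', hb'⟩ := h'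
  have A : Wind (fun t => rat (a1 (circ 0 1 t)) (a2 (circ 0 1 t)) (a1' (circ 0 1 t)) (a2' (circ 0 1 t))) 0 :=
    wind_of_hasLog (G := fun w => rat (a1 w) (a2 w) (a1' w) (a2' w))
      (hasLog_convex (convex_closedBall (0:ℂ) 1) (rat_cont ca1 ca2 ca1' ca2' fun x hx => (hs x hx).1)
      fun w hw => (rat_spec (hs w hw).1 (hs' w hw).1 ((hs w hw).2.2.1.trans (hs' w hw).2.2.1.symm)).2.2)
      (circ_continuous 0 1) (circ_per 0 1) circ01_mem
  have B : Wind (fun t => rat (b1 (circ 0 1 t)) (b2 (circ 0 1 t)) (b1' (circ 0 1 t)) (b2' (circ 0 1 t))) 0 :=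
    wind_of_hasLog (G := fun w => rat (b1 w) (b2 w) (b1' w) (b2' w))
      (hasLog_convex (convex_closedBall (0:ℂ) 1) (rat_cont cb1 cb2 cb1' cb2' fun x hx => (hs x hx).2.1)
      fun w hw => (rat_spec (hs w hw).2.1 (hs' w hw).2.1 ((hs w hw).2.2.2.trans (hs' w hw).2.2.2.symm)).2.2)
      (circ_continuous 0 1) (circ_per 0 1) circ01_mem
  have h1 := B.mul hl
  have h2 := hl'.mul A
  rw [zero_add] at h1
  rw [add_zero] at h2
  refine h1.unique (h2.congr fun t => ?_)
  have hw := circ01_mem t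
  obtain ⟨r1, r2, -⟩ := rat_spec (hs _ hw).1 (hs' _ hw).1 ((hs _ hw).2.2.1.trans (hs' _ hw).2.2.1.symm)
  obtain ⟨s1, s2, -⟩ := rat_spec (hs _ hw).2.1 (hs' _ hw).2.1 ((hs _ hw).2.2.2.trans (hs' _ hw).2.2.2.symm)
  generalize rat (a1 (circ 0 1 t)) (a2 (circ 0 1 t)) (a1' (circ 0 1 t)) (a2' (circ 0 1 t)) = ρ at *
  generalize rat (b1 (circ 0 1 t)) (b2 (circ 0 1 t)) (b1' (circ 0 1 t)) (b2' (circ 0 1 t)) = s at *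
  have q1 := (hb t).1
  have q2 := (hb t).2
  have q3 := (hb' t).1
  have q4 := (hb' t).2
  rcases (hs _ hw).1 with h | h
  · apply mul_right_cancel₀ h
    linear_combination -s1 - s * q1 + q3 + l' t * r1
  · apply mul_right_cancel₀ h
    linear_combination -s2 - s * q2 + q4 + l' t * r2

end BKE

namespace BKE
open Set Filter Topology Metric
open scoped unitInterval ComplexConjugate

def ret (w : ℂ) : closedBall (0:ℂ) 1 := ⟨((max 1 ‖w‖)⁻¹ : ℝ) * w, by
  rw [mem_closedBall_zero_iff, norm_mul, Complex.norm_real, Real.norm_eq_abs,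
    abs_of_nonneg (by positivity), inv_mul_le_iff₀ (by positivity)]
  simp⟩

theorem ret_cont : Continuous ret := by
  apply Continuous.subtype_mk
  refine Continuous.mul (Complex.continuous_ofReal.comp (Continuous.inv₀ (by fun_prop) ?_)) continuous_id
  intro w
  positivity

theorem ret_of_mem {w : ℂ} (hw : w ∈ closedBall (0:ℂ) 1) : ret w = ⟨w, hw⟩ := by
  apply Subtype.ext
  rw [mem_closedBall_zero_iff] at hw
  simp [ret, max_eq_left hw]

theorem clutch_inv (b : ℂ) {R : ℝ} (hR : 0 < R) {G : I × S2 → S2} (hG : Continuous G) :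
    ∃ M, Clutch b R (fun x => G (0, x)) M ∧ Clutch b R (fun x => G (1, x)) M := by
  have h1 : Continuous fun q : I × (I × closedBall (0:ℂ) 1) =>
      G (q.1 * q.2.1, em b R ((q.1 : ℝ) * (q.2.2 : ℂ))) := by
    have := em_cont b R
    fun_prop
  have h2 : Continuous fun q : I × (I × closedBall (0:ℂ) 1) =>
      G (q.1 * q.2.1, ep b R ((q.1 : ℝ) * (q.2.2 : ℂ))) := by
    have := ep_cont b hR
    fun_prop
  obtain ⟨a1, a2, ca1, ca2, na, ea⟩ := lift_homotopy h1 (k0 := G (0, em b R 0)) (fun x => by simp)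
  obtain ⟨b1, b2, cb1, cb2, nb, eb⟩ := lift_homotopy h2 (k0 := G (0, ep b R 0)) (fun x => by simp)
  have hmem := circ01_mem
  have ee : ∀ s : I, ∀ t : ℝ, eta (a1 (s, ret (circ 0 1 t))) (a2 (s, ret (circ 0 1 t))) =
      eta (b1 (s, ret (circ 0 1 t))) (b2 (s, ret (circ 0 1 t))) := by
    intro s t
    rw [ea, eb]
    dsimp only
    rw [ret_of_mem (hmem t)]
    simp only [Set.Icc.coe_one, Complex.ofReal_one, one_mul]
    rw [em_eq_ep b R (circ01_norm t)]
  let L : ℝ → ℝ → ℂ := fun s t => rat (a1 (projIcc 0 1 zero_le_one s, ret (circ 0 1 t)))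
    (a2 (projIcc 0 1 zero_le_one s, ret (circ 0 1 t)))
    (b1 (projIcc 0 1 zero_le_one s, ret (circ 0 1 t))) (b2 (projIcc 0 1 zero_le_one s, ret (circ 0 1 t)))
  have hpc : Continuous fun p : ℝ × ℝ => (projIcc (0:ℝ) 1 zero_le_one p.1, ret (circ 0 1 p.2)) :=
    (continuous_projIcc.comp continuous_fst).prodMk (ret_cont.comp ((circ_continuous 0 1).comp continuous_snd))
  have hLc : Continuous fun p : ℝ × ℝ => L p.1 p.2 := by
    rw [← continuousOn_univ]
    exact rat_cont (ca1.comp hpc).continuousOn (ca2.comp hpc).continuousOn (cb1.comp hpc).continuousOn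
      (cb2.comp hpc).continuousOn fun x _ => na _
  have hL0 : ∀ s t, L s t ≠ 0 := fun s t => (rat_spec (na _) (nb _) (ee _ t)).2.2
  have hLp : ∀ s t, L s (t + 1) = L s t := fun s t => by simp only [L]; rw [circ_per]
  obtain ⟨M, hM⟩ := exists_wind (g := L 0) (by fun_prop) (hL0 0) (hLp 0)
  have hM1 : Wind (L 1) M := Wind.homotopy hLc.continuousOn (fun s _ => hL0 s) (fun s _ => hLp s) hM
  have fin : ∀ s : I, Wind (L s) M → Clutch b R (fun x => G (s, x)) M := by
    intro s hs
    have hrc : Continuous fun w => (s, ret w) := continuous_const.prodMk ret_cont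
    refine ⟨fun w => a1 (s, ret w), fun w => a2 (s, ret w), fun w => b1 (s, ret w), fun w => b2 (s, ret w),
      (ca1.comp hrc).continuousOn, (ca2.comp hrc).continuousOn, (cb1.comp hrc).continuousOn,
      (cb2.comp hrc).continuousOn, fun w hw => ⟨na _, nb _, ?_, ?_⟩, L s, hs, fun t => ?_⟩
    · dsimp only; rw [ea]; dsimp only; rw [ret_of_mem hw]; simp
    · dsimp only; rw [eb]; dsimp only; rw [ret_of_mem hw]; simp
    · simp only [L, projIcc_val]
      have := rat_spec (na _) (nb _) (ee s t)
      exact ⟨this.1, this.2.1⟩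
  refine ⟨M, fin 0 ?_, fin 1 ?_⟩
  · simpa using hM
  · simpa using hM1

theorem circ_eq (b : ℂ) (R t : ℝ) : b + R * circ 0 1 t = circ b R t := by
  simp [circ]

theorem conj_circ_inv (t : ℝ) : conj (circ 0 1 t) = (circ 0 1 t)⁻¹ :=
  eq_inv_of_mul_eq_one_left (conj_unit (circ01_norm t))

theorem wind_circ01 : Wind (circ 0 1) 1 := by
  have := wind_circ 0 one_pos
  exact this.congr fun t => by simp

theorem wind_conj_circ : Wind (fun t => conj (circ 0 1 t)) (-1) :=
  wind_circ01.inv.congr conj_circ_inv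

theorem clutch_id (b : ℂ) {R : ℝ} (hR : 0 < R) : Clutch b R (fun x => x) (-1) := by
  have hc := Complex.continuous_conj
  refine ⟨fun w => b + R * w, fun _ => 1, fun w => R + b * conj w, fun w => conj w, by fun_prop, by fun_prop,
    by fun_prop, by fun_prop, fun w hw => ⟨Or.inr one_ne_zero, ep_ne b hR w, rfl, rfl⟩, _, wind_conj_circ, fun t => ?_⟩
  have := conj_unit (circ01_norm t)
  constructor
  · dsimp only; linear_combination (-(R:ℂ)) * this
  · dsimp only; ring

theorem clutch_neg : Clutch 0 1 (fun x => -x) 1 := by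
  have hc := Complex.continuous_conj
  refine ⟨fun w => -1, fun w => conj w, fun w => -w, fun w => 1, by fun_prop, by fun_prop,
    by fun_prop, by fun_prop, fun w hw => ⟨Or.inl (by simp), Or.inr one_ne_zero, ?_, ?_⟩, _, wind_circ01, fun t => ?_⟩
  · simp only [em]
    rw [neg_eta (Or.inr one_ne_zero)]
    simp
  · simp only [ep]
    rw [neg_eta (ep_ne 0 one_pos w)]
    simp
  · have := conj_unit (circ01_norm t)
    constructor
    · dsimp only; ring
    · dsimp only; linear_combination -this

/-- homotopic to the identity -/
def HId (f : S2 → S2) : Prop := ∃ G : I × S2 → S2, Continuous G ∧ (∀ x, G (0, x) = f x) ∧ ∀ x, G (1, x) = x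

theorem HId.clutch {f : S2 → S2} (h : HId f) (b : ℂ) {R : ℝ} (hR : 0 < R) : Clutch b R f (-1) := by
  obtain ⟨G, hG, h0, h1⟩ := h
  obtain ⟨M, m0, m1⟩ := clutch_inv b hR hG
  simp only [h1] at m1
  simp only [h0] at m0
  rwa [m1.unique (clutch_id b hR)] at m0

theorem HId.continuous {f : S2 → S2} (h : HId f) : Continuous f := by
  obtain ⟨G, hG, h0, h1⟩ := h
  have : f = fun x => G (0, x) := by funext x; rw [h0]
  rw [this]
  fun_prop

theorem HId.id : HId (fun x => x) := ⟨fun q => q.2, continuous_snd, fun _ => rfl, fun _ => rfl⟩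

theorem HId.comp {f g : S2 → S2} (hf : HId f) (hg : HId g) : HId (fun x => f (g x)) := by
  have hfc := hf.continuous
  obtain ⟨F, hF, f0, f1⟩ := hf
  obtain ⟨G, hG, g0, g1⟩ := hg
  exact ⟨fun q => F (q.1, G q), by fun_prop, fun x => by dsimp only; rw [g0, f0], fun x => by dsimp only; rw [g1, f1]⟩

theorem HId.iterate {f : S2 → S2} (hf : HId f) (n : ℕ) : HId f^[n] := by
  induction n with
  | zero => exact HId.id
  | succ n ih =>
    have := hf.comp ih
    convert this using 1
    funext x
    exact Function.iterate_succ_apply' f n x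

theorem HId.conj {f : S2 → S2} (hf : HId f) {r r' : S2 → S2} (hr : Continuous r) (hr' : Continuous r')
    (e : ∀ x, r (r' x) = x) : HId (fun x => r (f (r' x))) := by
  obtain ⟨F, hF, f0, f1⟩ := hf
  exact ⟨fun q => r (F (q.1, r' q.2)), by fun_prop, fun x => by dsimp only; rw [f0], fun x => by dsimp only; rw [f1, e]⟩

def nrm (v : EuclideanSpace ℝ (Fin 3)) (hv : v ≠ 0) : S2 := ⟨‖v‖⁻¹ • v, by
  rw [mem_sphere_zero_iff_norm, norm_smul, norm_inv, norm_norm, inv_mul_cancel₀ (norm_ne_zero_iff.2 hv)]⟩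

theorem HId.fixed {f : S2 → S2} (hf : HId f) : ∃ x, f x = x := by
  by_contra hcon
  push Not at hcon
  have hfc := hf.continuous
  have hne : ∀ q : I × S2, (1 - (q.1:ℝ)) • (f q.2).1 - (q.1:ℝ) • q.2.1 ≠ 0 := by
    intro ⟨s, x⟩ h
    dsimp only at h
    rw [sub_eq_zero] at h
    have hs0 := s.2.1
    have hs1 := s.2.2
    have h1 := congrArg norm h
    rw [norm_smul, norm_smul, mem_sphere_zero_iff_norm.1 (f x).2, mem_sphere_zero_iff_norm.1 x.2,
      Real.norm_eq_abs, Real.norm_eq_abs, abs_of_nonneg (by linarith), abs_of_nonneg hs0] at h1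
    have h2 : (s:ℝ) = 1/2 := by linarith
    rw [h2] at h
    apply hcon x
    apply Subtype.ext
    have h3 : (1 - 1/2 : ℝ) = 1/2 := by norm_num
    rw [h3] at h
    exact smul_right_injective _ (by norm_num : (1/2:ℝ) ≠ 0) h
  have hGc : Continuous fun q : I × S2 => nrm _ (hne q) := by
    apply Continuous.subtype_mk
    have h1 : Continuous fun q : I × S2 => (1 - (q.1:ℝ)) • (f q.2).1 - (q.1:ℝ) • q.2.1 := by fun_prop
    exact (h1.norm.inv₀ fun q => norm_ne_zero_iff.2 (hne q)).smul h1
  obtain ⟨M, m0, m1⟩ := clutch_inv 0 one_pos hGc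
  have e0 : (fun x : S2 => nrm _ (hne (0, x))) = f := by
    funext x
    apply Subtype.ext
    simp [nrm, mem_sphere_zero_iff_norm.1 (f x).2]
  have e1 : (fun x : S2 => nrm _ (hne (1, x))) = fun x => -x := by
    funext x
    apply Subtype.ext
    simp [nrm, mem_sphere_zero_iff_norm.1 x.2]
  rw [e0] at m0
  rw [e1] at m1
  have h1 := m0.unique (hf.clutch 0 one_pos)
  have h2 := m1.unique clutch_neg
  rw [h1] at h2
  norm_num at h2

/-! stereographic chart -/
def st (z : ℂ) : S2 := eta z 1

theorem st_cont : Continuous st := eta_cont continuous_id continuous_const fun _ => Or.inr one_ne_zero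

theorem nS_eq {a : ℂ} (ha : a ≠ 0) : eta a 0 = nS := by
  apply eta_of_lin (Or.inl ha)
  · simp [nS]
  · simp [nS]

def stinv (k : S2) : ℂ := zc k / (1 - hc k)

theorem hc_ne_one {k : S2} (h : k ≠ nS) : (1 - hc k : ℂ) ≠ 0 := by
  intro h0
  have h1 : hc k = 1 := by
    have : (1:ℂ) = hc k := sub_eq_zero.1 h0
    exact_mod_cast this.symm
  apply h
  have h2 := S2_eq k
  rw [h1] at h2
  have h3 : zc k = 0 := by rw [← Complex.normSq_eq_zero]; linarith
  apply S2_ext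
  · rw [h3]; simp [nS]
  · rw [h1]; simp [nS]

theorem stinv_cont : ContinuousOn stinv {nS}ᶜ := by
  apply ContinuousOn.div zc_cont.continuousOn
  · exact (continuous_const.sub (Complex.continuous_ofReal.comp hc_cont)).continuousOn
  · exact fun k hk => hc_ne_one hk

theorem st_stinv {k : S2} (h : k ≠ nS) : st (stinv k) = k := by
  have h1 := hc_ne_one h
  apply eta_of_lin (Or.inr one_ne_zero)
  · unfold stinv; rw [div_mul_cancel₀ _ h1]; ring
  · unfold stinv; rw [div_mul_eq_mul_div, div_eq_iff h1]; linear_combination S2_eqC k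

theorem st_ne (z : ℂ) : st z ≠ nS := by
  intro h
  rw [← nS_eq one_ne_zero] at h
  have := eta_prop (Or.inr one_ne_zero) (by simp) h
  simp at this

theorem st_inj : Function.Injective st := by
  intro z w h
  have := eta_prop (Or.inr one_ne_zero) (Or.inr one_ne_zero) h
  simpa using this

theorem stinv_st (z : ℂ) : stinv (st z) = z := st_inj (st_stinv (st_ne z))

theorem ori_of_HId {f : S2 → S2} (hf : HId f) {H : ℂ → ℂ} (hH : Continuous H) (hi : Function.Injective H)
    (hp : Tendsto H (cocompact ℂ) (cocompact ℂ)) (hfH : ∀ z, f (st z) = st (H z)) (hfn : f nS = nS) :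
    Ori H := by
  intro b
  have h1 := hp.eventually ((tendsto_norm_cocompact_atTop (E := ℂ)).eventually_gt_atTop ‖H b‖)
  rw [← cobounded_eq_cocompact, eventually_iff, ← comap_norm_atTop, mem_comap] at h1
  obtain ⟨U, hU, hUs⟩ := h1
  obtain ⟨R0, hR0⟩ := mem_atTop_sets.1 hU
  obtain ⟨R, hR, hRb⟩ : ∃ R : ℝ, 0 < R ∧ ∀ z, R ≤ ‖z - b‖ → ‖H b‖ < ‖H z‖ := by
    refine ⟨|R0| + ‖b‖ + 1, by positivity, fun z hz => ?_⟩
    apply hUs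
    apply hR0
    have := norm_sub_le z b
    have := le_abs_self R0
    linarith
  have hHc : ∀ t, ‖H b‖ < ‖H (circ b R t)‖ := fun t => hRb _ (norm_circ_sub b hR.le t).ge
  have hne : ∀ t, H (circ b R t) ≠ 0 := fun t => norm_pos_iff.1 ((norm_nonneg _).trans_lt (hHc t))
  have hcc : Continuous fun t => H (circ b R t) := hH.comp (circ_continuous b R)
  obtain ⟨M, hM⟩ := exists_wind hcc hne fun t => by rw [circ_per]
  have hwn : ∀ w ∈ closedBall (0:ℂ) 1, w ≠ 0 → H (b + R * (conj w)⁻¹) ≠ 0 := by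
    intro w hw h0
    apply norm_pos_iff.1
    apply (norm_nonneg (H b)).trans_lt
    apply hRb
    rw [mem_closedBall_zero_iff] at hw
    rw [add_sub_cancel_left, norm_mul, norm_inv, Complex.norm_conj, Complex.norm_real, Real.norm_eq_abs, abs_of_pos hR]
    have : 1 ≤ ‖w‖⁻¹ := (one_le_inv₀ (norm_pos_iff.2 h0)).2 hw
    nlinarith
  have hcl : Clutch b R f (-M) := by
    refine ⟨fun w => H (b + R * w), fun _ => 1, fun _ => 1,
      Function.update (fun w => (H (b + R * (conj w)⁻¹))⁻¹) 0 0, ?_, continuousOn_const, continuousOn_const,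
      ?_, fun w hw => ⟨Or.inr one_ne_zero, Or.inl one_ne_zero, ?_, ?_⟩, _, hM.inv, fun t => ⟨?_, ?_⟩⟩
    · exact Continuous.continuousOn (by fun_prop)
    · intro w hw
      by_cases h0 : w = 0
      · subst h0
        apply ContinuousAt.continuousWithinAt
        rw [continuousAt_update_same]
        have e1 : Tendsto (fun w : ℂ => (conj w)) (𝓝[≠] 0) (𝓝[≠] 0) := by
          refine tendsto_nhdsWithin_iff.2 ⟨?_, ?_⟩
          · have := Complex.continuous_conj.tendsto 0
            rw [map_zero] at this
            exact this.mono_left nhdsWithin_le_nhds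
          · filter_upwards [self_mem_nhdsWithin] with w hw
            simpa using hw
        have e2 : Tendsto (fun w : ℂ => b + R * (conj w)⁻¹) (𝓝[≠] 0) (cocompact ℂ) := by
          rw [← cobounded_eq_cocompact]
          have h3 : Tendsto (fun w : ℂ => (conj w)⁻¹) (𝓝[≠] 0) (Bornology.cobounded ℂ) :=
            tendsto_inv₀_nhdsNE_zero.comp e1
          have h4 := tendsto_norm_cobounded_atTop.comp h3
          rw [← tendsto_norm_atTop_iff_cobounded]
          have h5 : Tendsto (fun w : ℂ => R * ‖(conj w)⁻¹‖ - ‖b‖) (𝓝[≠] 0) atTop :=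
            tendsto_atTop_add_const_right _ _ (h4.const_mul_atTop hR)
          refine tendsto_atTop_mono (fun w => ?_) h5
          have := norm_sub_le (b + R * (conj w)⁻¹) b
          rw [add_sub_cancel_left, norm_mul, Complex.norm_real, Real.norm_eq_abs, abs_of_pos hR] at this
          linarith
        have e3 := hp.comp e2
        rw [← cobounded_eq_cocompact] at e3
        exact tendsto_inv₀_cobounded.comp e3
      · apply ContinuousAt.continuousWithinAt
        rw [continuousAt_update_of_ne h0]
        have hc0 : conj w ≠ 0 := by simpa using h0
        refine ContinuousAt.inv₀ ?_ (hwn w hw h0)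
        refine hH.continuousAt.comp ?_
        exact continuousAt_const.add (continuousAt_const.mul (Complex.continuous_conj.continuousAt.inv₀ hc0))
    · dsimp only [em]
      exact (hfH _).symm
    · by_cases h0 : w = 0
      · subst h0
        simp only [Function.update_self, ep, map_zero, mul_zero, add_zero]
        rw [nS_eq one_ne_zero, nS_eq (by exact_mod_cast hR.ne'), hfn]
      · rw [Function.update_of_ne h0]
        have hc0 : conj w ≠ 0 := by simpa using h0
        have e1 : ep b R w = st (b + R * (conj w)⁻¹) := by
          unfold ep st
          rw [← eta_smul (a := b + R * (conj w)⁻¹) (b := 1) (Or.inr one_ne_zero) hc0, mul_one]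
          congr 1
          field_simp
          ring
        rw [e1, hfH]
        have h2 := hwn w hw h0
        unfold st
        rw [← eta_smul (a := H (b + R * (conj w)⁻¹)) (b := 1) (Or.inr one_ne_zero) (inv_ne_zero h2), inv_mul_cancel₀ h2, mul_one]
    · dsimp only; rw [circ_eq, inv_mul_cancel₀ (hne t)]
    · have h0 : circ 0 1 t ≠ 0 := norm_pos_iff.1 (by rw [circ01_norm]; exact one_pos)
      rw [Function.update_of_ne h0]
      dsimp only
      rw [conj_circ_inv, inv_inv, circ_eq, mul_one]
  have hM1 : M = 1 := by
    have := hcl.unique (hf.clutch b hR)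
    linarith
  subst hM1
  have hW : Wind (fun t => H (circ b R t) - H b) 1 := by
    refine hM.of_close (hcc.sub continuous_const) (fun t => by rw [circ_per]) fun t => ?_
    rw [sub_sub_cancel_left, norm_neg]
    exact hHc t
  have hW0 := hW.div (wind_circ b hR)
  have hset : {z : ℂ | ‖z - b‖ ∈ Ioi (0:ℝ)} = {b}ᶜ := by
    ext z
    simp [sub_eq_zero]
  rw [← hset]
  refine annulus_log ordConnected_Ioi (fun r hr => hr) (mem_Ioi.2 hR) ?_ ?_ hW0
  · rw [hset]
    exact (hH.continuousOn.sub continuousOn_const).div (continuousOn_id.sub continuousOn_const)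
      fun z hz => sub_ne_zero.2 hz
  · intro z hz
    have hz' : z ≠ b := fun h => by subst h; simp at hz
    exact div_ne_zero (sub_ne_zero.2 fun h => hz' (hi h)) (sub_ne_zero.2 hz')

end BKE

namespace BKE
open Set Filter Topology Metric
open scoped unitInterval ComplexConjugate

/-! ### charts -/

def rho (P : S2) (x : S2) : S2 := ⟨(ℝ ∙ ((nS : EuclideanSpace ℝ (Fin 3)) - P))ᗮ.reflection x, by
  rw [mem_sphere_zero_iff_norm, LinearIsometryEquiv.norm_map]; exact mem_sphere_zero_iff_norm.1 x.2⟩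

theorem rho_cont (P : S2) : Continuous (rho P) := by
  apply Continuous.subtype_mk
  exact (LinearIsometryEquiv.continuous _).comp continuous_subtype_val

theorem rho_rho (P x : S2) : rho P (rho P x) = x := by
  apply Subtype.ext
  simp [rho]

theorem rho_nS (P : S2) : rho P nS = P := by
  apply Subtype.ext
  simp only [rho]
  apply Submodule.reflection_sub
  rw [mem_sphere_zero_iff_norm.1 nS.2, mem_sphere_zero_iff_norm.1 P.2]

theorem rho_inj (P : S2) : Function.Injective (rho P) := (show Function.LeftInverse (rho P) (rho P) from rho_rho P).injective

theorem rho_ne {P x : S2} (h : x ≠ P) : rho P x ≠ nS := fun e => h (rho_inj P (by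
  rw [e]
  have := rho_nS P
  have h2 := rho_rho P nS
  rw [this] at h2
  exact h2.symm))

def ch (P : S2) (z : ℂ) : S2 := rho P (st z)
def chi (P : S2) (k : S2) : ℂ := stinv (rho P k)

theorem ch_cont (P : S2) : Continuous (ch P) := (rho_cont P).comp st_cont
theorem ch_inj (P : S2) : Function.Injective (ch P) := (rho_inj P).comp st_inj
theorem ch_ne (P : S2) (z : ℂ) : ch P z ≠ P := fun h => by
  have h2 : rho P (st z) = rho P nS := by rw [rho_nS]; exact h
  exact st_ne z (rho_inj P h2)
theorem chi_cont (P : S2) : ContinuousOn (chi P) {P}ᶜ :=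
  stinv_cont.comp (rho_cont P).continuousOn fun x hx => rho_ne hx
theorem ch_chi {P k : S2} (h : k ≠ P) : ch P (chi P k) = k := by
  unfold ch chi
  rw [st_stinv (rho_ne h), rho_rho]
theorem chi_ch (P : S2) (z : ℂ) : chi P (ch P z) = z := ch_inj P (ch_chi (ch_ne P z))

theorem range_ch (P : S2) : range (ch P) = {P}ᶜ := by
  ext x
  constructor
  · rintro ⟨z, rfl⟩; exact ch_ne P z
  · intro h; exact ⟨_, ch_chi h⟩

theorem ch_open (P : S2) {U : Set ℂ} (hU : IsOpen U) : IsOpen (ch P '' U) := by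
  have : ch P '' U = {P}ᶜ ∩ chi P ⁻¹' U := by
    ext x
    constructor
    · rintro ⟨z, hz, rfl⟩
      exact ⟨ch_ne P z, by rw [mem_preimage, chi_ch]; exact hz⟩
    · rintro ⟨h1, h2⟩
      exact ⟨_, h2, ch_chi h1⟩
  rw [this]
  exact (chi_cont P).isOpen_inter_preimage isOpen_compl_singleton hU

/-- the map in the chart -/
def cm (P : S2) (f : S2 → S2) (z : ℂ) : ℂ := chi P (f (ch P z))

theorem cm_spec {P : S2} {f : S2 → S2} (hi : Function.Injective f) (hP : f P = P) (z : ℂ) :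
    ch P (cm P f z) = f (ch P z) :=
  ch_chi fun h => ch_ne P z (hi (h.trans hP.symm))

theorem cm_cont {P : S2} {f : S2 → S2} (hf : Continuous f) (hi : Function.Injective f) (hP : f P = P) :
    Continuous (cm P f) := by
  rw [← continuousOn_univ]
  exact (chi_cont P).comp (hf.comp (ch_cont P)).continuousOn
    fun z _ h => ch_ne P z (hi (h.trans hP.symm))

theorem cm_iter {P : S2} {f : S2 → S2} (hi : Function.Injective f) (hP : f P = P) (k : ℕ) (z : ℂ) :
    ch P ((cm P f)^[k] z) = f^[k] (ch P z) := by
  induction k with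
  | zero => rfl
  | succ k ih =>
    rw [Function.iterate_succ_apply' f, Function.iterate_succ_apply' (cm P f), cm_spec hi hP, ih]

theorem iter_fix {X : Type*} {f : X → X} {P : X} (hP : f P = P) (k : ℕ) : f^[k] P = P :=
  Function.iterate_fixed hP k

theorem inj_of_iter {X : Type*} {f : X → X} {n : ℕ} (hn : 1 ≤ n) (h : f^[n] = id) : Function.Injective f := by
  obtain ⟨m, rfl⟩ : ∃ m, n = m + 1 := ⟨n - 1, by omega⟩
  intro x y e
  have h1 := congrFun h x
  have h2 := congrFun h y
  rw [Function.iterate_succ_apply, id] at h1 h2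
  rw [← h1, ← h2, e]

theorem cm_iter_id {P : S2} {f : S2 → S2} {n : ℕ} (hn : 1 ≤ n) (h : f^[n] = id) (hP : f P = P) :
    (cm P f)^[n] = id := by
  funext z
  apply ch_inj P
  rw [cm_iter (inj_of_iter hn h) hP, h]
  rfl

theorem cm_ori {P : S2} {f : S2 → S2} (hf : HId f) {n : ℕ} (hn : 1 ≤ n) (h : f^[n] = id) (hP : f P = P) :
    Ori (cm P f) := by
  have hi := inj_of_iter hn h
  have hc := cm_cont hf.continuous hi hP
  have hid := cm_iter_id hn h hP
  have hHi := inj_of_iter hn hid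
  have hrn : rho P P = nS := by
    have h2 := rho_rho P nS
    rwa [rho_nS] at h2
  refine ori_of_HId (hf.conj (rho_cont P) (rho_cont P) (rho_rho P)) hc hHi ?_ ?_ ?_
  · obtain ⟨m, rfl⟩ : ∃ m, n = m + 1 := ⟨n - 1, by omega⟩
    let e : ℂ ≃ₜ ℂ :=
      { toFun := cm P f
        invFun := (cm P f)^[m]
        left_inv := fun z => by
          have := congrFun hid z
          rwa [Function.iterate_succ_apply] at this
        right_inv := fun z => by
          have := congrFun hid z
          rwa [Function.iterate_succ_apply'] at this
        continuous_toFun := hc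
        continuous_invFun := hc.iterate m }
    exact e.isClosedEmbedding.tendsto_cocompact
  · intro z
    have := cm_spec hi hP z
    unfold ch at this
    rw [← this, rho_rho]
  · rw [rho_nS, hP, hrn]

theorem two_points {f : S2 → S2} (hf : HId f) {n : ℕ} (hn : 2 ≤ n) (h : f^[n] = id)
    (hmin : ∀ k, 0 < k → k < n → f^[k] ≠ id) :
    ∃ N S, N ≠ S ∧ f N = N ∧ f S = S ∧ ∀ k, 0 < k → k < n → ∀ x, f^[k] x = x → x = N ∨ x = S := by
  obtain ⟨N, hN⟩ := hf.fixed
  have hi := inj_of_iter (by omega) h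
  have hHid := cm_iter_id (by omega) h hN
  set H := cm N f with hH
  have hHc : Continuous H := cm_cont hf.continuous hi hN
  have hori : Ori H := cm_ori hf (by omega) h hN
  have hHi : Function.Injective H := inj_of_iter (by omega) hHid
  have key : ∀ p, p.Prime → p ∣ n → ∃ b, H b = b ∧ ∀ z, H^[n / p] z = z → z = b := by
    intro p hp hpn
    have hdp : 0 < n / p := Nat.div_pos (Nat.le_of_dvd (by omega) hpn) hp.pos
    have h1 : (H^[n/p])^[p] = id := by
      rw [← Function.iterate_mul, Nat.div_mul_cancel hpn, hHid]
    have h2 : H^[n/p] ≠ id := by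
      intro e
      refine hmin (n/p) hdp (Nat.div_lt_self (by omega) hp.one_lt) ?_
      funext x
      by_cases hx : x = N
      · rw [hx, iter_fix hN]; rfl
      · rw [← ch_chi hx, ← cm_iter hi hN, ← hH, e]; rfl
    obtain ⟨b, hb, hb'⟩ := theorem_AB (hHc.iterate _) hp h1 (hori.iterate hHc hHi _) h2
    refine ⟨b, hb' _ ?_, hb'⟩
    rw [← Function.iterate_succ_apply, Function.iterate_succ_apply', hb]
  obtain ⟨p0, hp0, hp0n⟩ := Nat.exists_prime_and_dvd (show n ≠ 1 by omega)
  obtain ⟨b, hb, hb'⟩ := key p0 hp0 hp0n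
  refine ⟨N, ch N b, (ch_ne N b).symm, hN, ?_, ?_⟩
  · rw [← cm_spec hi hN, ← hH, hb]
  · intro k hk hkn x hx
    by_cases hxN : x = N
    · exact Or.inl hxN
    right
    rw [← ch_chi hxN] at hx ⊢
    rw [← cm_iter hi hN, ← hH] at hx
    have hx1 : H^[k] (chi N x) = chi N x := ch_inj N hx
    generalize chi N x = z at *
    have hg : Function.IsPeriodicPt H (k.gcd n) z := by
      apply Function.IsPeriodicPt.gcd
      · exact hx1
      · exact congrFun hHid z
    have hdn : k.gcd n ∣ n := Nat.gcd_dvd_right k n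
    have hdk : k.gcd n ≤ k := Nat.le_of_dvd hk (Nat.gcd_dvd_left k n)
    have hd0 : 0 < k.gcd n := Nat.gcd_pos_of_pos_left _ hk
    obtain ⟨e, he⟩ := hdn
    have he1 : e ≠ 1 := by rintro rfl; omega
    obtain ⟨p, hp, e', rfl⟩ := Nat.exists_prime_and_dvd he1
    have hpn : p ∣ n := ⟨k.gcd n * e', he.trans (by ring)⟩
    obtain ⟨b1, hb1, hb1'⟩ := key p hp hpn
    have e1 : n / p = k.gcd n * e' := by
      apply Nat.div_eq_of_eq_mul_left hp.pos
      rw [mul_assoc, mul_comm e' p]; exact he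
    have hz : z = b1 := by
      apply hb1'
      rw [e1]
      exact hg.mul_const e'
    have hbb : b1 = b := hb' _ (iter_fix hb1 _)
    rw [hz, hbb]

end BKE

namespace BKE
open Set Filter Topology Metric
open scoped unitInterval ComplexConjugate

/-! ### Jordan curves on the sphere -/

/-- `C` is a connected component of the complement of `K`. -/
structure Cmp (K C : Set S2) : Prop where
  op : IsOpen C
  pre : IsPreconnected C
  ne : C.Nonempty
  disj : Disjoint C K
  cl : closure C ⊆ C ∪ K

theorem Cmp.absorb {K C T : Set S2} (h : Cmp K C) (hT : IsPreconnected T) (hd : Disjoint T K)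
    (hne : (T ∩ C).Nonempty) : T ⊆ C := by
  refine hT.subset_left_of_subset_union h.op isClosed_closure.isOpen_compl
    (disjoint_left.2 fun x hx hx' => hx' (subset_closure hx)) (fun x hx => ?_) hne
  by_cases hxc : x ∈ closure C
  · rcases h.cl hxc with h1 | h1
    · exact Or.inl h1
    · exact absurd h1 (disjoint_left.1 hd hx)
  · exact Or.inr hxc

theorem Cmp.eq {K C D : Set S2} (h : Cmp K C) (h' : Cmp K D) (hne : (C ∩ D).Nonempty) : C = D :=
  Subset.antisymm (h'.absorb h.pre h.disj hne) (h.absorb h'.pre h'.disj (by rwa [inter_comm]))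

theorem compl_pair_eq {P Q : S2} (h : Q ≠ P) : ({P, Q} : Set S2)ᶜ = ch P '' {chi P Q}ᶜ := by
  ext x
  constructor
  · intro hx
    simp only [mem_compl_iff, mem_insert_iff, mem_singleton_iff, not_or] at hx
    refine ⟨chi P x, fun e => hx.2 ?_, ch_chi hx.1⟩
    rw [← ch_chi hx.1, mem_singleton_iff.1 e, ch_chi h]
  · rintro ⟨z, hz, rfl⟩
    simp only [mem_compl_iff, mem_insert_iff, mem_singleton_iff, not_or]
    refine ⟨ch_ne P z, fun e => hz ?_⟩
    rw [mem_singleton_iff, ← e, chi_ch]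

theorem compl_pair_preconnected {P Q : S2} (h : Q ≠ P) : IsPreconnected ({P, Q} : Set S2)ᶜ := by
  rw [compl_pair_eq h]
  exact (isConnected_compl_singleton_of_one_lt_rank (by simp) _).isPreconnected.image _ (ch_cont P).continuousOn

theorem S2_preconnected : IsPreconnected (univ : Set S2) := by
  have : IsConnected (sphere (0 : EuclideanSpace ℝ (Fin 3)) 1) := isConnected_sphere (by
    rw [← Module.finrank_eq_rank]; simp) 0 zero_le_one
  haveI : PreconnectedSpace S2 := Subtype.preconnectedSpace this.isPreconnected
  exact isPreconnected_univ

theorem not_open_singleton (P : S2) : ¬ IsOpen ({P} : Set S2) := by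
  intro h
  haveI : PreconnectedSpace S2 := ⟨S2_preconnected⟩
  have : ({P} : Set S2) = univ := IsClopen.eq_univ ⟨isClosed_singleton, h⟩ ⟨P, rfl⟩
  have h2 : ch P 0 ∈ ({P} : Set S2) := by rw [this]; trivial
  exact ch_ne P 0 h2

theorem IsJordan.exists_off {c : ℝ → S2} (hc : IsJordan c) : ∃ P, P ∉ range c := by
  by_contra hcon
  push Not at hcon
  have h01 : c (1/2) ≠ c 0 := by
    intro e
    obtain ⟨k, hk⟩ := hc.inj _ _ e
    have : (1:ℝ) = ((2 * k : ℤ) : ℝ) := by push_cast; linarith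
    have : (1:ℤ) = 2 * k := by exact_mod_cast this
    omega
  have hp := compl_pair_preconnected h01
  rw [isPreconnected_closed_iff] at hp
  have hA : IsClosed (c '' Icc 0 (1/2)) := (isCompact_Icc.image hc.cont).isClosed
  have hB : IsClosed (c '' Icc (1/2) 1) := (isCompact_Icc.image hc.cont).isClosed
  have hinj : ∀ s ∈ Icc (0:ℝ) 1, ∀ t ∈ Icc (0:ℝ) 1, c s = c t → s = t ∨ (s = 0 ∧ t = 1) ∨ (s = 1 ∧ t = 0) := by
    intro s hs t ht e
    obtain ⟨k, hk⟩ := hc.inj _ _ e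
    have h1 : (k:ℝ) ≤ 1 := by linarith [hs.2, ht.1]
    have h2 : (-1:ℝ) ≤ k := by linarith [hs.1, ht.2]
    have h1' : k ≤ 1 := by exact_mod_cast h1
    have h2' : -1 ≤ k := by exact_mod_cast h2
    have : k = -1 ∨ k = 0 ∨ k = 1 := by omega
    rcases this with rfl | rfl | rfl
    · push_cast at hk; right; left; constructor <;> linarith [hs.1, hs.2, ht.1, ht.2]
    · push_cast at hk; left; linarith
    · push_cast at hk; right; right; constructor <;> linarith [hs.1, hs.2, ht.1, ht.2]
  have hmem : ∀ s ∈ Icc (0:ℝ) 1, s ≠ 0 → s ≠ 1/2 → s ≠ 1 → c s ∈ ({c 0, c (1/2)} : Set S2)ᶜ := by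
    intro s hs h0 h2 h1 hm
    rcases hm with e | e
    · rcases hinj s hs 0 (by simp) e with h | h | h
      · exact h0 h
      · exact h0 h.1
      · exact h1 h.1
    · rcases hinj s hs (1/2) (by norm_num) e with h | h | h
      · exact h2 h
      · exact h0 h.1
      · exact h1 h.1
  have hcov : ({c 0, c (1/2)} : Set S2)ᶜ ⊆ c '' Icc 0 (1/2) ∪ c '' Icc (1/2) 1 := by
    intro x _
    obtain ⟨t, rfl⟩ := hcon x
    obtain ⟨s, hs, e⟩ := exists_rep hc.per 0 t
    rw [← e]
    rcases le_total s (1/2) with h | h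
    · left; exact ⟨s, ⟨hs.1, h⟩, rfl⟩
    · right; exact ⟨s, ⟨h, by linarith [hs.2]⟩, rfl⟩
  obtain ⟨x, hx, ⟨s, hs, rfl⟩, ⟨t, ht, hst⟩⟩ := hp _ _ hA hB hcov
    ⟨c (1/4), hmem _ (by norm_num) (by norm_num) (by norm_num) (by norm_num), 1/4, by norm_num, rfl⟩
    ⟨c (3/4), hmem _ (by norm_num) (by norm_num) (by norm_num) (by norm_num), 3/4, by norm_num, rfl⟩
  · have hs' : s ∈ Icc (0:ℝ) 1 := ⟨hs.1, by linarith [hs.2]⟩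
    have ht' : t ∈ Icc (0:ℝ) 1 := ⟨by linarith [ht.1], ht.2⟩
    apply hx
    rcases hinj t ht' s hs' hst with h | h | h
    · right
      have : s = 1/2 := le_antisymm hs.2 (by rw [← h]; exact ht.1)
      rw [this]; rfl
    · exfalso; linarith [ht.1, h.1]
    · left; rw [h.2]

theorem IsJordan.chart {c : ℝ → S2} (hc : IsJordan c) {P : S2} (hP : P ∉ range c) :
    IsJordan (fun t => chi P (c t)) := by
  have hne : ∀ t, c t ≠ P := fun t h => hP ⟨t, h⟩
  refine ⟨?_, fun t => by rw [hc.per], fun s t e => hc.inj s t ?_⟩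
  · rw [← continuousOn_univ]
    exact (chi_cont P).comp hc.cont.continuousOn fun t _ => hne t
  · rw [← ch_chi (hne s), ← ch_chi (hne t), e]

theorem chart_range {c : ℝ → S2} {P : S2} (hP : P ∉ range c) :
    ch P '' range (fun t => chi P (c t)) = range c := by
  rw [← range_comp]
  congr 1
  funext t
  exact ch_chi fun h => hP ⟨t, h⟩

theorem chart_jordan {c : ℝ → S2} (hc : IsJordan c) {P : S2} (hP : P ∉ range c) :
    ∃ C D, C = ch P '' inside (fun t => chi P (c t)) ∧ P ∈ D ∧ Cmp (range c) C ∧ Cmp (range c) D ∧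
      Disjoint C D ∧ C ∪ D = (range c)ᶜ ∧ range c ⊆ closure C ∧ range c ⊆ closure D := by
  have hr := chart_range hP
  have hj := hc.chart hP
  set c' : ℝ → ℂ := fun t => chi P (c t)
  have hL : IsCompact (ch P '' closure (inside c')) := hj.isCompact_closure.image (ch_cont P)
  have hLe : ch P '' closure (inside c') = ch P '' inside c' ∪ range c := by
    rw [hj.closure_inside, image_union, hr]
  have hPL : P ∉ ch P '' closure (inside c') := by rintro ⟨z, -, e⟩; exact ch_ne P z e
  have hDe : (ch P '' closure (inside c'))ᶜ = ch P '' outside c' ∪ {P} := by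
    rw [← hj.compl_closure_inside]
    ext x
    constructor
    · intro hx
      by_cases h : x = P
      · exact Or.inr h
      · exact Or.inl ⟨chi P x, fun h' => hx ⟨_, h', ch_chi h⟩, ch_chi h⟩
    · rintro (⟨z, hz, rfl⟩ | h)
      · rintro ⟨w, hw, e⟩
        rw [ch_inj P e] at hw
        exact hz hw
      · rw [mem_singleton_iff.1 h]; exact hPL
  have hCo : IsOpen (ch P '' inside c') := ch_open P hj.inside_open
  have hDo : IsOpen (ch P '' closure (inside c'))ᶜ := hL.isClosed.isOpen_compl
  have hCr : Disjoint (ch P '' inside c') (range c) := by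
    rw [← hr]
    refine (disjoint_image_iff (ch_inj P)).2 ?_
    exact disjoint_left.2 fun z h h' => h.1 h'
  have hPcl : P ∈ closure (ch P '' outside c') := by
    by_contra hcon
    apply not_open_singleton P
    have : ({P} : Set S2) = (closure (ch P '' outside c'))ᶜ ∩ (ch P '' closure (inside c'))ᶜ := by
      ext x
      constructor
      · intro h; rw [mem_singleton_iff.1 h]; exact ⟨hcon, hPL⟩
      · rintro ⟨h1, h2⟩
        rw [hDe] at h2
        rcases h2 with h | h
        · exact absurd (subset_closure h) h1
        · exact h
    rw [this]
    exact isClosed_closure.isOpen_compl.inter hDo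
  refine ⟨_, _, rfl, hPL, ⟨hCo, hj.inside_connected.isPreconnected.image _ (ch_cont P).continuousOn,
    hj.inside_connected.nonempty.image _, hCr, ?_⟩, ⟨hDo, ?_, ⟨P, hPL⟩, ?_, ?_⟩, ?_, ?_, ?_, ?_⟩
  · rw [← hLe]
    exact closure_minimal (image_mono subset_closure) hL.isClosed
  · rw [hDe]
    refine (hj.outside_connected.isPreconnected.image _ (ch_cont P).continuousOn).subset_closure
      subset_union_left (union_subset subset_closure ?_)
    rintro _ rfl
    exact hPcl
  · rw [hLe]
    exact disjoint_left.2 fun x h h' => h (Or.inr h')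
  · have h1 : closure (ch P '' closure (inside c'))ᶜ ⊆ (ch P '' inside c')ᶜ :=
      closure_minimal (compl_subset_compl.2 (image_mono subset_closure)) hCo.isClosed_compl
    intro x hx
    by_cases h : x ∈ range c
    · exact Or.inr h
    · left
      rw [hLe]
      rintro (h' | h')
      · exact h1 hx h'
      · exact h h'
  · exact disjoint_left.2 fun x h h' => h' (image_mono subset_closure h)
  · rw [hLe]
    ext x
    constructor
    · rintro (h | h)
      · exact disjoint_left.1 hCr h
      · exact fun h' => h (Or.inr h')
    · intro h
      by_cases hx : x ∈ ch P '' inside c'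
      · exact Or.inl hx
      · exact Or.inr fun h' => h'.elim hx h
  · rw [← hr]
    exact (image_mono hj.subset_closure_inside).trans (image_closure_subset_closure_image (ch_cont P))
  · rw [← hr, hDe]
    exact (image_mono hj.subset_closure_outside).trans ((image_closure_subset_closure_image (ch_cont P)).trans
      (closure_mono subset_union_left))

theorem IsJordan.other {c : ℝ → S2} (hc : IsJordan c) {C : Set S2} (h : Cmp (range c) C) :
    ∃ D, Cmp (range c) D ∧ Disjoint C D ∧ C ∪ D = (range c)ᶜ ∧ range c ⊆ closure C ∧ range c ⊆ closure D := by
  obtain ⟨P, hP⟩ := hc.exists_off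
  obtain ⟨A, B, -, -, hA, hB, hd, hu, h1, h2⟩ := chart_jordan hc hP
  obtain ⟨x, hx⟩ := h.ne
  have hx' : x ∈ A ∪ B := by rw [hu]; exact disjoint_left.1 h.disj hx
  rcases hx' with h' | h'
  · rw [h.eq hA ⟨x, hx, h'⟩]
    exact ⟨B, hB, hd, hu, h1, h2⟩
  · rw [h.eq hB ⟨x, hx, h'⟩]
    exact ⟨A, hA, hd.symm, by rw [union_comm, hu], h2, h1⟩

theorem IsJordan.two {c : ℝ → S2} (hc : IsJordan c) :
    ∃ C D, Cmp (range c) C ∧ Cmp (range c) D ∧ Disjoint C D ∧ C ∪ D = (range c)ᶜ := by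
  obtain ⟨P, hP⟩ := hc.exists_off
  obtain ⟨A, B, -, -, hA, hB, hd, hu, h1, h2⟩ := chart_jordan hc hP
  exact ⟨A, B, hA, hB, hd, hu⟩

theorem IsJordan.cl_eq {c : ℝ → S2} (hc : IsJordan c) {C : Set S2} (h : Cmp (range c) C) :
    closure C = C ∪ range c := by
  obtain ⟨D, _, _, _, h1, _⟩ := hc.other h
  exact Subset.antisymm h.cl (union_subset subset_closure h1)

theorem IsJordan.cmp_inside {c : ℝ → S2} (hc : IsJordan c) {C : Set S2} (h : Cmp (range c) C) {P : S2}
    (hP : P ∉ range c) (hPC : P ∉ C) : C = ch P '' inside (fun t => chi P (c t)) := by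
  obtain ⟨A, B, hAe, hPB, hA, hB, hd, hu, h1, h2⟩ := chart_jordan hc hP
  obtain ⟨x, hx⟩ := h.ne
  have hx' : x ∈ A ∪ B := by rw [hu]; exact disjoint_left.1 h.disj hx
  rcases hx' with h' | h'
  · rw [h.eq hA ⟨x, hx, h'⟩, hAe]
  · rw [h.eq hB ⟨x, hx, h'⟩] at hPC
    exact absurd hPB hPC

theorem IsJordan.exists_ext {c : ℝ → S2} (hc : IsJordan c) {C : Set S2} (h : Cmp (range c) C) :
    ∃ P, P ∉ range c ∧ P ∉ C := by
  obtain ⟨D, hD, hd, _, _, _⟩ := hc.other h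
  obtain ⟨P, hP⟩ := hD.ne
  exact ⟨P, disjoint_left.1 hD.disj hP, disjoint_right.1 hd hP⟩

theorem IsJordan.schoen {c : ℝ → S2} (hc : IsJordan c) {C : Set S2} (h : Cmp (range c) C) :
    ∃ Ψ : ℂ → S2, ContinuousOn Ψ (closedBall 0 1) ∧ InjOn Ψ (closedBall 0 1) ∧
      Ψ '' closedBall 0 1 = closure C ∧ Ψ '' ball 0 1 = C ∧ ∀ t, Ψ (circ 0 1 t) = c t := by
  obtain ⟨P, hP, hPC⟩ := hc.exists_ext h
  have he := hc.cmp_inside h hP hPC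
  have hr := chart_range hP
  have hj := hc.chart hP
  obtain ⟨Ψ, h1, h2, h3, h4, h5⟩ := schoenflies hj
  refine ⟨fun z => ch P (Ψ z), (ch_cont P).comp_continuousOn h1, fun z hz w hw e => h2 hz hw (ch_inj P e), ?_, ?_, fun t => ?_⟩
  · rw [← image_image (ch P) Ψ, h3, hc.cl_eq h, he, hj.closure_inside, image_union, hr]
  · rw [← image_image (ch P) Ψ, h4, he]
  · dsimp only; rw [h5]; exact ch_chi fun h => hP ⟨t, h⟩

theorem IsJordan.cmp_hasLog {c : ℝ → S2} (hc : IsJordan c) {C : Set S2} (h : Cmp (range c) C)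
    {g : S2 → ℂ} (hg : ContinuousOn g C) (h0 : ∀ x ∈ C, g x ≠ 0) : HasLog g C := by
  obtain ⟨Ψ, h1, h2, h3, h4, h5⟩ := hc.schoen h
  obtain ⟨Ξ, hΞ, hΞΨ⟩ := descend_compact (isCompact_closedBall (0:ℂ) 1) h1 h2 continuousOn_id
  have hm : MapsTo Ψ (ball 0 1) C := fun z hz => by rw [← h4]; exact ⟨z, hz, rfl⟩
  obtain ⟨u, hu, he⟩ := hasLog_convex (convex_ball (0:ℂ) 1) (g := fun z => g (Ψ z))
    (hg.comp (h1.mono ball_subset_closedBall) hm) (fun z hz => h0 _ (hm hz))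
  have hm2 : MapsTo Ξ C (ball 0 1) := by
    intro x hx
    rw [← h4] at hx
    obtain ⟨z, hz, rfl⟩ := hx
    rw [hΞΨ z (ball_subset_closedBall hz)]
    exact hz
  refine ⟨fun x => u (Ξ x), hu.comp (hΞ.mono ?_) hm2, ?_⟩
  · rw [← h4]; exact image_mono ball_subset_closedBall
  · intro x hx
    rw [← h4] at hx
    obtain ⟨z, hz, rfl⟩ := hx
    dsimp only
    rw [hΞΨ z (ball_subset_closedBall hz)]
    exact he z hz

theorem theta {c1 c2 c3 : ℝ → S2} (h1 : IsJordan c1) (h2 : IsJordan c2) (h3 : IsJordan c3) {E F V : Set S2}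
    (hE : Cmp (range c1) E) (hF : Cmp (range c2) F) (hV : Cmp (range c3) V) {P : S2}
    (p1 : P ∉ range c1) (p2 : P ∉ range c2) (p3 : P ∉ range c3) (pE : P ∉ E) (pF : P ∉ F) (pV : P ∉ V)
    (hr : range c3 ⊆ range c1 ∪ range c2) (hpre : IsPreconnected (closure E ∩ closure F)) :
    V ⊆ closure E ∪ closure F := by
  have e1 := h1.cmp_inside hE p1 pE
  have e2 := h2.cmp_inside hF p2 pF
  have e3 := h3.cmp_inside hV p3 pV
  have cl1 := h1.cl_eq hE
  have cl2 := h2.cl_eq hF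
  have r1 := chart_range p1
  have r2 := chart_range p2
  have r3 := chart_range p3
  have j1 := h1.chart p1
  have j2 := h2.chart p2
  have j3 := h3.chart p3
  set k1 : ℝ → ℂ := fun t => chi P (c1 t)
  set k2 : ℝ → ℂ := fun t => chi P (c2 t)
  set k3 : ℝ → ℂ := fun t => chi P (c3 t)
  have A1 : closure E = ch P '' closure (inside k1) := by rw [cl1, e1, j1.closure_inside, image_union, r1]
  have A2 : closure F = ch P '' closure (inside k2) := by rw [cl2, e2, j2.closure_inside, image_union, r2]
  have hpre' : IsPreconnected (closure (inside k1) ∩ closure (inside k2)) := by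
    have : closure (inside k1) ∩ closure (inside k2) = chi P '' (closure E ∩ closure F) := by
      rw [A1, A2, ← image_inter (ch_inj P), image_image]
      simp [chi_ch]
    rw [this]
    refine hpre.image _ ((chi_cont P).mono ?_)
    rintro x ⟨hx, -⟩
    rw [A1] at hx
    obtain ⟨z, -, rfl⟩ := hx
    exact ch_ne P z
  intro x hx
  rw [e3] at hx
  obtain ⟨z, hz, rfl⟩ := hx
  by_contra hcon
  have z1 : z ∉ closure (inside k1) := fun h => hcon (Or.inl (by rw [A1]; exact ⟨z, h, rfl⟩))
  have z2 : z ∉ closure (inside k2) := fun h => hcon (Or.inr (by rw [A2]; exact ⟨z, h, rfl⟩))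
  obtain ⟨R, hR⟩ := ((j1.isCompact.union j2.isCompact).union j3.isCompact).isBounded.subset_ball 0
  set y : ℂ := ((|R| : ℝ) : ℂ)
  have hy : R ≤ ‖y‖ := by simp [y, le_abs_self]
  have y1 : y ∈ outside k1 := j1.outside_far ((subset_union_left.trans subset_union_left).trans hR) hy
  have y2 : y ∈ outside k2 := j2.outside_far ((subset_union_right.trans subset_union_left).trans hR) hy
  have y3 : y ∈ outside k3 := j3.outside_far (subset_union_right.trans hR) hy
  have J1 : JoinedIn (closure (inside k1))ᶜ z y := by
    rw [j1.compl_closure_inside]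
    exact (j1.outside_open.isConnected_iff_isPathConnected.1 j1.outside_connected).joinedIn _
      (by rw [← j1.compl_closure_inside]; exact z1) _ y1
  have J2 : JoinedIn (closure (inside k2))ᶜ z y := by
    rw [j2.compl_closure_inside]
    exact (j2.outside_open.isConnected_iff_isPathConnected.1 j2.outside_connected).joinedIn _
      (by rw [← j2.compl_closure_inside]; exact z2) _ y2
  have J3 := janiszewski j1.isCompact_closure j2.isCompact_closure hpre' J1 J2
  have hsub : range k3 ⊆ closure (inside k1) ∪ closure (inside k2) := by
    rintro _ ⟨t, rfl⟩
    have : c3 t ∈ range c1 ∪ range c2 := hr ⟨t, rfl⟩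
    rcases this with ⟨s, hs⟩ | ⟨s, hs⟩
    · exact Or.inl (j1.subset_closure_inside ⟨s, by simp only [k1, k3, hs]⟩)
    · exact Or.inr (j2.subset_closure_inside ⟨s, by simp only [k2, k3, hs]⟩)
  exact hz.2 (j3.wind_of_joined (J3.mono (compl_subset_compl.2 hsub)) y3.2)

end BKE

namespace BKE
open Set Filter Topology Metric
open scoped unitInterval ComplexConjugate

/-- A finite group acting on the sphere, freely off the two common fixed points `N`, `S`. -/
structure Act {Γ : Type} [AddCommGroup Γ] (a : Γ → S2 → S2) (N S : S2) : Prop where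
  cont : ∀ i, Continuous (a i)
  zero : ∀ x, a 0 x = x
  add : ∀ i j x, a (i + j) x = a i (a j x)
  fN : ∀ i, a i N = N
  fS : ∀ i, a i S = S
  free : ∀ i, i ≠ 0 → ∀ x, a i x = x → x = N ∨ x = S
  ne : N ≠ S
  hid : ∀ i, HId (a i)

theorem S2_path (N S : S2) : ∃ p : ℝ → S2, Continuous p ∧ p 0 = N ∧ p 1 = S := by
  have : IsPathConnected (sphere (0 : EuclideanSpace ℝ (Fin 3)) 1) := isPathConnected_sphere (by
    rw [← Module.finrank_eq_rank]; simp) 0 zero_le_one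
  haveI : PathConnectedSpace S2 := isPathConnected_iff_pathConnectedSpace.1 this
  obtain ⟨p⟩ := PathConnectedSpace.joined N S
  exact ⟨p.extend, p.continuous_extend, p.extend_zero, p.extend_one⟩

theorem mapCluster_unique {Y X Q : Type*} [TopologicalSpace X] [TopologicalSpace Q] [T2Space Q]
    [CompactSpace X] {q : X → Q} (hq : Continuous q) {l : Filter Y} {γ : Y → X} {c : Y → Q} {x₀ : X}
    (hc : Tendsto c l (𝓝 (q x₀))) (he : ∀ᶠ t in l, q (γ t) = c t) (hu : ∀ x, q x = q x₀ → x = x₀) :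
    Tendsto γ l (𝓝 x₀) := by
  apply tendsto_nhds_of_unique_mapClusterPt
  intro x hx
  apply hu
  have h1 : MapClusterPt (q x) l (q ∘ γ) := hx.continuousAt_comp hq.continuousAt
  have h2 : Tendsto (q ∘ γ) l (𝓝 (q x₀)) := hc.congr' (he.mono fun t ht => ht.symm)
  have h3 : (𝓝 (q x) ⊓ 𝓝 (q x₀)).NeBot := by
    have h4 : (𝓝 (q x) ⊓ map (q ∘ γ) l).NeBot := h1
    exact h4.mono (inf_le_inf_left _ h2)
  exact eq_of_nhds_neBot h3

theorem Act.arc {Γ : Type} [AddCommGroup Γ] [Finite Γ] {a : Γ → S2 → S2} {N S : S2} (h : Act a N S) :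
    ∃ γ : ℝ → S2, ContinuousOn γ (Icc 0 1) ∧ InjOn γ (Icc 0 1) ∧ γ 0 = N ∧ γ 1 = S ∧
      ∀ i, i ≠ 0 → ∀ s ∈ Icc (0:ℝ) 1, ∀ t ∈ Icc (0:ℝ) 1, a i (γ s) = γ t →
        (s = 0 ∧ t = 0) ∨ (s = 1 ∧ t = 1) := by
  letI iA : AddAction Γ S2 :=
    { vadd := fun i x => a i x
      zero_vadd := h.zero
      add_vadd := h.add }
  have hv : ∀ (i : Γ) (x : S2), i +ᵥ x = a i x := fun i x => rfl
  haveI : ContinuousConstVAdd Γ S2 := ⟨fun i => h.cont i⟩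
  haveI : SecondCountableTopology (Quotient (AddAction.orbitRel Γ S2)) :=
    ContinuousConstVAdd.secondCountableTopology
  let q : S2 → Quotient (AddAction.orbitRel Γ S2) := Quotient.mk _
  have hq : Continuous q := continuous_quot_mk
  have hqe : ∀ x y, q x = q y ↔ ∃ i, a i y = x := by
    intro x y
    exact Quotient.eq''.trans Iff.rfl
  have hqN : ∀ x, q x = q N → x = N := by
    intro x hx
    obtain ⟨i, hi⟩ := (hqe _ _).1 hx
    rw [← hi, h.fN]
  have hqS : ∀ x, q x = q S → x = S := by
    intro x hx
    obtain ⟨i, hi⟩ := (hqe _ _).1 hx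
    rw [← hi, h.fS]
  letI : MetricSpace (Quotient (AddAction.orbitRel Γ S2)) := TopologicalSpace.metrizableSpaceMetric _
  obtain ⟨p, hp, hp0, hp1⟩ := S2_path N S
  obtain ⟨c, hc, hci, hc0, hc1, -⟩ := arc_lemma (p := fun t => q (p t)) (hq.comp hp)
    (by try dsimp only
        rw [hp0, hp1]; exact fun e => h.ne (hqS _ e))
  try dsimp only at hc0 hc1
  rw [hp0] at hc0
  rw [hp1] at hc1
  have hcov := isCoveringMapOn_quotientMk_of_properlyDiscontinuousVAdd (G := Γ) (E := S2)
  have hU : IsOpen (Ioo (0:ℝ) 1) := isOpen_Ioo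
  haveI : LocallyPathConnectedSpace (Ioo (0:ℝ) 1) := hU.locallyPathConnectedSpace
  haveI : ContractibleSpace (Ioo (0:ℝ) 1) :=
    (convex_Ioo (0:ℝ) 1).contractibleSpace ⟨1/2, by norm_num⟩
  have hm : (1/2:ℝ) ∈ Ioo (0:ℝ) 1 := by norm_num
  obtain ⟨e₀, he₀⟩ : ∃ e, q e = c (1/2) := Quotient.exists_rep _
  have hIoo : ContinuousOn c (Ioo 0 1) := hc.mono Ioo_subset_Icc_self
  have h0m : (0:ℝ) ∈ Icc (0:ℝ) 1 := by simp
  have h1m : (1:ℝ) ∈ Icc (0:ℝ) 1 := by simp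
  obtain ⟨F, ⟨-, hF⟩, -⟩ := hcov.existsUnique_continuousMap_lifts (A := Ioo (0:ℝ) 1)
    ⟨fun t => c t, continuousOn_iff_continuous_domRestrict.1 hIoo⟩ (a₀ := ⟨1/2, hm⟩) (e₀ := e₀) he₀ (by
      rintro ⟨t, ht⟩
      have ht' := Ioo_subset_Icc_self ht
      obtain ⟨x, hx⟩ : ∃ e, q e = c t := Quotient.exists_rep _
      refine ⟨x, ?_, hx⟩
      change AddAction.stabilizer Γ x = ⊥
      rw [eq_bot_iff]
      intro i hi
      rw [AddSubgroup.mem_bot]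
      by_contra hi0
      have hi' : a i x = x := hi
      rcases h.free i hi0 x hi' with e | e
      · rw [e, ← hc0] at hx
        have := hci h0m ht' hx
        rw [← this] at ht; exact lt_irrefl _ ht.1
      · rw [e, ← hc1] at hx
        have := hci h1m ht' hx
        rw [← this] at ht; exact lt_irrefl _ ht.2)
  have hF' : ∀ t (ht : t ∈ Ioo (0:ℝ) 1), q (F ⟨t, ht⟩) = c t := fun t ht => congrFun hF ⟨t, ht⟩
  let γ : ℝ → S2 := fun t => if ht : t ∈ Ioo (0:ℝ) 1 then F ⟨t, ht⟩ else if t ≤ 0 then N else S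
  have hγ : ∀ t (ht : t ∈ Ioo (0:ℝ) 1), γ t = F ⟨t, ht⟩ := fun t ht => dif_pos ht
  have hγ0 : γ 0 = N := by
    have : (0:ℝ) ∉ Ioo (0:ℝ) 1 := by simp
    simp only [γ]; rw [dif_neg this, if_pos le_rfl]
  have hγ1 : γ 1 = S := by
    have : (1:ℝ) ∉ Ioo (0:ℝ) 1 := by simp
    simp only [γ]; rw [dif_neg this, if_neg (by norm_num)]
  have hqγ : ∀ t ∈ Icc (0:ℝ) 1, q (γ t) = c t := by
    intro t ht
    rcases eq_or_lt_of_le ht.1 with e | e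
    · rw [← e, hγ0, hc0]
    rcases eq_or_lt_of_le ht.2 with e' | e'
    · rw [e', hγ1, hc1]
    rw [hγ t ⟨e, e'⟩]
    exact hF' t ⟨e, e'⟩
  have hinj : InjOn γ (Icc 0 1) := fun s hs t ht e => hci hs ht (by rw [← hqγ s hs, ← hqγ t ht, e])
  refine ⟨γ, ?_, hinj, hγ0, hγ1, ?_⟩
  · intro t ht
    have hev : ∀ᶠ t in 𝓝[Icc (0:ℝ) 1] t, q (γ t) = c t := eventually_of_mem self_mem_nhdsWithin hqγ
    rcases eq_or_lt_of_le ht.1 with e | e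
    · subst e
      have h2 := hc 0 h0m
      unfold ContinuousWithinAt at h2 ⊢
      rw [hγ0]; rw [hc0] at h2
      exact mapCluster_unique hq h2 hev hqN
    rcases eq_or_lt_of_le ht.2 with e' | e'
    · subst e'
      have h2 := hc 1 h1m
      unfold ContinuousWithinAt at h2 ⊢
      rw [hγ1]; rw [hc1] at h2
      exact mapCluster_unique hq h2 hev hqS
    have h3 : ContinuousOn γ (Ioo 0 1) := by
      rw [continuousOn_iff_continuous_domRestrict]
      have : (Ioo (0:ℝ) 1).domRestrict γ = F := by
        funext t
        exact hγ t.1 t.2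
      rw [this]; exact F.continuous
    exact ((h3 t ⟨e, e'⟩).continuousAt (hU.mem_nhds ⟨e, e'⟩)).continuousWithinAt
  · intro i hi s hs t ht e
    have h1 : c s = c t := by
      rw [← hqγ s hs, ← hqγ t ht]
      exact ((hqe _ _).2 ⟨i, e⟩).symm
    have h2 := hci hs ht h1
    subst h2
    rcases h.free i hi _ e with e | e
    · left; have := hinj hs h0m (e.trans hγ0.symm); exact ⟨this, this⟩
    · right; have := hinj hs h1m (e.trans hγ1.symm); exact ⟨this, this⟩

end BKE

namespace BKE
open Set Filter Topology Metric
open scoped unitInterval ComplexConjugate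

/-- An action with a nice arc joining the two fixed points. -/
structure Sys {Γ : Type} [AddCommGroup Γ] (a : Γ → S2 → S2) (N S : S2) (γ : ℝ → S2) : Prop
    extends Act a N S where
  gc : ContinuousOn γ (Icc 0 1)
  gi : InjOn γ (Icc 0 1)
  g0 : γ 0 = N
  g1 : γ 1 = S
  gd : ∀ i, i ≠ 0 → ∀ s ∈ Icc (0:ℝ) 1, ∀ t ∈ Icc (0:ℝ) 1, a i (γ s) = γ t →
        (s = 0 ∧ t = 0) ∨ (s = 1 ∧ t = 1)

/-- open translates of the arc -/
def OA {Γ : Type} (a : Γ → S2 → S2) (γ : ℝ → S2) (i : Γ) : Set S2 := (fun t => a i (γ t)) '' Ioo 0 1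
/-- closed translates of the arc -/
def LA {Γ : Type} (a : Γ → S2 → S2) (γ : ℝ → S2) (i : Γ) : Set S2 := (fun t => a i (γ t)) '' Icc 0 1

section
variable {Γ : Type} [AddCommGroup Γ] {a : Γ → S2 → S2} {N S : S2} {γ : ℝ → S2}

theorem Act.inv_left (h : Act a N S) (i : Γ) (x : S2) : a (-i) (a i x) = x := by
  rw [← h.add, neg_add_cancel, h.zero]

theorem Act.inv_right (h : Act a N S) (i : Γ) (x : S2) : a i (a (-i) x) = x := by
  rw [← h.add, add_neg_cancel, h.zero]

/-- the homeomorphism of an element -/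
def Act.homeo (h : Act a N S) (i : Γ) : S2 ≃ₜ S2 where
  toFun := a i
  invFun := a (-i)
  left_inv := h.inv_left i
  right_inv := h.inv_right i
  continuous_toFun := h.cont i
  continuous_invFun := h.cont (-i)

theorem Act.homeo_coe (h : Act a N S) (i : Γ) : ⇑(h.homeo i) = a i := rfl

theorem Act.inj (h : Act a N S) (i : Γ) : Function.Injective (a i) := (h.homeo i).injective

theorem Act.image_image (h : Act a N S) (i j : Γ) (E : Set S2) : a i '' (a j '' E) = a (i + j) '' E := by
  rw [Set.image_image]
  exact image_congr fun x _ => (h.add i j x).symm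

theorem Act.image_zero (h : Act a N S) (E : Set S2) : a 0 '' E = E := by
  rw [show a 0 = id from funext h.zero, image_id]

theorem Act.cmp (h : Act a N S) (g : Γ) {K C : Set S2} (hC : Cmp K C) : Cmp (a g '' K) (a g '' C) := by
  refine ⟨?_, hC.pre.image _ (h.cont g).continuousOn, hC.ne.image _, ?_, ?_⟩
  · rw [← h.homeo_coe]; exact (h.homeo g).isOpenMap _ hC.op
  · exact (disjoint_image_iff (h.inj g)).2 hC.disj
  · rw [← image_union, ← h.homeo_coe, ← (h.homeo g).image_closure]
    exact image_mono hC.cl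

theorem OA_sub (i : Γ) : OA a γ i ⊆ LA a γ i := image_mono Ioo_subset_Icc_self

theorem Sys.L_eq (h : Sys a N S γ) (i : Γ) : LA a γ i = OA a γ i ∪ {N, S} := by
  apply Subset.antisymm
  · rintro _ ⟨t, ht, rfl⟩
    rcases eq_or_lt_of_le ht.1 with e | e
    · right; left; dsimp only; rw [← e, h.g0, h.fN]
    rcases eq_or_lt_of_le ht.2 with e' | e'
    · right; right; dsimp only; rw [e', h.g1, h.fS]; rfl
    · left; exact ⟨t, ⟨e, e'⟩, rfl⟩
  · refine union_subset (OA_sub i) ?_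
    rintro x (rfl | hx)
    · exact ⟨0, by simp, by dsimp only; rw [h.g0, h.fN]⟩
    · rw [mem_singleton_iff] at hx
      exact ⟨1, by simp, by dsimp only; rw [h.g1, h.fS, hx]⟩

theorem Sys.N_mem (h : Sys a N S γ) (i : Γ) : N ∈ LA a γ i := by
  rw [h.L_eq]; right; left; rfl

theorem Sys.S_mem (h : Sys a N S γ) (i : Γ) : S ∈ LA a γ i := by
  rw [h.L_eq]; right; right; rfl

theorem Sys.cross (h : Sys a N S γ) {i j : Γ} (hij : i ≠ j) {s t : ℝ} (hs : s ∈ Icc (0:ℝ) 1)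
    (ht : t ∈ Icc (0:ℝ) 1) (e : a i (γ s) = a j (γ t)) : (s = 0 ∧ t = 0) ∨ (s = 1 ∧ t = 1) := by
  apply h.gd (-j + i) (fun e => hij ?_) s hs t ht
  · rw [h.add, e, h.inv_left]
  · have := neg_add_eq_zero.1 e
    exact this.symm

theorem Sys.O_disj (h : Sys a N S γ) {i j : Γ} {x : S2} (hi : x ∈ OA a γ i) (hj : x ∈ OA a γ j) : i = j := by
  by_contra hij
  obtain ⟨s, hs, rfl⟩ := hi
  obtain ⟨t, ht, e⟩ := hj
  rcases h.cross hij (Ioo_subset_Icc_self hs) (Ioo_subset_Icc_self ht) e.symm with h1 | h1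
  · linarith [hs.1, h1.1]
  · linarith [hs.2, h1.1]

theorem Sys.N_notin (h : Sys a N S γ) (i : Γ) : N ∉ OA a γ i := by
  rintro ⟨t, ht, e⟩
  dsimp only at e
  rw [← h.fN i] at e
  have e2 := h.inj i e
  rw [← h.g0] at e2
  have := h.gi (Ioo_subset_Icc_self ht) (by simp) e2
  linarith [ht.1]

theorem Sys.S_notin (h : Sys a N S γ) (i : Γ) : S ∉ OA a γ i := by
  rintro ⟨t, ht, e⟩
  dsimp only at e
  rw [← h.fS i] at e
  have e2 := h.inj i e
  rw [← h.g1] at e2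
  have := h.gi (Ioo_subset_Icc_self ht) (by simp) e2
  linarith [ht.2]

theorem Sys.OL (h : Sys a N S γ) {i j : Γ} {x : S2} (hi : x ∈ OA a γ i) (hj : x ∈ LA a γ j) : i = j := by
  rw [h.L_eq] at hj
  rcases hj with hj | rfl | hj
  · exact h.O_disj hi hj
  · exact absurd hi (h.N_notin i)
  · rw [mem_singleton_iff] at hj; subst hj; exact absurd hi (h.S_notin i)

theorem Sys.O_ne (h : Sys a N S γ) (i : Γ) : (OA a γ i).Nonempty := ⟨_, 1/2, by norm_num, rfl⟩

theorem Sys.g_cont (h : Sys a N S γ) (i : Γ) : ContinuousOn (fun t => a i (γ t)) (Icc 0 1) :=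
  (h.cont i).comp_continuousOn h.gc

theorem Sys.O_pre (h : Sys a N S γ) (i : Γ) : IsPreconnected (OA a γ i) :=
  isPreconnected_Ioo.image _ ((h.g_cont i).mono Ioo_subset_Icc_self)

theorem Sys.L_pre (h : Sys a N S γ) (i : Γ) : IsPreconnected (LA a γ i) :=
  isPreconnected_Icc.image _ (h.g_cont i)

theorem Sys.O_image (h : Sys a N S γ) (g i : Γ) : a g '' OA a γ i = OA a γ (g + i) := by
  unfold OA
  rw [Set.image_image]
  exact image_congr fun t _ => (h.add _ _ _).symm

theorem Sys.L_image (h : Sys a N S γ) (g i : Γ) : a g '' LA a γ i = LA a γ (g + i) := by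
  unfold LA
  rw [Set.image_image]
  exact image_congr fun t _ => (h.add _ _ _).symm

theorem Sys.jordan (h : Sys a N S γ) {i j : Γ} (hij : i ≠ j) :
    ∃ c : ℝ → S2, IsJordan c ∧ range c = LA a γ i ∪ LA a γ j ∧
      (∀ t ∈ Icc (0:ℝ) (1/2), c t = a i (γ (2 * t))) ∧ (∀ t ∈ Icc (1/2:ℝ) 1, c t = a j (γ (2 - 2 * t))) :=
  two_arcs (h.g_cont i) (h.g_cont j) (fun s hs t ht e => h.gi hs ht (h.inj i e))
    (fun s hs t ht e => h.gi hs ht (h.inj j e)) (by rw [h.g0, h.fN, h.fN]) (by rw [h.g1, h.fS, h.fS])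
    (fun s hs t ht e => h.cross hij hs ht e)

theorem Sys.O_off (h : Sys a N S γ) {i j k : Γ} (hi : k ≠ i) (hj : k ≠ j) :
    Disjoint (OA a γ k) (LA a γ i ∪ LA a γ j) := by
  rw [disjoint_left]
  rintro x hx (h1 | h1)
  · exact hi (h.OL hx h1)
  · exact hj (h.OL hx h1)

theorem Sys.lens_ind [Finite Γ] (h : Sys a N S γ) (m : ℕ) : ∀ (i j : Γ) (C : Set S2), i ≠ j →
    Cmp (LA a γ i ∪ LA a γ j) C → {k | OA a γ k ⊆ C}.ncard ≤ m →
    ∃ i j E, i ≠ j ∧ Cmp (LA a γ i ∪ LA a γ j) E ∧ ∀ k, ¬ OA a γ k ⊆ E := by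
  induction m using Nat.strong_induction_on with
  | _ m ih =>
  intro i j C hij hC hm
  by_cases hk : ∃ k, OA a γ k ⊆ C
  swap
  · exact ⟨i, j, C, hij, hC, fun k hk' => hk ⟨k, hk'⟩⟩
  obtain ⟨k, hk⟩ := hk
  have hki : k ≠ i := by
    rintro rfl
    obtain ⟨x, hx⟩ := h.O_ne k
    exact disjoint_left.1 hC.disj (hk hx) (Or.inl (OA_sub k hx))
  have hkj : k ≠ j := by
    rintro rfl
    obtain ⟨x, hx⟩ := h.O_ne k
    exact disjoint_left.1 hC.disj (hk hx) (Or.inr (OA_sub k hx))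
  obtain ⟨c, hc, hcr, -⟩ := h.jordan hij
  rw [← hcr] at hC
  obtain ⟨D, hD, hCD, hu, h1, h2⟩ := hc.other hC
  rw [hcr] at hC hD hu h1 h2
  have hT : IsPreconnected (D ∪ OA a γ j) := hD.pre.subset_closure subset_union_left
    (union_subset subset_closure fun x hx => h2 (Or.inr (OA_sub j hx)))
  have hTd : Disjoint (D ∪ OA a γ j) (LA a γ i ∪ LA a γ k) := by
    rw [disjoint_left]
    rintro x (hx | hx) (h' | h')
    · exact disjoint_left.1 hD.disj hx (Or.inl h')
    · rw [h.L_eq] at h'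
      rcases h' with h' | h'
      · exact disjoint_left.1 hCD (hk h') hx
      · exact disjoint_left.1 hD.disj hx (by left; rw [h.L_eq]; right; exact h')
    · exact hij (h.OL hx h').symm
    · exact hkj (h.OL hx h').symm
  obtain ⟨c', hc', hcr', -⟩ := h.jordan hki.symm
  have key : ∀ A B, Cmp (LA a γ i ∪ LA a γ k) A → Cmp (LA a γ i ∪ LA a γ k) B → Disjoint A B →
      ((D ∪ OA a γ j) ∩ B).Nonempty → ∃ i j E, i ≠ j ∧ Cmp (LA a γ i ∪ LA a γ j) E ∧ ∀ k, ¬ OA a γ k ⊆ E := by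
    intro A B hA hB hAB hne
    have hTB := hB.absorb hT hTd hne
    have hAC : A ⊆ C := by
      intro x hx
      have hxB : x ∉ B := disjoint_left.1 hAB hx
      have hx1 : x ∉ D := fun h' => hxB (hTB (Or.inl h'))
      have hx2 : x ∉ OA a γ j := fun h' => hxB (hTB (Or.inr h'))
      have hx3 := disjoint_left.1 hA.disj hx
      have hx4 : x ∈ C ∪ D := by
        rw [hu]
        rintro (h' | h')
        · exact hx3 (Or.inl h')
        · rw [h.L_eq] at h'
          rcases h' with h' | h'
          · exact hx2 h'
          · exact hx3 (Or.inl (by rw [h.L_eq]; right; exact h'))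
      exact hx4.resolve_right hx1
    have hss : {l | OA a γ l ⊆ A} ⊂ {l | OA a γ l ⊆ C} := by
      have hsb : {l | OA a γ l ⊆ A} ⊆ {l | OA a γ l ⊆ C} := fun l hl => Subset.trans hl hAC
      rw [ssubset_iff_of_subset hsb]
      refine ⟨k, hk, fun hk' => ?_⟩
      obtain ⟨x, hx⟩ := h.O_ne k
      exact disjoint_left.1 hA.disj (hk' hx) (Or.inr (OA_sub k hx))
    have hlt := ncard_lt_ncard hss (toFinite _)
    exact ih _ (lt_of_lt_of_le hlt hm) i k A hki.symm hA le_rfl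
  obtain ⟨A, B, hA, hB, hAB, hABu⟩ := hc'.two
  rw [hcr'] at hA hB hABu
  obtain ⟨x, hx⟩ := h.O_ne j
  have hxu : x ∈ A ∪ B := by rw [hABu]; exact disjoint_left.1 hTd (Or.inr hx)
  rcases hxu with h' | h'
  · exact key B A hB hA hAB.symm ⟨x, Or.inr hx, h'⟩
  · exact key A B hA hB hAB ⟨x, Or.inr hx, h'⟩

/-- a minimal lens -/
structure Lens (a : Γ → S2 → S2) (γ : ℝ → S2) (d : Γ) (E : Set S2) : Prop where
  hd : d ≠ 0
  cmp : Cmp (LA a γ 0 ∪ LA a γ d) E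
  fr : ∀ k, Disjoint (OA a γ k) E

theorem Sys.lens [Finite Γ] [Nontrivial Γ] (h : Sys a N S γ) : ∃ d E, Lens a γ d E := by
  obtain ⟨j, hj⟩ := exists_ne (0 : Γ)
  obtain ⟨c, hc, hcr, -⟩ := h.jordan hj.symm
  obtain ⟨C, D, hC, -⟩ := hc.two
  rw [hcr] at hC
  obtain ⟨i, j, E, hij, hE, hfr⟩ := h.lens_ind _ 0 j C hj.symm hC le_rfl
  have h1 := h.cmp (-i) hE
  rw [image_union, h.L_image, h.L_image, neg_add_cancel] at h1
  refine ⟨-i + j, a (-i) '' E, fun e => hij (neg_add_eq_zero.1 e), h1, fun k => ?_⟩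
  have h2 : ∀ l, Disjoint (OA a γ l) E := by
    intro l
    by_cases hl : l = i ∨ l = j
    · apply Disjoint.symm
      apply hE.disj.mono_right
      rcases hl with rfl | rfl
      · exact (OA_sub l).trans subset_union_left
      · exact (OA_sub l).trans subset_union_right
    · push Not at hl
      by_contra hnd
      rw [not_disjoint_iff_nonempty_inter] at hnd
      exact hfr l (hE.absorb (h.O_pre l) (h.O_off hl.1 hl.2) hnd)
  have h3 := (disjoint_image_iff (h.inj (-i))).2 (h2 (i + k))
  rwa [h.O_image, neg_add_cancel_left] at h3

theorem disc_invol {c : ℝ → S2} (hc : IsJordan c) {E : Set S2} (hE : Cmp (range c) E) {φ : S2 → S2}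
    (hφ : Continuous φ) (hm : ∀ x ∈ E, φ x ∈ E) (h2 : ∀ x, φ (φ x) = x) : ∃ x ∈ E, φ x = x := by
  obtain ⟨Ψ, p1, p2, p3, p4, p5⟩ := hc.schoen hE
  obtain ⟨Ξ, hΞ, hΞΨ⟩ := descend_compact (isCompact_closedBall (0:ℂ) 1) p1 p2 continuousOn_id
  rw [p3] at hΞ
  have hΞ2 : ∀ x ∈ E, Ξ x ∈ ball (0:ℂ) 1 ∧ Ψ (Ξ x) = x := by
    intro x hx
    rw [← p4] at hx
    obtain ⟨z, hz, rfl⟩ := hx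
    rw [hΞΨ z (ball_subset_closedBall hz)]
    exact ⟨hz, rfl⟩
  have hΨm : ∀ z ∈ ball (0:ℂ) 1, Ψ z ∈ E := fun z hz => by rw [← p4]; exact ⟨z, hz, rfl⟩
  let e : ℂ ≃ₜ ball (0:ℂ) 1 := Homeomorph.unitBall
  have hB : ∀ z : ℂ, Ξ (φ (Ψ (e z))) ∈ ball (0:ℂ) 1 := fun z => (hΞ2 _ (hm _ (hΨm _ (e z).2))).1
  let T : ℂ → ℂ := fun z => e.symm ⟨Ξ (φ (Ψ (e z))), hB z⟩
  have hT : Continuous T := by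
    refine e.symm.continuous.comp (Continuous.subtype_mk ?_ _)
    have c1 : Continuous fun z : ℂ => Ψ (e z) :=
      p1.comp_continuous (continuous_subtype_val.comp e.continuous) fun z => ball_subset_closedBall (e z).2
    exact hΞ.comp_continuous (hφ.comp c1) fun z => subset_closure (hm _ (hΨm _ (e z).2))
  have heT : ∀ z, ((e (T z) : ball (0:ℂ) 1) : ℂ) = Ξ (φ (Ψ (e z))) := fun z => by
    simp only [T, Homeomorph.apply_symm_apply]
  have hT2 : T^[2] = id := by
    funext z
    show T (T z) = z
    apply e.injective
    apply Subtype.ext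
    rw [heT, heT, (hΞ2 _ (hm _ (hΨm _ (e z).2))).2, h2, hΞΨ _ (ball_subset_closedBall (e z).2)]
    rfl
  obtain ⟨b, hb⟩ := prime_fixed hT Nat.prime_two hT2
  refine ⟨Ψ (e b), hΨm _ (e b).2, ?_⟩
  have h3 := heT b
  rw [hb] at h3
  rw [← (hΞ2 _ (hm _ (hΨm _ (e b).2))).2, ← h3]

theorem Lens.N_notin {d : Γ} {E : Set S2} (l : Lens a γ d E) (h : Sys a N S γ) : N ∉ E :=
  fun h' => disjoint_left.1 l.cmp.disj h' (Or.inl (h.N_mem 0))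

theorem Lens.S_notin {d : Γ} {E : Set S2} (l : Lens a γ d E) (h : Sys a N S γ) : S ∉ E :=
  fun h' => disjoint_left.1 l.cmp.disj h' (Or.inl (h.S_mem 0))

theorem Lens.L_disj {d : Γ} {E : Set S2} (l : Lens a γ d E) (h : Sys a N S γ) (k : Γ) :
    Disjoint E (LA a γ k) := by
  rw [h.L_eq, disjoint_left]
  rintro x hx (h' | rfl | h')
  · exact disjoint_left.1 (l.fr k) h' hx
  · exact l.N_notin h hx
  · rw [mem_singleton_iff] at h'; subst h'; exact l.S_notin h hx

theorem Lens.img {d : Γ} {E : Set S2} (l : Lens a γ d E) (h : Sys a N S γ) (g : Γ) :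
    Cmp (LA a γ g ∪ LA a γ (g + d)) (a g '' E) := by
  have := h.cmp g l.cmp
  rwa [image_union, h.L_image, h.L_image, add_zero] at this

theorem Lens.img_disj {d : Γ} {E : Set S2} (l : Lens a γ d E) (h : Sys a N S γ) (g k : Γ) :
    Disjoint (a g '' E) (LA a γ k) := by
  have := (disjoint_image_iff (h.inj g)).2 (l.L_disj h (-g + k))
  rwa [h.L_image, add_neg_cancel_left] at this

theorem Sys.cl_cmp (h : Sys a N S γ) {i j : Γ} (hij : i ≠ j) {C : Set S2}
    (hC : Cmp (LA a γ i ∪ LA a γ j) C) : closure C = C ∪ (LA a γ i ∪ LA a γ j) := by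
  obtain ⟨c, hc, hcr, -⟩ := h.jordan hij
  rw [← hcr] at hC ⊢
  exact hc.cl_eq hC

theorem Lens.dich {d : Γ} {E : Set S2} (l : Lens a γ d E) (h : Sys a N S γ) {g : Γ}
    (hne : (E ∩ a g '' E).Nonempty) : a g '' E = E := by
  apply Subset.antisymm
  · refine l.cmp.absorb (l.img h g).pre ?_ (by rwa [inter_comm])
    exact disjoint_union_right.2 ⟨l.img_disj h g _, l.img_disj h g _⟩
  · refine (l.img h g).absorb l.cmp.pre ?_ hne
    exact disjoint_union_right.2 ⟨l.L_disj h _, l.L_disj h _⟩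

theorem Lens.noinv {d : Γ} {E : Set S2} (l : Lens a γ d E) (h : Sys a N S γ) {g : Γ} (hg : g ≠ 0) :
    Disjoint E (a g '' E) := by
  by_contra hnd
  rw [not_disjoint_iff_nonempty_inter] at hnd
  have he := l.dich h hnd
  have h1 := h.cl_cmp l.hd.symm l.cmp
  have h2 := h.cl_cmp (fun e => l.hd (left_eq_add.1 e)) (l.img h g)
  rw [he, h1] at h2
  have h3 : ∀ k, LA a γ k ⊆ LA a γ 0 ∪ LA a γ d → k = g ∨ k = g + d := by
    intro k hk
    obtain ⟨x, hx⟩ := h.O_ne k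
    have h4 : x ∈ E ∪ (LA a γ 0 ∪ LA a γ d) := Or.inr (hk (OA_sub k hx))
    rw [h2] at h4
    rcases h4 with h4 | h4 | h4
    · exact absurd h4 (disjoint_left.1 (l.fr k) hx)
    · exact Or.inl (h.OL hx h4)
    · exact Or.inr (h.OL hx h4)
  have h4 : g + d = 0 := by
    rcases h3 0 subset_union_left with e | e
    · exact absurd e.symm hg
    · exact e.symm
  have h5 : d = g := by
    rcases h3 d subset_union_right with e | e
    · exact e
    · exact absurd (right_eq_add.1 e) hg
  subst h5
  obtain ⟨c, hc, hcr, -⟩ := h.jordan l.hd.symm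
  have hE := l.cmp
  rw [← hcr] at hE
  obtain ⟨x, hx, hfx⟩ := disc_invol hc hE (h.cont d) (fun x hx => by rw [← he]; exact ⟨x, hx, rfl⟩)
    (fun x => by rw [← h.add, h4, h.zero])
  rcases h.free d hg x hfx with rfl | rfl
  · exact l.N_notin h hx
  · exact l.S_notin h hx

theorem Lens.cover2 {d : Γ} {E : Set S2} (l : Lens a γ d E) (h : Sys a N S γ) (h2 : d + d = 0) {x : S2}
    (hN : x ≠ N) (hS : x ≠ S) : ∃ g ∈ AddSubgroup.zmultiples d, x ∈ a g '' (E ∪ OA a γ 0) := by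
  obtain ⟨c, hc, hcr, -⟩ := h.jordan l.hd.symm
  have hE := l.cmp
  rw [← hcr] at hE
  obtain ⟨D, hD, hED, hu, -, -⟩ := hc.other hE
  rw [hcr] at hD hu
  have hF := l.img h d
  rw [h2, union_comm] at hF
  have hFD : a d '' E = D := by
    apply hF.eq hD
    obtain ⟨y, hy⟩ := hF.ne
    have h3 : y ∈ E ∪ D := by rw [hu]; exact disjoint_left.1 hF.disj hy
    exact ⟨y, hy, h3.resolve_left fun h' => disjoint_left.1 (l.noinv h l.hd) h' hy⟩
  have z0 : (0:Γ) ∈ AddSubgroup.zmultiples d := zero_mem _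
  have z1 := AddSubgroup.mem_zmultiples d
  by_cases hx : x ∈ LA a γ 0 ∪ LA a γ d
  · rw [h.L_eq, h.L_eq] at hx
    have hx' : x ∉ ({N, S} : Set S2) := by rintro (e | e); exacts [hN e, hS e]
    rcases hx with (h' | h') | (h' | h')
    · exact ⟨0, z0, by rw [h.image_zero]; exact Or.inr h'⟩
    · exact absurd h' hx'
    · exact ⟨d, z1, by rw [image_union, h.O_image, add_zero]; exact Or.inr h'⟩
    · exact absurd h' hx'
  · have h3 : x ∈ E ∪ D := by rw [hu]; exact hx
    rcases h3 with h' | h'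
    · exact ⟨0, z0, by rw [h.image_zero]; exact Or.inl h'⟩
    · exact ⟨d, z1, by rw [image_union, hFD]; exact Or.inl h'⟩

theorem Lens.nbhd {d : Γ} {E : Set S2} (l : Lens a γ d E) (h : Sys a N S γ) (h2 : d + d ≠ 0) :
    ∃ V, IsOpen V ∧ E ∪ OA a γ 0 ⊆ V ∧ V ⊆ E ∪ OA a γ 0 ∪ a (-d) '' E := by
  have hdd : d ≠ -d := fun e => h2 (by nth_rewrite 2 [e]; exact add_neg_cancel d)
  have hF := l.img h (-d)
  rw [neg_add_cancel] at hF
  have hd0 : -d ≠ 0 := neg_ne_zero.2 l.hd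
  obtain ⟨c1, hc1, hr1, -⟩ := h.jordan l.hd.symm
  obtain ⟨c2, hc2, hr2, -⟩ := h.jordan hd0
  obtain ⟨c3, hc3, hr3, -⟩ := h.jordan hdd
  have hO := h.O_off (k := 0) l.hd.symm hd0.symm
  obtain ⟨x, hx⟩ := h.O_ne 0
  obtain ⟨V, V', hV, hV', hVV, hu, hxV⟩ : ∃ V V', Cmp (range c3) V ∧ Cmp (range c3) V' ∧ Disjoint V V' ∧
      V ∪ V' = (range c3)ᶜ ∧ x ∈ V := by
    obtain ⟨A, B, hA, hB, hAB, hu⟩ := hc3.two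
    have : x ∈ A ∪ B := by rw [hu, hr3]; exact disjoint_left.1 hO hx
    rcases this with h' | h'
    · exact ⟨A, B, hA, hB, hAB, hu, h'⟩
    · exact ⟨B, A, hB, hA, hAB.symm, by rw [union_comm, hu], h'⟩
  obtain ⟨P, hP⟩ := hV'.ne
  have cE := h.cl_cmp l.hd.symm l.cmp
  have cF := h.cl_cmp hd0 hF
  have hEV : E ∪ OA a γ 0 ⊆ V := by
    refine hV.absorb (l.cmp.pre.subset_closure subset_union_left (union_subset subset_closure ?_)) ?_
      ⟨x, Or.inr hx, hxV⟩
    · rw [cE]; exact fun y hy => Or.inr (Or.inl (OA_sub 0 hy))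
    · rw [hr3]
      exact disjoint_union_left.2 ⟨disjoint_union_right.2 ⟨l.L_disj h _, l.L_disj h _⟩, hO⟩
  have hFV : a (-d) '' E ∪ OA a γ 0 ⊆ V := by
    refine hV.absorb (hF.pre.subset_closure subset_union_left (union_subset subset_closure ?_)) ?_
      ⟨x, Or.inr hx, hxV⟩
    · rw [cF]; exact fun y hy => Or.inr (Or.inr (OA_sub 0 hy))
    · rw [hr3]
      exact disjoint_union_left.2 ⟨disjoint_union_right.2 ⟨l.img_disj h _ _, l.img_disj h _ _⟩, hO⟩
  have hPV : P ∉ V := fun h' => disjoint_left.1 hVV h' hP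
  have hP3 : P ∉ LA a γ d ∪ LA a γ (-d) := by rw [← hr3]; exact disjoint_left.1 hV'.disj hP
  have hP0 : P ∉ LA a γ 0 := by
    rw [h.L_eq]
    rintro (h' | h')
    · exact hPV (hEV (Or.inr h'))
    · exact hP3 (Or.inl (by rw [h.L_eq]; exact Or.inr h'))
  have hcap : closure E ∩ closure (a (-d) '' E) = LA a γ 0 := by
    rw [cE, cF]
    apply Subset.antisymm
    · rintro y ⟨h1 | h1 | h1, h2 | h2 | h2⟩
      · exact absurd h2 (disjoint_left.1 (l.noinv h hd0) h1)
      · exact absurd h2 (disjoint_left.1 (l.L_disj h _) h1)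
      · exact h2
      · exact h1
      · exact h1
      · exact h1
      · exact absurd h1 (disjoint_left.1 (l.img_disj h _ _) h2)
      · rw [h.L_eq] at h1
        rcases h1 with h1 | h1
        · exact absurd (h.OL h1 h2) hdd
        · rw [h.L_eq]; exact Or.inr h1
      · exact h2
    · exact fun y hy => ⟨Or.inr (Or.inl hy), Or.inr (Or.inr hy)⟩
  have hth := theta hc1 hc2 hc3 (E := E) (F := a (-d) '' E) (V := V) (P := P) (by rw [hr1]; exact l.cmp)
    (by rw [hr2]; exact hF) hV
    (by rw [hr1]; rintro (h' | h'); exacts [hP0 h', hP3 (Or.inl h')])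
    (by rw [hr2]; rintro (h' | h'); exacts [hP3 (Or.inr h'), hP0 h'])
    (by rw [hr3]; exact hP3) (fun h' => hPV (hEV (Or.inl h'))) (fun h' => hPV (hFV (Or.inl h'))) hPV
    (by
      rw [hr1, hr2, hr3]
      rintro y (h' | h')
      · exact Or.inl (Or.inr h')
      · exact Or.inr (Or.inl h'))
    (by rw [hcap]; exact h.L_pre 0)
  refine ⟨V, hV.op, hEV, fun y hy => ?_⟩
  have hyr := disjoint_left.1 hV.disj hy
  rw [hr3] at hyr
  have hy0 : y ∈ LA a γ 0 → y ∈ OA a γ 0 := by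
    intro h'
    rw [h.L_eq] at h'
    rcases h' with h' | h'
    · exact h'
    · exact absurd (Or.inl (by rw [h.L_eq]; exact Or.inr h')) hyr
  have h3 := hth hy
  rw [cE, cF] at h3
  rcases h3 with (h' | h' | h') | (h' | h' | h')
  · exact Or.inl (Or.inl h')
  · exact Or.inl (Or.inr (hy0 h'))
  · exact absurd (Or.inl h') hyr
  · exact Or.inr h'
  · exact absurd (Or.inr h') hyr
  · exact Or.inl (Or.inr (hy0 h'))

theorem Lens.cover [Finite Γ] {d : Γ} {E : Set S2} (l : Lens a γ d E) (h : Sys a N S γ) {x : S2}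
    (hN : x ≠ N) (hS : x ≠ S) : ∃ g ∈ AddSubgroup.zmultiples d, x ∈ a g '' (E ∪ OA a γ 0) := by
  by_cases h2 : d + d = 0
  · exact l.cover2 h h2 hN hS
  obtain ⟨V, hV, hEV, hVE⟩ := l.nbhd h h2
  let W : Set S2 := {x | ∃ g ∈ AddSubgroup.zmultiples d, x ∈ a g '' (E ∪ OA a γ 0)}
  have z1 := AddSubgroup.mem_zmultiples d
  have hWV : W = ⋃ g : AddSubgroup.zmultiples d, a g '' V := by
    apply Subset.antisymm
    · rintro y ⟨g, hg, hy⟩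
      exact mem_iUnion.2 ⟨⟨g, hg⟩, image_mono hEV hy⟩
    · intro y hy
      obtain ⟨⟨g, hg⟩, z, hz, rfl⟩ := mem_iUnion.1 hy
      rcases hVE hz with h' | ⟨w, hw, rfl⟩
      · exact ⟨g, hg, z, h', rfl⟩
      · refine ⟨g + -d, add_mem hg (neg_mem z1), w, Or.inl hw, h.add _ _ _⟩
  have hW : IsOpen W := by
    rw [hWV]
    refine isOpen_iUnion fun g => ?_
    rw [← h.homeo_coe]; exact (h.homeo _).isOpenMap _ hV
  let Z : Set S2 := ⋃ g : AddSubgroup.zmultiples d, a g '' closure E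
  have hZ : IsClosed Z := by
    refine isClosed_iUnion_of_finite fun g => ?_
    rw [← h.homeo_coe]; exact (h.homeo _).isClosedMap _ isClosed_closure
  have cE := h.cl_cmp l.hd.symm l.cmp
  have hWZ : W ⊆ Z := by
    rintro y ⟨g, hg, hy⟩
    refine mem_iUnion.2 ⟨⟨g, hg⟩, image_mono ?_ hy⟩
    rw [cE]
    exact union_subset_union_right _ ((OA_sub 0).trans subset_union_left)
  have hZW : ∀ y, y ≠ N → y ≠ S → y ∈ Z → y ∈ W := by
    intro y hyN hyS hy
    obtain ⟨⟨g, hg⟩, z, hz, rfl⟩ := mem_iUnion.1 hy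
    dsimp only at *
    have hz' : z ∉ ({N, S} : Set S2) := by
      rintro (rfl | e)
      · exact hyN (h.fN g)
      · rw [mem_singleton_iff] at e; subst e; exact hyS (h.fS g)
    rw [cE, h.L_eq, h.L_eq] at hz
    rcases hz with h' | (h' | h') | (h' | h')
    · exact ⟨g, hg, z, Or.inl h', rfl⟩
    · exact ⟨g, hg, z, Or.inr h', rfl⟩
    · exact absurd h' hz'
    · have h3 := h.O_image d 0
      rw [add_zero] at h3
      rw [← h3] at h'
      obtain ⟨w, hw, rfl⟩ := h'
      exact ⟨g + d, add_mem hg z1, w, Or.inr hw, h.add _ _ _⟩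
    · exact absurd h' hz'
  have hpre := compl_pair_preconnected h.ne.symm
  have hsub : ({N, S} : Set S2)ᶜ ⊆ W := by
    refine hpre.subset_left_of_subset_union hW hZ.isOpen_compl
      (disjoint_left.2 fun y hy hy' => hy' (hWZ hy)) (fun y hy => ?_) ?_
    · by_cases hyZ : y ∈ Z
      · exact Or.inl (hZW y (fun e => hy (Or.inl e)) (fun e => hy (Or.inr e)) hyZ)
      · exact Or.inr hyZ
    · obtain ⟨y, hy⟩ := l.cmp.ne
      refine ⟨y, ?_, 0, zero_mem _, by rw [h.image_zero]; exact Or.inl hy⟩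
      rintro (rfl | e)
      · exact l.N_notin h hy
      · rw [mem_singleton_iff] at e; subst e; exact l.S_notin h hy
  exact hsub (by rintro (e | e); exacts [hN e, hS e])

theorem Lens.gen [Finite Γ] {d : Γ} {E : Set S2} (l : Lens a γ d E) (h : Sys a N S γ) (k : Γ) :
    k ∈ AddSubgroup.zmultiples d := by
  obtain ⟨x, hx⟩ := h.O_ne k
  obtain ⟨g, hg, hxg⟩ := l.cover h (x := x) (by rintro rfl; exact h.N_notin k hx)
    (by rintro rfl; exact h.S_notin k hx)
  rw [image_union, h.O_image, add_zero] at hxg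
  rcases hxg with h' | h'
  · exact absurd (OA_sub k hx) (disjoint_left.1 (l.img_disj h g k) h')
  · rwa [h.O_disj hx h']

end
end BKE

namespace BKE
open Set Filter Topology Metric
open scoped unitInterval ComplexConjugate

/-! ### Sectors and gluing -/

theorem iter_mod {X : Type*} {f : X → X} {n : ℕ} (h : f^[n] = id) (m : ℕ) : f^[m % n] = f^[m] := by
  conv_rhs => rw [← Nat.mod_add_div m n, Function.iterate_add, Function.iterate_mul, h, Function.iterate_id]
  rfl

theorem act_of {f : S2 → S2} (hf : HId f) {n : ℕ} [NeZero n] (hn : 2 ≤ n) (h : f^[n] = id)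
    (hmin : ∀ k, 0 < k → k < n → f^[k] ≠ id) :
    ∃ N S, Act (fun k : ZMod n => f^[k.val]) N S := by
  obtain ⟨N, S, hne, hN, hS, hfree⟩ := two_points hf hn h hmin
  refine ⟨N, S, fun i => (hf.iterate _).continuous, fun x => by simp, fun i j x => ?_,
    fun i => iter_fix hN _, fun i => iter_fix hS _, fun i hi x e => ?_, hne, fun i => hf.iterate _⟩
  · rw [ZMod.val_add, iter_mod h, Function.iterate_add_apply]
  · refine hfree i.val ?_ (ZMod.val_lt i) x e
    rw [Nat.pos_iff_ne_zero]
    intro h0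
    exact hi ((ZMod.val_eq_zero i).1 h0)

/-- The identifications on translates of a sector. -/
def RR {n : ℕ} (k : ZMod n) (z w : ℂ) : Prop :=
  (k = 0 ∧ z = w) ∨ (z = w ∧ (z = 1 ∨ z = -1)) ∨
  (k = 1 ∧ ∃ t ∈ Icc (0:ℝ) (1/2), z = circ 0 1 t ∧ w = circ 0 1 (1 - t)) ∨
  (k = -1 ∧ ∃ t ∈ Icc (0:ℝ) (1/2), z = circ 0 1 (1 - t) ∧ w = circ 0 1 t)

/-- A parametrised fundamental sector. -/
structure Sector {n : ℕ} (b : ZMod n → S2 → S2) (Ψ : ℂ → S2) : Prop where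
  bc : ∀ i, Continuous (b i)
  zero : ∀ x, b 0 x = x
  add : ∀ i j x, b (i + j) x = b i (b j x)
  pc : ContinuousOn Ψ (closedBall 0 1)
  surj : ∀ x, ∃ k, ∃ z ∈ closedBall (0:ℂ) 1, b k (Ψ z) = x
  sep : ∀ k, ∀ z ∈ closedBall (0:ℂ) 1, ∀ w ∈ closedBall (0:ℂ) 1, b k (Ψ z) = Ψ w ↔ RR k z w

theorem circ_zero' : circ 0 1 0 = 1 := by simp [circ]

theorem circ_half : circ 0 1 (1/2) = -1 := by
  have : ((1/2 : ℝ) : ℂ) * (2 * Real.pi * Complex.I) = Real.pi * Complex.I := by push_cast; ring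
  simp only [circ]
  rw [this, Complex.exp_pi_mul_I]; simp

theorem circ_one' : circ 0 1 1 = 1 := by
  have := circ_per 0 1 0
  rw [zero_add] at this
  rw [this, circ_zero']

theorem sphere_rep {z : ℂ} (hz : z ∈ sphere (0:ℂ) 1) :
    ∃ s ∈ Icc (0:ℝ) (1/2), z = circ 0 1 s ∨ z = circ 0 1 (1 - s) := by
  rw [← range_circ_unit] at hz
  obtain ⟨t, rfl⟩ := hz
  obtain ⟨s, hs, e⟩ := exists_rep (circ_per 0 1) 0 t
  rw [← e]
  rcases le_total s (1/2) with h | h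
  · exact ⟨s, ⟨hs.1, h⟩, Or.inl rfl⟩
  · refine ⟨1 - s, ⟨by linarith [hs.2], by linarith⟩, Or.inr ?_⟩
    rw [sub_sub_cancel]

theorem Lens.sector {n : ℕ} [NeZero n] {b : ZMod n → S2 → S2} {N S : S2} {γ : ℝ → S2} {E : Set S2}
    (h : Sys b N S γ) (l : Lens b γ 1 E) : ∃ Ψ, Sector b Ψ := by
  have h01 : (0 : ZMod n) ≠ 1 := l.hd.symm
  obtain ⟨c, hc, hcr, hc1, hc2⟩ := h.jordan h01
  have hcmp : Cmp (range c) E := by rw [hcr]; exact l.cmp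
  obtain ⟨Ψ, pc, pi, -, pb, pt⟩ := hc.schoen hcmp
  have e1 : ∀ t ∈ Icc (0:ℝ) (1/2), Ψ (circ 0 1 t) = b 0 (γ (2 * t)) := fun t ht => by
    rw [pt, hc1 t ht]
  have e2 : ∀ t ∈ Icc (0:ℝ) (1/2), Ψ (circ 0 1 (1 - t)) = b 1 (γ (2 * t)) := fun t ht => by
    rw [pt, hc2 (1 - t) ⟨by linarith [ht.2], by linarith [ht.1]⟩]
    congr 2; ring
  have eN : Ψ 1 = N := by
    rw [← circ_zero', e1 0 (by norm_num), mul_zero, h.g0, h.fN]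
  have eS : Ψ (-1) = S := by
    rw [← circ_half, e1 (1/2) (by norm_num), show (2:ℝ) * (1/2) = 1 by norm_num, h.g1, h.fS]
  -- sphere points
  have hsph : ∀ z ∈ sphere (0:ℂ) 1, ∃ s ∈ Icc (0:ℝ) (1/2),
      (z = circ 0 1 s ∧ Ψ z = b 0 (γ (2 * s))) ∨ (z = circ 0 1 (1 - s) ∧ Ψ z = b 1 (γ (2 * s))) := by
    intro z hz
    obtain ⟨s, hs, e | e⟩ := sphere_rep hz
    · exact ⟨s, hs, Or.inl ⟨e, by rw [e, e1 s hs]⟩⟩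
    · exact ⟨s, hs, Or.inr ⟨e, by rw [e, e2 s hs]⟩⟩
  have hdbl : ∀ s ∈ Icc (0:ℝ) (1/2), 2 * s ∈ Icc (0:ℝ) 1 := fun s hs =>
    ⟨by linarith [hs.1], by linarith [hs.2]⟩
  have hsL : ∀ z ∈ sphere (0:ℂ) 1, ∃ j, Ψ z ∈ LA b γ j := by
    intro z hz
    obtain ⟨s, hs, ⟨-, e⟩ | ⟨-, e⟩⟩ := hsph z hz
    · exact ⟨0, 2 * s, hdbl s hs, e.symm⟩
    · exact ⟨1, 2 * s, hdbl s hs, e.symm⟩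
  have hE : ∀ z ∈ ball (0:ℂ) 1, Ψ z ∈ E := fun z hz => by rw [← pb]; exact ⟨z, hz, rfl⟩
  have hcases : ∀ z ∈ closedBall (0:ℂ) 1, z ∈ ball (0:ℂ) 1 ∨ z ∈ sphere (0:ℂ) 1 := fun z hz => by
    rw [← ball_union_sphere] at hz; exact hz
  have hinj : ∀ i, ∀ s ∈ Icc (0:ℝ) (1/2), ∀ t ∈ Icc (0:ℝ) (1/2), b i (γ (2 * s)) = b i (γ (2 * t)) → s = t := by
    intro i s hs t ht e
    have := h.gi (hdbl s hs) (hdbl t ht) (h.inj i e)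
    linarith
  have hpole : ∀ i j, i ≠ j → ∀ s ∈ Icc (0:ℝ) (1/2), ∀ t ∈ Icc (0:ℝ) (1/2), b i (γ (2 * s)) = b j (γ (2 * t)) →
      (s = 0 ∧ t = 0) ∨ (s = 1/2 ∧ t = 1/2) := by
    intro i j hij s hs t ht e
    rcases h.cross hij (hdbl s hs) (hdbl t ht) e with ⟨p, q⟩ | ⟨p, q⟩
    · left; constructor <;> linarith
    · right; constructor <;> linarith
  have c10 : circ 0 1 (1 - 0) = 1 := by rw [sub_zero, circ_one']
  have c12 : circ 0 1 (1 - 1/2) = -1 := by rw [show (1:ℝ) - 1/2 = 1/2 by norm_num, circ_half]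
  refine ⟨Ψ, h.cont, h.zero, h.add, pc, fun x => ?_, fun k z hz w hw => ⟨fun e => ?_, fun r => ?_⟩⟩
  · by_cases hN : x = N
    · exact ⟨0, 1, by simp, by rw [eN, hN, h.zero]⟩
    by_cases hS : x = S
    · exact ⟨0, -1, by simp, by rw [eS, hS, h.zero]⟩
    obtain ⟨g, -, y, hy | hy, e⟩ := l.cover h hN hS
    · rw [← pb] at hy
      obtain ⟨z, hz, rfl⟩ := hy
      exact ⟨g, z, ball_subset_closedBall hz, e⟩
    · obtain ⟨t, ht, rfl⟩ := hy
      refine ⟨g, circ 0 1 (t / 2), circ01_mem _, ?_⟩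
      rw [e1 (t/2) ⟨by linarith [ht.1], by linarith [ht.2]⟩, show 2 * (t / 2) = t by ring]
      exact e
  · rcases hcases z hz with hz' | hz'
    · rcases hcases w hw with hw' | hw'
      · by_cases hk : k = 0
        · left
          rw [hk, h.zero] at e
          exact ⟨hk, pi hz hw e⟩
        · exact ((disjoint_left.1 (l.noinv h hk)) (hE w hw') ⟨_, hE z hz', e⟩).elim
      · obtain ⟨j, hj⟩ := hsL w hw'
        exact ((disjoint_left.1 (l.img_disj h k j)) ⟨_, hE z hz', e⟩ hj).elim
    · rcases hcases w hw with hw' | hw'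
      · obtain ⟨j, hj⟩ := hsL z hz'
        refine ((disjoint_left.1 (l.L_disj h (k + j))) (hE w hw') ?_).elim
        rw [← h.L_image]
        exact ⟨_, hj, e⟩
      · obtain ⟨s, hs, ⟨a1, a2⟩ | ⟨a1, a2⟩⟩ := hsph z hz' <;>
        obtain ⟨t, ht, ⟨d1, d2⟩ | ⟨d1, d2⟩⟩ := hsph w hw' <;>
        rw [a2, d2, ← h.add] at e
        · by_cases hk : k + 0 = 0
          · rw [hk] at e
            have := hinj _ s hs t ht e
            left; exact ⟨by simpa using hk, by rw [a1, d1, this]⟩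
          · right; left
            rcases hpole _ _ hk s hs t ht e with ⟨p, q⟩ | ⟨p, q⟩ <;> rw [a1, d1, p, q]
            · exact ⟨rfl, Or.inl circ_zero'⟩
            · exact ⟨rfl, Or.inr circ_half⟩
        · by_cases hk : k + 0 = 1
          · rw [hk] at e
            have := hinj _ s hs t ht e
            right; right; left; exact ⟨by simpa using hk, s, hs, a1, by rw [d1, this]⟩
          · right; left
            rcases hpole _ _ hk s hs t ht e with ⟨p, q⟩ | ⟨p, q⟩ <;> rw [a1, d1, p, q]
            · exact ⟨by rw [c10, circ_zero'], Or.inl circ_zero'⟩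
            · exact ⟨by rw [c12, circ_half], Or.inr circ_half⟩
        · by_cases hk : k + 1 = 0
          · rw [hk] at e
            have := hinj _ s hs t ht e
            right; right; right; exact ⟨eq_neg_of_add_eq_zero_left hk, s, hs, a1, by rw [d1, this]⟩
          · right; left
            rcases hpole _ _ hk s hs t ht e with ⟨p, q⟩ | ⟨p, q⟩ <;> rw [a1, d1, p, q]
            · exact ⟨by rw [c10, circ_zero'], Or.inl c10⟩
            · exact ⟨by rw [c12, circ_half], Or.inr c12⟩
        · by_cases hk : k + 1 = 1
          · rw [hk] at e
            have := hinj _ s hs t ht e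
            left; exact ⟨by simpa using hk, by rw [a1, d1, this]⟩
          · right; left
            rcases hpole _ _ hk s hs t ht e with ⟨p, q⟩ | ⟨p, q⟩ <;> rw [a1, d1, p, q]
            · exact ⟨rfl, Or.inl c10⟩
            · exact ⟨rfl, Or.inr c12⟩
  · rcases r with ⟨rfl, rfl⟩ | ⟨rfl, rfl | rfl⟩ | ⟨rfl, t, ht, rfl, rfl⟩ | ⟨rfl, t, ht, rfl, rfl⟩
    · rw [h.zero]
    · rw [eN, h.fN]
    · rw [eS, h.fS]
    · rw [e1 t ht, e2 t ht, h.zero]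
    · rw [e1 t ht, e2 t ht, h.inv_left, h.zero]

theorem exists_sector {f : S2 → S2} (hf : HId f) {n : ℕ} [NeZero n] (hn : 2 ≤ n) (h : f^[n] = id)
    (hmin : ∀ k, 0 < k → k < n → f^[k] ≠ id) :
    ∃ d u : ZMod n, u * d = 1 ∧ ∃ Ψ, Sector (fun k : ZMod n => f^[(k * d).val]) Ψ := by
  obtain ⟨N, S, hA⟩ := act_of hf hn h hmin
  obtain ⟨γ, g1, g2, g3, g4, g5⟩ := hA.arc
  have hS : Sys (fun k : ZMod n => f^[k.val]) N S γ := ⟨hA, g1, g2, g3, g4, g5⟩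
  haveI : Fact (1 < n) := ⟨by omega⟩
  obtain ⟨d, E, l⟩ := hS.lens
  have hg := l.gen hS 1
  obtain ⟨m, hm⟩ := AddSubgroup.mem_zmultiples_iff.1 hg
  have hud : (m : ZMod n) * d = 1 := by rw [← zsmul_eq_mul]; exact hm
  refine ⟨d, m, hud, ?_⟩
  have hk0 : ∀ k : ZMod n, k ≠ 0 → k * d ≠ 0 := by
    intro k hk e
    apply hk
    calc k = k * ((m : ZMod n) * d) := by rw [hud, mul_one]
      _ = (k * d) * m := by ring
      _ = 0 := by rw [e, zero_mul]
  have hB : Sys (fun k : ZMod n => f^[(k * d).val]) N S γ := by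
    refine ⟨⟨fun i => hA.cont (i * d), fun x => ?_, fun i j x => ?_, fun i => hA.fN (i * d), fun i => hA.fS (i * d),
      fun i hi => hA.free (i * d) (hk0 i hi), hA.ne, fun i => hA.hid (i * d)⟩, g1, g2, g3, g4,
      fun i hi => g5 (i * d) (hk0 i hi)⟩
    · have := hA.zero x
      try dsimp only at this ⊢
      rw [zero_mul]; exact this
    · have := hA.add (i * d) (j * d) x
      try dsimp only at this ⊢
      rw [add_mul]; exact this
  have hL : ∀ k, LA (fun k : ZMod n => f^[(k * d).val]) γ k = LA (fun k : ZMod n => f^[k.val]) γ (k * d) :=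
    fun k => rfl
  have hO : ∀ k, OA (fun k : ZMod n => f^[(k * d).val]) γ k = OA (fun k : ZMod n => f^[k.val]) γ (k * d) :=
    fun k => rfl
  have lB : Lens (fun k : ZMod n => f^[(k * d).val]) γ 1 E := by
    refine ⟨one_ne_zero, ?_, fun k => ?_⟩
    · rw [hL, hL, zero_mul, one_mul]; exact l.cmp
    · rw [hO]; exact l.fr _
  exact Lens.sector hB lB

theorem Sector.eq_iff {n : ℕ} {b : ZMod n → S2 → S2} {Ψ : ℂ → S2} (h : Sector b Ψ) (k j : ZMod n) {z w : ℂ}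
    (hz : z ∈ closedBall (0:ℂ) 1) (hw : w ∈ closedBall (0:ℂ) 1) :
    b k (Ψ z) = b j (Ψ w) ↔ RR (-j + k) z w := by
  rw [← h.sep _ z hz w hw, h.add]
  constructor
  · intro e
    rw [e, ← h.add, neg_add_cancel, h.zero]
  · intro e
    rw [← e, ← h.add, add_neg_cancel, h.zero]

theorem Sector.map {n : ℕ} [NeZero n] {b b' : ZMod n → S2 → S2} {Ψ Ψ' : ℂ → S2} (h : Sector b Ψ) (h' : Sector b' Ψ') :
    ∃ u : S2 → S2, Continuous u ∧ ∀ k, ∀ z ∈ closedBall (0:ℂ) 1, u (b k (Ψ z)) = b' k (Ψ' z) := by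
  have hc : ∀ {b : ZMod n → S2 → S2} {Ψ : ℂ → S2}, Sector b Ψ →
      ContinuousOn (fun q : ZMod n × ℂ => b q.1 (Ψ q.2)) (univ ×ˢ closedBall (0:ℂ) 1) := by
    intro b Ψ h
    rw [continuousOn_prod_of_discrete_left]
    intro k
    have : {x : ℂ | (k, x) ∈ (univ : Set (ZMod n)) ×ˢ closedBall (0:ℂ) 1} = closedBall 0 1 := by
      ext x; simp
    rw [this]
    exact (h.bc k).comp_continuousOn h.pc
  have hK : IsCompact ((univ : Set (ZMod n)) ×ˢ closedBall (0:ℂ) 1) :=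
    (Set.toFinite _).isCompact.prod (isCompact_closedBall _ _)
  haveI : Nonempty S2 := ⟨nS⟩
  obtain ⟨u, hu, he⟩ := descend_quot hK (hc h) (hc h') (by
    intro s hs t ht e
    exact (h'.eq_iff s.1 t.1 hs.2 ht.2).2 ((h.eq_iff s.1 t.1 hs.2 ht.2).1 e))
  refine ⟨u, ?_, fun k z hz => he (k, z) ⟨trivial, hz⟩⟩
  rw [← continuousOn_univ]
  refine hu.mono fun x _ => ?_
  obtain ⟨k, z, hz, e⟩ := h.surj x
  exact ⟨(k, z), ⟨trivial, hz⟩, e⟩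

theorem Sector.glue {n : ℕ} [NeZero n] {b b' : ZMod n → S2 → S2} {Ψ Ψ' : ℂ → S2} (h : Sector b Ψ) (h' : Sector b' Ψ') :
    ∃ g : S2 ≃ₜ S2, ∀ k x, g (b k x) = b' k (g x) := by
  obtain ⟨u, hu, eu⟩ := h.map h'
  obtain ⟨v, hv, ev⟩ := h'.map h
  refine ⟨⟨⟨u, v, fun x => ?_, fun x => ?_⟩, hu, hv⟩, fun k x => ?_⟩
  · obtain ⟨k, z, hz, rfl⟩ := h.surj x
    rw [eu k z hz, ev k z hz]
  · obtain ⟨k, z, hz, rfl⟩ := h'.surj x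
    rw [ev k z hz, eu k z hz]
  · obtain ⟨j, z, hz, rfl⟩ := h.surj x
    show u (b k (b j (Ψ z))) = b' k (u (b j (Ψ z)))
    rw [← h.add, eu _ z hz, eu _ z hz, h'.add]

/-! ### The model rotation -/

def rotS (θ : ℝ) (x : S2) : S2 := mkS (Complex.exp (θ * Complex.I) * zc x) (hc x) (by
  rw [map_mul, Complex.normSq_eq_norm_sq (Complex.exp _), Complex.norm_exp_ofReal_mul_I, one_pow, one_mul, S2_eq])

theorem zc_rotS (θ x) : zc (rotS θ x) = Complex.exp (θ * Complex.I) * zc x := by rw [rotS, zc_mkS]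
theorem hc_rotS (θ x) : hc (rotS θ x) = hc x := by rw [rotS, hc_mkS]

theorem rotS_zero (x : S2) : rotS 0 x = x := S2_ext (by rw [zc_rotS]; simp) (hc_rotS _ _)

theorem rotS_add (θ η : ℝ) (x : S2) : rotS (θ + η) x = rotS θ (rotS η x) := by
  apply S2_ext
  · rw [zc_rotS, zc_rotS, zc_rotS, ← mul_assoc, ← Complex.exp_add]
    congr 2; push_cast; ring
  · rw [hc_rotS, hc_rotS, hc_rotS]

theorem rotS_iter (θ : ℝ) (k : ℕ) : (rotS θ)^[k] = rotS (k * θ) := by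
  induction k with
  | zero => funext x; simp [rotS_zero]
  | succ k ih =>
    funext x
    rw [Function.iterate_succ_apply', ih, ← rotS_add]
    congr 1; push_cast; ring

theorem rotS_hid (θ : ℝ) : HId (rotS θ) := by
  refine ⟨fun q => rotS ((1 - (q.1 : ℝ)) * θ) q.2, ?_, fun x => by simp, fun x => by simp [rotS_zero]⟩
  apply continuous_to_S2
  · simp only [zc_rotS]
    have := zc_cont
    fun_prop
  · simp only [hc_rotS]
    exact hc_cont.comp continuous_snd

def eS2 : S2 := mkS 1 0 (by simp)

theorem rotS_id_iff (θ : ℝ) : rotS θ = id ↔ Complex.exp (θ * Complex.I) = 1 := by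
  constructor
  · intro h
    have := congrArg zc (congrFun h eS2)
    rw [zc_rotS] at this
    simpa [eS2] using this
  · intro h
    funext x
    exact S2_ext (by rw [zc_rotS, h, one_mul]; rfl) (hc_rotS _ _)

theorem rotS_order {n : ℕ} (hn : 1 ≤ n) (k : ℕ) : (rotS (2 * Real.pi / n))^[k] = id ↔ n ∣ k := by
  have hn0 : (n : ℂ) ≠ 0 := by exact_mod_cast (by omega : n ≠ 0)
  rw [rotS_iter, rotS_id_iff, Complex.exp_eq_one_iff]
  constructor
  · rintro ⟨m, hm⟩
    have h2 : (2 * Real.pi * Complex.I : ℂ) ≠ 0 := Complex.two_pi_I_ne_zero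
    have h3 : (k : ℂ) / n * (2 * Real.pi * Complex.I) = m * (2 * Real.pi * Complex.I) := by
      rw [← hm]; push_cast; ring
    have h4 := mul_right_cancel₀ h2 h3
    rw [div_eq_iff hn0] at h4
    have h5 : (k : ℤ) = m * n := by exact_mod_cast h4
    exact Int.natCast_dvd_natCast.1 ⟨m, by rw [h5]; ring⟩
  · rintro ⟨m, rfl⟩
    refine ⟨m, ?_⟩
    push_cast
    field_simp

/-- rotation matrix about the vertical axis -/
def rotM (θ : ℝ) : Matrix (Fin 3) (Fin 3) ℝ :=
  !![Real.cos θ, -Real.sin θ, 0; Real.sin θ, Real.cos θ, 0; 0, 0, 1]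

def rotL (θ : ℝ) : EuclideanSpace ℝ (Fin 3) →ₗ[ℝ] EuclideanSpace ℝ (Fin 3) := Matrix.toLpLin 2 2 (rotM θ)

theorem rotL_apply (θ : ℝ) (v : EuclideanSpace ℝ (Fin 3)) :
    rotL θ v = !₂[Real.cos θ * v 0 - Real.sin θ * v 1, Real.sin θ * v 0 + Real.cos θ * v 1, v 2] := by
  ext i
  fin_cases i <;> simp [rotL, Matrix.toLpLin_apply, rotM, Matrix.mulVec, dotProduct, Fin.sum_univ_three] <;> ring

theorem rotL_norm (θ : ℝ) (v : EuclideanSpace ℝ (Fin 3)) : ‖rotL θ v‖ = ‖v‖ := by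
  rw [EuclideanSpace.norm_eq, EuclideanSpace.norm_eq, rotL_apply]
  congr 1
  simp only [Fin.sum_univ_three, Real.norm_eq_abs, sq_abs]
  simp
  linear_combination (v 0 ^ 2 + v 1 ^ 2) * Real.sin_sq_add_cos_sq θ

theorem rotL_det (θ : ℝ) : LinearMap.det (rotL θ) = 1 := by
  rw [rotL, Matrix.toLpLin_eq_toLin, LinearMap.det_toLin, Matrix.det_fin_three]
  simp [rotM]
  linear_combination Real.sin_sq_add_cos_sq θ

def rotE (θ : ℝ) : EuclideanSpace ℝ (Fin 3) ≃ₗᵢ[ℝ] EuclideanSpace ℝ (Fin 3) :=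
  LinearIsometry.toLinearIsometryEquiv ⟨rotL θ, rotL_norm θ⟩ rfl

theorem rotE_apply (θ : ℝ) (v : EuclideanSpace ℝ (Fin 3)) : rotE θ v = rotL θ v := rfl

theorem rotE_det (θ : ℝ) : LinearMap.det ((rotE θ).toLinearEquiv :
    EuclideanSpace ℝ (Fin 3) →ₗ[ℝ] EuclideanSpace ℝ (Fin 3)) = 1 := by
  have : ((rotE θ).toLinearEquiv : EuclideanSpace ℝ (Fin 3) →ₗ[ℝ] EuclideanSpace ℝ (Fin 3)) = rotL θ :=
    LinearMap.ext fun v => rfl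
  rw [this, rotL_det]

theorem rotS_coe (θ : ℝ) (x : S2) : (rotS θ x : EuclideanSpace ℝ (Fin 3)) = rotE θ x := by
  rw [rotE_apply, rotL_apply, S2_vec (rotS θ x), zc_rotS, hc_rotS, Complex.exp_mul_I,
    ← Complex.ofReal_cos, ← Complex.ofReal_sin]
  congr 1
  simp [zc, hc, -Complex.ofReal_cos, -Complex.ofReal_sin]
  ring

/-- The main theorem at the level of maps. -/
theorem main_maps {f : S2 → S2} (hf : HId f) {n : ℕ} (hn : 1 ≤ n) (h : f^[n] = id)
    (hmin : ∀ k, 0 < k → k < n → f^[k] ≠ id) :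
    ∃ (g : S2 ≃ₜ S2) (θ : ℝ), ∀ x, g (f x) = rotS θ (g x) := by
  rcases eq_or_lt_of_le hn with h1 | h1
  · refine ⟨Homeomorph.refl _, 0, fun x => ?_⟩
    subst h1
    rw [rotS_zero]
    exact congrFun h x
  haveI : NeZero n := ⟨by omega⟩
  obtain ⟨d, u, hud, Ψ, hΨ⟩ := exists_sector hf h1 h hmin
  obtain ⟨d', u', hud', Ψ', hΨ'⟩ := exists_sector (rotS_hid (2 * Real.pi / n)) h1
    ((rotS_order hn n).2 dvd_rfl) (fun k hk hkn e => by
      have := Nat.le_of_dvd hk ((rotS_order hn k).1 e)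
      omega)
  obtain ⟨g, hg⟩ := hΨ.glue hΨ'
  refine ⟨g, ((u * d').val : ℕ) * (2 * Real.pi / n), fun x => ?_⟩
  haveI : Fact (1 < n) := ⟨h1⟩
  have := hg u x
  rw [hud, ZMod.val_one, rotS_iter] at this
  exact this

end BKE

/-- Ahlfors' trick in genus zero / Brouwer–Eilenberg–Kerékjártó:
a finite-order self-homeomorphism of `S²` homotopic to the identity is conjugate, in the
group of self-homeomorphisms of `S²`, to the restriction of a rotation `A ∈ SO(3)`. -/
theorem finite_order_homeo_conjugate_to_rotation (f : S2 ≃ₜ S2)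
    (hfin : ∃ n : ℕ, 1 ≤ n ∧ f ^ n = 1)
    (hhtp : ContinuousMap.Homotopic ⟨f, f.continuous⟩ (ContinuousMap.id S2)) :
    ∃ (g : S2 ≃ₜ S2) (A : EuclideanSpace ℝ (Fin 3) ≃ₗᵢ[ℝ] EuclideanSpace ℝ (Fin 3)),
      LinearMap.det (A.toLinearEquiv : EuclideanSpace ℝ (Fin 3) →ₗ[ℝ] EuclideanSpace ℝ (Fin 3))
        = 1 ∧
      ∀ x : S2, f x = g⁻¹ ⟨A (g x), by
        rw [mem_sphere_zero_iff_norm, A.norm_map]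
        exact mem_sphere_zero_iff_norm.mp (g x).2⟩ := by
  classical
  have hpow : ∀ (m : ℕ) (x : S2), (f ^ m) x = f^[m] x := by
    intro m
    induction m with
    | zero => intro x; rfl
    | succ m ih =>
      intro x
      rw [pow_succ, Function.iterate_succ_apply, ← ih]
      rfl
  have hone : ∀ m, f ^ m = 1 ↔ f^[m] = id := by
    intro m
    constructor
    · intro e
      funext x
      rw [← hpow, e]
      rfl
    · intro e
      apply Homeomorph.ext
      intro x
      rw [hpow, e]
      rfl
  obtain ⟨H⟩ := hhtp
  have hf : BKE.HId f := ⟨fun q => H q, H.continuous, fun x => H.apply_zero x, fun x => H.apply_one x⟩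
  have hn := Nat.find_spec hfin
  have hmin : ∀ k, 0 < k → k < Nat.find hfin → f^[k] ≠ id := by
    intro k hk hkn e
    exact Nat.find_min hfin hkn ⟨hk, (hone k).2 e⟩
  obtain ⟨g, θ, hg⟩ := BKE.main_maps hf hn.1 ((hone _).1 hn.2) hmin
  refine ⟨g, BKE.rotE θ, BKE.rotE_det θ, fun x => ?_⟩
  have h1 : f x = g.symm (g (f x)) := (g.symm_apply_apply _).symm
  rw [h1, hg x]
  exact congrArg g.symm (Subtype.ext (BKE.rotS_coe θ (g x)))

end
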